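/- Let p be an odd prime and let G be a finite p-solvable group. Suppose that χ ∈ Irr(G) is a lift of φ ∈ IBr(G). Then all of the vertex pairs for χ are conjugate in G. -/

import Mathlib

open scoped Classical

noncomputable section

/-- All prime divisors of `n` belong to the set of primes `σ`. -/
def IsPiNumber (σ : Set ℕ) (n : ℕ) : Prop :=
  ∀ q : ℕ, q.Prime → q ∣ n → q ∈ σ

/-- `g` is a `σ`-element: its order is a `σ`-number. -/
def IsPiElt (σ : Set ℕ) {G : Type} [Group G] (g : G) : Prop :=
  IsPiNumber σ (orderOf g)

/-- The `p`-part of a natural number. -/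
def pPart (p n : ℕ) : ℕ := p ^ (n.factorization p)

/-- `χ` is the character of a finite-dimensional complex representation of `G`. -/
def IsCharacter (G : Type) [Group G] (χ : G → ℂ) : Prop :=
  ∃ V : FDRep ℂ G, ∀ g, χ g = V.character g

/-- `χ` is an irreducible (ordinary, complex) character of `G`: a nonzero character
which is not the sum of two nonzero characters. -/
def IsIrrChar (G : Type) [Group G] (χ : G → ℂ) : Prop :=
  IsCharacter G χ ∧ χ ≠ 0 ∧
    ¬ ∃ χ₁ χ₂ : G → ℂ, IsCharacter G χ₁ ∧ χ₁ ≠ 0 ∧ IsCharacter G χ₂ ∧ χ₂ ≠ 0 ∧ χ = χ₁ + χ₂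

/-- Restriction of a class function on `G` to a subgroup `H`. -/
def resChar {G : Type} [Group G] (H : Subgroup G) (χ : G → ℂ) : ↥H → ℂ :=
  fun h => χ (h : G)

/-- Restriction of a class function between nested subgroups. -/
def resCharLe {G : Type} [Group G] {K H : Subgroup G} (hKH : K ≤ H) (χ : ↥H → ℂ) : ↥K → ℂ :=
  fun k => χ ⟨(k : G), hKH k.2⟩

/-- The induced class function from a subgroup `H` of `G`, given by the usual
induction formula. -/
def indChar {G : Type} [Group G] [Fintype G] (H : Subgroup G) (ψ : ↥H → ℂ) : G → ℂ :=
  fun g => (Nat.card ↥H : ℂ)⁻¹ *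
    ∑ x : G, if h : x * g * x⁻¹ ∈ H then ψ ⟨x * g * x⁻¹, h⟩ else 0

/-- Induction of a class function between nested subgroups. -/
def indCharLe {G : Type} [Group G] [Fintype G] {K H : Subgroup G} (_ : K ≤ H)
    (ψ : ↥K → ℂ) : ↥H → ℂ :=
  fun x => (Nat.card ↥K : ℂ)⁻¹ *
    ∑ y : ↥H, if h : (y : G) * (x : G) * (y : G)⁻¹ ∈ K then ψ ⟨(y : G) * (x : G) * (y : G)⁻¹, h⟩ else 0

/-- `θ` is an irreducible constituent of the class function `χ`. -/
def IsConstituent {G : Type} [Group G] (θ χ : G → ℂ) : Prop :=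
  IsIrrChar G θ ∧ ∃ ξ : G → ℂ, (ξ = 0 ∨ IsCharacter G ξ) ∧ χ = θ + ξ

/-- The restriction `χ^o` of a class function to the `σ`-elements of `G`
(extended by zero elsewhere). -/
def piRestrict (σ : Set ℕ) {G : Type} [Group G] (χ : G → ℂ) : G → ℂ :=
  fun g => if IsPiElt σ g then χ g else 0

/-- `φ` is a `σ`-partial character of `G`: the restriction to the `σ`-elements of an
ordinary character. -/
def IsPartialChar (σ : Set ℕ) (G : Type) [Group G] (φ : G → ℂ) : Prop :=
  ∃ χ : G → ℂ, IsCharacter G χ ∧ χ ≠ 0 ∧ φ = piRestrict σ χ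

/-- `φ ∈ I_σ(G)`: an irreducible `σ`-partial character, i.e. one which is not the
sum of two `σ`-partial characters. -/
def IsIPiChar (σ : Set ℕ) (G : Type) [Group G] (φ : G → ℂ) : Prop :=
  IsPartialChar σ G φ ∧
    ¬ ∃ φ₁ φ₂ : G → ℂ, IsPartialChar σ G φ₁ ∧ IsPartialChar σ G φ₂ ∧ φ = φ₁ + φ₂

/-- `φ ∈ IBr(G)` (at the prime `p`): irreducible Brauer characters are the irreducible
`p'`-partial characters, where the `p`-regular elements are the `{p}ᶜ`-elements. -/
def IsIBrChar (p : ℕ) (G : Type) [Group G] (φ : G → ℂ) : Prop :=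
  IsIPiChar ({p}ᶜ) G φ

/-- The restriction `χ^o` of `χ` to the `p`-regular elements of `G`. -/
def brRestrict (p : ℕ) {G : Type} [Group G] (χ : G → ℂ) : G → ℂ :=
  piRestrict ({p}ᶜ) χ

/-- `χ` is a lift of the `σ`-partial character `φ`. -/
def IsLiftOfPi (σ : Set ℕ) (G : Type) [Group G] (χ φ : G → ℂ) : Prop :=
  IsIrrChar G χ ∧ piRestrict σ χ = φ

/-- `χ` is a lift: `χ` is irreducible and `χ^o` is an irreducible `σ`-partial character. -/
def IsLiftPi (σ : Set ℕ) (G : Type) [Group G] (χ : G → ℂ) : Prop :=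
  IsIrrChar G χ ∧ IsIPiChar σ G (piRestrict σ χ)

/-- `H` is a subnormal subgroup of `G`. -/
def IsSubnormalSubgroup {G : Type} [Group G] (H : Subgroup G) : Prop :=
  ∃ (n : ℕ) (c : Fin (n + 1) → Subgroup G),
    c 0 = H ∧ c (Fin.last n) = ⊤ ∧
    ∀ i : Fin n, c i.castSucc ≤ c i.succ ∧ ((c i.castSucc).subgroupOf (c i.succ)).Normal

/-- The determinantal order `o(det θ)` of `θ` is a `σ`-number. -/
def HasPiDetOrder (σ : Set ℕ) (G : Type) [Group G] (θ : G → ℂ) : Prop :=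
  ∃ V : FDRep ℂ G, (∀ g, θ g = V.character g) ∧
    IsPiNumber σ (orderOf (fun g : G => LinearMap.det (V.ρ g)))

/-- `χ` is a `σ`-special character of `G`: `χ` is irreducible, `χ(1)` is a `σ`-number,
and for every subnormal subgroup `M` of `G`, every irreducible constituent of `χ_M`
has determinantal order a `σ`-number. -/
def IsPiSpecial (σ : Set ℕ) (G : Type) [Group G] (χ : G → ℂ) : Prop :=
  IsIrrChar G χ ∧ (∃ n : ℕ, χ 1 = (n : ℂ) ∧ IsPiNumber σ n) ∧
    ∀ M : Subgroup G, IsSubnormalSubgroup M →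
      ∀ θ : ↥M → ℂ, IsConstituent θ (resChar M χ) → HasPiDetOrder σ ↥M θ

/-- `χ` is `σ`-factored: `χ = αβ` with `α` `σ`-special and `β` `σ'`-special. -/
def IsPiFactored (σ : Set ℕ) (G : Type) [Group G] (χ : G → ℂ) : Prop :=
  ∃ α β : G → ℂ, IsPiSpecial σ G α ∧ IsPiSpecial σᶜ G β ∧ χ = α * β

/-- `G` is `σ`-separable: it has a subnormal series each of whose factors is a
`σ`-group or a `σ'`-group (equivalently, every composition factor is a `σ`-group or a
`σ'`-group). -/
def IsPiSeparable (σ : Set ℕ) (G : Type) [Group G] : Prop :=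
  ∃ (n : ℕ) (c : Fin (n + 1) → Subgroup G),
    c 0 = ⊥ ∧ c (Fin.last n) = ⊤ ∧
    ∀ i : Fin n, c i.castSucc ≤ c i.succ ∧ ((c i.castSucc).subgroupOf (c i.succ)).Normal ∧
      (IsPiNumber σ (Nat.card (↥(c i.succ) ⧸ (c i.castSucc).subgroupOf (c i.succ))) ∨
        IsPiNumber σᶜ (Nat.card (↥(c i.succ) ⧸ (c i.castSucc).subgroupOf (c i.succ))))

/-- `G` is `p`-solvable: every composition factor is a `p`-group or a `p'`-group. -/
def IsPSolvable (p : ℕ) (G : Type) [Group G] : Prop :=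
  IsPiSeparable {p} G

/-- The character `δ` of the subgroup `Q` is invariant under (conjugation by the
elements of) the subgroup `S`. -/
def InvariantUnder {G : Type} [Group G] (Q : Subgroup G) (δ : ↥Q → ℂ) (S : Subgroup G) : Prop :=
  ∀ g ∈ S, ∀ x : ↥Q, ∀ h : g * (x : G) * g⁻¹ ∈ Q, δ ⟨g * (x : G) * g⁻¹, h⟩ = δ x

/-- `(Q, δ)` is a vertex pair for `χ ∈ Irr(G)` (at the prime `p`): `Q` is a `p`-subgroup
of `G`, `δ ∈ Irr(Q)`, and there are a subgroup `U ≤ G` and an irreducible character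
`ψ = αβ` of `U` with `α` `p'`-special and `β` `p`-special, such that `ψ^G = χ`, `Q` is a
Sylow `p`-subgroup of `U`, and `β_Q = δ`. -/
def IsVertexPair (p : ℕ) {G : Type} [Group G] [Fintype G] (χ : G → ℂ)
    (Q : Subgroup G) (δ : ↥Q → ℂ) : Prop :=
  IsPGroup p ↥Q ∧ IsIrrChar ↥Q δ ∧
    ∃ (U : Subgroup G) (hQU : Q ≤ U) (α β : ↥U → ℂ),
      IsPiSpecial ({p}ᶜ) ↥U α ∧ IsPiSpecial {p} ↥U β ∧
      IsIrrChar ↥U (α * β) ∧ indChar U (α * β) = χ ∧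
      ¬ p ∣ (Q.subgroupOf U).index ∧
      ∀ x : ↥Q, δ x = β ⟨(x : G), hQU x.2⟩

/-- `(Q, δ)` is a generalized `σ`-vertex for `χ ∈ Irr(G)`: there are `U ≤ G` and an
irreducible `ψ = αβ ∈ Irr(U)` with `α` `σ`-special and `β` `σ'`-special such that
`ψ^G = χ`, `Q` is a Hall `σ'`-subgroup of `U` and `δ = β_Q`. -/
def IsGenPiVertex (σ : Set ℕ) {G : Type} [Group G] [Fintype G] (χ : G → ℂ)
    (Q : Subgroup G) (δ : ↥Q → ℂ) : Prop :=
  ∃ (U : Subgroup G) (hQU : Q ≤ U) (α β : ↥U → ℂ),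
    IsPiSpecial σ ↥U α ∧ IsPiSpecial σᶜ ↥U β ∧
    IsIrrChar ↥U (α * β) ∧ indChar U (α * β) = χ ∧
    IsPiNumber σᶜ (Nat.card ↥Q) ∧ IsPiNumber σ ((Q.subgroupOf U).index) ∧
    ∀ x : ↥Q, δ x = β ⟨(x : G), hQU x.2⟩

/-- The pair `(Q₂, δ₂)` is the conjugate of the pair `(Q₁, δ₁)` by the element `g`. -/
def IsConjPair {G : Type} [Group G] (g : G)
    (Q₁ : Subgroup G) (δ₁ : ↥Q₁ → ℂ) (Q₂ : Subgroup G) (δ₂ : ↥Q₂ → ℂ) : Prop :=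
  Q₂ = Subgroup.map (MulAut.conj g).toMonoidHom Q₁ ∧
    ∀ x : ↥Q₁, ∀ h : g * (x : G) * g⁻¹ ∈ Q₂, δ₂ ⟨g * (x : G) * g⁻¹, h⟩ = δ₁ x

/-- `Q` is a vertex (subgroup) of the irreducible `σ`-partial character `φ` of `G`:
`Q` is a Hall `σ'`-subgroup of a subgroup `U ≤ G` possessing an irreducible `σ`-partial
character `κ` of `σ`-degree with `κ^G = φ`. -/
def IsVertexSubgroup (σ : Set ℕ) {G : Type} [Group G] [Fintype G] (φ : G → ℂ)
    (Q : Subgroup G) : Prop :=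
  ∃ (U : Subgroup G) (κ : ↥U → ℂ), Q ≤ U ∧
    IsPiNumber σᶜ (Nat.card ↥Q) ∧ IsPiNumber σ ((Q.subgroupOf U).index) ∧
    IsIPiChar σ ↥U κ ∧ (∃ n : ℕ, κ 1 = (n : ℂ) ∧ IsPiNumber σ n) ∧
    indChar U κ = φ

/-- `θ ∈ I_σ(M)` is an irreducible constituent of the restriction `φ_M`. -/
def IsIPiConstituent (σ : Set ℕ) {G : Type} [Group G] (M : Subgroup G)
    (θ : ↥M → ℂ) (φ : G → ℂ) : Prop :=
  IsIPiChar σ ↥M θ ∧ ∃ ξ : ↥M → ℂ, (ξ = 0 ∨ IsPartialChar σ ↥M ξ) ∧ resChar M φ = θ + ξ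

section RepresentationTheory

variable {Γ : Type} [Group Γ] [Finite Γ]

open Representation in
/-- Induction principle for complex representations of a finite group, coming from Maschke. -/
theorem rep_induction
    (P : ∀ (V : Type) [AddCommGroup V] [Module ℂ V] [FiniteDimensional ℂ V],
      Representation ℂ Γ V → Prop)
    (h0 : ∀ (V : Type) [AddCommGroup V] [Module ℂ V] [FiniteDimensional ℂ V]
      (ρ : Representation ℂ Γ V), Subsingleton V → P V ρ)
    (hirr : ∀ (V : Type) [AddCommGroup V] [Module ℂ V] [FiniteDimensional ℂ V]
      (ρ : Representation ℂ Γ V), ρ.IsIrreducible → P V ρ)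
    (hsum : ∀ (V : Type) [AddCommGroup V] [Module ℂ V] [FiniteDimensional ℂ V]
      (ρ : Representation ℂ Γ V) (W W' : Subrepresentation ρ),
      IsCompl W.toSubmodule W'.toSubmodule →
      W ≠ ⊥ → W' ≠ ⊥ →
      P W.toSubmodule W.toRepresentation → P W'.toSubmodule W'.toRepresentation → P V ρ)
    (V : Type) [AddCommGroup V] [Module ℂ V] [FiniteDimensional ℂ V]
    (ρ : Representation ℂ Γ V) : P V ρ := by
  suffices H : ∀ n : ℕ, ∀ (V : Type) [AddCommGroup V] [Module ℂ V] [FiniteDimensional ℂ V]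
      (ρ : Representation ℂ Γ V), Module.finrank ℂ V = n → P V ρ from H _ V ρ rfl
  intro n
  induction n using Nat.strong_induction_on with
  | _ n ih =>
  intro V _ _ _ ρ hn
  by_cases hs : Subsingleton V
  · exact h0 V ρ hs
  by_cases hI : ρ.IsIrreducible
  · exact hirr V ρ hI
  have hnt : Nontrivial V := not_subsingleton_iff_nontrivial.mp hs
  have hNT : Nontrivial (Subrepresentation ρ) := by
    refine ⟨⊥, ⊤, fun h => ?_⟩
    have := congrArg Subrepresentation.toSubmodule h
    exact bot_ne_top (α := Submodule ℂ V) this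
  obtain ⟨W, hW0, hW1⟩ : ∃ W : Subrepresentation ρ, W ≠ ⊥ ∧ W ≠ ⊤ := by
    by_contra hcon
    push Not at hcon
    apply hI
    exact { eq_bot_or_eq_top := fun a => by
              by_cases h : a = ⊥
              · exact Or.inl h
              · exact Or.inr (hcon a h) }
  have : NeZero (Nat.card Γ : ℂ) := ⟨by
    exact_mod_cast Nat.card_pos.ne'⟩
  obtain ⟨W', hc⟩ := exists_isCompl W
  have hc' : IsCompl W.toSubmodule W'.toSubmodule := by
    constructor
    · rw [disjoint_iff]
      have := disjoint_iff.mp hc.1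
      have := congrArg Subrepresentation.toSubmodule this
      exact this
    · rw [codisjoint_iff]
      have := codisjoint_iff.mp hc.2
      have := congrArg Subrepresentation.toSubmodule this
      exact this
  have hW'0 : W' ≠ ⊥ := by
    rintro rfl
    exact hW1 (by simpa using codisjoint_iff.mp hc.2)
  have hW'1 : W' ≠ ⊤ := by
    rintro rfl
    exact hW0 (by simpa using disjoint_iff.mp hc.1)
  have l1 : ∀ X : Subrepresentation ρ, X ≠ ⊤ → Module.finrank ℂ X.toSubmodule < n := by
    intro X hX
    rw [← hn]
    apply Submodule.finrank_lt
    intro h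
    apply hX
    exact Subrepresentation.toSubmodule_injective h
  exact hsum V ρ W W' hc' hW0 hW'0 (ih _ (l1 W hW1) _ _ rfl) (ih _ (l1 W' hW'1) _ _ rfl)

omit [Finite Γ] in
theorem end_decomp {V : Type} [AddCommGroup V] [Module ℂ V] [FiniteDimensional ℂ V]
    (ρ : Representation ℂ Γ V) (W W' : Subrepresentation ρ)
    (hc : IsCompl W.toSubmodule W'.toSubmodule) (g : Γ) :
    LinearMap.trace ℂ V (ρ g) = LinearMap.trace ℂ _ (W.toRepresentation g) +
      LinearMap.trace ℂ _ (W'.toRepresentation g) ∧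
    LinearMap.det (ρ g) = LinearMap.det (W.toRepresentation g) *
      LinearMap.det (W'.toRepresentation g) := by
  let e := Submodule.prodEquivOfIsCompl _ _ hc
  have key : e.conj (LinearMap.prodMap (W.toRepresentation g) (W'.toRepresentation g)) = ρ g := by
    ext v
    obtain ⟨⟨a, b⟩, rfl⟩ := e.surjective v
    simp [e, LinearEquiv.conj_apply, Subrepresentation.toRepresentation]
  refine ⟨?_, ?_⟩
  · rw [← key, LinearMap.trace_conj', LinearMap.trace_prodMap']
  · rw [← key, LinearEquiv.conj_apply]
    have := LinearMap.det_conj (LinearMap.prodMap (W.toRepresentation g) (W'.toRepresentation g)) e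
    rw [← LinearMap.det_prodMap, ← this]
    rfl

end RepresentationTheory

section Characters

variable {Γ : Type} [Group Γ] [Finite Γ]

omit [Finite Γ] in
theorem isCharacter_of_rep {V : Type} [AddCommGroup V] [Module ℂ V] [FiniteDimensional ℂ V]
    (ρ : Representation ℂ Γ V) : IsCharacter Γ ρ.character :=
  ⟨FDRep.of ρ, fun _ => rfl⟩

omit [Finite Γ] in
theorem IsCharacter.exists_rep {χ : Γ → ℂ} (h : IsCharacter Γ χ) :
    ∃ (V : Type) (_ : AddCommGroup V) (_ : Module ℂ V) (_ : FiniteDimensional ℂ V)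
      (ρ : Representation ℂ Γ V), χ = ρ.character := by
  obtain ⟨V, hV⟩ := h
  exact ⟨V, inferInstance, inferInstance, inferInstance, V.ρ, funext hV⟩

theorem char_ip_nat {V W : Type} [AddCommGroup V] [Module ℂ V] [FiniteDimensional ℂ V]
    [AddCommGroup W] [Module ℂ W] [FiniteDimensional ℂ W] [Fintype Γ]
    (ρ : Representation ℂ Γ V) (τ : Representation ℂ Γ W) :
    (Nat.card Γ : ℂ)⁻¹ * ∑ g : Γ, ρ.character g * τ.character g⁻¹ =
      Module.finrank ℂ (Representation.IntertwiningMap τ ρ) := by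
  have : Invertible (Nat.card Γ : ℂ) := invertibleOfNonzero (by exact_mod_cast Nat.card_pos.ne')
  exact Representation.card_inv_mul_sum_char_mul_char_eq_finrank τ ρ

omit [Finite Γ] in
theorem irr_rep_of_isIrrChar [Finite Γ] {V : Type} [AddCommGroup V] [Module ℂ V]
    [FiniteDimensional ℂ V] (ρ : Representation ℂ Γ V) (h : IsIrrChar Γ ρ.character) :
    ρ.IsIrreducible := by
  obtain ⟨-, h0, hs⟩ := h
  revert h0 hs
  refine rep_induction (fun V _ _ _ ρ => ρ.character ≠ 0 → (¬ ∃ χ₁ χ₂ : Γ → ℂ,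
    IsCharacter Γ χ₁ ∧ χ₁ ≠ 0 ∧ IsCharacter Γ χ₂ ∧ χ₂ ≠ 0 ∧ ρ.character = χ₁ + χ₂) →
    ρ.IsIrreducible) ?_ ?_ ?_ V ρ
  · intro V _ _ _ ρ hV h0
    exact absurd (funext fun g => by
      have : ρ g = 0 := Subsingleton.elim _ _
      simp [Representation.character, this]) h0
  · intro V _ _ _ ρ hI _ _
    exact hI
  · intro V _ _ _ ρ W W' hc hW hW' _ _ h0 hs
    have ne : ∀ X : Subrepresentation ρ, X ≠ ⊥ → X.toRepresentation.character ≠ 0 := by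
      intro X hX hz
      have := congrFun hz 1
      rw [Representation.char_one] at this
      have h2 : Module.finrank ℂ X.toSubmodule = 0 := by simpa using this
      rw [Submodule.finrank_eq_zero] at h2
      exact hX (Subrepresentation.toSubmodule_injective h2)
    exact absurd ⟨_, _, isCharacter_of_rep _, ne W hW, isCharacter_of_rep _, ne W' hW',
      funext fun g => (end_decomp ρ W W' hc g).1⟩ hs

omit [Finite Γ] in
theorem char_self_pos {V : Type} [AddCommGroup V] [Module ℂ V] [FiniteDimensional ℂ V]
    (ρ : Representation ℂ Γ V) (h : ρ.character ≠ 0) :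
    1 ≤ Module.finrank ℂ (Representation.IntertwiningMap ρ ρ) := by
  rw [Nat.one_le_iff_ne_zero]
  intro h0
  have := Module.finrank_zero_iff.mp h0
  apply h
  have h1 : (Representation.IntertwiningMap.id ρ) = 0 := Subsingleton.elim _ _
  have h2 : ∀ v : V, v = 0 := fun v => by
    have := congrArg (fun f : Representation.IntertwiningMap ρ ρ => f v) h1
    simpa using this
  have : Subsingleton V := ⟨fun a b => by rw [h2 a, h2 b]⟩
  funext g
  have : ρ g = 0 := Subsingleton.elim _ _
  simp [Representation.character, this]

theorem isIrrChar_of_irr_rep {V : Type} [AddCommGroup V] [Module ℂ V]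
    [FiniteDimensional ℂ V] (ρ : Representation ℂ Γ V) (h : ρ.IsIrreducible) :
    IsIrrChar Γ ρ.character := by
  have := Fintype.ofFinite Γ
  have h1 : Module.finrank ℂ (Representation.IntertwiningMap ρ ρ) = 1 :=
    Representation.IsIrreducible.finrank_intertwiningMap_self ρ
  refine ⟨isCharacter_of_rep _, ?_, ?_⟩
  · intro hz
    have := char_ip_nat ρ ρ
    rw [hz, h1] at this
    simp at this
  · rintro ⟨χ₁, χ₂, hc1, h01, hc2, h02, he⟩
    obtain ⟨V1, _, _, _, ρ1, rfl⟩ := hc1.exists_rep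
    obtain ⟨V2, _, _, _, ρ2, rfl⟩ := hc2.exists_rep
    have e := char_ip_nat ρ ρ
    rw [he, h1] at e
    simp only [Pi.add_apply, add_mul, mul_add, Finset.sum_add_distrib, char_ip_nat] at e
    have a1 := char_self_pos ρ1 h01
    have a2 := char_self_pos ρ2 h02
    have e' : Module.finrank ℂ (Representation.IntertwiningMap ρ1 ρ1) +
      Module.finrank ℂ (Representation.IntertwiningMap ρ1 ρ2) +
      (Module.finrank ℂ (Representation.IntertwiningMap ρ2 ρ1) +
      Module.finrank ℂ (Representation.IntertwiningMap ρ2 ρ2)) = 1 := by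
      have : ((Module.finrank ℂ (Representation.IntertwiningMap ρ1 ρ1) +
      Module.finrank ℂ (Representation.IntertwiningMap ρ1 ρ2) +
      (Module.finrank ℂ (Representation.IntertwiningMap ρ2 ρ1) +
      Module.finrank ℂ (Representation.IntertwiningMap ρ2 ρ2)) : ℕ) : ℂ) = 1 := by
        push_cast
        rw [← e.trans Nat.cast_one]
      exact_mod_cast this
    omega

/-- Completeness of the irreducible characters. -/
theorem class_fn_eq_zero [Fintype Γ] {f : Γ → ℂ} (hf : ∀ x g, f (x * g * x⁻¹) = f g)
    (ho : ∀ χ, IsIrrChar Γ χ → ∑ g, f g * χ g⁻¹ = 0) : f = 0 := by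
  have key : ∀ (V : Type) [AddCommGroup V] [Module ℂ V] [FiniteDimensional ℂ V]
      (ρ : Representation ℂ Γ V), ∑ g, f g • ρ g⁻¹ = 0 := by
    intro V _ _ _ ρ
    refine rep_induction (fun V _ _ _ ρ => ∑ g, f g • ρ g⁻¹ = 0) ?_ ?_ ?_ V ρ
    · intro V _ _ _ ρ _
      exact Subsingleton.elim _ _
    · intro V _ _ _ ρ hI
      let T : V →ₗ[ℂ] V := ∑ g, f g • ρ g⁻¹
      have hT : ∀ x, T ∘ₗ ρ x = ρ x ∘ₗ T := by
        intro x
        change T * ρ x = ρ x * T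
        simp only [T, Finset.sum_mul, Finset.mul_sum, smul_mul_assoc, mul_smul_comm, ← map_mul]
        rw [← Equiv.sum_comp (MulAut.conj x).toEquiv]
        refine Finset.sum_congr rfl fun g _ => ?_
        have := hf x g
        rw [mul_assoc] at this
        simp [MulAut.conj_apply, mul_assoc, this]
      let T' : Representation.IntertwiningMap ρ ρ := ⟨T, hT⟩
      obtain ⟨c, hc⟩ :=
        (Representation.IsIrreducible.algebraMap_intertwiningMap_bijective_of_isAlgClosed
          (ρ := ρ)).2 T'
      have hTc : T = c • LinearMap.id := by
        ext v
        have := congrArg (fun F : Representation.IntertwiningMap ρ ρ => F v) hc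
        have h3 : T' v = c • v := by simpa [Algebra.algebraMap_eq_smul_one] using this.symm
        exact h3
      have htr : LinearMap.trace ℂ V T = 0 := by
        simp only [T, map_sum, map_smul]
        exact ho _ (isIrrChar_of_irr_rep ρ hI)
      have hV : (Module.finrank ℂ V : ℂ) ≠ 0 := by
        intro h0
        have := (isIrrChar_of_irr_rep ρ hI).2.1
        apply this
        have h0' : Module.finrank ℂ V = 0 := by exact_mod_cast h0
        have := Module.finrank_zero_iff.mp h0'
        funext g
        have : ρ g = 0 := Subsingleton.elim _ _
        simp [Representation.character, this]
      rw [hTc] at htr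
      simp only [map_smul, LinearMap.trace_id, smul_eq_mul, mul_eq_zero, hV, or_false] at htr
      change T = 0
      rw [hTc, htr, zero_smul]
    · intro V _ _ _ ρ W W' hc _ _ h1 h2
      ext v
      obtain ⟨⟨a, b⟩, rfl⟩ := (Submodule.prodEquivOfIsCompl _ _ hc).surjective v
      have e1 := congrArg (fun F => ((F a : W.toSubmodule) : V)) h1
      have e2 := congrArg (fun F => ((F b : W'.toSubmodule) : V)) h2
      simp only [LinearMap.sum_apply, LinearMap.smul_apply, Submodule.coe_sum, Submodule.coe_smul,
        LinearMap.zero_apply, Submodule.coe_zero, Subrepresentation.toRepresentation,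
        MonoidHom.coe_mk, OneHom.coe_mk, LinearMap.restrict_apply] at e1 e2
      simp only [LinearMap.sum_apply, LinearMap.smul_apply, map_add,
        Submodule.coe_prodEquivOfIsCompl', smul_add, Finset.sum_add_distrib, e1, e2]
      simp
  let ρ : Representation ℂ Γ (Γ → ℂ) :=
    { toFun := fun g => LinearMap.funLeft ℂ ℂ (fun x => g⁻¹ * x)
      map_one' := by ext; simp [LinearMap.funLeft]
      map_mul' := by intro a b; ext; simp [LinearMap.funLeft, mul_assoc] }
  have h := key _ ρ
  funext g
  have h2 := congrFun (congrArg (fun F => F (Pi.single g (1:ℂ))) h) 1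
  simp only [LinearMap.sum_apply, LinearMap.smul_apply, Finset.sum_apply, Pi.smul_apply,
    LinearMap.zero_apply, Pi.zero_apply] at h2
  simpa [ρ, LinearMap.funLeft, Pi.single_apply] using h2

end Characters

section Closure

variable {Γ Δ : Type} [Group Γ] [Group Δ]

theorem IsCharacter.zero : IsCharacter Γ (0 : Γ → ℂ) := by
  have := isCharacter_of_rep (1 : Representation ℂ Γ PUnit.{1})
  convert this
  ext g
  have h0 : (1 : Representation ℂ Γ PUnit.{1}) g = 0 := Subsingleton.elim _ _
  simp [Representation.character, h0]

theorem IsCharacter.one : IsCharacter Γ (1 : Γ → ℂ) := by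
  have := isCharacter_of_rep (1 : Representation ℂ Γ ℂ)
  convert this
  ext g
  simp [Representation.character]

theorem IsCharacter.add {χ ψ : Γ → ℂ} (hχ : IsCharacter Γ χ) (hψ : IsCharacter Γ ψ) :
    IsCharacter Γ (χ + ψ) := by
  obtain ⟨V, _, _, _, ρ, rfl⟩ := hχ.exists_rep
  obtain ⟨W, _, _, _, τ, rfl⟩ := hψ.exists_rep
  let π : Representation ℂ Γ (V × W) :=
    { toFun := fun g => LinearMap.prodMap (ρ g) (τ g)
      map_one' := by simp
      map_mul' := by intro a b; simp [LinearMap.prodMap_mul] }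
  have := isCharacter_of_rep π
  convert this
  ext g
  exact (LinearMap.trace_prodMap' (ρ g) (τ g)).symm

theorem IsCharacter.mul {χ ψ : Γ → ℂ} (hχ : IsCharacter Γ χ) (hψ : IsCharacter Γ ψ) :
    IsCharacter Γ (χ * ψ) := by
  obtain ⟨V, _, _, _, ρ, rfl⟩ := hχ.exists_rep
  obtain ⟨W, _, _, _, τ, rfl⟩ := hψ.exists_rep
  rw [← Representation.char_tensor]
  exact isCharacter_of_rep _

theorem IsCharacter.comp {χ : Γ → ℂ} (hχ : IsCharacter Γ χ) (f : Δ →* Γ) :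
    IsCharacter Δ (fun x => χ (f x)) := by
  obtain ⟨V, _, _, _, ρ, rfl⟩ := hχ.exists_rep
  exact isCharacter_of_rep (ρ.comp f : Representation ℂ Δ V)

/-- `d` is the determinant of a representation affording `χ`. -/
def DetOf (χ d : Γ → ℂ) : Prop :=
  ∃ (n : ℕ) (ρ : Γ →* Matrix (Fin n) (Fin n) ℂ), (∀ g, χ g = (ρ g).trace) ∧ ∀ g, d g = (ρ g).det

theorem DetOf.isCharacter {χ d : Γ → ℂ} (h : DetOf χ d) : IsCharacter Γ χ := by
  obtain ⟨n, ρ, h1, -⟩ := h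
  let π : Representation ℂ Γ (Fin n → ℂ) :=
    (Matrix.toLinAlgEquiv' (R := ℂ) (n := Fin n)).toAlgHom.toMonoidHom.comp ρ
  have := isCharacter_of_rep π
  convert this
  ext g
  rw [h1, Representation.character]
  change _ = LinearMap.trace ℂ _ (Matrix.toLin' (ρ g))
  rw [Matrix.trace_toLin'_eq]

theorem detOf_rep {V : Type} [AddCommGroup V] [Module ℂ V] [FiniteDimensional ℂ V]
    (ρ : Representation ℂ Γ V) : DetOf ρ.character (fun g => LinearMap.det (ρ g)) := by
  let b := Module.finBasis ℂ V
  refine ⟨Module.finrank ℂ V,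
    (LinearMap.toMatrixAlgEquiv b).toAlgHom.toMonoidHom.comp ρ, fun g => ?_, fun g => ?_⟩
  · rw [Representation.character, LinearMap.trace_eq_matrix_trace ℂ b]
    rfl
  · change LinearMap.det (ρ g) = _
    rw [← LinearMap.det_toMatrix b]
    rfl

theorem IsCharacter.exists_detOf {χ : Γ → ℂ} (h : IsCharacter Γ χ) : ∃ d, DetOf χ d := by
  obtain ⟨V, _, _, _, ρ, rfl⟩ := h.exists_rep
  exact ⟨_, detOf_rep ρ⟩

theorem hasPiDetOrder_imp {σ : Set ℕ} {χ : Γ → ℂ} (h : HasPiDetOrder σ Γ χ) :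
    ∃ d, DetOf χ d ∧ IsPiNumber σ (orderOf d) := by
  obtain ⟨V, h1, h2⟩ := h
  refine ⟨_, ?_, h2⟩
  have := detOf_rep (V.ρ)
  convert this using 1
  exact funext h1

theorem DetOf.comp {χ d : Γ → ℂ} (h : DetOf χ d) (f : Δ →* Γ) :
    DetOf (fun x => χ (f x)) (fun x => d (f x)) := by
  obtain ⟨n, ρ, h1, h2⟩ := h
  exact ⟨n, ρ.comp f, fun x => h1 _, fun x => h2 _⟩

theorem DetOf.map {χ d : Γ → ℂ} (h : DetOf χ d) (σ : ℂ →+* ℂ) :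
    DetOf (fun x => σ (χ x)) (fun x => σ (d x)) := by
  obtain ⟨n, ρ, h1, h2⟩ := h
  refine ⟨n, (σ.mapMatrix : Matrix (Fin n) (Fin n) ℂ →+* _).toMonoidHom.comp ρ, fun x => ?_,
    fun x => ?_⟩
  · change σ (χ x) = _
    rw [h1]
    simp [Matrix.trace]
  · change σ (d x) = _
    rw [h2, RingHom.map_det]
    rfl

theorem IsCharacter.map {χ : Γ → ℂ} (h : IsCharacter Γ χ) (σ : ℂ →+* ℂ) :
    IsCharacter Γ (fun x => σ (χ x)) := by
  obtain ⟨d, hd⟩ := h.exists_detOf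
  exact (hd.map σ).isCharacter

theorem DetOf.mul_lin {χ d : Γ → ℂ} (h : DetOf χ d) (l : Γ →* ℂ) {n : ℕ} (hn : χ 1 = n) :
    DetOf (fun x => χ x * l x) (fun x => d x * l x ^ n) := by
  obtain ⟨m, ρ, h1, h2⟩ := h
  have hm : m = n := by
    rw [h1] at hn
    simp at hn
    exact_mod_cast hn
  subst hm
  refine ⟨m, { toFun := fun x => l x • ρ x, map_one' := by simp, map_mul' := ?_ },
    fun x => ?_, fun x => ?_⟩
  · intro a b
    simp [smul_smul, mul_comm]
  · simp [h1, mul_comm]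
  · simp [h2, Matrix.det_smul, mul_comm]

theorem DetOf.map_mul {χ d : Γ → ℂ} (h : DetOf χ d) (a b : Γ) : d (a * b) = d a * d b := by
  obtain ⟨m, ρ, h1, h2⟩ := h
  simp [h2]

theorem DetOf.map_one {χ d : Γ → ℂ} (h : DetOf χ d) : d 1 = 1 := by
  obtain ⟨m, ρ, h1, h2⟩ := h
  simp [h2]

theorem DetOf.map_pow {χ d : Γ → ℂ} (h : DetOf χ d) (a : Γ) (n : ℕ) : d (a ^ n) = d a ^ n := by
  obtain ⟨m, ρ, h1, h2⟩ := h
  simp [h2]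

end Closure

section Eigenvalues

variable {Γ : Type} [Group Γ] [Finite Γ]

/-- `s` is the multiset of eigenvalues of `g` on a representation with character `χ`
and determinant `d`. -/
def EigOf (χ d : Γ → ℂ) (g : Γ) (s : Multiset ℂ) : Prop :=
  (∀ μ ∈ s, μ ^ orderOf g = 1) ∧ (∀ k : ℕ, χ (g ^ k) = (s.map (· ^ k)).sum) ∧ d g = s.prod

theorem rep_exists_eig {V : Type} [AddCommGroup V] [Module ℂ V] [FiniteDimensional ℂ V]
    (ρ : Representation ℂ Γ V) (g : Γ) :
    ∃ s, EigOf ρ.character (fun g => LinearMap.det (ρ g)) g s := by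
  let Z := Subgroup.zpowers g
  let z : Z := ⟨g, Subgroup.mem_zpowers g⟩
  let τ : Representation ℂ Z V := ρ.comp Z.subtype
  have key : ∃ s : Multiset ℂ, (∀ μ ∈ s, μ ^ orderOf g = 1) ∧
      (∀ k : ℕ, τ.character (z ^ k) = (s.map (· ^ k)).sum) ∧ LinearMap.det (τ z) = s.prod := by
    refine rep_induction (fun V _ _ _ τ => ∃ s : Multiset ℂ, (∀ μ ∈ s, μ ^ orderOf g = 1) ∧
      (∀ k : ℕ, τ.character (z ^ k) = (s.map (· ^ k)).sum) ∧ LinearMap.det (τ z) = s.prod)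
      ?_ ?_ ?_ V τ
    · intro V _ _ _ ρ hV
      refine ⟨0, by simp, fun k => ?_, ?_⟩
      · have : ρ (z ^ k) = 0 := Subsingleton.elim _ _
        simp [Representation.character, this]
      · have : ρ z = LinearMap.id := Subsingleton.elim _ _
        rw [this, LinearMap.det_id]
        simp
    · intro V _ _ _ ρ hI
      have h1 : Module.finrank ℂ V = 1 :=
        Representation.IsIrreducible.finrank_eq_one_of_isMulCommutative ρ
      obtain ⟨c, hc, -⟩ := LinearMap.existsUnique_eq_smul_id_of_finrank_eq_one h1 (ρ z)
      have hp : ∀ k : ℕ, ρ (z ^ k) = c ^ k • LinearMap.id := by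
        intro k
        rw [_root_.map_pow, hc]
        change (c • (1 : Module.End ℂ V)) ^ k = c ^ k • (1 : Module.End ℂ V)
        rw [smul_pow, one_pow]
      refine ⟨{c}, ?_, ?_, ?_⟩
      · simp only [Multiset.mem_singleton, forall_eq]
        have h2 := hp (orderOf g)
        have h3 : z ^ orderOf g = 1 := Subtype.ext (by simp [z, pow_orderOf_eq_one])
        rw [h3, _root_.map_one] at h2
        have h4 := congrArg (LinearMap.trace ℂ V) h2
        simpa [h1] using h4.symm
      · intro k
        simp [Representation.character, hp, h1]
      · rw [hc, LinearMap.det_smul, h1]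
        simp
    · rintro V _ _ _ ρ W W' hc _ _ ⟨s, a1, a2, a3⟩ ⟨s', b1, b2, b3⟩
      refine ⟨s + s', ?_, ?_, ?_⟩
      · intro μ hμ
        rcases Multiset.mem_add.mp hμ with h | h
        exacts [a1 _ h, b1 _ h]
      · intro k
        rw [Multiset.map_add, Multiset.sum_add, ← a2, ← b2]
        exact (end_decomp ρ W W' hc _).1
      · rw [Multiset.prod_add, ← a3, ← b3]
        exact (end_decomp ρ W W' hc _).2
  exact key

theorem DetOf.exists_eig {χ d : Γ → ℂ} (h : DetOf χ d) (g : Γ) : ∃ s, EigOf χ d g s := by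
  obtain ⟨n, ρ, h1, h2⟩ := h
  let π : Representation ℂ Γ (Fin n → ℂ) :=
    (Matrix.toLinAlgEquiv' (R := ℂ) (n := Fin n)).toAlgHom.toMonoidHom.comp ρ
  obtain ⟨s, hs⟩ := rep_exists_eig π g
  refine ⟨s, ?_⟩
  convert hs using 1
  · ext g
    rw [h1, Representation.character]
    change _ = LinearMap.trace ℂ _ (Matrix.toLin' (ρ g))
    rw [Matrix.trace_toLin'_eq]
  · ext g
    rw [h2]
    change _ = LinearMap.det (Matrix.toLin' (ρ g))
    rw [LinearMap.det_toLin']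

theorem multiset_eq_of_powersums {n : ℕ} (hn : 0 < n) {s t : Multiset ℂ}
    (hs : ∀ μ ∈ s, μ ^ n = 1) (ht : ∀ μ ∈ t, μ ^ n = 1)
    (h : ∀ k : ℕ, (s.map (· ^ k)).sum = (t.map (· ^ k)).sum) : s = t := by
  have key : ∀ s : Multiset ℂ, (∀ μ ∈ s, μ ^ n = 1) → ∀ μ : ℂ, μ ^ n = 1 →
      ∑ k ∈ Finset.range n, (s.map (· ^ k)).sum * (μ⁻¹) ^ k = n * (s.count μ : ℂ) := by
    intro s
    induction s using Multiset.induction_on with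
    | empty => intro _ μ _; simp
    | cons a s ih =>
      intro hs μ hμ
      have ha : a ^ n = 1 := hs a (by simp)
      have := ih (fun x hx => hs x (by simp [hx])) μ hμ
      simp only [Multiset.map_cons, Multiset.sum_cons, add_mul, Finset.sum_add_distrib, this,
        ← mul_pow]
      have hμ0 : μ ≠ 0 := by rintro rfl; simp [hn.ne'] at hμ
      by_cases e : a = μ
      · subst e
        simp [hμ0, mul_add]
        ring
      · rw [Multiset.count_cons_of_ne (Ne.symm e)]
        have h1 : a * μ⁻¹ ≠ 1 := fun h => e (by
          field_simp at h
          exact h)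
        rw [geom_sum_eq h1, mul_pow, inv_pow, ha, hμ]
        simp
  ext μ
  by_cases hμ : μ ^ n = 1
  · have a := key s hs μ hμ
    have b := key t ht μ hμ
    simp only [h] at a
    rw [b] at a
    have hn' : (n : ℂ) ≠ 0 := by exact_mod_cast hn.ne'
    have := mul_left_cancel₀ hn' a
    exact_mod_cast this.symm
  · rw [Multiset.count_eq_zero_of_notMem fun h => hμ (hs _ h),
      Multiset.count_eq_zero_of_notMem fun h => hμ (ht _ h)]

theorem DetOf.unique {χ d d' : Γ → ℂ} (h : DetOf χ d) (h' : DetOf χ d') : d = d' := by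
  ext g
  obtain ⟨s, a1, a2, a3⟩ := h.exists_eig g
  obtain ⟨t, b1, b2, b3⟩ := h'.exists_eig g
  rw [a3, b3, multiset_eq_of_powersums (orderOf_pos g) a1 b1 fun k => by rw [← a2, ← b2]]

theorem EigOf.card {χ d : Γ → ℂ} {g : Γ} {s : Multiset ℂ} (h : EigOf χ d g s) :
    χ 1 = (s.card : ℂ) := by
  have := h.2.1 0
  simpa using this

theorem EigOf.apply {χ d : Γ → ℂ} {g : Γ} {s : Multiset ℂ} (h : EigOf χ d g s) :
    χ g = s.sum := by
  have := h.2.1 1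
  simpa using this

theorem root_inv_conj {n : ℕ} (hn : n ≠ 0) {μ : ℂ} (h : μ ^ n = 1) :
    μ ^ (n - 1) = (starRingEnd ℂ) μ := by
  have h0 : μ ≠ 0 := by rintro rfl; simp [hn] at h
  have h1 : ‖μ‖ = 1 := Complex.norm_eq_one_of_pow_eq_one h hn
  rw [← Complex.inv_eq_conj h1]
  apply eq_inv_of_mul_eq_one_left
  rw [← pow_succ]
  rwa [Nat.sub_add_cancel (Nat.one_le_iff_ne_zero.mpr hn)]

theorem IsCharacter.inv_eq_conj {χ : Γ → ℂ} (h : IsCharacter Γ χ) (g : Γ) :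
    χ g⁻¹ = (starRingEnd ℂ) (χ g) := by
  obtain ⟨d, hd⟩ := h.exists_detOf
  obtain ⟨s, a1, a2, a3⟩ := hd.exists_eig g
  have h1 : g⁻¹ = g ^ (orderOf g - 1) := by
    rw [inv_eq_iff_mul_eq_one, ← pow_succ', Nat.sub_add_cancel (orderOf_pos g), pow_orderOf_eq_one]
  rw [h1, a2, EigOf.apply ⟨a1, a2, a3⟩, map_multiset_sum]
  congr 1
  exact Multiset.map_congr rfl fun μ hμ => root_inv_conj (orderOf_pos g).ne' (a1 μ hμ)

end Eigenvalues

section Masked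

variable {G : Type} [Group G]

/-- `f` is a character of the subgroup `H`, extended by zero to the whole group. -/
def Chr (H : Subgroup G) (f : G → ℂ) : Prop :=
  (∀ g, g ∉ H → f g = 0) ∧ IsCharacter ↥H (fun h => f h)

/-- `f` is an irreducible character of the subgroup `H`, extended by zero. -/
def Irr (H : Subgroup G) (f : G → ℂ) : Prop :=
  (∀ g, g ∉ H → f g = 0) ∧ IsIrrChar ↥H (fun h => f h)

/-- `f` is a class function of `H`, extended by zero. -/
def ClassOn (H : Subgroup G) (f : G → ℂ) : Prop :=
  (∀ g, g ∉ H → f g = 0) ∧ ∀ x ∈ H, ∀ g, f (x * g * x⁻¹) = f g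

/-- The inner product of functions supported on `H`. -/
def ip [Fintype G] (H : Subgroup G) (f h : G → ℂ) : ℂ :=
  (Nat.card H : ℂ)⁻¹ * ∑ g, f g * (starRingEnd ℂ) (h g)

/-- Restriction of a function to `K`, extended by zero. -/
def res (K : Subgroup G) (f : G → ℂ) : G → ℂ := fun g => if g ∈ K then f g else 0

/-- Conjugate of a function. -/
def cj (x : G) (f : G → ℂ) : G → ℂ := fun g => f (x⁻¹ * g * x)

/-- Induction from `K` to `H` of functions supported on `K`. -/
def ind [Fintype G] (K H : Subgroup G) (f : G → ℂ) : G → ℂ :=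
  fun g => (Nat.card K : ℂ)⁻¹ * ∑ x, if x ∈ H then f (x * g * x⁻¹) else 0

theorem card_ne_zero' [Finite G] (H : Subgroup G) : (Nat.card H : ℂ) ≠ 0 := by
  exact_mod_cast Nat.card_pos.ne'

theorem sum_subgroup [Fintype G] (H : Subgroup G) (F : G → ℂ) :
    ∑ h : H, F h = ∑ g, if g ∈ H then F g else 0 := by
  rw [← Finset.sum_filter]
  exact (Finset.sum_subtype (Finset.univ.filter (· ∈ H)) (fun x => by simp) F).symm

theorem sum_subgroup_of_supp [Fintype G] {H : Subgroup G} {F : G → ℂ}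
    (hF : ∀ g, g ∉ H → F g = 0) : ∑ h : H, F h = ∑ g, F g := by
  rw [sum_subgroup]
  refine Finset.sum_congr rfl fun g _ => ?_
  split_ifs with h
  · rfl
  · exact (hF g h).symm

theorem ext_on {H : Subgroup G} {f h : G → ℂ} (hf : ∀ g, g ∉ H → f g = 0)
    (hh : ∀ g, g ∉ H → h g = 0) (e : ∀ g ∈ H, f g = h g) : f = h := by
  funext g
  by_cases hg : g ∈ H
  · exact e g hg
  · rw [hf g hg, hh g hg]

theorem Chr.classOn {H : Subgroup G} {f : G → ℂ} (h : Chr H f) : ClassOn H f := by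
  refine ⟨h.1, fun x hx g => ?_⟩
  by_cases hg : g ∈ H
  · obtain ⟨V, _, _, _, ρ, hρ⟩ := h.2.exists_rep
    have a := congrFun hρ ⟨g, hg⟩
    have b := congrFun hρ (⟨x, hx⟩ * ⟨g, hg⟩ * ⟨x, hx⟩⁻¹)
    rw [Representation.char_conj, ← a] at b
    exact b
  · rw [h.1 g hg, h.1]
    intro h1
    apply hg
    have := H.mul_mem (H.mul_mem (H.inv_mem hx) h1) hx
    simpa [mul_assoc] using this

theorem Irr.chr {H : Subgroup G} {f : G → ℂ} (h : Irr H f) : Chr H f := ⟨h.1, h.2.1⟩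

theorem Irr.ne_zero {H : Subgroup G} {f : G → ℂ} (h : Irr H f) : f ≠ 0 := by
  rintro rfl
  exact h.2.2.1 rfl

section ipAlgebra
variable [Fintype G] (H : Subgroup G) (f f' h h' : G → ℂ)

theorem ip_add_left : ip H (f + f') h = ip H f h + ip H f' h := by
  simp [ip, add_mul, Finset.sum_add_distrib, mul_add]

theorem ip_sub_left : ip H (f - f') h = ip H f h - ip H f' h := by
  simp [ip, sub_mul, Finset.sum_sub_distrib, mul_sub]

theorem ip_smul_left (c : ℂ) : ip H (c • f) h = c * ip H f h := by
  simp only [ip, Pi.smul_apply, smul_eq_mul, mul_assoc, ← Finset.mul_sum]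
  ring

theorem ip_zero_left : ip H 0 h = 0 := by simp [ip]
theorem ip_conj : (starRingEnd ℂ) (ip H f h) = ip H h f := by
  simp [ip, mul_comm]

theorem ip_smul_right (c : ℂ) : ip H f (c • h) = (starRingEnd ℂ) c * ip H f h := by
  rw [← ip_conj, ip_smul_left, map_mul, ip_conj]

theorem ip_sum_left {ι : Type*} (s : Finset ι) (F : ι → G → ℂ) :
    ip H (∑ i ∈ s, F i) h = ∑ i ∈ s, ip H (F i) h := by
  induction s using Finset.induction_on with
  | empty => simp [ip]
  | insert a s ha ih => rw [Finset.sum_insert ha, Finset.sum_insert ha, ip_add_left, ih]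

end ipAlgebra

/-- Extension by zero of a function on a subgroup. -/
def mask (H : Subgroup G) (f : ↥H → ℂ) : G → ℂ := fun g => if h : g ∈ H then f ⟨g, h⟩ else 0

@[simp] theorem mask_coe (H : Subgroup G) (f : ↥H → ℂ) (x : H) : mask H f x = f x := by
  simp [mask]

theorem mask_supp (H : Subgroup G) (f : ↥H → ℂ) : ∀ g, g ∉ H → mask H f g = 0 := by
  intro g hg
  simp [mask, hg]

theorem chr_mask {H : Subgroup G} {f : ↥H → ℂ} (h : IsCharacter ↥H f) : Chr H (mask H f) :=
  ⟨mask_supp H f, by simpa using h⟩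

theorem irr_mask {H : Subgroup G} {f : ↥H → ℂ} (h : IsIrrChar ↥H f) : Irr H (mask H f) :=
  ⟨mask_supp H f, by simpa using h⟩

theorem mask_res_self {H : Subgroup G} {f : G → ℂ} (h : ∀ g, g ∉ H → f g = 0) :
    mask H (fun x => f x) = f := by
  funext g
  by_cases hg : g ∈ H
  · simp [mask, hg]
  · simp [mask, hg, h g hg]

variable [Fintype G]

theorem ip_eq_sub {H : Subgroup G} {f h : G → ℂ} (hf : ∀ g, g ∉ H → f g = 0) :
    ip H f h = (Nat.card H : ℂ)⁻¹ * ∑ x : H, f x * (starRingEnd ℂ) (h x) := by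
  rw [ip, sum_subgroup_of_supp (F := fun g => f g * (starRingEnd ℂ) (h g))]
  intro g hg
  rw [hf g hg, zero_mul]

theorem Chr.ip_nat {H : Subgroup G} {f h : G → ℂ} (hf : Chr H f) (hh : Chr H h) :
    ∃ n : ℕ, ip H f h = n := by
  obtain ⟨V, _, _, _, ρ, hρ⟩ := hf.2.exists_rep
  obtain ⟨W, _, _, _, τ, hτ⟩ := hh.2.exists_rep
  refine ⟨Module.finrank ℂ (Representation.IntertwiningMap τ ρ), ?_⟩
  rw [ip_eq_sub hf.1, ← char_ip_nat ρ τ]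
  congr 1
  refine Finset.sum_congr rfl fun x _ => ?_
  rw [← hρ, ← hτ]
  exact congrArg (f x * ·) (hh.2.inv_eq_conj x).symm

theorem Irr.orth {H : Subgroup G} {f h : G → ℂ} (hf : Irr H f) (hh : Irr H h) :
    ip H f h = if f = h then 1 else 0 := by
  obtain ⟨V, _, _, _, ρ, hρ⟩ := hf.2.1.exists_rep
  obtain ⟨W, _, _, _, τ, hτ⟩ := hh.2.1.exists_rep
  have h1 : ρ.IsIrreducible := irr_rep_of_isIrrChar ρ (hρ ▸ hf.2)
  have h2 : τ.IsIrreducible := irr_rep_of_isIrrChar τ (hτ ▸ hh.2)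
  have : Invertible (Nat.card H : ℂ) := invertibleOfNonzero (card_ne_zero' H)
  have key := Representation.char_orthonormal ρ τ
  have e : ip H f h = if Nonempty (τ.Equiv ρ) then 1 else 0 := by
    rw [← key, ip_eq_sub hf.1]
    congr 1
    refine Finset.sum_congr rfl fun x _ => ?_
    rw [← hρ, ← hτ]
    exact congrArg (f x * ·) (hh.2.1.inv_eq_conj x).symm
  rw [e]
  by_cases hfh : f = h
  · subst hfh
    simp only [if_true]
    by_contra hne
    have h0 : ip H f f = 0 := by
      rw [e]
      split_ifs with hh
      · exact absurd (by simp [hh]) hne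
      · rfl
    have := char_ip_nat ρ ρ
    have h3 : Module.finrank ℂ (Representation.IntertwiningMap ρ ρ) = 1 :=
      Representation.IsIrreducible.finrank_intertwiningMap_self ρ
    rw [h3] at this
    rw [ip_eq_sub hf.1] at h0
    have e2 : (Nat.card H : ℂ)⁻¹ * ∑ x : H, f x * (starRingEnd ℂ) (f x) =
        (Nat.card H : ℂ)⁻¹ * ∑ g : H, ρ.character g * ρ.character g⁻¹ := by
      congr 1
      refine Finset.sum_congr rfl fun x _ => ?_
      rw [← hρ]
      exact congrArg (f x * ·) (hf.2.1.inv_eq_conj x).symm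
    rw [e2, this] at h0
    simp at h0
  · rw [if_neg hfh, if_neg]
    rintro ⟨φ⟩
    apply hfh
    have := Representation.char_iso φ
    refine ext_on hf.1 hh.1 fun g hg => ?_
    have a := congrFun hρ ⟨g, hg⟩
    have b := congrFun hτ ⟨g, hg⟩
    rw [this] at b
    exact a.trans b.symm

theorem irr_finite (H : Subgroup G) : {χ : G → ℂ | Irr H χ}.Finite := by
  have hli : LinearIndependent ℂ (fun χ : {χ : G → ℂ // Irr H χ} => χ.1) := by
    rw [linearIndependent_iff']
    intro s c hc χ hχ
    have := congrArg (fun f => ip H f χ.1) hc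
    simp only [ip_sum_left, ip_smul_left, ip_zero_left] at this
    rw [Finset.sum_eq_single χ] at this
    · simpa [χ.2.orth χ.2] using this
    · intro ψ _ hne
      rw [ψ.2.orth χ.2, if_neg fun h => hne (Subtype.ext h), mul_zero]
    · intro h
      exact absurd hχ h
  exact hli.setFinite

/-- The finite set of irreducible characters of `H`. -/
def IrrF (H : Subgroup G) : Finset (G → ℂ) := (irr_finite H).toFinset

theorem mem_IrrF {H : Subgroup G} {χ : G → ℂ} : χ ∈ IrrF H ↔ Irr H χ := by
  simp [IrrF]

theorem ClassOn.eq_zero {H : Subgroup G} {f : G → ℂ} (hf : ClassOn H f)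
    (h : ∀ χ, Irr H χ → ip H f χ = 0) : f = 0 := by
  have : (fun x : H => f x) = 0 := by
    refine class_fn_eq_zero (fun x g => hf.2 x x.2 g) fun χ hχ => ?_
    have h1 := h _ (irr_mask hχ)
    rw [ip_eq_sub hf.1, mul_eq_zero] at h1
    have h2 := h1.resolve_left (inv_ne_zero (card_ne_zero' H))
    rw [← h2]
    refine Finset.sum_congr rfl fun x _ => ?_
    rw [mask_coe, hχ.1.inv_eq_conj]
  refine ext_on hf.1 (fun _ _ => rfl) fun g hg => ?_
  exact congrFun this ⟨g, hg⟩

theorem ClassOn.add {H : Subgroup G} {f h : G → ℂ} (hf : ClassOn H f) (hh : ClassOn H h) :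
    ClassOn H (f + h) :=
  ⟨fun g hg => by simp [hf.1 g hg, hh.1 g hg], fun x hx g => by simp [hf.2 x hx, hh.2 x hx]⟩

theorem ClassOn.sub {H : Subgroup G} {f h : G → ℂ} (hf : ClassOn H f) (hh : ClassOn H h) :
    ClassOn H (f - h) :=
  ⟨fun g hg => by simp [hf.1 g hg, hh.1 g hg], fun x hx g => by simp [hf.2 x hx, hh.2 x hx]⟩

theorem ClassOn.smul {H : Subgroup G} {f : G → ℂ} (c : ℂ) (hf : ClassOn H f) :
    ClassOn H (c • f) :=
  ⟨fun g hg => by simp [hf.1 g hg], fun x hx g => by simp [hf.2 x hx]⟩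

theorem ClassOn.zero {H : Subgroup G} : ClassOn H (0 : G → ℂ) :=
  ⟨fun _ _ => rfl, fun _ _ _ => rfl⟩

theorem ClassOn.sum {H : Subgroup G} {ι : Type*} (s : Finset ι) (F : ι → G → ℂ)
    (h : ∀ i ∈ s, ClassOn H (F i)) : ClassOn H (∑ i ∈ s, F i) := by
  induction s using Finset.induction_on with
  | empty => simpa using ClassOn.zero
  | insert a s ha ih =>
    rw [Finset.sum_insert ha]
    exact (h a (by simp)).add (ih fun i hi => h i (by simp [hi]))

theorem ip_expand {H : Subgroup G} (c : (G → ℂ) → ℂ) {s : Finset (G → ℂ)}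
    (hs : ∀ χ ∈ s, Irr H χ) {ψ : G → ℂ} (hψ : Irr H ψ) :
    ip H (∑ χ ∈ s, c χ • χ) ψ = if ψ ∈ s then c ψ else 0 := by
  rw [ip_sum_left]
  simp only [ip_smul_left]
  split_ifs with h
  · rw [Finset.sum_eq_single ψ]
    · simp [hψ.orth hψ]
    · intro b hb hne
      rw [(hs b hb).orth hψ, if_neg hne, mul_zero]
    · intro h'
      exact absurd h h'
  · refine Finset.sum_eq_zero fun b hb => ?_
    rw [(hs b hb).orth hψ, if_neg (fun e : b = ψ => h (e ▸ hb)), mul_zero]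

theorem ClassOn.expand {H : Subgroup G} {f : G → ℂ} (hf : ClassOn H f) :
    f = ∑ χ ∈ IrrF H, ip H f χ • χ := by
  rw [← sub_eq_zero]
  refine ClassOn.eq_zero (H := H) (hf.sub (ClassOn.sum _ _ fun χ hχ =>
    (mem_IrrF.mp hχ).chr.classOn.smul _)) fun ψ hψ => ?_
  rw [ip_sub_left, ip_expand (fun χ => ip H f χ) (fun χ hχ => mem_IrrF.mp hχ) hψ,
    if_pos (mem_IrrF.mpr hψ), sub_self]

theorem ClassOn.ip_eq {H : Subgroup G} {f h : G → ℂ} (hf : ClassOn H f) :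
    ip H f h = ∑ χ ∈ IrrF H, ip H f χ * ip H χ h := by
  conv_lhs => rw [hf.expand]
  rw [ip_sum_left]
  simp only [ip_smul_left]

theorem Chr.zero {H : Subgroup G} : Chr H (0 : G → ℂ) :=
  ⟨fun _ _ => rfl, IsCharacter.zero⟩

theorem Chr.add {H : Subgroup G} {f h : G → ℂ} (hf : Chr H f) (hh : Chr H h) : Chr H (f + h) :=
  ⟨fun g hg => by simp [hf.1 g hg, hh.1 g hg], hf.2.add hh.2⟩

theorem Chr.mul {H : Subgroup G} {f h : G → ℂ} (hf : Chr H f) (hh : Chr H h) : Chr H (f * h) :=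
  ⟨fun g hg => by simp [hf.1 g hg], hf.2.mul hh.2⟩

theorem Chr.sum {H : Subgroup G} {ι : Type*} (s : Finset ι) (F : ι → G → ℂ)
    (h : ∀ i ∈ s, Chr H (F i)) : Chr H (∑ i ∈ s, F i) := by
  induction s using Finset.induction_on with
  | empty => simpa using Chr.zero
  | insert a s ha ih =>
    rw [Finset.sum_insert ha]
    exact (h a (by simp)).add (ih fun i hi => h i (by simp [hi]))

theorem Chr.nsmul {H : Subgroup G} {f : G → ℂ} (n : ℕ) (hf : Chr H f) : Chr H ((n : ℂ) • f) := by
  induction n with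
  | zero => simpa using Chr.zero
  | succ n ih =>
    rw [Nat.cast_succ, add_smul, one_smul]
    exact ih.add hf

theorem chr_iff {H : Subgroup G} {f : G → ℂ} :
    Chr H f ↔ ClassOn H f ∧ ∀ χ, Irr H χ → ∃ n : ℕ, ip H f χ = n := by
  refine ⟨fun h => ⟨h.classOn, fun χ hχ => h.ip_nat hχ.chr⟩, fun ⟨h1, h2⟩ => ?_⟩
  rw [h1.expand]
  refine Chr.sum _ _ fun χ hχ => ?_
  obtain ⟨n, hn⟩ := h2 χ (mem_IrrF.mp hχ)
  rw [hn]
  exact (mem_IrrF.mp hχ).chr.nsmul n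

theorem Irr.ip_self {H : Subgroup G} {f : G → ℂ} (h : Irr H f) : ip H f f = 1 := by
  rw [h.orth h, if_pos rfl]

theorem Irr.of_norm {H : Subgroup G} {f : G → ℂ} (h : Chr H f) (h1 : ip H f f = 1) : Irr H f := by
  have e := h.classOn.ip_eq (h := f)
  rw [h1] at e
  choose! n hn using fun χ (hχ : χ ∈ IrrF H) => h.ip_nat (mem_IrrF.mp hχ).chr
  have e2 : (1 : ℂ) = ((∑ χ ∈ IrrF H, n χ * n χ : ℕ) : ℂ) := by
    rw [e]
    push_cast
    refine Finset.sum_congr rfl fun χ hχ => ?_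
    rw [← ip_conj H f χ, hn χ hχ]
    simp
  have e3 : 1 = ∑ χ ∈ IrrF H, n χ * n χ := by exact_mod_cast e2
  obtain ⟨χ, hχ, hne⟩ : ∃ χ ∈ IrrF H, n χ * n χ ≠ 0 := by
    by_contra hc
    push Not at hc
    rw [Finset.sum_eq_zero hc] at e3
    omega
  have e4 : ∑ χ ∈ (IrrF H).erase χ, n χ * n χ = 0 ∧ n χ = 1 := by
    rw [← Finset.add_sum_erase _ _ hχ] at e3
    have : n χ ≠ 0 := fun h => hne (by simp [h])
    have : n χ * n χ ≤ 1 := by omega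
    have : n χ ≤ 1 := by nlinarith
    have : n χ = 1 := by omega
    refine ⟨?_, this⟩
    rw [this] at e3
    omega
  have : f = χ := by
    conv_lhs => rw [h.classOn.expand]
    rw [← Finset.add_sum_erase _ _ hχ, hn χ hχ, e4.2, Finset.sum_eq_zero]
    · simp
    · intro ψ hψ
      have := Finset.sum_eq_zero_iff.mp e4.1 ψ hψ
      rw [hn ψ (Finset.mem_of_mem_erase hψ)]
      have : n ψ = 0 := by simpa using this
      simp [this]
  rw [this]
  exact mem_IrrF.mp hχ

theorem Chr.exists_const {H : Subgroup G} {f : G → ℂ} (h : Chr H f) (h0 : f ≠ 0) :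
    ∃ χ, Irr H χ ∧ ip H f χ ≠ 0 := by
  by_contra hc
  push Not at hc
  exact h0 (h.classOn.eq_zero hc)

theorem Chr.deg_nat {H : Subgroup G} {f : G → ℂ} (h : Chr H f) : ∃ n : ℕ, f 1 = n := by
  obtain ⟨V, _, _, _, ρ, hρ⟩ := h.2.exists_rep
  have := congrFun hρ 1
  rw [Representation.char_one] at this
  exact ⟨_, this⟩

theorem Chr.eq_zero_of_deg {H : Subgroup G} {f : G → ℂ} (h : Chr H f) (h1 : f 1 = 0) : f = 0 := by
  obtain ⟨V, _, _, _, ρ, hρ⟩ := h.2.exists_rep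
  have := congrFun hρ 1
  rw [Representation.char_one] at this
  have h2 : (Module.finrank ℂ V : ℂ) = 0 := by rw [← this]; exact h1
  have h3 : Module.finrank ℂ V = 0 := by exact_mod_cast h2
  have := Module.finrank_zero_iff.mp h3
  refine ext_on h.1 (fun _ _ => rfl) fun g hg => ?_
  have a := congrFun hρ ⟨g, hg⟩
  have : ρ ⟨g, hg⟩ = 0 := Subsingleton.elim _ _
  simpa [Representation.character, this] using a

theorem Irr.deg_pos {H : Subgroup G} {f : G → ℂ} (h : Irr H f) : ∃ n : ℕ, 0 < n ∧ f 1 = n := by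
  obtain ⟨n, hn⟩ := h.chr.deg_nat
  refine ⟨n, Nat.pos_of_ne_zero fun h0 => h.ne_zero (h.chr.eq_zero_of_deg (by rw [hn, h0]; simp)), hn⟩

theorem Irr.deg_ne {H : Subgroup G} {f : G → ℂ} (h : Irr H f) : f 1 ≠ 0 := by
  obtain ⟨n, h0, hn⟩ := h.deg_pos
  rw [hn]
  exact_mod_cast h0.ne.symm

/-- If an irreducible occurs in `f` with nonzero multiplicity, it can be subtracted. -/
theorem Chr.sub_const {H : Subgroup G} {f χ : G → ℂ} (h : Chr H f) (hχ : Irr H χ)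
    (h0 : ip H f χ ≠ 0) : Chr H (f - χ) := by
  rw [chr_iff]
  refine ⟨h.classOn.sub hχ.chr.classOn, fun ψ hψ => ?_⟩
  rw [ip_sub_left, hχ.orth hψ]
  obtain ⟨n, hn⟩ := h.ip_nat hψ.chr
  split_ifs with e
  · subst e
    rw [hn] at h0 ⊢
    have : n ≠ 0 := by rintro rfl; simp at h0
    exact ⟨n - 1, by rw [Nat.cast_sub (by omega)]; simp⟩
  · exact ⟨n, by rw [hn, sub_zero]⟩

end Masked

section ResInd

variable {G : Type} [Group G]

theorem res_of_mem {K : Subgroup G} {f : G → ℂ} {g : G} (h : g ∈ K) : res K f g = f g := if_pos h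
theorem res_supp (K : Subgroup G) (f : G → ℂ) : ∀ g, g ∉ K → res K f g = 0 := fun _ h => if_neg h

theorem res_eq_self {K : Subgroup G} {f : G → ℂ} (h : ∀ g, g ∉ K → f g = 0) : res K f = f :=
  ext_on (res_supp K f) h fun _ hg => res_of_mem hg

theorem res_res {K L : Subgroup G} (h : K ≤ L) (f : G → ℂ) : res K (res L f) = res K f :=
  ext_on (res_supp _ _) (res_supp _ _) fun g hg => by
    rw [res_of_mem hg, res_of_mem hg, res_of_mem (h hg)]

theorem res_add (K : Subgroup G) (f h : G → ℂ) : res K (f + h) = res K f + res K h := by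
  funext g
  by_cases hg : g ∈ K <;> simp [res, hg]

theorem res_mul (K : Subgroup G) (f h : G → ℂ) : res K (f * h) = res K f * res K h := by
  funext g
  by_cases hg : g ∈ K <;> simp [res, hg]

theorem res_one {K : Subgroup G} (f : G → ℂ) : res K f 1 = f 1 := res_of_mem K.one_mem

theorem Chr.res {K H : Subgroup G} {f : G → ℂ} (h : Chr H f) (hK : K ≤ H) : Chr K (res K f) := by
  refine ⟨res_supp _ _, ?_⟩
  have := h.2.comp (Subgroup.inclusion hK)
  convert this using 2
  exact res_of_mem (Subtype.prop _)

/-- The conjugate subgroup `x H x⁻¹`. -/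
def cjS (x : G) (H : Subgroup G) : Subgroup G := H.map (MulAut.conj x).toMonoidHom

theorem mem_cjS {x : G} {H : Subgroup G} {g : G} : g ∈ cjS x H ↔ x⁻¹ * g * x ∈ H := by
  constructor
  · rintro ⟨h, hh, rfl⟩
    simpa [mul_assoc] using hh
  · intro h
    exact ⟨_, h, by simp [mul_assoc]⟩

theorem cjS_mul (x y : G) (H : Subgroup G) : cjS (x * y) H = cjS x (cjS y H) := by
  ext g
  simp [mem_cjS, mul_assoc]

theorem cjS_one (H : Subgroup G) : cjS 1 H = H := by
  ext g
  simp [mem_cjS]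

theorem cjS_inv_cjS (x : G) (H : Subgroup G) : cjS x⁻¹ (cjS x H) = H := by
  rw [← cjS_mul, inv_mul_cancel, cjS_one]

theorem cjS_mono {x : G} {H K : Subgroup G} (h : H ≤ K) : cjS x H ≤ cjS x K := by
  intro g hg
  rw [mem_cjS] at hg ⊢
  exact h hg

theorem cjS_of_mem {x : G} {H : Subgroup G} (h : x ∈ H) : cjS x H = H := by
  ext g
  rw [mem_cjS]
  constructor
  · intro hg
    have := H.mul_mem (H.mul_mem h hg) (H.inv_mem h)
    simpa [mul_assoc] using this
  · intro hg
    exact H.mul_mem (H.mul_mem (H.inv_mem h) hg) h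

theorem card_cjS (x : G) (H : Subgroup G) : Nat.card (cjS x H) = Nat.card H :=
  (Nat.card_congr (H.equivMapOfInjective _ (MulAut.conj x).injective).toEquiv).symm

theorem cj_mul (x y : G) (f : G → ℂ) : cj (x * y) f = cj x (cj y f) := by
  funext g
  simp [cj, mul_assoc]

theorem cj_one (f : G → ℂ) : cj 1 f = f := by
  funext g
  simp [cj]

theorem cj_inv_cj (x : G) (f : G → ℂ) : cj x⁻¹ (cj x f) = f := by
  rw [← cj_mul, inv_mul_cancel, cj_one]

theorem cj_cj_inv (x : G) (f : G → ℂ) : cj x (cj x⁻¹ f) = f := by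
  rw [← cj_mul, mul_inv_cancel, cj_one]

theorem cj_inj {x : G} {f h : G → ℂ} (e : cj x f = cj x h) : f = h := by
  rw [← cj_inv_cj x f, e, cj_inv_cj]

theorem cj_mul_fun (x : G) (f h : G → ℂ) : cj x (f * h) = cj x f * cj x h := rfl
theorem cj_apply_one (x : G) (f : G → ℂ) : cj x f 1 = f 1 := by simp [cj]

theorem ClassOn.cj_eq {H : Subgroup G} {f : G → ℂ} (h : ClassOn H f) {x : G} (hx : x ∈ H) :
    cj x f = f := by
  funext g
  have := h.2 x⁻¹ (H.inv_mem hx) g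
  simpa [cj] using this

theorem ClassOn.of_cj {H : Subgroup G} {f : G → ℂ} (h0 : ∀ g, g ∉ H → f g = 0)
    (h : ∀ x ∈ H, cj x f = f) : ClassOn H f := by
  refine ⟨h0, fun x hx g => ?_⟩
  have := congrFun (h x⁻¹ (H.inv_mem hx)) g
  simpa [cj] using this

theorem cj_supp {x : G} {H : Subgroup G} {f : G → ℂ} (h : ∀ g, g ∉ H → f g = 0) :
    ∀ g, g ∉ cjS x H → cj x f g = 0 := by
  intro g hg
  exact h _ fun h' => hg (mem_cjS.mpr h')

theorem Chr.cj {H : Subgroup G} {f : G → ℂ} (h : Chr H f) (x : G) : Chr (cjS x H) (cj x f) := by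
  refine ⟨cj_supp h.1, ?_⟩
  let φ : cjS x H →* H :=
    { toFun := fun g => ⟨x⁻¹ * g * x, mem_cjS.mp g.2⟩
      map_one' := by ext; simp
      map_mul' := by intro a b; ext; simp [mul_assoc] }
  exact h.2.comp φ

theorem res_cj (x : G) (K : Subgroup G) (f : G → ℂ) : res (cjS x K) (cj x f) = cj x (res K f) := by
  funext g
  simp [res, cj, mem_cjS]

/-- Apply a ring endomorphism of the complex numbers to the values of a function. -/
def mp (σ : ℂ →+* ℂ) (f : G → ℂ) : G → ℂ := fun g => σ (f g)

theorem Chr.mp {H : Subgroup G} {f : G → ℂ} (h : Chr H f) (σ : ℂ →+* ℂ) : Chr H (mp σ f) :=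
  ⟨fun g hg => by simp [_root_.mp, h.1 g hg], h.2.map σ⟩

theorem cj_mp (x : G) (σ : ℂ →+* ℂ) (f : G → ℂ) : cj x (mp σ f) = mp σ (cj x f) := rfl
theorem res_mp (K : Subgroup G) (σ : ℂ →+* ℂ) (f : G → ℂ) : res K (mp σ f) = mp σ (res K f) := by
  funext g
  by_cases h : g ∈ K <;> simp [res, mp, h]

variable [Fintype G]

theorem mp_ind (σ : ℂ →+* ℂ) (K H : Subgroup G) (f : G → ℂ) :
    mp σ (ind K H f) = ind K H (mp σ f) := by
  funext g
  simp only [mp, ind, map_mul, map_inv₀, map_natCast, map_sum]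
  congr 1
  refine Finset.sum_congr rfl fun x _ => ?_
  split_ifs <;> simp

theorem Chr.ip_inv {H : Subgroup G} {h : G → ℂ} (hh : Chr H h) (f : G → ℂ) :
    ip H f h = (Nat.card H : ℂ)⁻¹ * ∑ g, f g * h g⁻¹ := by
  rw [ip]
  congr 1
  refine Finset.sum_congr rfl fun g _ => ?_
  congr 1
  by_cases hg : g ∈ H
  · exact (hh.2.inv_eq_conj ⟨g, hg⟩).symm
  · rw [hh.1 g hg, hh.1, map_zero]
    exact fun h => hg (by simpa using h)

theorem ip_mp {H : Subgroup G} {f h : G → ℂ} (hh : Chr H h) (σ : ℂ →+* ℂ) :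
    ip H (mp σ f) (mp σ h) = σ (ip H f h) := by
  rw [(hh.mp σ).ip_inv, hh.ip_inv]
  simp [mp]

theorem Irr.mp {H : Subgroup G} {f : G → ℂ} (h : Irr H f) (σ : ℂ →+* ℂ) : Irr H (mp σ f) :=
  .of_norm (h.chr.mp σ) (by rw [ip_mp h.chr, h.ip_self, map_one])

theorem ip_cj (x : G) (H : Subgroup G) (f h : G → ℂ) :
    ip (cjS x H) (cj x f) (cj x h) = ip H f h := by
  rw [ip, ip, card_cjS]
  congr 1
  rw [← Equiv.sum_comp (MulAut.conj x).toEquiv]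
  refine Finset.sum_congr rfl fun g _ => ?_
  simp [cj, mul_assoc]

theorem Irr.cj {H : Subgroup G} {f : G → ℂ} (h : Irr H f) (x : G) : Irr (cjS x H) (cj x f) :=
  .of_norm (h.chr.cj x) (by rw [ip_cj, h.ip_self])

theorem ip_res_left (K : Subgroup G) (f : G → ℂ) {h : G → ℂ} (hh : ∀ g, g ∉ K → h g = 0) :
    ip K (res K f) h = ip K f h := by
  rw [ip, ip]
  congr 1
  refine Finset.sum_congr rfl fun g _ => ?_
  by_cases hg : g ∈ K
  · rw [res_of_mem hg]
  · rw [hh g hg, map_zero, mul_zero, mul_zero]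

theorem ip_res_right (K : Subgroup G) {f : G → ℂ} (h : G → ℂ) (hf : ∀ g, g ∉ K → f g = 0) :
    ip K f (res K h) = ip K f h := by
  rw [← ip_conj, ip_res_left K h hf, ip_conj]

theorem ind_classOn {K H : Subgroup G} (hKH : K ≤ H) {f : G → ℂ} (hf : ∀ g, g ∉ K → f g = 0) :
    ClassOn H (ind K H f) := by
  refine ⟨fun g hg => ?_, fun y hy g => ?_⟩
  · rw [ind, Finset.sum_eq_zero, mul_zero]
    intro x _
    split_ifs with hx
    · apply hf
      intro h
      apply hg
      have := H.mul_mem (H.mul_mem (H.inv_mem hx) (hKH h)) hx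
      simpa [mul_assoc] using this
    · rfl
  · rw [ind, ind]
    congr 1
    rw [← Equiv.sum_comp (Equiv.mulRight y⁻¹)]
    refine Finset.sum_congr rfl fun x _ => ?_
    have : x * y⁻¹ ∈ H ↔ x ∈ H := H.mul_mem_cancel_right (H.inv_mem hy)
    simp [this, mul_assoc]

/-- Frobenius reciprocity. -/
theorem ip_ind_left {K H : Subgroup G} (f : G → ℂ) {h : G → ℂ} (hh : ClassOn H h) :
    ip H (ind K H f) h = ip K f h := by
  simp only [ip, ind]
  have : ∀ g, (Nat.card K : ℂ)⁻¹ * (∑ x, if x ∈ H then f (x * g * x⁻¹) else 0) *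
      (starRingEnd ℂ) (h g) = (Nat.card K : ℂ)⁻¹ * ∑ x, if x ∈ H then f (x * g * x⁻¹) *
      (starRingEnd ℂ) (h g) else 0 := by
    intro g
    rw [mul_assoc, Finset.sum_mul]
    congr 1
    refine Finset.sum_congr rfl fun x _ => ?_
    split_ifs <;> simp
  simp only [this]
  rw [← Finset.mul_sum, Finset.sum_comm]
  have h2 : ∀ x : G, (∑ g, if x ∈ H then f (x * g * x⁻¹) * (starRingEnd ℂ) (h g) else 0) =
      if x ∈ H then ∑ g, f g * (starRingEnd ℂ) (h g) else 0 := by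
    intro x
    split_ifs with hx
    · rw [← Equiv.sum_comp (MulAut.conj x).toEquiv (fun g => f g * (starRingEnd ℂ) (h g))]
      refine Finset.sum_congr rfl fun g _ => ?_
      simp [hh.2 x hx]
    · simp
  simp only [h2]
  rw [← sum_subgroup H (fun _ => ∑ g, f g * (starRingEnd ℂ) (h g))]
  simp only [Finset.sum_const, Finset.card_univ, nsmul_eq_mul, ← Nat.card_eq_fintype_card]
  have := card_ne_zero' H
  field_simp

theorem ip_ind_right {K H : Subgroup G} (f : G → ℂ) {h : G → ℂ} (hh : ClassOn H h) :
    ip H h (ind K H f) = ip K h f := by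
  rw [← ip_conj, ip_ind_left f hh, ip_conj]

theorem Chr.ind {K H : Subgroup G} {f : G → ℂ} (hf : Chr K f) (hKH : K ≤ H) :
    Chr H (ind K H f) := by
  rw [chr_iff]
  refine ⟨ind_classOn hKH hf.1, fun χ hχ => ?_⟩
  rw [ip_ind_left f hχ.chr.classOn, ← ip_res_right K χ hf.1]
  exact hf.ip_nat (hχ.chr.res hKH)

theorem ind_add (K H : Subgroup G) (f h : G → ℂ) : ind K H (f + h) = ind K H f + ind K H h := by
  funext g
  simp only [ind, Pi.add_apply, ← mul_add, ← Finset.sum_add_distrib]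
  congr 1
  refine Finset.sum_congr rfl fun x _ => ?_
  split_ifs <;> simp

theorem ind_smul (K H : Subgroup G) (c : ℂ) (f : G → ℂ) : ind K H (c • f) = c • ind K H f := by
  funext g
  simp only [ind, Pi.smul_apply, smul_eq_mul]
  rw [mul_left_comm c, Finset.mul_sum (a := c)]
  simp only [mul_ite, mul_zero]

theorem ind_zero (K H : Subgroup G) : ind K H 0 = 0 := by
  funext g
  simp [ind]

theorem ind_mul (K H : Subgroup G) (f : G → ℂ) {h : G → ℂ} (hh : ClassOn H h) :
    ind K H (f * h) = ind K H f * h := by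
  funext g
  simp only [ind, Pi.mul_apply]
  rw [mul_assoc, Finset.sum_mul]
  congr 1
  refine Finset.sum_congr rfl fun x _ => ?_
  split_ifs with hx
  · rw [hh.2 x hx]
  · simp

theorem ind_ind {K L H : Subgroup G} (hLH : L ≤ H) (f : G → ℂ) :
    ind L H (ind K L f) = ind K H f := by
  funext g
  simp only [ind]
  have : ∀ x : G, (if x ∈ H then (Nat.card K : ℂ)⁻¹ *
      ∑ y, (if y ∈ L then f (y * (x * g * x⁻¹) * y⁻¹) else 0) else 0) =
      (Nat.card K : ℂ)⁻¹ * ∑ y, if y ∈ L then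
        (if x ∈ H then f ((y * x) * g * (y * x)⁻¹) else 0) else 0 := by
    intro x
    split_ifs
    · simp [mul_assoc]
    · simp
  simp only [this]
  rw [← Finset.mul_sum, Finset.sum_comm]
  have h2 : ∀ y : G, (∑ x, if y ∈ L then
        (if x ∈ H then f ((y * x) * g * (y * x)⁻¹) else 0) else 0) =
      if y ∈ L then ∑ x, (if x ∈ H then f (x * g * x⁻¹) else 0) else 0 := by
    intro y
    split_ifs with hy
    · rw [← Equiv.sum_comp (Equiv.mulLeft y) (fun x => if x ∈ H then f (x * g * x⁻¹) else 0)]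
      refine Finset.sum_congr rfl fun x _ => ?_
      have : y * x ∈ H ↔ x ∈ H := H.mul_mem_cancel_left (hLH hy)
      simp [this]
    · simp
  simp only [h2]
  rw [← sum_subgroup L (fun _ => ∑ x, (if x ∈ H then f (x * g * x⁻¹) else 0))]
  simp only [Finset.sum_const, Finset.card_univ, nsmul_eq_mul, ← Nat.card_eq_fintype_card]
  have := card_ne_zero' L
  field_simp

theorem ind_one (K H : Subgroup G) (f : G → ℂ) :
    ind K H f 1 = (Nat.card H : ℂ) / Nat.card K * f 1 := by
  simp only [ind, mul_one, mul_inv_cancel]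
  rw [← sum_subgroup H (fun _ => f 1)]
  simp only [Finset.sum_const, Finset.card_univ, nsmul_eq_mul, ← Nat.card_eq_fintype_card]
  field_simp

theorem cj_ind (x : G) (K H : Subgroup G) (f : G → ℂ) :
    cj x (ind K H f) = ind (cjS x K) (cjS x H) (cj x f) := by
  funext g
  simp only [cj, ind, card_cjS]
  congr 1
  rw [← Equiv.sum_comp (MulAut.conj x).toEquiv (fun y => if y ∈ cjS x H then
    f (x⁻¹ * (y * g * y⁻¹) * x) else 0)]
  refine Finset.sum_congr rfl fun y _ => ?_
  simp [mem_cjS, mul_assoc]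

theorem ind_cj {K H : Subgroup G} (hKH : K ≤ H) {f : G → ℂ} (hf : ∀ g, g ∉ K → f g = 0) {x : G}
    (hx : x ∈ H) : ind (cjS x K) H (cj x f) = ind K H f := by
  have := cj_ind x K H f
  rw [cjS_of_mem hx, (ind_classOn hKH hf).cj_eq hx] at this
  exact this.symm

theorem ind_self {H : Subgroup G} {f : G → ℂ} (hf : ClassOn H f) : ind H H f = f := by
  funext g
  simp only [ind]
  have : ∀ x : G, (if x ∈ H then f (x * g * x⁻¹) else 0) = if x ∈ H then f g else 0 := by
    intro x
    split_ifs with h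
    · exact hf.2 x h g
    · rfl
  simp only [this]
  rw [← sum_subgroup H (fun _ => f g)]
  simp only [Finset.sum_const, Finset.card_univ, nsmul_eq_mul, ← Nat.card_eq_fintype_card]
  have := card_ne_zero' H
  field_simp

end ResInd

section Linear
variable {G : Type} [Group G]

/-- A linear character of `H`, extended by zero. -/
def Lin (H : Subgroup G) (l : G → ℂ) : Prop :=
  (∀ g, g ∉ H → l g = 0) ∧ l 1 = 1 ∧ ∀ x ∈ H, ∀ y ∈ H, l (x * y) = l x * l y

/-- The principal character of `H`. -/
def pr (H : Subgroup G) : G → ℂ := fun g => if g ∈ H then 1 else 0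

theorem pr_of_mem {H : Subgroup G} {g : G} (h : g ∈ H) : pr H g = 1 := if_pos h

theorem lin_pr (H : Subgroup G) : Lin H (pr H) :=
  ⟨fun _ h => if_neg h, pr_of_mem H.one_mem, fun x hx y hy => by
    simp [pr_of_mem, hx, hy, H.mul_mem hx hy]⟩

/-- The homomorphism attached to a linear character. -/
def Lin.hom {H : Subgroup G} {l : G → ℂ} (h : Lin H l) : H →* ℂ where
  toFun x := l x
  map_one' := h.2.1
  map_mul' x y := h.2.2 x x.2 y y.2

theorem lin_mask {H : Subgroup G} (φ : H →* ℂ) : Lin H (mask H φ) := by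
  refine ⟨mask_supp H φ, ?_, ?_⟩
  · rw [mask, dif_pos H.one_mem]
    exact φ.map_one
  · intro x hx y hy
    simp only [mask, dif_pos hx, dif_pos hy, dif_pos (H.mul_mem hx hy)]
    exact φ.map_mul ⟨x, hx⟩ ⟨y, hy⟩

theorem Lin.mul {H : Subgroup G} {l m : G → ℂ} (hl : Lin H l) (hm : Lin H m) : Lin H (l * m) :=
  ⟨fun g hg => by simp [hl.1 g hg], by simp [hl.2.1, hm.2.1], fun x hx y hy => by
    simp only [Pi.mul_apply, hl.2.2 x hx y hy, hm.2.2 x hx y hy]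
    ring⟩

/-- Powers of a linear character. -/
def lpow (H : Subgroup G) (l : G → ℂ) (n : ℕ) : G → ℂ := fun g => if g ∈ H then l g ^ n else 0

theorem Lin.lpow {H : Subgroup G} {l : G → ℂ} (hl : Lin H l) (n : ℕ) : Lin H (lpow H l n) :=
  ⟨fun g hg => if_neg hg, by simp [_root_.lpow, H.one_mem, hl.2.1], fun x hx y hy => by
    simp [_root_.lpow, hx, hy, H.mul_mem hx hy, hl.2.2 x hx y hy, mul_pow]⟩

theorem Lin.map_inv {H : Subgroup G} {l : G → ℂ} (hl : Lin H l) {x : G} (hx : x ∈ H) :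
    l x⁻¹ * l x = 1 := by
  rw [← hl.2.2 _ (H.inv_mem hx) _ hx, inv_mul_cancel, hl.2.1]

theorem Lin.ne_zero {H : Subgroup G} {l : G → ℂ} (hl : Lin H l) {x : G} (hx : x ∈ H) :
    l x ≠ 0 := by
  intro h
  have := hl.map_inv hx
  rw [h, mul_zero] at this
  exact zero_ne_one this

theorem Lin.map_pow {H : Subgroup G} {l : G → ℂ} (hl : Lin H l) {x : G} (hx : x ∈ H) (n : ℕ) :
    l (x ^ n) = l x ^ n := by
  induction n with
  | zero => simp [hl.2.1]
  | succ n ih => rw [pow_succ, pow_succ, hl.2.2 _ (H.pow_mem hx n) _ hx, ih]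

theorem Lin.res {K H : Subgroup G} {l : G → ℂ} (hl : Lin H l) (h : K ≤ H) : Lin K (res K l) := by
  refine ⟨res_supp _ _, ?_, ?_⟩
  · rw [res_one, hl.2.1]
  · intro x hx y hy
    rw [res_of_mem hx, res_of_mem hy, res_of_mem (K.mul_mem hx hy), hl.2.2 x (h hx) y (h hy)]

theorem Lin.cj {H : Subgroup G} {l : G → ℂ} (hl : Lin H l) (x : G) : Lin (cjS x H) (cj x l) := by
  refine ⟨cj_supp hl.1, ?_, ?_⟩
  · rw [cj_apply_one, hl.2.1]
  · intro a ha b hb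
    rw [mem_cjS] at ha hb
    rw [_root_.cj, _root_.cj, _root_.cj, ← hl.2.2 _ ha _ hb]
    congr 1
    group

theorem Lin.conj_apply {H : Subgroup G} {l : G → ℂ} (hl : Lin H l) {x y : G} (hx : x ∈ H)
    (hy : y ∈ H) : l (x * y * x⁻¹) = l y := by
  rw [hl.2.2 _ (H.mul_mem hx hy) _ (H.inv_mem hx), hl.2.2 _ hx _ hy, mul_comm, ← mul_assoc,
    hl.map_inv hx, one_mul]

theorem Lin.norm_eq [Finite G] {H : Subgroup G} {l : G → ℂ} (hl : Lin H l) {x : G} (hx : x ∈ H) :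
    l x * (starRingEnd ℂ) (l x) = 1 := by
  have h : l x ^ orderOf x = 1 := by rw [← hl.map_pow hx, pow_orderOf_eq_one, hl.2.1]
  have h1 := Complex.norm_eq_one_of_pow_eq_one h (orderOf_pos x).ne'
  rw [Complex.mul_conj, Complex.normSq_eq_norm_sq, h1]
  simp

theorem Lin.chr {H : Subgroup G} {l : G → ℂ} (hl : Lin H l) : Chr H l := by
  refine ⟨hl.1, ?_⟩
  obtain ⟨d, hd⟩ := (IsCharacter.one (Γ := H)).exists_detOf
  have := (hd.mul_lin hl.hom (n := 1) (by simp)).isCharacter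
  simpa [Lin.hom] using this

variable [Fintype G]

theorem Lin.irr {H : Subgroup G} {l : G → ℂ} (hl : Lin H l) : Irr H l := by
  refine .of_norm hl.chr ?_
  have h2 : ∀ g, l g * (starRingEnd ℂ) (l g) = if g ∈ H then 1 else 0 := by
    intro g
    split_ifs with h
    · exact hl.norm_eq h
    · rw [hl.1 g h, zero_mul]
  simp only [ip, h2]
  rw [← sum_subgroup H (fun _ => 1)]
  simp only [Finset.sum_const, Finset.card_univ, nsmul_eq_mul, ← Nat.card_eq_fintype_card]
  have := card_ne_zero' H
  field_simp

theorem ip_mul_lin {H : Subgroup G} {l : G → ℂ} (hl : Lin H l) {f : G → ℂ} (h : G → ℂ)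
    (hf : ∀ g, g ∉ H → f g = 0) : ip H (f * l) (h * l) = ip H f h := by
  rw [ip, ip]
  congr 1
  refine Finset.sum_congr rfl fun g _ => ?_
  by_cases hg : g ∈ H
  · have := hl.norm_eq hg
    simp only [Pi.mul_apply, map_mul]
    linear_combination f g * (starRingEnd ℂ) (h g) * this
  · simp [hf g hg]

theorem Irr.mul_lin {H : Subgroup G} {f l : G → ℂ} (hf : Irr H f) (hl : Lin H l) :
    Irr H (f * l) :=
  .of_norm (hf.chr.mul hl.chr) (by rw [ip_mul_lin hl f hf.1, hf.ip_self])

omit [Fintype G] in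
theorem Chr.lin_of_deg {H : Subgroup G} {f : G → ℂ} (hf : Chr H f) (h1 : f 1 = 1) : Lin H f := by
  obtain ⟨d, n, ρ, h2, h3⟩ := hf.2.exists_detOf
  have e1 := h2 1
  simp only [OneMemClass.coe_one, h1, map_one, Matrix.trace_one, Fintype.card_fin] at e1
  have e2 : n = 1 := by exact_mod_cast e1.symm
  subst e2
  refine ⟨hf.1, h1, fun x hx y hy => ?_⟩
  have a := h2 ⟨x, hx⟩
  have b := h2 ⟨y, hy⟩
  have c := h2 (⟨x, hx⟩ * ⟨y, hy⟩)
  simp only [Matrix.trace_fin_one, map_mul, Matrix.mul_apply, Fin.sum_univ_one] at a b c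
  rw [← a, ← b] at c
  exact c

end Linear

section Galois
open scoped IntermediateField

theorem exists_ringEquiv_lift {R A B : Type} [Field R] [Field A] [Field B] [Algebra R A]
    [Algebra R B] [IsAlgClosed A] [IsAlgClosed B] (hR : Cardinal.mk R ≤ Cardinal.aleph0)
    (hA : Cardinal.aleph0 < Cardinal.mk A) (hAB : Cardinal.mk A = Cardinal.mk B) :
    ∃ σ : A ≃+* B, ∀ x, σ (algebraMap R A x) = algebraMap R B x := by
  obtain ⟨s, hs⟩ := exists_isTranscendenceBasis R A
  obtain ⟨t, ht⟩ := exists_isTranscendenceBasis R B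
  have h1 := IsAlgClosed.cardinal_eq_cardinal_transcendence_basis_of_aleph0_lt' _ hs hR hA
  have h2 := IsAlgClosed.cardinal_eq_cardinal_transcendence_basis_of_aleph0_lt' _ ht hR (hAB ▸ hA)
  rw [hAB, h2] at h1
  obtain ⟨e⟩ := Cardinal.eq.mp h1.symm
  letI := IsAlgClosed.isAlgClosure_of_transcendence_basis _ hs
  letI := IsAlgClosed.isAlgClosure_of_transcendence_basis _ ht
  let E : Algebra.adjoin R (Set.range ((↑) : s → A)) ≃ₐ[R]
      Algebra.adjoin R (Set.range ((↑) : t → B)) :=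
    hs.1.aevalEquiv.symm.trans ((MvPolynomial.renameEquiv R e).trans ht.1.aevalEquiv)
  refine ⟨IsAlgClosure.equivOfEquiv A B E.toRingEquiv, fun x => ?_⟩
  have h3 := IsAlgClosure.equivOfEquiv_algebraMap A B E.toRingEquiv (algebraMap R _ x)
  rw [← IsScalarTower.algebraMap_apply] at h3
  rw [h3]
  have h4 : E.toRingEquiv (algebraMap R _ x) = algebraMap R _ x := E.commutes x
  rw [h4, ← IsScalarTower.algebraMap_apply]

theorem exists_galois {n t : ℕ} (hn : 0 < n) (ht : t.Coprime n) :
    ∃ σ : ℂ →+* ℂ, ∀ μ : ℂ, μ ^ n = 1 → σ μ = μ ^ t := by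
  haveI : NeZero n := ⟨hn.ne'⟩
  obtain ⟨ζ, hζ⟩ : ∃ ζ : ℂ, IsPrimitiveRoot ζ n := ⟨_, Complex.isPrimitiveRoot_exp n hn.ne'⟩
  have hζt := hζ.pow_of_coprime t ht
  have hit : IsIntegral ℚ ζ := (hζ.isIntegral hn).tower_top
  have hroot : ζ ^ t ∈ (minpoly ℚ ζ).aroots ℂ := by
    rw [Polynomial.mem_aroots]
    refine ⟨minpoly.ne_zero hit, ?_⟩
    rw [← Polynomial.cyclotomic_eq_minpoly_rat hζ hn, Polynomial.cyclotomic_eq_minpoly_rat hζt hn]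
    exact minpoly.aeval _ _
  let f := (IntermediateField.algHomAdjoinIntegralEquiv ℚ hit).symm ⟨ζ ^ t, hroot⟩
  have hf : f (IntermediateField.AdjoinSimple.gen ℚ ζ) = ζ ^ t :=
    IntermediateField.algHomAdjoinIntegralEquiv_symm_apply_gen ℚ hit ⟨ζ ^ t, hroot⟩
  have hcard : Cardinal.mk ℚ⟮ζ⟯ ≤ Cardinal.aleph0 := by
    haveI := IntermediateField.adjoin.finiteDimensional hit
    have := Algebra.IsAlgebraic.cardinalMk_le_max ℚ ℚ⟮ζ⟯
    simpa using this
  have hC : Cardinal.aleph0 < Cardinal.mk ℂ := by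
    rw [Cardinal.mk_complex]
    exact Cardinal.aleph0_lt_continuum
  obtain ⟨σ, hσ⟩ := @exists_ringEquiv_lift ℚ⟮ζ⟯ ℂ ℂ _ _ _ inferInstance f.toRingHom.toAlgebra
    inferInstance inferInstance hcard hC rfl
  refine ⟨σ.toRingHom, fun μ hμ => ?_⟩
  obtain ⟨i, -, rfl⟩ := hζ.eq_pow_of_pow_eq_one hμ
  have h1 : σ ζ = ζ ^ t := by
    have := hσ (IntermediateField.AdjoinSimple.gen ℚ ζ)
    rw [IntermediateField.AdjoinSimple.algebraMap_gen] at this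
    rw [this]
    exact hf
  change σ (ζ ^ i) = _
  rw [map_pow, h1, ← pow_mul, ← pow_mul, mul_comm]

/-- A ring endomorphism of `ℂ` that inverts the roots of unity of `p`-power order and fixes the
roots of unity of order prime to `p`, among those of order dividing `n`. -/
theorem exists_sigma {p n : ℕ} (hp : p.Prime) (hn : 0 < n) :
    ∃ σ : ℂ →+* ℂ, (∀ μ : ℂ, ∀ m, m ∣ n → ¬ p ∣ m → μ ^ m = 1 → σ μ = μ) ∧
      (∀ μ : ℂ, ∀ k, p ^ k ∣ n → μ ^ p ^ k = 1 → σ μ * μ = 1) ∧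
      ∀ μ : ℂ, μ ^ n = 1 → σ (σ μ) = μ := by
  obtain ⟨a, m, hm, rfl⟩ := Nat.exists_eq_pow_mul_and_not_dvd hn.ne' p hp.ne_one
  have hco : (p ^ a).Coprime m := Nat.Coprime.pow_left a ((hp.coprime_iff_not_dvd).mpr hm)
  have hpa : 0 < p ^ a := pow_pos hp.pos a
  obtain ⟨t, ht1, ht2⟩ := Nat.chineseRemainder hco (p ^ a - 1) 1
  have e1 : (t : ℤ) ≡ -1 [ZMOD (p ^ a : ℕ)] := by
    have := (Int.natCast_modEq_iff.mpr ht1)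
    rw [Nat.cast_sub hpa] at this
    refine this.trans ?_
    rw [Int.modEq_iff_dvd]
    exact ⟨-1, by push_cast; ring⟩
  have e2 : (t : ℤ) ≡ 1 [ZMOD (m : ℕ)] := by exact_mod_cast Int.natCast_modEq_iff.mpr ht2
  have q1 : (t * t : ℕ) ≡ 1 [MOD p ^ a] := by
    rw [← Int.natCast_modEq_iff]
    push_cast
    simpa using e1.mul e1
  have q2 : (t * t : ℕ) ≡ 1 [MOD m] := by
    rw [← Int.natCast_modEq_iff]
    push_cast
    simpa using e2.mul e2
  have q : (t * t : ℕ) ≡ 1 [MOD p ^ a * m] := (Nat.modEq_and_modEq_iff_modEq_mul hco).mp ⟨q1, q2⟩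
  have hcop : t.Coprime (p ^ a * m) := Nat.coprime_of_mul_modEq_one t q
  obtain ⟨σ, hσ⟩ := exists_galois hn hcop
  have hpow : ∀ (μ : ℂ) (d : ℕ), μ ^ d = 1 → ∀ i j : ℕ, i ≡ j [MOD d] → μ ^ i = μ ^ j :=
    fun μ d hd i j hij => pow_eq_pow_of_modEq hij hd
  refine ⟨σ, fun μ d hd hpd hμ => ?_, fun μ k hk hμ => ?_, fun μ hμ => ?_⟩
  · have h1 : d ∣ m := by
      refine Nat.Coprime.dvd_of_dvd_mul_left ?_ hd
      exact (Nat.Coprime.pow_left a ((hp.coprime_iff_not_dvd).mpr hpd)).symm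
    have h2 : μ ^ (p ^ a * m) = 1 := by
      obtain ⟨c, hc⟩ := hd
      rw [hc, pow_mul, hμ, one_pow]
    rw [hσ μ h2, hpow μ d hμ t 1 (ht2.of_dvd h1), pow_one]
  · have h1 : p ^ k ∣ p ^ a := by
      refine Nat.Coprime.dvd_of_dvd_mul_right ?_ hk
      exact Nat.Coprime.pow_left k ((hp.coprime_iff_not_dvd).mpr hm)
    have h2 : μ ^ (p ^ a * m) = 1 := by
      obtain ⟨c, hc⟩ := hk
      rw [hc, pow_mul, hμ, one_pow]
    rw [hσ μ h2, ← pow_succ]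
    have h3 : t + 1 ≡ p ^ a [MOD p ^ a] := by
      have := ht1.add_right 1
      rwa [Nat.sub_add_cancel hpa] at this
    rw [hpow μ _ hμ _ _ (h3.of_dvd h1)]
    obtain ⟨c, hc⟩ := h1
    rw [hc, pow_mul, hμ, one_pow]
  · rw [hσ μ hμ, map_pow, hσ μ hμ, ← pow_mul, hpow μ _ hμ _ _ q, pow_one]

end Galois

section KernelDet

theorem multiset_re_le {s : Multiset ℂ} (h : ∀ μ ∈ s, ‖μ‖ = 1) : s.sum.re ≤ s.card := by
  induction s using Multiset.induction_on with
  | empty => simp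
  | cons a s ih =>
    have h1 := ih fun μ hμ => h μ (Multiset.mem_cons_of_mem hμ)
    have h2 := Complex.re_le_norm a
    rw [h a (Multiset.mem_cons_self a s)] at h2
    simp only [Multiset.sum_cons, Complex.add_re, Multiset.card_cons, Nat.cast_add, Nat.cast_one]
    linarith

theorem multiset_eq_one {s : Multiset ℂ} (h : ∀ μ ∈ s, ‖μ‖ = 1) (hs : s.sum = s.card) :
    ∀ μ ∈ s, μ = 1 := by
  induction s using Multiset.induction_on with
  | empty => simp
  | cons a s ih =>
    have h0 := multiset_re_le fun μ hμ => h μ (Multiset.mem_cons_of_mem hμ)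
    have ha := h a (Multiset.mem_cons_self a s)
    have h2 := Complex.re_le_norm a
    rw [ha] at h2
    have h3 := congrArg Complex.re hs
    simp only [Multiset.sum_cons, Complex.add_re, Multiset.card_cons, Nat.cast_add, Nat.cast_one,
      Complex.natCast_re, Complex.one_re] at h3
    have h4 : a.re = 1 := by linarith
    have h5 : a = 1 := by
      have h6 : a.re = ‖a‖ := by rw [h4, ha]
      have h7 := Complex.re_eq_norm.mp h6
      rw [Complex.nonneg_iff] at h7
      exact Complex.ext (by simpa using h4) (by simpa using h7.2.symm)
    have h6 : s.sum = s.card := by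
      rw [Multiset.sum_cons, h5, Multiset.card_cons] at hs
      push_cast at hs
      linear_combination hs
    intro μ hμ
    rcases Multiset.mem_cons.mp hμ with rfl | hμ
    · exact h5
    · exact ih (fun μ hμ => h μ (Multiset.mem_cons_of_mem hμ)) h6 μ hμ

variable {Γ : Type} [Group Γ] [Finite Γ]

theorem EigOf.norm {χ d : Γ → ℂ} {g : Γ} {s : Multiset ℂ} (h : EigOf χ d g s) :
    ∀ μ ∈ s, ‖μ‖ = 1 := fun μ hμ =>
  Complex.norm_eq_one_of_pow_eq_one (h.1 μ hμ) (orderOf_pos g).ne'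

theorem IsCharacter.kernel {χ : Γ → ℂ} (h : IsCharacter Γ χ) {y : Γ} (hy : χ y = χ 1) (x : Γ) :
    χ (x * y) = χ x := by
  obtain ⟨d, hd⟩ := h.exists_detOf
  obtain ⟨s, hs⟩ := hd.exists_eig y
  have h1 : ∀ μ ∈ s, μ = 1 := multiset_eq_one hs.norm (by rw [← hs.apply, hy, hs.card])
  have h2 : ∀ k : ℕ, χ (y ^ k) = χ 1 := by
    intro k
    rw [hs.2.1, Multiset.map_congr rfl (g := fun _ => 1) fun μ hμ => by rw [h1 μ hμ, one_pow],
      hs.card]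
    simp
  obtain ⟨V, _, _, _, ρ, rfl⟩ := h.exists_rep
  set n := orderOf y with hn
  have hn0 : (n : ℂ) ≠ 0 := by exact_mod_cast (orderOf_pos y).ne'
  let P : Module.End ℂ V := (n : ℂ)⁻¹ • ∑ k ∈ Finset.range n, ρ (y ^ k)
  have hyP : ρ y * P = P := by
    simp only [P, mul_smul_comm, Finset.mul_sum, ← map_mul, ← pow_succ']
    congr 1
    have a1 := Finset.sum_range_succ (fun k => ρ (y ^ k)) n
    rw [Finset.sum_range_succ'] at a1
    rw [hn, pow_orderOf_eq_one, pow_zero] at a1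
    exact add_right_cancel a1
  have hkP : ∀ k : ℕ, ρ (y ^ k) * P = P := by
    intro k
    induction k with
    | zero => simp
    | succ k ih => rw [pow_succ, map_mul, mul_assoc, hyP, ih]
  have hPP : P * P = P := by
    conv_lhs => lhs; simp only [P]
    rw [smul_mul_assoc, Finset.sum_mul, Finset.sum_congr rfl fun k _ => hkP k]
    rw [Finset.sum_const, Finset.card_range, ← Nat.cast_smul_eq_nsmul ℂ, smul_smul,
      inv_mul_cancel₀ hn0, one_smul]
  have hI : IsIdempotentElem (1 - P) := by
    have : IsIdempotentElem P := hPP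
    exact this.one_sub
  have htr : LinearMap.trace ℂ V (1 - P) = 0 := by
    have a1 : ∀ k, LinearMap.trace ℂ V (ρ (y ^ k)) = LinearMap.trace ℂ V 1 := by
      intro k
      have := h2 k
      simp only [Representation.character, map_one] at this
      exact this
    simp only [P, map_sub, map_smul, map_sum, a1, Finset.sum_const, Finset.card_range]
    rw [nsmul_eq_mul, smul_eq_mul, inv_mul_cancel_left₀ hn0, sub_self]
  have hP : P = 1 := by
    have := LinearMap.IsIdempotentElem.eq_zero_of_trace_eq_zero hI htr
    exact (sub_eq_zero.mp this).symm
  rw [hP, mul_one] at hyP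
  simp only [Representation.character, map_mul, hyP, mul_one]

theorem EigOf.involution {χ d : Γ → ℂ} {x : Γ} {s : Multiset ℂ} (hs : EigOf χ d x s)
    (hd : d x = 1) (h2 : χ (x ^ 2) = χ 1) : ∃ k : ℕ, χ x + 4 * k = χ 1 := by
  have h1 : ∀ μ ∈ s, μ = 1 ∨ μ = -1 := by
    intro μ hμ
    have a := multiset_eq_one (s := s.map (· ^ 2)) (by
      intro ν hν
      obtain ⟨μ, hμ, rfl⟩ := Multiset.mem_map.mp hν
      rw [norm_pow, hs.norm μ hμ, one_pow]) (by
      rw [← hs.2.1, h2, hs.card, Multiset.card_map]) (μ ^ 2)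
      (Multiset.mem_map_of_mem _ hμ)
    exact sq_eq_one_iff.mp a
  have key : ∀ s : Multiset ℂ, (∀ μ ∈ s, μ = 1 ∨ μ = -1) →
      ∃ m : ℕ, s.sum + 2 * m = s.card ∧ s.prod = (-1) ^ m := by
    intro s
    induction s using Multiset.induction_on with
    | empty => exact fun _ => ⟨0, by simp, by simp⟩
    | cons a s ih =>
      intro h
      obtain ⟨m, hm1, hm2⟩ := ih fun μ hμ => h μ (Multiset.mem_cons_of_mem hμ)
      rcases h a (Multiset.mem_cons_self a s) with rfl | rfl
      · exact ⟨m, by rw [Multiset.sum_cons, Multiset.card_cons]; push_cast; linear_combination hm1,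
          by rw [Multiset.prod_cons, hm2, one_mul]⟩
      · exact ⟨m + 1, by rw [Multiset.sum_cons, Multiset.card_cons]; push_cast;
                         linear_combination hm1,
          by rw [Multiset.prod_cons, hm2, pow_succ, mul_comm]⟩
  obtain ⟨m, hm1, hm2⟩ := key s h1
  rw [← hs.2.2, hd] at hm2
  have hev : Even m := by
    by_contra h
    rw [Nat.not_even_iff_odd] at h
    rw [h.neg_one_pow] at hm2
    norm_num at hm2
  obtain ⟨k, rfl⟩ := hev
  refine ⟨k, ?_⟩
  rw [hs.apply, hs.card, ← hm1]
  push_cast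
  ring

end KernelDet

section MaskedDet
variable {G : Type} [Group G]

/-- `d` is the determinant of the character `χ` of `H`, both extended by zero. -/
def HasDet (H : Subgroup G) (χ d : G → ℂ) : Prop :=
  (∀ g, g ∉ H → d g = 0) ∧ DetOf (fun h : H => χ h) (fun h : H => d h)

theorem Chr.exists_det {H : Subgroup G} {χ : G → ℂ} (h : Chr H χ) : ∃ d, HasDet H χ d := by
  obtain ⟨d, hd⟩ := h.2.exists_detOf
  refine ⟨mask H d, mask_supp H d, ?_⟩
  convert hd using 1
  ext g
  exact mask_coe H d g

theorem HasDet.lin {H : Subgroup G} {χ d : G → ℂ} (h : HasDet H χ d) : Lin H d :=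
  ⟨h.1, h.2.map_one, fun x hx y hy => h.2.map_mul ⟨x, hx⟩ ⟨y, hy⟩⟩

theorem HasDet.mp {H : Subgroup G} {χ d : G → ℂ} (h : HasDet H χ d) (σ : ℂ →+* ℂ) :
    HasDet H (mp σ χ) (mp σ d) :=
  ⟨fun g hg => by simp [_root_.mp, h.1 g hg], h.2.map σ⟩

theorem HasDet.res {K H : Subgroup G} {χ d : G → ℂ} (h : HasDet H χ d) (hK : K ≤ H) :
    HasDet K (res K χ) (res K d) := by
  refine ⟨res_supp _ _, ?_⟩
  have := h.2.comp (Subgroup.inclusion hK)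
  convert this using 2
  · exact res_of_mem (Subtype.prop _)
  · exact res_of_mem (Subtype.prop _)

theorem HasDet.mul_lin {H : Subgroup G} {χ d l : G → ℂ} (h : HasDet H χ d) (hl : Lin H l) {n : ℕ}
    (hn : χ 1 = n) : HasDet H (χ * l) (d * lpow H l n) := by
  refine ⟨fun g hg => by simp [h.1 g hg], ?_⟩
  have h1 := h.2.mul_lin hl.hom (n := n) (by simpa using hn)
  have h2 : (fun g : H => (d * _root_.lpow H l n) g) = fun g : H => d g * hl.hom g ^ n := by
    funext g
    simp only [Pi.mul_apply, _root_.lpow, SetLike.coe_mem, if_true]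
    rfl
  rw [h2]
  exact h1

variable [Finite G]

theorem HasDet.unique {H : Subgroup G} {χ d d' : G → ℂ} (h : HasDet H χ d) (h' : HasDet H χ d') :
    d = d' :=
  ext_on h.1 h'.1 fun g hg => congrFun (h.2.unique h'.2) ⟨g, hg⟩

theorem Chr.kernel {H : Subgroup G} {χ : G → ℂ} (h : Chr H χ) {y : G} (hyH : y ∈ H)
    (hy : χ y = χ 1) (x : G) : χ (x * y) = χ x := by
  by_cases hx : x ∈ H
  · exact h.2.kernel (y := ⟨y, hyH⟩) hy ⟨x, hx⟩
  · rw [h.1 x hx, h.1]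
    exact fun hxy => hx ((H.mul_mem_cancel_right hyH).mp hxy)

/-- The kernel of a character. -/
def ker {H : Subgroup G} {χ : G → ℂ} (h : Chr H χ) : Subgroup G where
  carrier := {y | y ∈ H ∧ χ y = χ 1}
  one_mem' := ⟨H.one_mem, rfl⟩
  mul_mem' := fun {a b} ha hb => ⟨H.mul_mem ha.1 hb.1, by rw [h.kernel hb.1 hb.2, ha.2]⟩
  inv_mem' := fun {a} ha => ⟨H.inv_mem ha.1, by
    rw [← h.kernel ha.1 ha.2, inv_mul_cancel]⟩

theorem mem_ker {H : Subgroup G} {χ : G → ℂ} {h : Chr H χ} {y : G} :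
    y ∈ ker h ↔ y ∈ H ∧ χ y = χ 1 := Iff.rfl

theorem HasDet.involution {H : Subgroup G} {χ d : G → ℂ} (h : HasDet H χ d) {x : G} (hx : x ∈ H)
    (hd : d x = 1) (h2 : χ (x ^ 2) = χ 1) : ∃ k : ℕ, χ x + 4 * k = χ 1 := by
  obtain ⟨s, hs⟩ := h.2.exists_eig ⟨x, hx⟩
  exact hs.involution hd h2

theorem HasDet.lpow_eq {H : Subgroup G} {χ d l : G → ℂ} {τ : ℂ →+* ℂ} (h : HasDet H χ d)
    (hτ : _root_.mp τ d = d) (hl : Lin H l) {n : ℕ} (hn : χ 1 = n)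
    (he : _root_.mp τ χ = χ * l) : lpow H l n = pr H := by
  have h1 := h.mp τ
  rw [hτ, he] at h1
  have h2 := h1.unique (h.mul_lin hl hn)
  refine ext_on (fun g hg => if_neg hg) (fun g hg => if_neg hg) fun g hg => ?_
  have h3 := congrFun h2 g
  rw [Pi.mul_apply] at h3
  rw [pr_of_mem hg]
  exact mul_left_cancel₀ (h.lin.ne_zero hg) (by rw [← h3, mul_one])

end MaskedDet

section Clifford
variable {G : Type} [Group G]

/-- `M` is a normal subgroup of `H`, both being subgroups of `G`. -/
def Nrm (M H : Subgroup G) : Prop := M ≤ H ∧ ∀ x ∈ H, ∀ m ∈ M, x * m * x⁻¹ ∈ M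

theorem Nrm.le {M H : Subgroup G} (h : Nrm M H) : M ≤ H := h.1

theorem Nrm.refl (H : Subgroup G) : Nrm H H :=
  ⟨le_rfl, fun _ hx _ hm => H.mul_mem (H.mul_mem hx hm) (H.inv_mem hx)⟩

theorem Nrm.mono {M K H : Subgroup G} (h : Nrm M H) (h1 : M ≤ K) (h2 : K ≤ H) : Nrm M K :=
  ⟨h1, fun x hx m hm => h.2 x (h2 hx) m hm⟩

theorem Nrm.conj_mem_iff {M H : Subgroup G} (h : Nrm M H) {x g : G} (hx : x ∈ H) :
    x * g * x⁻¹ ∈ M ↔ g ∈ M := by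
  refine ⟨fun hg => ?_, fun hg => h.2 x hx g hg⟩
  have := h.2 x⁻¹ (H.inv_mem hx) _ hg
  simpa [mul_assoc] using this

theorem Nrm.conj_mem_iff' {M H : Subgroup G} (h : Nrm M H) {x g : G} (hx : x ∈ H) :
    x⁻¹ * g * x ∈ M ↔ g ∈ M := by
  have := h.conj_mem_iff (g := g) (H.inv_mem hx)
  rwa [inv_inv] at this

theorem Nrm.cjS {M H : Subgroup G} (h : Nrm M H) {x : G} (hx : x ∈ H) : cjS x M = M := by
  ext g
  rw [mem_cjS, h.conj_mem_iff' hx]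

theorem Nrm.irr_cj [Fintype G] {M H : Subgroup G} (h : Nrm M H) {x : G} (hx : x ∈ H) {θ : G → ℂ}
    (hθ : Irr M θ) : Irr M (cj x θ) := by
  have := hθ.cj x
  rwa [h.cjS hx] at this

theorem Nrm.classOn_cj {M H : Subgroup G} (h : Nrm M H) {x : G} (hx : x ∈ H) {θ : G → ℂ}
    (hθ : ClassOn M θ) : ClassOn M (cj x θ) := by
  refine .of_cj (fun g hg => hθ.1 _ fun hg' => hg ((h.conj_mem_iff' hx).mp hg')) fun y hy => ?_
  have : y * x = x * (x⁻¹ * y * x) := by group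
  rw [← cj_mul, this, cj_mul, hθ.cj_eq ((h.conj_mem_iff' hx).mpr hy)]

theorem Nrm.ip_cj [Fintype G] {M H : Subgroup G} (h : Nrm M H) {x : G} (hx : x ∈ H)
    (f k : G → ℂ) : ip M (cj x f) (cj x k) = ip M f k := by
  have := _root_.ip_cj x M f k
  rwa [h.cjS hx] at this

theorem Nrm.ip_cj_right [Fintype G] {M H : Subgroup G} (h : Nrm M H) {x : G} (hx : x ∈ H)
    {f : G → ℂ} (hf : ClassOn H f) (k : G → ℂ) : ip M f (cj x k) = ip M f k := by
  conv_lhs => rw [← hf.cj_eq hx]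
  exact h.ip_cj hx f k

/-- The stabilizer of a function under conjugation by elements of `H`. -/
def stab (H : Subgroup G) (θ : G → ℂ) : Subgroup G where
  carrier := {x | x ∈ H ∧ cj x θ = θ}
  one_mem' := ⟨H.one_mem, cj_one θ⟩
  mul_mem' := fun {a b} ha hb => ⟨H.mul_mem ha.1 hb.1, by rw [cj_mul, hb.2, ha.2]⟩
  inv_mem' := fun {a} ha => ⟨H.inv_mem ha.1, by
    conv_lhs => rw [← ha.2]
    exact cj_inv_cj a θ⟩

theorem mem_stab {H : Subgroup G} {θ : G → ℂ} {x : G} : x ∈ stab H θ ↔ x ∈ H ∧ cj x θ = θ :=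
  Iff.rfl

theorem stab_le (H : Subgroup G) (θ : G → ℂ) : stab H θ ≤ H := fun _ h => h.1

theorem Nrm.le_stab {M H : Subgroup G} (h : Nrm M H) {θ : G → ℂ} (hθ : ClassOn M θ) :
    M ≤ stab H θ := fun _ hx => ⟨h.1 hx, hθ.cj_eq hx⟩

theorem Nrm.stab {M H : Subgroup G} (h : Nrm M H) {θ : G → ℂ} (hθ : ClassOn M θ) :
    Nrm M (stab H θ) := h.mono (h.le_stab hθ) (stab_le _ _)

variable [Fintype G]

theorem sum_orbit (H : Subgroup G) (θ ψ : G → ℂ) (h : ∃ x ∈ H, cj x θ = ψ) :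
    (∑ x, if x ∈ H then (if cj x θ = ψ then (1 : ℂ) else 0) else 0) = Nat.card (_root_.stab H θ) := by
  obtain ⟨y, hy, rfl⟩ := h
  rw [← Equiv.sum_comp (Equiv.mulLeft y)]
  have h1 : ∀ x : G, (if Equiv.mulLeft y x ∈ H then
      (if cj (Equiv.mulLeft y x) θ = cj y θ then (1 : ℂ) else 0) else 0) =
      if x ∈ _root_.stab H θ then 1 else 0 := by
    intro x
    have a1 : y * x ∈ H ↔ x ∈ H := H.mul_mem_cancel_left hy
    have a2 : cj y (cj x θ) = cj y θ ↔ cj x θ = θ := ⟨cj_inj, fun e => by rw [e]⟩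
    simp only [Equiv.coe_mulLeft, cj_mul, a1, a2, mem_stab]
    by_cases b : x ∈ H <;> simp [b]
  simp only [h1]
  rw [← sum_subgroup (_root_.stab H θ) (fun _ => (1 : ℂ))]
  simp [← Nat.card_eq_fintype_card]

theorem Chr.ip_nat' {K H : Subgroup G} {f h : G → ℂ} (hf : Chr H f) (hK : K ≤ H) (hh : Chr K h) :
    ∃ n : ℕ, ip K f h = n := by
  rw [← ip_res_left K f hh.1]
  exact (hf.res hK).ip_nat hh

theorem Chr.sub_const' {K H : Subgroup G} {f ψ : G → ℂ} (hf : Chr H f) (hK : K ≤ H)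
    (hψ : Irr K ψ) (h0 : ip K f ψ ≠ 0) : Chr K (_root_.res K f - ψ) :=
  (hf.res hK).sub_const hψ (by rwa [ip_res_left K f hψ.1])

theorem Chr.ip_mid {M K H : Subgroup G} {χ θ : G → ℂ} (hχ : Chr H χ) (hM : M ≤ K) (hK : K ≤ H)
    (hθ : ∀ g, g ∉ M → θ g = 0) :
    ip M χ θ = ∑ ψ ∈ IrrF K, ip K χ ψ * ip M ψ θ := by
  rw [← ip_res_left M χ hθ, ← res_res hM, ip_res_left M _ hθ]
  conv_lhs => rw [(hχ.res hK).classOn.expand]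
  rw [ip_sum_left]
  refine Finset.sum_congr rfl fun ψ hψ => ?_
  rw [ip_smul_left, ip_res_left K χ (mem_IrrF.mp hψ).1]

theorem Chr.exists_mid {M K H : Subgroup G} {χ θ : G → ℂ} (hχ : Chr H χ) (hM : M ≤ K)
    (hK : K ≤ H) (hθ : ∀ g, g ∉ M → θ g = 0) (h0 : ip M χ θ ≠ 0) :
    ∃ ψ, Irr K ψ ∧ ip K χ ψ ≠ 0 ∧ ip M ψ θ ≠ 0 := by
  rw [hχ.ip_mid hM hK hθ] at h0
  obtain ⟨ψ, hψ, h1⟩ := Finset.exists_ne_zero_of_sum_ne_zero h0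
  exact ⟨ψ, mem_IrrF.mp hψ, left_ne_zero_of_mul h1, right_ne_zero_of_mul h1⟩

theorem Chr.ip_ge {M K H : Subgroup G} {χ θ ψ : G → ℂ} (hχ : Chr H χ) (hM : M ≤ K)
    (hK : K ≤ H) (hθ : Chr M θ) (hψ : Irr K ψ) (h0 : ip K χ ψ ≠ 0) :
    ∃ n : ℕ, ip M χ θ = ip M ψ θ + n := by
  obtain ⟨n, hn⟩ := (hχ.sub_const' hK hψ h0).ip_nat' hM hθ
  refine ⟨n, ?_⟩
  rw [← hn, ip_sub_left, ← ip_res_left M χ hθ.1, ← res_res hM, ip_res_left M _ hθ.1]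
  ring

theorem Chr.ip_trans {M K H : Subgroup G} {χ θ ψ : G → ℂ} (hχ : Chr H χ) (hM : M ≤ K)
    (hK : K ≤ H) (hθ : Chr M θ) (hψ : Irr K ψ) (h0 : ip K χ ψ ≠ 0) (h1 : ip M ψ θ ≠ 0) :
    ip M χ θ ≠ 0 := by
  obtain ⟨n, hn⟩ := hχ.ip_ge hM hK hθ hψ h0
  obtain ⟨m, hm⟩ := hψ.chr.ip_nat' hM hθ
  rw [hn, hm]
  rw [hm] at h1
  have : m ≠ 0 := by rintro rfl; simp at h1
  exact_mod_cast (by omega : m + n ≠ 0)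

theorem Irr.exists_under {M H : Subgroup G} {χ : G → ℂ} (hχ : Irr H χ) (hM : M ≤ H) :
    ∃ θ, Irr M θ ∧ ip M χ θ ≠ 0 := by
  obtain ⟨θ, h1, h2⟩ := (hχ.chr.res hM).exists_const (fun h => hχ.deg_ne (by
    rw [← res_one χ (K := M), h]; rfl))
  exact ⟨θ, h1, by rwa [ip_res_left M χ h1.1] at h2⟩

theorem Irr.exists_over {M H : Subgroup G} {θ : G → ℂ} (hθ : Irr M θ) (hM : M ≤ H) :
    ∃ χ, Irr H χ ∧ ip M χ θ ≠ 0 := by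
  have h0 : _root_.ind M H θ ≠ 0 := by
    intro h
    have := congrFun h 1
    rw [ind_one] at this
    exact mul_ne_zero (div_ne_zero (card_ne_zero' H) (card_ne_zero' M)) hθ.deg_ne this
  obtain ⟨χ, h1, h2⟩ := (hθ.chr.ind hM).exists_const h0
  refine ⟨χ, h1, ?_⟩
  rw [ip_ind_left θ h1.chr.classOn] at h2
  rwa [← ip_conj, ne_eq, map_eq_zero]

theorem ip_ne_comm {H : Subgroup G} {f h : G → ℂ} : ip H f h ≠ 0 ↔ ip H h f ≠ 0 := by
  rw [← ip_conj H f h, ne_eq, ne_eq, map_eq_zero]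

theorem Nrm.ind_apply {M H : Subgroup G} (θ : G → ℂ) (f : G → ℂ) :
    ip M (ind M H θ) f =
      (Nat.card M : ℂ)⁻¹ * ∑ x, if x ∈ H then ip M (cj x⁻¹ θ) f else 0 := by
  have h1 : ind M H θ = (Nat.card M : ℂ)⁻¹ • ∑ x, if x ∈ H then cj x⁻¹ θ else 0 := by
    funext g
    rw [ind, Pi.smul_apply, Finset.sum_apply, smul_eq_mul]
    congr 1
    refine Finset.sum_congr rfl fun x _ => ?_
    split_ifs <;> simp [cj]
  rw [h1, ip_smul_left, ip_sum_left]
  congr 1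
  refine Finset.sum_congr rfl fun x _ => ?_
  split_ifs
  · rfl
  · exact ip_zero_left _ _

/-- Constituents of the restriction to a normal subgroup are conjugate. -/
theorem Nrm.conj_const {M H : Subgroup G} (h : Nrm M H) {χ θ θ' : G → ℂ} (hχ : Irr H χ)
    (hθ : Irr M θ) (hθ' : Irr M θ') (h1 : ip M χ θ ≠ 0) (h2 : ip M χ θ' ≠ 0) :
    ∃ x ∈ H, θ' = cj x θ := by
  by_contra hc
  push Not at hc
  have h3 : ip M (ind M H θ) θ' = 0 := by
    rw [Nrm.ind_apply, Finset.sum_eq_zero, mul_zero]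
    intro x _
    split_ifs with hx
    · rw [(h.irr_cj (H.inv_mem hx) hθ).orth hθ', if_neg]
      exact fun e => hc _ (H.inv_mem hx) e.symm
    · rfl
  refine (hθ.chr.ind h.1).ip_trans h.1 le_rfl hθ'.chr hχ ?_ h2 h3
  rw [ip_ind_left θ hχ.chr.classOn]
  exact ip_ne_comm.mp h1

/-- The restriction of an irreducible character to a normal subgroup. -/
theorem Nrm.res_eq {M H : Subgroup G} (h : Nrm M H) {χ θ : G → ℂ} (hχ : Irr H χ)
    (hθ : Irr M θ) (h1 : ip M χ θ ≠ 0) {m : G} (hm : m ∈ M) :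
    χ m = ip M χ θ / Nat.card (_root_.stab H θ) * ∑ x, if x ∈ H then cj x θ m else 0 := by
  set c := ip M χ θ / Nat.card (_root_.stab H θ) with hc
  let R : G → ℂ := c • ∑ x, if x ∈ H then cj x θ else 0
  have hR : ClassOn M R := by
    refine ClassOn.smul _ (ClassOn.sum _ _ fun x _ => ?_)
    split_ifs with hx
    · exact h.classOn_cj hx hθ.chr.classOn
    · exact ClassOn.zero
  have key : res M χ - R = 0 := by
    refine ((hχ.chr.res h.1).classOn.sub hR).eq_zero fun ψ hψ => ?_
    rw [ip_sub_left, ip_res_left M χ hψ.1, ip_smul_left, ip_sum_left]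
    have e1 : ∀ x : G, ip M (if x ∈ H then cj x θ else 0) ψ =
        if x ∈ H then (if cj x θ = ψ then (1 : ℂ) else 0) else 0 := by
      intro x
      split_ifs with hx e
      · rw [(h.irr_cj hx hθ).orth hψ, if_pos e]
      · rw [(h.irr_cj hx hθ).orth hψ, if_neg e]
      · exact ip_zero_left _ _
    simp only [e1]
    by_cases hex : ∃ x ∈ H, cj x θ = ψ
    · rw [sum_orbit H θ ψ hex, hc, div_mul_cancel₀ _ (card_ne_zero' _)]
      obtain ⟨x, hx, rfl⟩ := hex
      rw [h.ip_cj_right hx hχ.chr.classOn, sub_self]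
    · rw [Finset.sum_eq_zero, mul_zero, sub_zero]
      · by_contra h0
        obtain ⟨x, hx, e⟩ := h.conj_const hχ hθ hψ h1 h0
        exact hex ⟨x, hx, e.symm⟩
      · intro x _
        split_ifs with hx e
        · exact absurd ⟨x, hx, e⟩ hex
        · rfl
        · rfl
  have h2 := congrFun (sub_eq_zero.mp key) m
  rw [res_of_mem hm] at h2
  rw [h2]
  simp only [R]
  rw [Pi.smul_apply, Finset.sum_apply, smul_eq_mul]
  congr 1
  refine Finset.sum_congr rfl fun x _ => ?_
  split_ifs <;> rfl

theorem Nrm.deg_eq {M H : Subgroup G} (h : Nrm M H) {χ θ : G → ℂ} (hχ : Irr H χ)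
    (hθ : Irr M θ) (h1 : ip M χ θ ≠ 0) :
    χ 1 = ip M χ θ * (Nat.card H / Nat.card (_root_.stab H θ)) * θ 1 := by
  rw [h.res_eq hχ hθ h1 M.one_mem]
  simp only [cj_apply_one]
  rw [← sum_subgroup H (fun _ => θ 1)]
  simp only [Finset.sum_const, Finset.card_univ, nsmul_eq_mul, ← Nat.card_eq_fintype_card]
  ring

theorem Nrm.res_of_inv {M H : Subgroup G} (h : Nrm M H) {χ θ : G → ℂ} (hχ : Irr H χ)
    (hθ : Irr M θ) (h1 : ip M χ θ ≠ 0) (hinv : ∀ x ∈ H, cj x θ = θ) {m : G} (hm : m ∈ M) :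
    χ m = ip M χ θ * θ m := by
  have hs : _root_.stab H θ = H := le_antisymm (stab_le _ _) fun x hx => ⟨hx, hinv x hx⟩
  rw [h.res_eq hχ hθ h1 hm, hs]
  have : ∀ x, (if x ∈ H then cj x θ m else 0) = if x ∈ H then θ m else 0 := by
    intro x
    split_ifs with hx
    · rw [hinv x hx]
    · rfl
  simp only [this]
  rw [← sum_subgroup H (fun _ => θ m)]
  simp only [Finset.sum_const, Finset.card_univ, nsmul_eq_mul, ← Nat.card_eq_fintype_card]
  have := card_ne_zero' H
  field_simp

theorem stab_stab (H : Subgroup G) (θ : G → ℂ) : _root_.stab (_root_.stab H θ) θ = _root_.stab H θ :=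
  le_antisymm (stab_le _ _) fun _ hx => ⟨hx, hx.2⟩

/-- Clifford correspondence. -/
theorem Nrm.clifford {M H : Subgroup G} (h : Nrm M H) {χ θ ψ : G → ℂ} (hχ : Irr H χ)
    (hθ : Irr M θ) (hψ : Irr (_root_.stab H θ) ψ) (h1 : ip M ψ θ ≠ 0)
    (h2 : ip (_root_.stab H θ) χ ψ ≠ 0) :
    ind (_root_.stab H θ) H ψ = χ ∧ ip M χ θ = ip M ψ θ := by
  set T := _root_.stab H θ with hT
  have hMT : M ≤ T := h.le_stab hθ.chr.classOn
  have hTH : T ≤ H := stab_le _ _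
  have hMTn : Nrm M T := h.stab hθ.chr.classOn
  have e1 := hMTn.deg_eq hψ hθ h1
  rw [hT, stab_stab, ← hT, div_self (card_ne_zero' T), mul_one] at e1
  have h3 := hχ.chr.ip_trans hMT hTH hθ.chr hψ h2 h1
  have e2 := h.deg_eq hχ hθ h3
  rw [← hT] at e2
  obtain ⟨n, hn⟩ := hχ.chr.ip_ge hMT hTH hθ.chr hψ h2
  have h4 : ip H (ind T H ψ) χ ≠ 0 := by
    rw [ip_ind_left ψ hχ.chr.classOn]
    exact ip_ne_comm.mp h2
  have h5 := (hψ.chr.ind hTH).sub_const hχ h4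
  obtain ⟨k, hk⟩ := h5.deg_nat
  obtain ⟨t, ht0, ht⟩ := hθ.deg_pos
  have hHT : 0 < Nat.card H ∧ 0 < Nat.card T := ⟨Nat.card_pos, Nat.card_pos⟩
  have hT0 := card_ne_zero' T
  rw [Pi.sub_apply, ind_one, e1, e2, hn, ht] at hk
  have h6 : (k : ℂ) * Nat.card T + n * Nat.card H * t = 0 := by
    rw [← hk]
    field_simp
    ring
  have h7 : k * Nat.card T + n * Nat.card H * t = 0 := by exact_mod_cast h6
  have h8 : k = 0 := by
    rcases Nat.eq_zero_of_add_eq_zero_right h7 with h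
    rcases Nat.mul_eq_zero.mp h with h | h
    · exact h
    · omega
  have h9 : n = 0 := by
    rcases Nat.eq_zero_of_add_eq_zero_left h7 with h
    rcases Nat.mul_eq_zero.mp h with h | h
    · rcases Nat.mul_eq_zero.mp h with h | h
      · exact h
      · omega
    · omega
  constructor
  · refine sub_eq_zero.mp (h5.eq_zero_of_deg ?_)
    rw [Pi.sub_apply, ind_one, e1, e2, hn, ht, hk, h8, Nat.cast_zero]
  · rw [hn, h9, Nat.cast_zero, add_zero]

theorem Nrm.clifford_exists {M H : Subgroup G} (h : Nrm M H) {χ θ : G → ℂ} (hχ : Irr H χ)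
    (hθ : Irr M θ) (h1 : ip M χ θ ≠ 0) :
    ∃ ψ, Irr (_root_.stab H θ) ψ ∧ ip M ψ θ ≠ 0 ∧ ip (_root_.stab H θ) χ ψ ≠ 0 ∧
      ind (_root_.stab H θ) H ψ = χ := by
  obtain ⟨ψ, h2, h3, h4⟩ := hχ.chr.exists_mid (h.le_stab hθ.chr.classOn) (stab_le H θ) hθ.1 h1
  exact ⟨ψ, h2, h4, h3, (h.clifford hχ hθ h2 h4 h3).1⟩

theorem Nrm.clifford_unique {M H : Subgroup G} (h : Nrm M H) {χ θ ψ ψ' : G → ℂ} (hχ : Irr H χ)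
    (hθ : Irr M θ) (hψ : Irr (_root_.stab H θ) ψ) (hψ' : Irr (_root_.stab H θ) ψ')
    (h1 : ip M ψ θ ≠ 0) (h1' : ip M ψ' θ ≠ 0)
    (h2 : ip (_root_.stab H θ) χ ψ ≠ 0) (h2' : ip (_root_.stab H θ) χ ψ' ≠ 0) : ψ = ψ' := by
  by_contra hne
  have hTH := stab_le H θ
  have hMT : M ≤ _root_.stab H θ := h.le_stab hθ.chr.classOn
  have h3 := hχ.chr.sub_const' hTH hψ h2
  have h4 : ip (_root_.stab H θ) (res (_root_.stab H θ) χ - ψ) ψ' ≠ 0 := by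
    rwa [ip_sub_left, ip_res_left _ _ hψ'.1, hψ.orth hψ', if_neg hne, sub_zero]
  have h5 := h3.ip_trans hMT le_rfl hθ.chr hψ' h4 h1'
  apply h5
  rw [ip_sub_left, ← ip_res_left M (res _ χ) hθ.1, res_res hMT, ip_res_left M χ hθ.1,
    (h.clifford hχ hθ hψ h1 h2).2, sub_self]

end Clifford

section Steps
variable {G : Type} [Group G]

/-- `K` is the kernel of a nontrivial linear character `l` of `L` of prime order `r`. -/
structure Step (K L : Subgroup G) (l : G → ℂ) (r : ℕ) : Prop where
  prime : r.Prime
  lin : Lin L l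
  pow : ∀ x ∈ L, l x ^ r = 1
  nontriv : ∃ x ∈ L, l x ≠ 1
  mem : ∀ x, x ∈ K ↔ x ∈ L ∧ l x = 1

theorem Step.le {K L : Subgroup G} {l : G → ℂ} {r : ℕ} (h : Step K L l r) : K ≤ L :=
  fun x hx => ((h.mem x).mp hx).1

theorem Step.lt {K L : Subgroup G} {l : G → ℂ} {r : ℕ} (h : Step K L l r) : K < L := by
  refine lt_of_le_of_ne h.le ?_
  rintro rfl
  obtain ⟨x, hx, hl⟩ := h.nontriv
  exact hl ((h.mem x).mp hx).2

theorem Step.nrm {K L : Subgroup G} {l : G → ℂ} {r : ℕ} (h : Step K L l r) : Nrm K L := by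
  refine ⟨h.le, fun x hx m hm => (h.mem _).mpr ?_⟩
  obtain ⟨h1, h2⟩ := (h.mem m).mp hm
  exact ⟨L.mul_mem (L.mul_mem hx h1) (L.inv_mem hx), by rw [h.lin.conj_apply hx h1, h2]⟩

theorem Step.mem_of_pow {K L : Subgroup G} {l : G → ℂ} {r : ℕ} (h : Step K L l r) {x : G}
    (hx : x ∈ L) {n : ℕ} (hn : ¬ r ∣ n) (hp : x ^ n ∈ K) : x ∈ K := by
  refine (h.mem x).mpr ⟨hx, ?_⟩
  have h1 := ((h.mem _).mp hp).2
  rw [h.lin.map_pow hx] at h1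
  have h2 := pow_gcd_eq_one.mpr ⟨h.pow x hx, h1⟩
  rwa [(h.prime.coprime_iff_not_dvd.mpr hn : Nat.gcd r n = 1), pow_one] at h2

theorem Step.lpow_inj {K L : Subgroup G} {l : G → ℂ} {r : ℕ} (h : Step K L l r) {n : ℕ} :
    lpow L l n = pr L ↔ r ∣ n := by
  constructor
  · intro e
    by_contra hn
    obtain ⟨x, hx, hl⟩ := h.nontriv
    apply hl
    have h1 : l x ^ n = 1 := by
      have := congrFun e x
      simpa [lpow, pr, hx] using this
    have h2 := pow_gcd_eq_one.mpr ⟨h.pow x hx, h1⟩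
    rwa [(h.prime.coprime_iff_not_dvd.mpr hn : Nat.gcd r n = 1), pow_one] at h2
  · rintro ⟨k, rfl⟩
    funext x
    by_cases hx : x ∈ L
    · simp [lpow, pr, hx, pow_mul, h.pow x hx]
    · simp [lpow, pr, hx]

theorem lpow_add (L : Subgroup G) (l : G → ℂ) (a b : ℕ) :
    lpow L l (a + b) = lpow L l a * lpow L l b := by
  funext x
  by_cases hx : x ∈ L <;> simp [lpow, hx, pow_add]

theorem mul_pr {L : Subgroup G} {f : G → ℂ} (hf : ∀ g, g ∉ L → f g = 0) : f * pr L = f := by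
  funext x
  by_cases hx : x ∈ L
  · simp [pr, hx]
  · simp [hf x hx]

theorem lpow_zero (L : Subgroup G) (l : G → ℂ) : lpow L l 0 = pr L := by
  funext x
  by_cases hx : x ∈ L <;> simp [lpow, pr, hx]

theorem Step.sum_lpow {K L : Subgroup G} {l : G → ℂ} {r : ℕ} (h : Step K L l r) (x : G) :
    ∑ j ∈ Finset.range r, lpow L l j x = r * pr K x := by
  by_cases hx : x ∈ L
  · simp only [lpow, hx, if_true]
    by_cases hK : x ∈ K
    · simp [pr, hK, ((h.mem x).mp hK).2]
    · have h1 : l x ≠ 1 := fun e => hK ((h.mem x).mpr ⟨hx, e⟩)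
      rw [geom_sum_eq h1, h.pow x hx]
      simp [pr, hK]
  · have : x ∉ K := fun hK => hx (h.le hK)
    simp [lpow, pr, hx, this]

variable [Fintype G]

theorem Step.card {K L : Subgroup G} {l : G → ℂ} {r : ℕ} (h : Step K L l r) :
    Nat.card L = r * Nat.card K := by
  have h1 : ∑ j ∈ Finset.range r, ip L (lpow L l j) (pr L) = 1 := by
    rw [Finset.sum_eq_single 0]
    · rw [lpow_zero, (lin_pr L).irr.ip_self]
    · intro j hj hj0
      rw [(h.lin.lpow j).irr.orth (lin_pr L).irr, if_neg]
      rw [h.lpow_inj]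
      exact fun hd => hj0 (Nat.eq_zero_of_dvd_of_lt hd (Finset.mem_range.mp hj))
    · intro h0
      exact absurd (Finset.mem_range.mpr h.prime.pos) h0
  rw [← ip_sum_left, ip] at h1
  have h2 : ∀ g, (∑ j ∈ Finset.range r, lpow L l j) g * (starRingEnd ℂ) (pr L g) =
      if g ∈ K then (r : ℂ) else 0 := by
    intro g
    rw [Finset.sum_apply, h.sum_lpow]
    by_cases hK : g ∈ K
    · simp [pr, hK, h.le hK]
    · simp [pr, hK]
  simp only [h2] at h1
  rw [← sum_subgroup K (fun _ => (r : ℂ))] at h1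
  simp only [Finset.sum_const, Finset.card_univ, nsmul_eq_mul, ← Nat.card_eq_fintype_card] at h1
  have h3 := card_ne_zero' L
  field_simp at h1
  have h4 : (Nat.card L : ℂ) = r * Nat.card K := by rw [← h1]; ring
  exact_mod_cast h4

theorem Step.sum_ip {K L : Subgroup G} {l : G → ℂ} {r : ℕ} (h : Step K L l r) {χ ψ : G → ℂ}
    (hχ : ∀ g, g ∉ L → χ g = 0) :
    ∑ j ∈ Finset.range r, ip L (χ * lpow L l j) ψ = ip K χ (res K ψ) := by
  rw [← ip_sum_left, ip, ip, h.card]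
  have h2 : ∀ g, (∑ j ∈ Finset.range r, χ * lpow L l j) g * (starRingEnd ℂ) (ψ g) =
      r * (χ g * (starRingEnd ℂ) (res K ψ g)) := by
    intro g
    rw [Finset.sum_apply]
    simp only [Pi.mul_apply]
    rw [← Finset.mul_sum, h.sum_lpow]
    by_cases hK : g ∈ K
    · simp [pr, res, hK]; ring
    · simp [pr, res, hK]
  simp only [h2]
  rw [← Finset.mul_sum]
  have h3 := card_ne_zero' K
  have h4 : (r : ℂ) ≠ 0 := by exact_mod_cast h.prime.ne_zero
  push_cast
  field_simp

/-- Invariant irreducible characters extend over a prime cyclic step. -/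
theorem Step.ext {K L : Subgroup G} {l : G → ℂ} {r : ℕ} (h : Step K L l r) {χ θ : G → ℂ}
    (hχ : Irr L χ) (hθ : Irr K θ) (h0 : ip K χ θ ≠ 0) (hinv : ∀ x ∈ L, cj x θ = θ) :
    res K χ = θ ∧ (∀ ψ, Irr L ψ → ip K ψ θ ≠ 0 → ∃ j < r, ψ = χ * lpow L l j) ∧
      ∀ j, χ * lpow L l j = χ → r ∣ j := by
  have hr : ∀ ψ, Irr L ψ → ip K ψ θ ≠ 0 → res K ψ = ip K ψ θ • θ := by
    intro ψ hψ h1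
    refine ext_on (res_supp K ψ) (fun g hg => by simp [hθ.1 g hg]) fun m hm => ?_
    rw [res_of_mem hm, h.nrm.res_of_inv hψ hθ h1 hinv hm]
    rfl
  have hcnt : ∀ ψ, Irr L ψ → ip K ψ θ ≠ 0 →
      ∑ j ∈ Finset.range r, ip L (χ * lpow L l j) ψ =
        ip K χ θ * ip K ψ θ := by
    intro ψ hψ h1
    rw [h.sum_ip hχ.1, hr ψ hψ h1, ip_smul_right]
    obtain ⟨n, hn⟩ := hψ.chr.ip_nat' h.le hθ.chr
    rw [hn, Complex.conj_natCast, mul_comm]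
  obtain ⟨e, he⟩ := hχ.chr.ip_nat' h.le hθ.chr
  have hdist : ∀ j, χ * lpow L l j = χ → r ∣ j := by
    intro j hj
    by_contra hd
    have hpow : ∀ k, χ * lpow L l (j * k) = χ := by
      intro k
      induction k with
      | zero => rw [Nat.mul_zero, lpow_zero, mul_pr hχ.1]
      | succ k ih => rw [Nat.mul_succ, lpow_add, ← mul_assoc, ih, hj]
    have hall : ∀ i, χ * lpow L l i = χ := by
      intro i
      have hc : Nat.Coprime j r := (h.prime.coprime_iff_not_dvd.mpr hd).symm
      obtain ⟨k, -, hk⟩ := Nat.exists_mul_mod_eq_one_of_coprime hc h.prime.one_lt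
      have h1 : j * (k * i) = i + r * (j * k / r * i) := by
        have := Nat.div_add_mod (j * k) r
        rw [hk] at this
        calc j * (k * i) = (j * k) * i := by ring
          _ = (r * (j * k / r) + 1) * i := by rw [this]
          _ = _ := by ring
      have h2 := hpow (k * i)
      rwa [h1, lpow_add, h.lpow_inj.mpr (dvd_mul_right _ _), ← mul_assoc, mul_pr] at h2
      intro g hg
      simp [hχ.1 g hg]
    have h3 := hcnt χ hχ h0
    simp only [hall, hχ.ip_self] at h3
    rw [he] at h3
    simp only [Finset.sum_const, Finset.card_range, nsmul_eq_mul, mul_one] at h3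
    have h4 : r = e * e := by exact_mod_cast h3
    exact h.prime.prime.not_isSquare ⟨e, h4⟩
  have he1 : ip K χ θ = 1 := by
    have h3 := hcnt χ hχ h0
    rw [Finset.sum_eq_single 0, lpow_zero, mul_pr hχ.1, hχ.ip_self, he] at h3
    · have h4 : 1 = e * e := by exact_mod_cast h3
      rw [he]
      have : e = 1 := Nat.eq_one_of_mul_eq_one_right h4.symm
      rw [this, Nat.cast_one]
    · intro j hj hj0
      rw [(hχ.mul_lin (h.lin.lpow j)).orth hχ, if_neg]
      intro e
      exact hj0 (Nat.eq_zero_of_dvd_of_lt (hdist j e) (Finset.mem_range.mp hj))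
    · intro h0
      exact absurd (Finset.mem_range.mpr h.prime.pos) h0
  refine ⟨by rw [hr χ hχ h0, he1, one_smul], fun ψ hψ h1 => ?_, hdist⟩
  have h3 := hcnt ψ hψ h1
  rw [he1, one_mul] at h3
  rw [← h3] at h1
  obtain ⟨j, hj, h4⟩ := Finset.exists_ne_zero_of_sum_ne_zero h1
  refine ⟨j, Finset.mem_range.mp hj, ?_⟩
  by_contra hne
  rw [(hχ.mul_lin (h.lin.lpow j)).orth hψ, if_neg (fun e => hne e.symm)] at h4
  exact h4 rfl

theorem Step.eq_or_eq {K L T : Subgroup G} {l : G → ℂ} {r : ℕ} (h : Step K L l r)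
    (hK : K ≤ T) (hL : T ≤ L) : T = K ∨ T = L := by
  obtain ⟨a, ha⟩ := Subgroup.card_dvd_of_le hK
  obtain ⟨b, hb⟩ := Subgroup.card_dvd_of_le hL
  rw [ha, h.card] at hb
  have hp : 0 < Nat.card K := Nat.card_pos
  have h1 : r = a * b := by
    apply Nat.eq_of_mul_eq_mul_right hp
    rw [hb]; ring
  rcases (Nat.dvd_prime h.prime).mp ⟨b, h1⟩ with h2 | h2
  · left
    refine (Subgroup.eq_of_le_of_card_ge hK ?_).symm
    rw [ha, h2, mul_one]
  · right
    refine Subgroup.eq_of_le_of_card_ge hL ?_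
    rw [ha, h.card, h2, mul_comm]

theorem Step.dichotomy {K L : Subgroup G} {l : G → ℂ} {r : ℕ} (h : Step K L l r) {χ θ : G → ℂ}
    (hχ : Irr L χ) (hθ : Irr K θ) (h0 : ip K χ θ ≠ 0) :
    (res K χ = θ ∧ ∀ x ∈ L, cj x θ = θ) ∨
      (stab L θ = K ∧ ind K L θ = χ ∧ χ 1 = r * θ 1 ∧ ip K χ θ = 1) := by
  rcases h.eq_or_eq (h.nrm.le_stab hθ.chr.classOn) (stab_le L θ) with hs | hs
  · right
    obtain ⟨ψ, h1, h2, h3, h4⟩ := h.nrm.clifford_exists hχ hθ h0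
    rw [hs] at h1 h3 h4
    have e : ψ = θ := by
      by_contra hne
      rw [h1.orth hθ, if_neg hne] at h2
      exact h2 rfl
    subst e
    refine ⟨hs, h4, ?_, ?_⟩
    · rw [← h4, ind_one, h.card]
      have := card_ne_zero' K
      push_cast
      field_simp
    · rw [← hs] at h1 h3
      rw [(h.nrm.clifford hχ hθ h1 h2 h3).2, hθ.ip_self]
  · left
    have hinv : ∀ x ∈ L, cj x θ = θ := by
      intro x hx
      rw [← hs] at hx
      exact hx.2
    exact ⟨(h.ext hχ hθ h0 hinv).1, hinv⟩

end Steps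

section Galois
variable {G : Type} [Group G]

/-- A field automorphism inverting `p`-power roots of unity and fixing roots of unity of order
prime to `p`, acting as an involution on character values of `G`. -/
structure Sg (p : ℕ) (G : Type) (σ : ℂ →+* ℂ) : Prop where
  prime : p.Prime
  odd : p ≠ 2
  reg : ∀ μ m, μ ^ Nat.card G = 1 → ¬ p ∣ m → μ ^ m = 1 → σ μ = μ
  inv : ∀ μ k, μ ^ Nat.card G = 1 → μ ^ p ^ k = 1 → σ μ * μ = 1
  invol : ∀ μ, μ ^ Nat.card G = 1 → σ (σ μ) = μ

theorem exists_sg [Finite G] {p : ℕ} (hp : p.Prime) (h2 : p ≠ 2) : ∃ σ, Sg p G σ := by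
  obtain ⟨σ, h1, h3, h4⟩ := exists_sigma hp (Nat.card_pos (α := G))
  refine ⟨σ, hp, h2, fun μ m hn hm h => ?_, fun μ k hn h => ?_, h4⟩
  · refine h1 μ (Nat.gcd m (Nat.card G)) (Nat.gcd_dvd_right _ _) ?_ (pow_gcd_eq_one.mpr ⟨h, hn⟩)
    exact fun hd => hm (hd.trans (Nat.gcd_dvd_left _ _))
  · obtain ⟨j, -, hj⟩ := (Nat.dvd_prime_pow hp).mp (Nat.gcd_dvd_left (p ^ k) (Nat.card G))
    refine h3 μ j (hj ▸ Nat.gcd_dvd_right _ _) ?_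
    rw [← hj]
    exact pow_gcd_eq_one.mpr ⟨h, hn⟩

variable {p : ℕ} {σ : ℂ →+* ℂ}

theorem Chr.exists_eig [Finite G] {H : Subgroup G} {f : G → ℂ} (hf : Chr H f) {g : G} (hg : g ∈ H) :
    ∃ s : Multiset ℂ, (∀ μ ∈ s, μ ^ orderOf g = 1) ∧ ∀ k : ℕ, f (g ^ k) = (s.map (· ^ k)).sum := by
  obtain ⟨d, hd⟩ := hf.exists_det
  obtain ⟨s, h1, h2, -⟩ := hd.2.exists_eig ⟨g, hg⟩
  refine ⟨s, fun μ hμ => ?_, h2⟩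
  have := h1 μ hμ
  rwa [Subgroup.orderOf_mk] at this

theorem pow_card_of_pow_orderOf [Finite G] {g : G} {μ : ℂ} (h : μ ^ orderOf g = 1) :
    μ ^ Nat.card G = 1 := by
  obtain ⟨c, hc⟩ := orderOf_dvd_natCard g
  rw [hc, pow_mul, h, one_pow]

theorem Sg.sq [Finite G] (hσ : Sg p G σ) {H : Subgroup G} {f : G → ℂ} (hf : Chr H f) :
    mp σ (mp σ f) = f := by
  funext g
  by_cases hg : g ∈ H
  · obtain ⟨s, h1, h2⟩ := hf.exists_eig hg
    have h3 := h2 1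
    simp only [pow_one, Multiset.map_id'] at h3
    rw [mp, mp, h3, map_multiset_sum, map_multiset_sum, Multiset.map_map]
    congr 1
    conv_rhs => rw [← Multiset.map_id s]
    exact Multiset.map_congr rfl fun μ hμ => hσ.invol μ (pow_card_of_pow_orderOf (h1 μ hμ))
  · simp [mp, hf.1 g hg]

theorem Sg.apply_reg [Finite G] (hσ : Sg p G σ) {H : Subgroup G} {f : G → ℂ} (hf : Chr H f) {g : G}
    (hp : ¬ p ∣ orderOf g) : σ (f g) = f g := by
  by_cases hg : g ∈ H
  · obtain ⟨s, h1, h2⟩ := hf.exists_eig hg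
    have h3 := h2 1
    simp only [pow_one, Multiset.map_id'] at h3
    rw [h3, map_multiset_sum]
    congr 1
    conv_rhs => rw [← Multiset.map_id s]
    exact Multiset.map_congr rfl fun μ hμ =>
      hσ.reg μ _ (pow_card_of_pow_orderOf (h1 μ hμ)) hp (h1 μ hμ)
  · simp [hf.1 g hg]

theorem Lin.pow_orderOf {H : Subgroup G} {l : G → ℂ} (hl : Lin H l) {x : G} (hx : x ∈ H) :
    l x ^ orderOf x = 1 := by
  rw [← hl.map_pow hx, pow_orderOf_eq_one, hl.2.1]

theorem Sg.lin_p [Finite G] (hσ : Sg p G σ) {H : Subgroup G} {l : G → ℂ} (hl : Lin H l)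
    (h : ∀ x ∈ H, ∃ k, l x ^ p ^ k = 1) : mp σ l * l = pr H := by
  funext g
  by_cases hg : g ∈ H
  · obtain ⟨k, hk⟩ := h g hg
    rw [pr_of_mem hg]
    exact hσ.inv _ k (pow_card_of_pow_orderOf (hl.pow_orderOf hg)) hk
  · simp [mp, hl.1 g hg, pr, hg]

theorem Sg.lin_p' [Finite G] (hσ : Sg p G σ) {H : Subgroup G} {l : G → ℂ} (hl : Lin H l)
    (h : ∀ x ∈ H, ∃ m, ¬ p ∣ m ∧ l x ^ m = 1) : mp σ l = l := by
  funext g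
  by_cases hg : g ∈ H
  · obtain ⟨m, hm, hk⟩ := h g hg
    exact hσ.reg _ m (pow_card_of_pow_orderOf (hl.pow_orderOf hg)) hm hk
  · simp [mp, hl.1 g hg]

/-- The composite of `σ` with complex conjugation. -/
def tau (σ : ℂ →+* ℂ) : ℂ →+* ℂ := (starRingEnd ℂ).comp σ

theorem Sg.tau_lin [Finite G] (hσ : Sg p G σ) {H : Subgroup G} {l : G → ℂ} (hl : Lin H l)
    (h : ∀ x ∈ H, ∃ k, l x ^ p ^ k = 1) : mp (tau σ) l = l := by
  funext g
  by_cases hg : g ∈ H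
  · have h1 := congrFun (hσ.lin_p hl h) g
    rw [pr_of_mem hg, Pi.mul_apply] at h1
    have h2 := congrArg (starRingEnd ℂ) h1
    rw [map_mul, map_one] at h2
    have h3 := hl.norm_eq hg
    have h4 : starRingEnd ℂ (l g) ≠ 0 := right_ne_zero_of_mul (h3.trans_ne one_ne_zero)
    exact mul_right_cancel₀ h4 (h2.trans h3.symm)
  · simp [mp, hl.1 g hg]

/-- A Galois twist realized by an element of odd order modulo a subgroup acting trivially is
trivial. -/
theorem mp_eq_of_odd {f : G → ℂ} {L : Subgroup G} (hf : ClassOn L f)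
    (h2 : mp σ (mp σ f) = f) {y : G} (hy : mp σ f = cj y f) {m : ℕ} (hm : Odd m)
    (hyL : y ^ m ∈ L) : mp σ f = f := by
  have h3 : cj (y * y) f = f := by
    rw [cj_mul, ← hy, cj_mp, ← hy, h2]
  have h4 : ∀ b : ℕ, cj (y ^ (2 * b)) f = f := by
    intro b
    induction b with
    | zero => rw [Nat.mul_zero, pow_zero, cj_one]
    | succ b ih => rw [Nat.mul_succ, pow_add, cj_mul, pow_two, h3, ih]
  obtain ⟨b, rfl⟩ := hm
  have h5 := hf.cj_eq hyL
  rw [add_comm, pow_add, pow_one, cj_mul, h4] at h5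
  rw [hy, h5]

end Galois

section Polyc
variable {G : Type} [Group G]

theorem Nrm.normal {M H : Subgroup G} (h : Nrm M H) : (M.subgroupOf H).Normal :=
  ⟨fun n hn g => h.2 g g.2 n hn⟩

theorem exists_step_of_solvable [Finite G] {M L : Subgroup G} (h : Nrm M L) (hlt : M < L)
    (hs : ∀ _ : (M.subgroupOf L).Normal, Group.IsSolvable (L ⧸ M.subgroupOf L)) :
    ∃ K l r, M ≤ K ∧ Step K L l r := by
  have := h.normal
  let Q := L ⧸ M.subgroupOf L
  have : Group.IsSolvable Q := hs _
  obtain ⟨x0, hx0, hx0M⟩ := SetLike.exists_of_lt hlt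
  let q : L →* Q := QuotientGroup.mk' _
  have hq : ∀ x : L, q x = 1 ↔ (x : G) ∈ M := fun x => by
    rw [show q x = (x : Q) from rfl, QuotientGroup.eq_one_iff, Subgroup.mem_subgroupOf]
  have : Nontrivial Q := ⟨q ⟨x0, hx0⟩, 1, fun e => hx0M ((hq _).mp e)⟩
  have hc := IsSolvable.commutator_lt_top_of_nontrivial Q
  obtain ⟨y, -, hy⟩ := SetLike.exists_of_lt hc
  have hy1 : Abelianization.of y ≠ 1 := by
    intro e
    apply hy
    rwa [← Abelianization.ker_of, MonoidHom.mem_ker]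
  have : Finite (Abelianization Q) := Quotient.finite _
  have : NeZero (Monoid.exponent (Abelianization Q)) := ⟨Monoid.exponent_ne_zero_of_finite⟩
  obtain ⟨φ, hφ⟩ := CommGroup.exists_apply_ne_one_of_hasEnoughRootsOfUnity (Abelianization Q) ℂ hy1
  let ψ : L →* ℂˣ := φ.comp (Abelianization.of.comp q)
  have hψM : ∀ x : L, (x : G) ∈ M → ψ x = 1 := fun x hx => by
    simp only [ψ, MonoidHom.comp_apply, (hq x).mpr hx, map_one]
  obtain ⟨y', hy'⟩ : ∃ y', q y' = y := QuotientGroup.mk'_surjective (M.subgroupOf L) y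
  have hψ1 : ψ y' ≠ 1 := by
    simp only [ψ, MonoidHom.comp_apply, hy']
    exact hφ
  have hex : ∃ n, 0 < n ∧ ∀ x, ψ x ^ n = 1 :=
    ⟨Nat.card L, Nat.card_pos, fun x => by rw [← map_pow, pow_card_eq_one', map_one]⟩
  obtain ⟨hn0, hn⟩ := Nat.find_spec hex
  have hmin := fun m => Nat.find_min (m := m) hex
  set n := Nat.find hex
  have hn1 : n ≠ 1 := fun e => hψ1 (by simpa [e] using hn y')
  let r := n.minFac
  have hr : r.Prime := Nat.minFac_prime hn1
  obtain ⟨c, hc⟩ : r ∣ n := Nat.minFac_dvd n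
  have hc0 : 0 < c := by
    rcases Nat.eq_zero_or_pos c with rfl | h
    · omega
    · exact h
  have hord : ¬ ∀ x, ψ x ^ c = 1 := fun e => hmin c (by have := hr.two_le; nlinarith) ⟨hc0, e⟩
  have hordr : ∀ x, (ψ x ^ c) ^ r = 1 := fun x => by rw [← pow_mul, mul_comm, ← hc, hn]
  let χ : L →* ℂ := (Units.coeHom ℂ).comp ((powMonoidHom c).comp ψ)
  have hχ : ∀ x : L, χ x = 1 ↔ ψ x ^ c = 1 := fun x => by
    rw [← Units.val_eq_one]
    rfl
  have hl : Lin L (mask L χ) := lin_mask χ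
  let K : Subgroup G :=
    { carrier := {x | x ∈ L ∧ mask L χ x = 1}
      one_mem' := ⟨L.one_mem, hl.2.1⟩
      mul_mem' := fun {a b} ha hb => ⟨L.mul_mem ha.1 hb.1, by
        rw [hl.2.2 a ha.1 b hb.1, ha.2, hb.2, one_mul]⟩
      inv_mem' := fun {a} ha => ⟨L.inv_mem ha.1, by
        have := hl.map_inv ha.1
        rwa [ha.2, mul_one] at this⟩ }
  refine ⟨K, mask L χ, r, fun x hx => ⟨h.le hx, ?_⟩, hr, hl, fun x hx => ?_, ?_, fun x => Iff.rfl⟩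
  · have : mask L χ ((⟨x, h.le hx⟩ : L) : G) = 1 := by
      rw [mask_coe, hχ, hψM _ hx, one_pow]
    exact this
  · have : mask L χ ((⟨x, hx⟩ : L) : G) ^ r = 1 := by
      rw [mask_coe, ← map_pow, hχ, map_pow, ← pow_mul, mul_comm, pow_mul, hordr]
    exact this
  · by_contra hcon
    push Not at hcon
    refine hord fun x => ?_
    have h1 := hcon x x.2
    rwa [mask_coe, hχ] at h1

/-- `L / M` is polycyclic. -/
def Polyc (M L : Subgroup G) : Prop :=
  Nrm M L ∧ ∀ K, M < K → K ≤ L → ∃ K' l r, M ≤ K' ∧ Step K' K l r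

theorem Polyc.mono {M K L : Subgroup G} (h : Polyc M L) (h1 : M ≤ K) (h2 : K ≤ L) : Polyc M K :=
  ⟨h.1.mono h1 h2, fun K' h3 h4 => h.2 K' h3 (h4.trans h2)⟩

theorem Polyc.induct [Finite G] {M : Subgroup G} {P : Subgroup G → Prop} (h0 : P M)
    (hstep : ∀ L K l r, M ≤ K → Polyc M L → Step K L l r → P K → P L) {L : Subgroup G}
    (h : Polyc M L) : P L := by
  induction hn : Nat.card L using Nat.strong_induction_on generalizing L with
  | _ n ih =>
    rcases eq_or_lt_of_le h.1.le with e | hlt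
    · exact e ▸ h0
    · obtain ⟨K, l, r, hMK, hs⟩ := h.2 L hlt le_rfl
      refine hstep L K l r hMK h hs (ih _ ?_ (h.mono hMK hs.le) rfl)
      rw [← hn]
      exact Set.Finite.card_lt_card (Set.toFinite _) hs.lt

/-- `M` is normal in `L` with `L / M` a `p`-group. -/
def PStep (p : ℕ) (M L : Subgroup G) : Prop := Nrm M L ∧ ∀ x ∈ L, ∃ k, x ^ p ^ k ∈ M

/-- `M` is normal in `L` with `L / M` a `p'`-group. -/
def QStep (p : ℕ) (M L : Subgroup G) : Prop := Nrm M L ∧ ∀ x ∈ L, ∃ m, ¬ p ∣ m ∧ x ^ m ∈ M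

/-- `M` is normal in `L` with `L / M` abelian. -/
def AbStep (M L : Subgroup G) : Prop := Nrm M L ∧ ∀ x ∈ L, ∀ y ∈ L, x * y * x⁻¹ * y⁻¹ ∈ M

theorem PStep.mono {p : ℕ} {M K L : Subgroup G} (h : PStep p M L) (h1 : M ≤ K) (h2 : K ≤ L) :
    PStep p M K := ⟨h.1.mono h1 h2, fun x hx => h.2 x (h2 hx)⟩

theorem QStep.mono {p : ℕ} {M K L : Subgroup G} (h : QStep p M L) (h1 : M ≤ K) (h2 : K ≤ L) :
    QStep p M K := ⟨h.1.mono h1 h2, fun x hx => h.2 x (h2 hx)⟩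

theorem PStep.poly [Finite G] {p : ℕ} (hp : p.Prime) {M L : Subgroup G} (h : PStep p M L) :
    Polyc M L := by
  refine ⟨h.1, fun K h1 h2 => exists_step_of_solvable (h.1.mono h1.le h2) h1 fun hN => ?_⟩
  have : IsPGroup p (K ⧸ M.subgroupOf K) := by
    intro q
    obtain ⟨x, rfl⟩ := QuotientGroup.mk_surjective q
    obtain ⟨k, hk⟩ := h.2 x (h2 x.2)
    refine ⟨k, ?_⟩
    rw [← QuotientGroup.mk_pow, QuotientGroup.eq_one_iff, Subgroup.mem_subgroupOf]
    exact hk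
  have : Fact p.Prime := ⟨hp⟩
  have := IsPGroup.isNilpotent ‹IsPGroup p (K ⧸ M.subgroupOf K)›
  infer_instance

theorem AbStep.poly [Finite G] {M L : Subgroup G} (h : AbStep M L) : Polyc M L := by
  refine ⟨h.1, fun K h1 h2 => exists_step_of_solvable (h.1.mono h1.le h2) h1 fun hN => ?_⟩
  refine isSolvable_of_comm fun a b => ?_
  obtain ⟨x, rfl⟩ := QuotientGroup.mk_surjective a
  obtain ⟨y, rfl⟩ := QuotientGroup.mk_surjective b
  rw [← QuotientGroup.mk_mul, ← QuotientGroup.mk_mul, eq_comm, QuotientGroup.eq,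
    Subgroup.mem_subgroupOf]
  have := h.2 _ (K.inv_mem x.2 |> fun h => h2 h) _ (K.inv_mem y.2 |> fun h => h2 h)
  simpa [mul_assoc] using this

end Polyc

section Chain
variable {G : Type} [Group G] [Fintype G] {p : ℕ} {σ : ℂ →+* ℂ}

/-- Coprime degree: restrictions along a polycyclic quotient stay irreducible, and invariance
under a field automorphism fixing all determinants propagates upwards. -/
theorem Polyc.chain {M L : Subgroup G} (h : Polyc M L) {γ : G → ℂ} (hγ : Irr L γ) {n : ℕ}
    (hn : γ 1 = n) (hc : ∀ x ∈ L, ∃ m, m.Coprime n ∧ x ^ m ∈ M) :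
    Irr M (res M γ) ∧ ∀ τ : ℂ →+* ℂ, mp τ (res M γ) = res M γ →
      (∀ K d, M ≤ K → Relation.ReflTransGen Nrm K L → HasDet K (res K γ) d → mp τ d = d) →
      mp τ γ = γ := by
  revert γ
  refine h.induct (P := fun L => (∀ x ∈ L, ∃ m, m.Coprime n ∧ x ^ m ∈ M) → ∀ {γ : G → ℂ},
    Irr L γ → γ 1 = n →
    Irr M (res M γ) ∧ ∀ τ : ℂ →+* ℂ, mp τ (res M γ) = res M γ →
      (∀ K d, M ≤ K → Relation.ReflTransGen Nrm K L → HasDet K (res K γ) d → mp τ d = d) →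
      mp τ γ = γ) ?_ ?_ hc
  · intro _ γ hγ _
    rw [res_eq_self hγ.1]
    exact ⟨hγ, fun _ h _ => h⟩
  · intro L K l r hMK hML hs ih hc γ hγ hn
    have hrn : ¬ r ∣ n := by
      intro hrn
      obtain ⟨x, hx, hl⟩ := hs.nontriv
      obtain ⟨m, hm, hxm⟩ := hc x hx
      have h1 : ¬ r ∣ m := fun h1 => hs.prime.one_lt.ne' (Nat.dvd_one.mp (hm ▸ Nat.dvd_gcd h1 hrn))
      exact hl ((hs.mem x).mp (hs.mem_of_pow hx h1 (hMK hxm))).2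
    obtain ⟨θ, hθ, h0⟩ := hγ.exists_under hs.le
    rcases hs.dichotomy hγ hθ h0 with ⟨h1, hinv⟩ | ⟨-, -, h1, -⟩
    · have hθn : θ 1 = n := by rw [← h1, res_one, hn]
      have hres : res M θ = res M γ := by rw [← h1, res_res hMK]
      obtain ⟨i1, i2⟩ := ih (fun x hx => hc x (hs.le hx)) hθ hθn
      rw [hres] at i1 i2
      refine ⟨i1, fun τ hτ hd => ?_⟩
      have hθτ : mp τ θ = θ := i2 τ hτ fun K' d hK' hsub hdet =>
        hd K' d hK' (hsub.tail hs.nrm) (by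
          have hK'K : K' ≤ K := by
            clear hdet hK'
            induction hsub using Relation.ReflTransGen.head_induction_on with
            | refl => exact le_rfl
            | head hab _ ih => exact hab.le.trans ih
          rwa [← h1, res_res hK'K] at hdet)
      have h2 : ip K (mp τ γ) θ ≠ 0 := by
        rw [← hθτ, ip_mp hθ.chr, ne_eq, map_eq_zero]
        exact h0
      obtain ⟨j, -, hj⟩ := (hs.ext hγ hθ h0 hinv).2.1 _ (hγ.mp τ) h2
      obtain ⟨d, hdet⟩ := hγ.chr.exists_det
      have hdτ := hd L d (hMK.trans hs.le) .refl (by rwa [res_eq_self hγ.1])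
      have h3 := hdet.lpow_eq hdτ (hs.lin.lpow j) hn hj
      have h4 : lpow L l (j * n) = pr L := by
        rw [← h3]
        funext x
        by_cases hx : x ∈ L <;> simp [lpow, hx, pow_mul]
      rw [hs.lpow_inj, hs.prime.dvd_mul] at h4
      rw [hj, hs.lpow_inj.mpr (h4.resolve_right hrn), mul_pr hγ.1]
    · obtain ⟨t, -, ht⟩ := hθ.deg_pos
      rw [hn, ht] at h1
      exact absurd ⟨t, by exact_mod_cast h1⟩ hrn

theorem Sg.fixed_under (hσ : Sg p G σ) {M L : Subgroup G} (h : PStep p M L) {η θ : G → ℂ}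
    (hη : Irr L η) (hησ : mp σ η = η) (hθ : Irr M θ) (h0 : ip M η θ ≠ 0) : mp σ θ = θ := by
  have h1 : ip M η (mp σ θ) ≠ 0 := by
    rw [← hησ, ip_mp hθ.chr, ne_eq, map_eq_zero]
    exact h0
  obtain ⟨y, hy, e⟩ := h.1.conj_const hη hθ (hθ.mp σ) h0 h1
  obtain ⟨k, hk⟩ := h.2 y hy
  exact mp_eq_of_odd hθ.chr.classOn (hσ.sq hθ.chr) e
    (hσ.prime.odd_of_ne_two hσ.odd |>.pow) hk

/-- Over a `σ`-fixed character of a normal subgroup of odd `p`-power index there is exactly one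
`σ`-fixed irreducible character. -/
theorem Sg.exists_unique_over (hσ : Sg p G σ) {M L : Subgroup G} (h : PStep p M L) {θ : G → ℂ}
    (hθ : Irr M θ) (hθσ : mp σ θ = θ) :
    ∃ η, Irr L η ∧ mp σ η = η ∧ ip M η θ = 1 ∧
      ∀ η', Irr L η' → mp σ η' = η' → ip M η' θ ≠ 0 → η' = η := by
  have hpoly := h.poly hσ.prime
  revert h
  refine hpoly.induct (P := fun L => PStep p M L → ∃ η, Irr L η ∧ mp σ η = η ∧ ip M η θ = 1 ∧
      ∀ η', Irr L η' → mp σ η' = η' → ip M η' θ ≠ 0 → η' = η) ?_ ?_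
  · intro _
    refine ⟨θ, hθ, hθσ, hθ.ip_self, fun η' h1 _ h3 => ?_⟩
    by_contra hne
    rw [h1.orth hθ, if_neg hne] at h3
    exact h3 rfl
  · intro L K l r hMK _ hs ih h
    have hrp : r = p := by
      obtain ⟨x, hx, hl⟩ := hs.nontriv
      obtain ⟨k, hk⟩ := h.2 x hx
      by_contra hne
      have : ¬ r ∣ p ^ k := fun hd =>
        hne ((Nat.prime_dvd_prime_iff_eq hs.prime hσ.prime).mp (hs.prime.dvd_of_dvd_pow hd))
      exact hl ((hs.mem x).mp (hs.mem_of_pow hx this (hMK hk))).2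
    subst hrp
    have hKL : PStep r K L := ⟨hs.nrm, fun x hx => (h.2 x hx).imp fun k hk => hMK hk⟩
    obtain ⟨η1, i1, i2, i3, i4⟩ := ih (h.mono hMK hs.le)
    have hover : ∀ η', Irr L η' → mp σ η' = η' → ip M η' θ ≠ 0 → ip K η' η1 ≠ 0 := by
      intro η' h1 h2 h3
      obtain ⟨ψ, k1, k2, k3⟩ := h1.chr.exists_mid hMK hs.le hθ.1 h3
      rwa [i4 ψ k1 (hσ.fixed_under hKL h1 h2 k1 k2) k3] at k2
    obtain ⟨χ, hχ, hχ0⟩ := i1.exists_over hs.le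
    rcases hs.dichotomy hχ i1 hχ0 with ⟨h1, hinv⟩ | ⟨h1, h2, -, h2'⟩
    · obtain ⟨e1, e2, e3⟩ := hs.ext hχ i1 hχ0 hinv
      have hχσ : ip K (mp σ χ) η1 ≠ 0 := by
        rw [← i2, ip_mp i1.chr, ne_eq, map_eq_zero]
        exact hχ0
      obtain ⟨j, -, hj⟩ := e2 _ (hχ.mp σ) hχσ
      have hlσ : ∀ a, mp σ (lpow L l a) * lpow L l a = pr L := fun a =>
        hσ.lin_p (hs.lin.lpow a) fun x hx => ⟨1, by
          simp only [lpow, hx, if_true, pow_one]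
          rw [← pow_mul, mul_comm, pow_mul, hs.pow x hx, one_pow]⟩
      have hmpmul : ∀ f g : G → ℂ, mp σ (f * g) = mp σ f * mp σ g := fun f g => by
        funext x; simp [mp]
      obtain ⟨b, hb⟩ : Odd r := hσ.prime.odd_of_ne_two hσ.odd
      have hsupp : ∀ a, ∀ g, g ∉ L → (χ * lpow L l a) g = 0 := fun a g hg => by
        simp [hχ.1 g hg]
      set η := χ * lpow L l (j * (b + 1)) with hη
      have hηirr : Irr L η := hχ.mul_lin (hs.lin.lpow _)
      have hησ : mp σ η = η := by
        have h5 : mp σ η * lpow L l (j * (b + 1)) = η * lpow L l (j * (b + 1)) := by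
          rw [hη, hmpmul, hj, mul_assoc, hlσ, mul_pr (hsupp j), mul_assoc, ← lpow_add,
            show j * (b + 1) + j * (b + 1) = j + r * j by rw [hb]; ring, lpow_add,
            hs.lpow_inj.mpr (dvd_mul_right r j), ← mul_assoc, mul_pr (hsupp j)]
        funext x
        by_cases hx : x ∈ L
        · have h6 := congrFun h5 x
          exact mul_right_cancel₀ ((hs.lin.lpow _).ne_zero hx) h6
        · simp [mp, hηirr.1 x hx]
      have hηK : ip K η η1 = 1 := by
        have : res K η = η1 := by
          rw [← e1]
          funext x
          by_cases hx : x ∈ K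
          · simp [res, hη, lpow, hx, hs.le hx, ((hs.mem x).mp hx).2]
          · simp [res, hx]
        rw [← ip_res_left K η i1.1, this, i1.ip_self]
      refine ⟨η, hηirr, hησ, ?_, fun η' k1 k2 k3 => ?_⟩
      · obtain ⟨f1, -, -⟩ := hs.ext hηirr i1 (by rw [hηK]; exact one_ne_zero) hinv
        rw [← ip_res_left M η hθ.1, ← res_res hMK, f1, ip_res_left M _ hθ.1, i3]
      · obtain ⟨-, f2, f3⟩ := hs.ext hηirr i1 (by rw [hηK]; exact one_ne_zero) hinv
        obtain ⟨a, -, ha⟩ := f2 η' k1 (hover η' k1 k2 k3)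
        have h5 : η * lpow L l (a + a) = η := by
          have h6 : mp σ η' * lpow L l a = η := by
            rw [ha, hmpmul, hησ, mul_assoc, hlσ, mul_pr hηirr.1]
          rw [lpow_add, ← mul_assoc, ← ha, ← k2, h6]
        have h7 := f3 _ h5
        rw [← two_mul, hs.prime.dvd_mul] at h7
        have h8 : r ∣ a := h7.resolve_left fun h8 =>
          hσ.odd ((Nat.prime_dvd_prime_iff_eq hσ.prime Nat.prime_two).mp h8)
        rw [ha, hs.lpow_inj.mpr h8, mul_pr hηirr.1]
    · have hχσ : mp σ χ = χ := by rw [← h2, mp_ind, i2]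
      refine ⟨χ, hχ, hχσ, ?_, fun η' k1 k2 k3 => ?_⟩
      · rw [hχ.chr.ip_mid hMK hs.le hθ.1, Finset.sum_eq_single η1, h2', i3, one_mul]
        · intro ψ hψ hne
          by_contra h5
          have k1 := mem_IrrF.mp hψ
          refine hne (i4 ψ k1 ?_ (right_ne_zero_of_mul h5))
          exact hσ.fixed_under hKL hχ hχσ k1 (left_ne_zero_of_mul h5)
        · intro h5
          exact absurd (mem_IrrF.mpr i1) h5
      · have k4 := hover η' k1 k2 k3
        rcases hs.dichotomy k1 i1 k4 with ⟨-, k5⟩ | ⟨-, k5, -, -⟩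
        · exfalso
          have : stab L η1 = L := le_antisymm (stab_le _ _) fun x hx => ⟨hx, k5 x hx⟩
          exact hs.lt.ne (h1.symm.trans this)
        · rw [← k5, h2]

end Chain

section Rest
variable {G : Type} [Group G] [Fintype G]

theorem card_mul_relIndex {M T : Subgroup G} (h : M ≤ T) :
    Nat.card M * M.relIndex T = Nat.card T := by
  have := Subgroup.relIndex_mul_relIndex ⊥ M T bot_le h
  rwa [Subgroup.relIndex_bot_left, Subgroup.relIndex_bot_left] at this

/-- Every element of `T` is a product of an element of `M` and one of `J`. -/
def Factors (T M J : Subgroup G) : Prop := ∀ t ∈ T, ∃ m ∈ M, ∃ j ∈ J, t = m * j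

theorem Nrm.card_mul {T M J : Subgroup G} (hM : Nrm M T) (hJ : J ≤ T) (hT : Factors T M J) :
    Nat.card T * Nat.card (J ⊓ M : Subgroup G) = Nat.card M * Nat.card J := by
  have e : T = M ⊔ J := le_antisymm (fun t ht => by
    obtain ⟨m, hm, j, hj, rfl⟩ := hT t ht
    exact Subgroup.mul_mem_sup hm hj) (sup_le hM.le hJ)
  have := hM.normal
  have h1 : (M.subgroupOf T).relIndex (J.subgroupOf T ⊔ M.subgroupOf T)
      = (M.subgroupOf T).relIndex (J.subgroupOf T) := Subgroup.relIndex_sup_right _ _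
  have h2 : J.subgroupOf T ⊔ M.subgroupOf T = ⊤ := by
    rw [← Subgroup.subgroupOf_sup hJ hM.le, sup_comm, ← e, Subgroup.subgroupOf_self]
  rw [h2, Subgroup.relIndex_top_right, Subgroup.relIndex_subgroupOf hJ] at h1
  have h3 : Nat.card M * M.relIndex T = Nat.card T := card_mul_relIndex hM.le
  have h4 : Nat.card (J ⊓ M : Subgroup G) * M.relIndex J = Nat.card J := by
    rw [← Subgroup.inf_relIndex_left]
    exact card_mul_relIndex inf_le_left
  have h5 : M.relIndex T = M.relIndex J := h1
  rw [← h3, ← h4, h5]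
  ring

theorem ip_comm_nat {H : Subgroup G} {f h : G → ℂ} {n : ℕ} (e : ip H f h = n) :
    ip H h f = n := by
  rw [← ip_conj, e, Complex.conj_natCast]

variable {T M J : Subgroup G} {θ κ : G → ℂ}

theorem Nrm.ind_inv (hM : Nrm M T) (h0 : ∀ g, g ∉ M → θ g = 0) (hinv : ∀ x ∈ T, cj x θ = θ) :
    ind M T θ = ((Nat.card T : ℂ) / Nat.card M) • θ := by
  ext g
  have : ∀ x, (if x ∈ T then θ (x * g * x⁻¹) else 0) = if x ∈ T then θ g else 0 := by
    intro x
    split_ifs with hx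
    · have := congrFun (hinv x⁻¹ (T.inv_mem hx)) g
      simpa [cj] using this
    · rfl
  have h2 : (∑ x : G, if x ∈ T then θ g else 0) = Nat.card T * θ g := by
    have := sum_subgroup T (fun _ => θ g)
    rw [← this]
    simp
  simp only [ind, Pi.smul_apply, smul_eq_mul]
  rw [Finset.sum_congr rfl fun x _ => this x, h2]
  ring

/-- The two matrix identities relating restriction from `T = MJ` to `J`. -/
theorem Nrm.rest_sums (hM : Nrm M T) (hJ : J ≤ T) (hT : Factors T M J) (hθ : Irr M θ)
    (hθi : ∀ x ∈ T, cj x θ = θ) (hκ : Irr (J ⊓ M) κ) (hκi : ∀ x ∈ J, cj x κ = κ)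
    (h1 : ip (J ⊓ M) θ κ = 1) :
    (∀ η, Irr T η → ip M η θ ≠ 0 →
      ∑ K ∈ IrrF J, ip J η K * ip (J ⊓ M) K κ = ip M η θ) ∧
    (∀ K, Irr J K → ip (J ⊓ M) K κ ≠ 0 →
      ∑ η ∈ IrrF T, ip M η θ * ip J η K = ip (J ⊓ M) K κ) := by
  have hN : Nrm (J ⊓ M) J := ⟨inf_le_left, fun x hx m hm =>
    ⟨J.mul_mem (J.mul_mem hx hm.1) (J.inv_mem hx), hM.2 x (hJ hx) m hm.2⟩⟩
  constructor
  · intro η hη h0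
    rw [← hη.chr.ip_mid inf_le_left hJ hκ.1]
    have e : ip (J ⊓ M) η κ = ip M η θ * ip (J ⊓ M) θ κ := by
      rw [← ip_smul_left, ← ip_res_left _ η hκ.1, ← ip_res_left _ (_ • θ) hκ.1]
      congr 1
      refine ext_on (res_supp _ _) (res_supp _ _) fun g hg => ?_
      rw [res_of_mem hg, res_of_mem hg, hM.res_of_inv hη hθ h0 hθi hg.2]
      rfl
    rw [e, h1, mul_one]
  · intro K hK h0
    have e1 : ip J (ind M T θ) K = ∑ η ∈ IrrF T, ip M η θ * ip J η K := by
      have hc := (hθ.chr.ind hM.le).classOn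
      conv_lhs => rw [hc.expand, ip_sum_left]
      refine Finset.sum_congr rfl fun η hη => ?_
      rw [mem_IrrF] at hη
      rw [ip_smul_left, ip_ind_left θ hη.chr.classOn]
      obtain ⟨n, hn⟩ := hη.chr.ip_nat' hM.le hθ.chr
      rw [hn, ip_comm_nat hn]
    rw [← e1, hM.ind_inv hθ.1 hθi, ip_smul_left]
    have e2 : ip J θ K = Nat.card (J ⊓ M : Subgroup G) / Nat.card J * ip (J ⊓ M) θ K := by
      have := card_ne_zero' (J ⊓ M)
      simp only [ip]
      rw [div_eq_inv_mul, mul_assoc, mul_inv_cancel_left₀ this]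
    have e3 : ip (J ⊓ M) θ K = ip (J ⊓ M) K κ := by
      obtain ⟨n, hn⟩ := hK.chr.ip_nat' hN.le hκ.chr
      have : ip (J ⊓ M) θ K = ip (J ⊓ M) θ ((n : ℂ) • κ) := by
        simp only [ip]
        congr 1
        refine Finset.sum_congr rfl fun g _ => ?_
        by_cases hgM : g ∈ M
        · by_cases hgJ : g ∈ J
          · have := hN.res_of_inv hK hκ h0 hκi (m := g) ⟨hgJ, hgM⟩
            rw [this, hn]
            rfl
          · rw [hK.1 g hgJ, Pi.smul_apply, hκ.1 g fun h => hgJ h.1, smul_zero]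
        · rw [hθ.1 g hgM, zero_mul, zero_mul]
      rw [this, ip_smul_right, h1, hn]
      simp
    rw [e2, e3]
    have hc : (Nat.card T : ℂ) * Nat.card (J ⊓ M : Subgroup G) = Nat.card M * Nat.card J := by
      exact_mod_cast hM.card_mul hJ hT
    have := card_ne_zero' M
    have := card_ne_zero' J
    field_simp
    linear_combination hc

/-- Nonnegative integer matrices with `m f = e` and `mᵀ e = f` are permutation matrices. -/
theorem Nrm.rest (hM : Nrm M T) (hJ : J ≤ T) (hT : Factors T M J) (hθ : Irr M θ)
    (hθi : ∀ x ∈ T, cj x θ = θ) (hκ : Irr (J ⊓ M) κ) (hκi : ∀ x ∈ J, cj x κ = κ)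
    (h1 : ip (J ⊓ M) θ κ = 1) :
    (∀ η, Irr T η → ip M η θ ≠ 0 → ∃ K, Irr J K ∧ ip (J ⊓ M) K κ = ip M η θ ∧
      (∀ η', Irr T η' → ip M η' θ ≠ 0 → ip J η' K = if η' = η then 1 else 0) ∧
      ∀ K', Irr J K' → ip (J ⊓ M) K' κ ≠ 0 → ip J η K' = if K' = K then 1 else 0) ∧
    (∀ K, Irr J K → ip (J ⊓ M) K κ ≠ 0 → ∃ η, Irr T η ∧ ip M η θ = ip (J ⊓ M) K κ ∧
      (∀ η', Irr T η' → ip M η' θ ≠ 0 → ip J η' K = if η' = η then 1 else 0) ∧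
      ∀ K', Irr J K' → ip (J ⊓ M) K' κ ≠ 0 → ip J η K' = if K' = K then 1 else 0) := by
  obtain ⟨s1, s2⟩ := hM.rest_sums hJ hT hθ hθi hκ hκi h1
  have hm : ∀ η K, ∃ n : ℕ, Irr T η → Irr J K → ip J η K = n := fun η K => by
    by_cases h : Irr T η ∧ Irr J K
    · obtain ⟨n, hn⟩ := h.1.chr.ip_nat' hJ h.2.chr
      exact ⟨n, fun _ _ => hn⟩
    · exact ⟨0, fun a b => absurd ⟨a, b⟩ h⟩
  choose m hm using hm
  have he : ∀ η, ∃ n : ℕ, Irr T η → ip M η θ = n := fun η => by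
    by_cases h : Irr T η
    · obtain ⟨n, hn⟩ := h.chr.ip_nat' hM.le hθ.chr
      exact ⟨n, fun _ => hn⟩
    · exact ⟨0, fun a => absurd a h⟩
  choose e he using he
  have hf : ∀ K, ∃ n : ℕ, Irr J K → ip (J ⊓ M) K κ = n := fun K => by
    by_cases h : Irr J K
    · obtain ⟨n, hn⟩ := h.chr.ip_nat' inf_le_left hκ.chr
      exact ⟨n, fun _ => hn⟩
    · exact ⟨0, fun a => absurd a h⟩
  choose f hf using hf
  have t1 : ∀ η, Irr T η → ip M η θ ≠ 0 → ∑ K ∈ IrrF J, m η K * f K = e η := by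
    intro η hη h0
    have := s1 η hη h0
    rw [he η hη, Finset.sum_congr rfl fun K hK => by
      rw [hm η K hη (mem_IrrF.mp hK), hf K (mem_IrrF.mp hK)]] at this
    exact_mod_cast this
  have t2 : ∀ K, Irr J K → ip (J ⊓ M) K κ ≠ 0 → ∑ η ∈ IrrF T, e η * m η K = f K := by
    intro K hK h0
    have := s2 K hK h0
    rw [hf K hK, Finset.sum_congr rfl fun η hη => by
      rw [hm η K (mem_IrrF.mp hη) hK, he η (mem_IrrF.mp hη)]] at this
    exact_mod_cast this
  have key : ∀ η K, Irr T η → ip M η θ ≠ 0 → Irr J K → ip (J ⊓ M) K κ ≠ 0 → m η K ≠ 0 →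
      ip (J ⊓ M) K κ = ip M η θ ∧
      (∀ η', Irr T η' → ip M η' θ ≠ 0 → ip J η' K = if η' = η then 1 else 0) ∧
      ∀ K', Irr J K' → ip (J ⊓ M) K' κ ≠ 0 → ip J η K' = if K' = K then 1 else 0 := by
    intro η K hη h0 hK k0 hmn
    have e0 : e η ≠ 0 := fun h => h0 (by rw [he η hη, h, Nat.cast_zero])
    have f0 : f K ≠ 0 := fun h => k0 (by rw [hf K hK, h, Nat.cast_zero])
    have a1 : m η K * f K ≤ e η := by
      rw [← t1 η hη h0]
      exact Finset.single_le_sum (f := fun K => m η K * f K) (fun _ _ => Nat.zero_le _)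
        (mem_IrrF.mpr hK)
    have a2 : e η * m η K ≤ f K := by
      rw [← t2 K hK k0]
      exact Finset.single_le_sum (f := fun η => e η * m η K) (fun _ _ => Nat.zero_le _)
        (mem_IrrF.mpr hη)
    have mpos := Nat.pos_of_ne_zero hmn
    have ef : e η = f K := le_antisymm ((Nat.le_mul_of_pos_right _ mpos).trans a2)
      ((Nat.le_mul_of_pos_left _ mpos).trans a1)
    have m1 : m η K = 1 := by
      rw [ef] at a1
      exact le_antisymm (Nat.le_of_mul_le_mul_right (by simpa using a1) (Nat.pos_of_ne_zero f0))
        mpos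
    refine ⟨by rw [hf K hK, he η hη, ef], fun η' hη' h0' => ?_, fun K' hK' k0' => ?_⟩
    · split_ifs with h
      · rw [h, hm η K hη hK, m1, Nat.cast_one]
      · have := t2 K hK k0
        rw [← Finset.sum_erase_add _ _ (mem_IrrF.mpr hη), m1, mul_one, ef] at this
        have hz : ∑ η ∈ (IrrF T).erase η, e η * m η K = 0 := by omega
        rw [Finset.sum_eq_zero_iff] at hz
        have hz' := hz η' (Finset.mem_erase.mpr ⟨h, mem_IrrF.mpr hη'⟩)
        have e0' : e η' ≠ 0 := fun h => h0' (by rw [he η' hη', h, Nat.cast_zero])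
        rw [hm η' K hη' hK, (Nat.mul_eq_zero.mp hz').resolve_left e0', Nat.cast_zero]
    · split_ifs with h
      · rw [h, hm η K hη hK, m1, Nat.cast_one]
      · have := t1 η hη h0
        rw [← Finset.sum_erase_add _ _ (mem_IrrF.mpr hK), m1, one_mul, ef] at this
        have hz : ∑ K ∈ (IrrF J).erase K, m η K * f K = 0 := by omega
        rw [Finset.sum_eq_zero_iff] at hz
        have hz' := hz K' (Finset.mem_erase.mpr ⟨h, mem_IrrF.mpr hK'⟩)
        have f0' : f K' ≠ 0 := fun h => k0' (by rw [hf K' hK', h, Nat.cast_zero])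
        rw [hm η K' hη hK', (Nat.mul_eq_zero.mp hz').resolve_right f0', Nat.cast_zero]
  constructor
  · intro η hη h0
    have e0 : ∑ K ∈ IrrF J, m η K * f K ≠ 0 := by
      rw [t1 η hη h0]
      exact fun h => h0 (by rw [he η hη, h, Nat.cast_zero])
    obtain ⟨K, hK, hne⟩ := Finset.exists_ne_zero_of_sum_ne_zero e0
    rw [mem_IrrF] at hK
    refine ⟨K, hK, key η K hη h0 hK ?_ (Nat.mul_ne_zero_iff.mp hne).1⟩
    rw [hf K hK]
    exact_mod_cast (Nat.mul_ne_zero_iff.mp hne).2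
  · intro K hK k0
    have f0 : ∑ η ∈ IrrF T, e η * m η K ≠ 0 := by
      rw [t2 K hK k0]
      exact fun h => k0 (by rw [hf K hK, h, Nat.cast_zero])
    obtain ⟨η, hη, hne⟩ := Finset.exists_ne_zero_of_sum_ne_zero f0
    rw [mem_IrrF] at hη
    have h0 : ip M η θ ≠ 0 := by
      rw [he η hη]
      exact_mod_cast (Nat.mul_ne_zero_iff.mp hne).1
    have := key η K hη h0 hK k0 (Nat.mul_ne_zero_iff.mp hne).2
    exact ⟨η, hη, this.1.symm, this.2⟩
end Rest

section Series
variable {G : Type} [Group G]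

/-- `M` is normal in `L`, and every element of `L` has a power with exponent in `E` lying in `M`. -/
def EStep (E : Set ℕ) (M L : Subgroup G) : Prop := Nrm M L ∧ ∀ x ∈ L, ∃ m ∈ E, x ^ m ∈ M

theorem EStep.exists_max [Finite G] {E : Set ℕ} (hE : ∀ a ∈ E, ∀ b ∈ E, a * b ∈ E)
    (M H : Subgroup G) (hM : ∃ W, Nrm W H ∧ EStep E M W) :
    ∃ W, Nrm W H ∧ EStep E M W ∧ ∀ W', Nrm W' H → EStep E M W' → W' ≤ W := by
  obtain ⟨W, ⟨hW, hW2⟩, hmax⟩ := Set.Finite.exists_maximal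
    (Set.toFinite {W : Subgroup G | Nrm W H ∧ EStep E M W}) hM
  refine ⟨W, hW, hW2, fun W' hW' hW2' => ?_⟩
  have hn : ∀ x ∈ W ⊔ W', ∃ a ∈ W, ∃ b ∈ W', a * b = x := by
    intro x hx
    have := hW.normal
    have hx' : x ∈ ((W ⊔ W' : Subgroup G)) := hx
    refine Subgroup.closure_induction (p := fun x _ => ∃ a ∈ W, ∃ b ∈ W', a * b = x)
      (k := (W : Set G) ∪ W') ?_ ⟨1, W.one_mem, 1, W'.one_mem, one_mul 1⟩ ?_ ?_
      (by rwa [Subgroup.closure_union, Subgroup.closure_eq, Subgroup.closure_eq])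
    · rintro x (h | h)
      · exact ⟨x, h, 1, W'.one_mem, mul_one x⟩
      · exact ⟨1, W.one_mem, x, h, one_mul x⟩
    · rintro _ _ _ _ ⟨a, ha, b, hb, rfl⟩ ⟨c, hc, d, hd, rfl⟩
      exact ⟨a * (b * c * b⁻¹), W.mul_mem ha (hW.2 b (hW'.le hb) c hc), b * d, W'.mul_mem hb hd,
        by group⟩
    · rintro _ _ ⟨a, ha, b, hb, rfl⟩
      refine ⟨b⁻¹ * a⁻¹ * b, ?_, b⁻¹, W'.inv_mem hb, by group⟩
      have := hW.2 b⁻¹ (H.inv_mem (hW'.le hb)) a⁻¹ (W.inv_mem ha)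
      rwa [inv_inv] at this
  have h1 : Nrm (W ⊔ W') H := ⟨sup_le hW.le hW'.le, fun x hx m hm => by
    obtain ⟨a, ha, b, hb, rfl⟩ := hn m hm
    have : x * (a * b) * x⁻¹ = (x * a * x⁻¹) * (x * b * x⁻¹) := by group
    rw [this]
    exact Subgroup.mul_mem_sup (hW.2 x hx a ha) (hW'.2 x hx b hb)⟩
  have h2 : EStep E M (W ⊔ W') := by
    refine ⟨⟨hW2.1.le.trans le_sup_left, fun x hx m hm => ?_⟩, fun x hx => ?_⟩
    · obtain ⟨a, ha, b, hb, rfl⟩ := hn x hx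
      have : a * b * m * (a * b)⁻¹ = a * (b * m * b⁻¹) * a⁻¹ := by group
      rw [this]
      exact hW2.1.2 a ha _ (hW2'.1.2 b hb m hm)
    · obtain ⟨a, ha, b, hb, rfl⟩ := hn x hx
      obtain ⟨k, hk, hbk⟩ := hW2'.2 b hb
      have hpow : ∀ n : ℕ, ∃ c ∈ W, (a * b) ^ n = c * b ^ n := by
        intro n
        induction n with
        | zero => exact ⟨1, W.one_mem, by simp⟩
        | succ n ih =>
          obtain ⟨c, hc, e⟩ := ih
          refine ⟨c * (b ^ n * a * (b ^ n)⁻¹), W.mul_mem hc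
            (hW.2 _ (H.pow_mem (hW'.le hb) n) a ha), ?_⟩
          rw [pow_succ, e, pow_succ]
          group
      obtain ⟨c, hc, e⟩ := hpow k
      have hxW : (a * b) ^ k ∈ W := by
        rw [e]
        exact W.mul_mem hc (hW2.1.le hbk)
      obtain ⟨l, hl, hx2⟩ := hW2.2 _ hxW
      exact ⟨k * l, hE k hk l hl, by rwa [pow_mul]⟩
  exact le_sup_right.trans (hmax ⟨h1, h2⟩ le_sup_left)

/-- `N` is a series of normal subgroups from `⊥` with all steps `p`- or `p'`-steps, which is
constantly `M` from `n` on. -/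
structure NSeries (p n : ℕ) (N : ℕ → Subgroup G) (M : Subgroup G) : Prop where
  zero : N 0 = ⊥
  normal : ∀ i, (N i).Normal
  step : ∀ i, PStep p (N i) (N (i + 1)) ∨ QStep p (N i) (N (i + 1))
  last : ∀ i, n ≤ i → N i = M

theorem NSeries.snoc {p n : ℕ} {N : ℕ → Subgroup G} {M L : Subgroup G} (h : NSeries p n N M)
    (hL : L.Normal) (hs : PStep p M L ∨ QStep p M L) :
    NSeries p (n + 1) (fun i => if i ≤ n then N i else L) L where
  zero := by simp [h.zero]
  normal i := by
    split_ifs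
    · exact h.normal i
    · exact hL
  step i := by
    rcases lt_trichotomy i n with hi | rfl | hi
    · have h1 : i ≤ n := hi.le
      have h2 : i + 1 ≤ n := hi
      simpa [h1, h2] using h.step i
    · simpa [h.last i le_rfl] using hs
    · have h1 : ¬ i ≤ n := by omega
      have h2 : ¬ i + 1 ≤ n := by omega
      simp only [h1, h2, if_false]
      exact .inl ⟨Nrm.refl L, fun x hx => ⟨0, by simpa using hx⟩⟩
  last i hi := if_neg (by omega)

theorem cjS_nrm {M H K : Subgroup G} (h : Nrm M H) (x : G) (hK : cjS x H = K) :
    Nrm (cjS x M) K := by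
  subst hK
  refine ⟨cjS_mono h.le, fun y hy m hm => ?_⟩
  rw [mem_cjS] at *
  have := h.2 _ hy _ hm
  have e : x⁻¹ * (y * m * y⁻¹) * x = x⁻¹ * y * x * (x⁻¹ * m * x) * (x⁻¹ * y * x)⁻¹ := by group
  rwa [e]

theorem EStep.lift [Finite G] {E : Set ℕ} (hE : ∀ a ∈ E, ∀ b ∈ E, a * b ∈ E)
    {M H K W : Subgroup G} (hMn : M.Normal) (hHK : Nrm H K) (hW : Nrm W H) (hW2 : EStep E M W)
    (hlt : M < W) : ∃ W', Nrm W' K ∧ EStep E M W' ∧ M < W' := by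
  obtain ⟨V, h1, h2, h3⟩ := EStep.exists_max hE M H ⟨W, hW, hW2⟩
  refine ⟨V, ⟨h1.le.trans hHK.le, fun x hx m hm => ?_⟩, h2, hlt.trans_le (h3 W hW hW2)⟩
  have e1 : cjS x M = M := by
    ext g
    rw [mem_cjS]
    have := hMn.mem_comm_iff (a := x⁻¹ * g) (b := x)
    rw [this]
    simp
  refine h3 (cjS x V) (cjS_nrm h1 x (hHK.cjS hx)) ⟨?_, fun y hy => ?_⟩ ?_
  · have := cjS_nrm h2.1 x rfl
    rwa [e1] at this
  · rw [mem_cjS] at hy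
    obtain ⟨k, hk, hyk⟩ := h2.2 _ hy
    refine ⟨k, hk, ?_⟩
    have : (x⁻¹ * y * x) ^ k = x⁻¹ * y ^ k * x := by
      have := conj_pow (i := k) (a := x⁻¹) (b := y)
      simpa using this
    rw [this] at hyk
    rw [← e1, mem_cjS]
    exact hyk
  · rw [mem_cjS]
    simpa [mul_assoc] using hm

theorem exists_pow_mem_of_card {M L : Subgroup G} (hn : (M.subgroupOf L).Normal) {x : G}
    (hx : x ∈ L) : x ^ Nat.card (L ⧸ M.subgroupOf L) ∈ M := by
  have : (QuotientGroup.mk (⟨x, hx⟩ : L) : L ⧸ M.subgroupOf L)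
      ^ Nat.card (L ⧸ M.subgroupOf L) = 1 := pow_card_eq_one'
  rw [← QuotientGroup.mk_pow, QuotientGroup.eq_one_iff, Subgroup.mem_subgroupOf] at this
  exact this

theorem exists_nseries [Finite G] {p : ℕ} (hp : p.Prime) (hG : IsPSolvable p G) :
    ∃ n N, NSeries p n N (⊤ : Subgroup G) := by
  obtain ⟨k, c, hc0, hck, hc⟩ := hG
  have hbot : ∃ n N, NSeries p n N (⊥ : Subgroup G) :=
    ⟨0, fun _ => ⊥, rfl, fun _ => inferInstance,
      fun _ => .inl ⟨Nrm.refl _, fun x hx => ⟨0, by simpa using hx⟩⟩, fun _ _ => rfl⟩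
  obtain ⟨M, ⟨hMn, n, N, hN⟩, hmax⟩ := Set.Finite.exists_maximal
    (Set.toFinite {M : Subgroup G | M.Normal ∧ ∃ n N, NSeries p n N M})
    ⟨⊥, inferInstance, hbot⟩
  have hfin : ∀ E : Set ℕ, (∀ a ∈ E, ∀ b ∈ E, a * b ∈ E) →
      (∀ L, EStep E M L → PStep p M L ∨ QStep p M L) → ∀ i : Fin (k + 1),
      (∃ W, Nrm W (c i ⊔ M) ∧ EStep E M W ∧ M < W) → False := by
    intro E hE hPQ i hi
    have hup : ∀ j : Fin (k + 1), i ≤ j → ∃ W, Nrm W (c j ⊔ M) ∧ EStep E M W ∧ M < W := by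
      intro j
      induction j using Fin.induction with
      | zero =>
        intro h
        rwa [le_antisymm (Fin.zero_le i) h] 
      | succ j ih =>
        intro h
        rcases eq_or_lt_of_le h with e | hlt
        · rwa [← e]
        · obtain ⟨W, h1, h2, h3⟩ := ih (by
            rw [Fin.le_def]; rw [Fin.lt_def] at hlt; simp at hlt ⊢; omega)
          refine EStep.lift hE hMn ⟨sup_le_sup_right (hc j).1 M, fun x hx m hm => ?_⟩ h1 h2 h3
          have hnn := (hc j).2.1
          rw [Subgroup.mem_sup_of_normal_right] at hx hm ⊢
          obtain ⟨a, ha, b, hb, rfl⟩ := hx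
          obtain ⟨d, hd, e, he, rfl⟩ := hm
          refine ⟨a * d * a⁻¹, ?_, (a * d⁻¹ * a⁻¹) * (a * b * (d * e) * (a * b)⁻¹), ?_, by group⟩
          · exact hnn.conj_mem ⟨d, (hc j).1 hd⟩ hd ⟨a, ha⟩
          · have : (a * d⁻¹ * a⁻¹) * (a * b * (d * e) * (a * b)⁻¹)
                = a * (d⁻¹ * b * d * e * b⁻¹) * a⁻¹ := by group
            rw [this]
            refine hMn.conj_mem _ (M.mul_mem (M.mul_mem ?_ he) (M.inv_mem hb)) a
            simpa using hMn.conj_mem b hb d⁻¹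
    obtain ⟨W, h1, h2, h3⟩ := hup (Fin.last k) (Fin.le_last i)
    rw [hck, top_sup_eq] at h1
    have hWn : W.Normal := ⟨fun m hm x => h1.2 x trivial m hm⟩
    exact absurd (hmax ⟨hWn, _, _, hN.snoc hWn (hPQ W h2)⟩ h3.le) h3.not_ge
  have hall : ∀ i : Fin (k + 1), c i ≤ M := by
    intro i
    induction i using Fin.induction with
    | zero => rw [hc0]; exact bot_le
    | succ j ih =>
      by_contra hne
      have hlt : M < c j.succ ⊔ M := lt_of_le_of_ne le_sup_right fun e => hne (e ▸ le_sup_left)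
      have hstep : ∀ x ∈ c j.succ ⊔ M, x ^ Nat.card (c j.succ ⧸ (c j.castSucc).subgroupOf
          (c j.succ)) ∈ M := by
        intro x hx
        rw [Subgroup.mem_sup_of_normal_right] at hx
        obtain ⟨a, ha, b, hb, rfl⟩ := hx
        have h1 := ih (exists_pow_mem_of_card (hc j).2.1 ha)
        have : (QuotientGroup.mk (a * b) : G ⧸ M) = QuotientGroup.mk a := by
          rw [QuotientGroup.mk_mul_of_mem _ hb]
        rw [← QuotientGroup.eq_one_iff, QuotientGroup.mk_pow] at h1 ⊢
        rw [this, h1]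
      have hnrm : Nrm M (c j.succ ⊔ M) := ⟨le_sup_right, fun x _ m hm => hMn.conj_mem m hm x⟩
      rcases (hc j).2.2 with h | h
      · refine hfin {m | ∃ a, m = p ^ a} ?_ (fun L hL => .inl ⟨hL.1, fun x hx => ?_⟩) j.succ
          ⟨_, Nrm.refl _, ⟨hnrm, fun x hx => ⟨_, ?_, hstep x hx⟩⟩, hlt⟩
        · rintro _ ⟨a, rfl⟩ _ ⟨b, rfl⟩
          exact ⟨a + b, (pow_add p a b).symm⟩
        · obtain ⟨_, ⟨a, rfl⟩, ha⟩ := hL.2 x hx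
          exact ⟨a, ha⟩
        · refine ⟨_, Nat.eq_prime_pow_of_unique_prime_dvd Nat.card_pos.ne' fun {q} hq hd => ?_⟩
          exact h q hq hd
      · refine hfin {m | ¬ p ∣ m} ?_ (fun L hL => .inr ⟨hL.1, hL.2⟩) j.succ
          ⟨_, Nrm.refl _, ⟨hnrm, fun x hx => ⟨_, ?_, hstep x hx⟩⟩, hlt⟩
        · intro a ha b hb hab
          exact (hp.dvd_mul.mp hab).elim ha hb
        · exact fun hd => h p hp hd rfl
  have : M = ⊤ := top_le_iff.mp (hck ▸ hall (Fin.last k))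
  exact ⟨n, N, this ▸ hN⟩
end Series

section Complement
variable {Γ : Type} [Group Γ] [Finite Γ]

/-- The averaging argument for conjugating complements of an abelian normal subgroup. -/
theorem conj_le_of_comm {N K₁ K₂ : Subgroup Γ} (hab : ∀ a ∈ N, ∀ b ∈ N, a * b = b * a)
    (hN : ∀ k ∈ K₁, ∀ a ∈ N, k * a * k⁻¹ ∈ N) (hco : (Nat.card K₁).Coprime (Nat.card N))
    (h12 : ∀ k ∈ K₁, ∃ a ∈ N, a * k ∈ K₂) (hK : ∀ a ∈ N, a ∈ K₂ → a = 1) :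
    ∃ c ∈ N, ∀ k ∈ K₁, c * k * c⁻¹ ∈ K₂ := by
  letI : CommGroup N := { (inferInstance : Group N) with
    mul_comm := fun a b => Subtype.ext (hab a a.2 b b.2) }
  have := Fintype.ofFinite K₁
  have hf : ∀ k : K₁, ∃ a : N, (a : Γ) * k ∈ K₂ := fun k => by
    obtain ⟨a, ha, h⟩ := h12 k k.2
    exact ⟨⟨a, ha⟩, h⟩
  choose f hf using hf
  let φ : K₁ → (N →* N) := fun k =>
    { toFun := fun a => ⟨k * a * (k : Γ)⁻¹, hN k k.2 a a.2⟩
      map_one' := Subtype.ext (by simp)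
      map_mul' := fun a b => Subtype.ext (by simp) }
  have hφ : ∀ k a, ((φ k a : N) : Γ) = k * a * (k : Γ)⁻¹ := fun _ _ => rfl
  have hcoc : ∀ k l, f (k * l) = f k * φ k (f l) := by
    intro k l
    have h1 : (f k : Γ) * φ k (f l) * (k * l : K₁) ∈ K₂ := by
      have := K₂.mul_mem (hf k) (hf l)
      convert this using 1
      rw [hφ]
      push_cast
      group
    have h2 := K₂.mul_mem (hf (k * l)) (K₂.inv_mem h1)
    have h3 : ((f (k * l) * (f k * φ k (f l))⁻¹ : N) : Γ) ∈ K₂ := by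
      convert h2 using 1
      push_cast
      group
    have := hK _ (f (k * l) * (f k * φ k (f l))⁻¹ : N).2 h3
    rw [← mul_inv_eq_one]
    exact Subtype.ext this
  set n := Nat.card K₁ with hn
  have hF : ∀ k, ∏ l, f l = f k ^ n * φ k (∏ l, f l) := by
    intro k
    rw [map_prod, hn, Nat.card_eq_fintype_card, ← Finset.card_univ, ← Finset.prod_const,
      ← Finset.prod_mul_distrib]
    rw [← Equiv.prod_comp (Equiv.mulLeft k)]
    exact Finset.prod_congr rfl fun l _ => hcoc k l
  obtain ⟨c, hc⟩ := (powCoprime hco.symm).surjective (∏ l, f l)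
  rw [powCoprime_apply] at hc
  refine ⟨c, c.2, fun k hk => ?_⟩
  have h1 : c = f ⟨k, hk⟩ * φ ⟨k, hk⟩ c := by
    apply (powCoprime hco.symm).injective
    rw [powCoprime_apply, powCoprime_apply, mul_pow, ← map_pow, hc]
    exact hF ⟨k, hk⟩
  have h2 := hf ⟨k, hk⟩
  have h3 : (c : Γ) = f ⟨k, hk⟩ * (k * c * k⁻¹) := congrArg Subtype.val h1
  have h4 : (f ⟨k, hk⟩ : Γ) = c * (k * (c : Γ)⁻¹ * k⁻¹) := by
    rw [eq_mul_inv_of_mul_eq h3.symm]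
    group
  rw [h4] at h2
  simpa [mul_assoc] using h2

/-- `p'`-subgroups congruent modulo a normal `p`-subgroup are conjugate under it. -/
theorem conj_le_of_isPGroup {p : ℕ} (hp : p.Prime) {N K₁ K₂ : Subgroup Γ} (hn : N.Normal)
    (hN : IsPGroup p N) (h1 : ¬ p ∣ Nat.card K₁) (h2 : ¬ p ∣ Nat.card K₂)
    (h12 : ∀ k ∈ K₁, ∃ a ∈ N, a * k ∈ K₂) :
    ∃ c ∈ N, ∀ k ∈ K₁, c * k * c⁻¹ ∈ K₂ := by
  induction hm : Nat.card Γ using Nat.strong_induction_on generalizing Γ with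
  | _ m ih =>
    have : Fact p.Prime := ⟨hp⟩
    have hdisj : ∀ {A K : Subgroup Γ}, IsPGroup p A → ¬ p ∣ Nat.card K → ∀ a ∈ A, a ∈ K →
        a = 1 := by
      intro A K hA hK a ha hak
      obtain ⟨k, hk⟩ := hA ⟨a, ha⟩
      have hk' : a ^ p ^ k = 1 := congrArg Subtype.val hk
      have hd : orderOf a ∣ Nat.card K := Subgroup.orderOf_dvd_natCard K hak
      have hd2 : orderOf a ∣ p ^ k := orderOf_dvd_of_pow_eq_one hk'
      have hco : (Nat.card K).Coprime (p ^ k) :=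
        (Nat.Coprime.pow_right k ((hp.coprime_iff_not_dvd.mpr hK).symm))
      rw [← orderOf_eq_one_iff]
      exact Nat.eq_one_of_dvd_coprimes hco hd hd2
    by_cases hNb : N = ⊥
    · refine ⟨1, N.one_mem, fun k hk => ?_⟩
      obtain ⟨a, ha, h⟩ := h12 k hk
      rw [hNb, Subgroup.mem_bot] at ha
      simpa [ha] using h
    · have : Nontrivial N := (Subgroup.nontrivial_iff_ne_bot N).mpr hNb
      have hZ := hN.center_nontrivial
      set Z : Subgroup Γ := (Subgroup.center N).map N.subtype with hZd
      have hZn : Z.Normal := inferInstance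
      have hZN : Z ≤ N := by
        rintro _ ⟨a, _, rfl⟩
        exact a.2
      have hZp : IsPGroup p Z := hN.to_le hZN
      have hZ1 : Z ≠ ⊥ := by
        intro h
        rw [hZd, Subgroup.map_eq_bot_iff_of_injective _ N.subtype_injective] at h
        exact (Subgroup.nontrivial_iff_ne_bot _).mp hZ h
      have hcard : Nat.card (Γ ⧸ Z) < m := by
        rw [← hm, ← Subgroup.card_mul_index Z]
        have h3 : 1 < Nat.card Z := by
          have : Nontrivial Z := (Subgroup.nontrivial_iff_ne_bot Z).mpr hZ1
          exact Finite.one_lt_card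
        have h4 : 0 < Z.index := Nat.pos_of_ne_zero Subgroup.index_ne_zero_of_finite
        rw [Subgroup.index] at *
        nlinarith
      let q := QuotientGroup.mk' Z
      have hq : Function.Surjective q := QuotientGroup.mk'_surjective Z
      obtain ⟨c', ⟨c, hc, rfl⟩, hcK⟩ := ih _ hcard (Γ := Γ ⧸ Z) (N := N.map q) (K₁ := K₁.map q)
        (K₂ := K₂.map q) (hn.map q hq) (hN.map q)
        (fun h => h1 (h.trans (Subgroup.card_map_dvd K₁ q)))
        (fun h => h2 (h.trans (Subgroup.card_map_dvd K₂ q))) (by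
          rintro _ ⟨k, hk, rfl⟩
          obtain ⟨a, ha, h⟩ := h12 k hk
          exact ⟨q a, ⟨a, ha, rfl⟩, a * k, h, map_mul q a k⟩) rfl
      have hK : ∀ k ∈ K₁, ∃ a ∈ Z, a * (c * k * c⁻¹) ∈ K₂ := by
        intro k hk
        obtain ⟨l, hl, e⟩ := hcK (q k) ⟨k, hk, rfl⟩
        refine ⟨l * (c * k * c⁻¹)⁻¹, ?_, by rwa [inv_mul_cancel_right]⟩
        rw [← QuotientGroup.eq_one_iff]
        have : q (l * (c * k * c⁻¹)⁻¹) = 1 := by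
          rw [map_mul, map_inv, map_mul, map_mul, map_inv, e, mul_inv_cancel]
        exact this
      have hcc : Nat.card (K₁.map (MulAut.conj c).toMonoidHom) = Nat.card K₁ :=
        Nat.card_congr (K₁.equivMapOfInjective _ (MulAut.conj c).injective).toEquiv.symm
      obtain ⟨d, hd, hdK⟩ := conj_le_of_comm (N := Z) (K₁ := K₁.map (MulAut.conj c).toMonoidHom)
        (K₂ := K₂) (by
          rintro _ ⟨a, ha, rfl⟩ _ ⟨b, hb, rfl⟩
          have := (Subgroup.mem_center_iff.mp hb) a
          exact congrArg Subtype.val this) (fun k _ a ha => hZn.conj_mem a ha k) (by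
          rw [hcc]
          obtain ⟨n, hn⟩ := hZp.exists_card_eq
          rw [hn]
          exact Nat.Coprime.pow_right n ((hp.coprime_iff_not_dvd.mpr h1).symm)) (by
          rintro _ ⟨k, hk, rfl⟩
          exact hK k hk) (hdisj hZp h2)
      refine ⟨d * c, N.mul_mem (hZN hd) hc, fun k hk => ?_⟩
      have := hdK _ ⟨k, hk, rfl⟩
      simpa [mul_assoc] using this

theorem not_dvd_card_of_pow {p : ℕ} (hp : p.Prime) (h : ∀ x : Γ, ∃ m, ¬ p ∣ m ∧ x ^ m = 1) :
    ¬ p ∣ Nat.card Γ := by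
  intro hd
  have : Fact p.Prime := ⟨hp⟩
  obtain ⟨x, hx⟩ := exists_prime_orderOf_dvd_card' p hd
  obtain ⟨m, hm, hxm⟩ := h x
  exact hm (hx ▸ orderOf_dvd_of_pow_eq_one hxm)
end Complement

section Relative
variable {G : Type} [Group G] [Finite G] {p : ℕ} {A R S : Subgroup G}

/-- Existence of complements modulo `A` for `R / A` a `p`-group and `S / R` a `p'`-group. -/
theorem PStep.exists_compl (hp : p.Prime) (hA : Nrm A S) (hR : QStep p R S) (hRA : PStep p A R) :
    ∃ J, A ≤ J ∧ J ≤ S ∧ Factors S R J ∧ J ⊓ R = A := by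
  have := hA.normal
  have hRn := hR.1.normal
  have : Fact p.Prime := ⟨hp⟩
  let q := QuotientGroup.mk' (A.subgroupOf S)
  have hq : Function.Surjective q := QuotientGroup.mk'_surjective _
  set N := (R.subgroupOf S).map q with hN
  have hNn : N.Normal := hRn.map q hq
  have hNp : IsPGroup p N := by
    rintro ⟨_, x, hx, rfl⟩
    obtain ⟨k, hk⟩ := hRA.2 x hx
    refine ⟨k, Subtype.ext ?_⟩
    change q x ^ p ^ k = 1
    rw [← map_pow]
    exact (QuotientGroup.eq_one_iff _).mpr hk
  have hi : ¬ p ∣ N.index := by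
    refine not_dvd_card_of_pow (Γ := (S ⧸ A.subgroupOf S) ⧸ N) hp fun x => ?_
    obtain ⟨x, rfl⟩ := QuotientGroup.mk_surjective x
    obtain ⟨x, rfl⟩ := hq x
    obtain ⟨m, hm, hx⟩ := hR.2 x x.2
    refine ⟨m, hm, ?_⟩
    rw [← QuotientGroup.mk_pow, QuotientGroup.eq_one_iff, ← map_pow]
    exact ⟨_, hx, rfl⟩
  have hco : (Nat.card N).Coprime N.index := by
    obtain ⟨n, hn⟩ := hNp.exists_card_eq
    rw [hn]
    exact Nat.Coprime.pow_left n (hp.coprime_iff_not_dvd.mpr hi)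
  obtain ⟨K, hK⟩ := Subgroup.exists_right_complement'_of_coprime hco
  have hmk : ∀ x : S, q x = 1 ↔ (x : G) ∈ A := fun x => QuotientGroup.eq_one_iff _
  refine ⟨(K.comap q).map S.subtype, fun a ha => ?_, ?_, fun t ht => ?_, ?_⟩
  · refine ⟨⟨a, hA.le ha⟩, ?_, rfl⟩
    have : q ⟨a, hA.le ha⟩ = 1 := (hmk _).mpr ha
    exact (Subgroup.mem_comap.mpr (this ▸ K.one_mem))
  · rintro _ ⟨a, _, rfl⟩
    exact a.2
  · obtain ⟨⟨⟨a, x, hx, hxa⟩, b⟩, hab⟩ := hK.2 (q ⟨t, ht⟩)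
    have hab' : a * (b : S ⧸ A.subgroupOf S) = q ⟨t, ht⟩ := hab
    refine ⟨x, hx, x⁻¹ * t, ⟨x⁻¹ * ⟨t, ht⟩, ?_, rfl⟩, by simp⟩
    have : q (x⁻¹ * ⟨t, ht⟩) = b := by
      rw [map_mul, map_inv, hxa, ← hab']
      group
    exact Subgroup.mem_comap.mpr (this ▸ b.2)
  · ext a
    constructor
    · rintro ⟨⟨x, hx, rfl⟩, hxR⟩
      rw [S.subtype_apply, ← hmk]
      have := hK.disjoint
      rw [Subgroup.disjoint_def] at this
      exact this ⟨x, hxR, rfl⟩ hx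
    · intro ha
      refine ⟨⟨⟨a, hA.le ha⟩, ?_, rfl⟩, hRA.1.le ha⟩
      have : q ⟨a, hA.le ha⟩ = 1 := (hmk _).mpr ha
      exact (Subgroup.mem_comap.mpr (this ▸ K.one_mem))

/-- Conjugacy of complements modulo `A`. -/
theorem PStep.conj_compl (hp : p.Prime) (hA : Nrm A S) (hR : QStep p R S) (hRA : PStep p A R)
    {J₁ J₂ : Subgroup G} (h1 : J₁ ≤ S) (h2 : J₂ ≤ S) (hA2 : A ≤ J₂)
    (hd1 : J₁ ⊓ R ≤ A) (hd2 : J₂ ⊓ R ≤ A) (h12 : ∀ k ∈ J₁, ∃ a ∈ R, a * k ∈ J₂) :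
    ∃ c ∈ R, ∀ k ∈ J₁, c * k * c⁻¹ ∈ J₂ := by
  have := hA.normal
  have hRn := hR.1.normal
  let q := QuotientGroup.mk' (A.subgroupOf S)
  have hq : Function.Surjective q := QuotientGroup.mk'_surjective _
  have hmk : ∀ x : S, q x = 1 ↔ (x : G) ∈ A := fun x => QuotientGroup.eq_one_iff _
  have hNp : IsPGroup p ((R.subgroupOf S).map q) := by
    rintro ⟨_, x, hx, rfl⟩
    obtain ⟨k, hk⟩ := hRA.2 x hx
    refine ⟨k, Subtype.ext ?_⟩
    change q x ^ p ^ k = 1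
    rw [← map_pow]
    exact (QuotientGroup.eq_one_iff _).mpr hk
  have hJ : ∀ J : Subgroup G, J ⊓ R ≤ A → ¬ p ∣ Nat.card ((J.subgroupOf S).map q) := by
    intro J hd
    refine not_dvd_card_of_pow hp ?_
    rintro ⟨_, x, hx, rfl⟩
    obtain ⟨m, hm, hxm⟩ := hR.2 x x.2
    refine ⟨m, hm, Subtype.ext ?_⟩
    change q x ^ m = 1
    rw [← map_pow, hmk]
    exact hd ⟨J.pow_mem hx m, hxm⟩
  obtain ⟨_, ⟨c, hc, rfl⟩, h⟩ := conj_le_of_isPGroup hp (hRn.map q hq) hNp (hJ J₁ hd1) (hJ J₂ hd2)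
    (by
      rintro _ ⟨k, hk, rfl⟩
      obtain ⟨a, ha, hak⟩ := h12 k hk
      exact ⟨q ⟨a, hR.1.le ha⟩, ⟨_, ha, rfl⟩, ⟨a, hR.1.le ha⟩ * k, hak, map_mul q _ _⟩)
  refine ⟨c, hc, fun k hk => ?_⟩
  obtain ⟨l, hl, e⟩ := h (q ⟨k, h1 hk⟩) ⟨_, hk, rfl⟩
  have : q (l⁻¹ * (c * ⟨k, h1 hk⟩ * c⁻¹)) = 1 := by
    rw [map_mul, map_inv, map_mul, map_mul, map_inv, e, inv_mul_cancel]
  have := J₂.mul_mem hl (hA2 ((hmk _).mp this))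
  simpa using this
end Relative

section Regular
variable {G : Type} [Group G] {p : ℕ}

theorem not_dvd_orderOf_of_pow (hp : p.Prime) {x : G} {m : ℕ} (hm : ¬ p ∣ m)
    (h : ¬ p ∣ orderOf (x ^ m)) : ¬ p ∣ orderOf x := by
  intro hx
  have h1 : orderOf x ∣ m * orderOf (x ^ m) := by
    rw [orderOf_dvd_iff_pow_eq_one, pow_mul, pow_orderOf_eq_one]
  rcases hp.dvd_mul.mp (hx.trans h1) with h2 | h2
  · exact hm h2
  · exact h h2

theorem mem_of_pow_mem_of_coprime [Finite G] {H : Subgroup G} {x : G} {n : ℕ}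
    (hn : (orderOf x).Coprime n) (h : x ^ n ∈ H) : x ∈ H := by
  obtain ⟨m, hm⟩ := exists_pow_eq_self_of_coprime hn.symm
  rw [← hm]
  exact H.pow_mem h m

theorem coprime_of_not_dvd (hp : p.Prime) {x : G} (h : ¬ p ∣ orderOf x) (k : ℕ) :
    (orderOf x).Coprime (p ^ k) :=
  Nat.Coprime.pow_right k ((hp.coprime_iff_not_dvd.mpr h).symm)

theorem PStep.mem_of_reg [Finite G] (hp : p.Prime) {M L : Subgroup G} (h : PStep p M L) {x : G}
    (hx : x ∈ L) (hr : ¬ p ∣ orderOf x) : x ∈ M := by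
  obtain ⟨k, hk⟩ := h.2 x hx
  exact mem_of_pow_mem_of_coprime (coprime_of_not_dvd hp hr k) hk

/-- Some `p`-power of an element is `p`-regular. -/
theorem exists_pow_reg [Finite G] (hp : p.Prime) (x : G) : ∃ k, ¬ p ∣ orderOf (x ^ p ^ k) := by
  obtain ⟨k, m, hm, e⟩ := Nat.exists_eq_pow_mul_and_not_dvd (orderOf_pos x).ne' p hp.ne_one
  refine ⟨k, fun h => hm (h.trans ?_)⟩
  rw [orderOf_dvd_iff_pow_eq_one, ← pow_mul, ← e, pow_orderOf_eq_one]
end Regular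

section Fong
variable {G : Type} [Group G]

/-- The stabilizer in `X` of a pair consisting of a subgroup and a function on it. -/
def pstab (X J : Subgroup G) (κ : G → ℂ) : Subgroup G where
  carrier := {x | x ∈ X ∧ cjS x J = J ∧ cj x κ = κ}
  one_mem' := ⟨X.one_mem, cjS_one J, cj_one κ⟩
  mul_mem' := fun {a b} ha hb => ⟨X.mul_mem ha.1 hb.1, by rw [cjS_mul, hb.2.1, ha.2.1],
    by rw [cj_mul, hb.2.2, ha.2.2]⟩
  inv_mem' := fun {a} ha => ⟨X.inv_mem ha.1, by
    conv_lhs => rw [← ha.2.1]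
    exact cjS_inv_cjS a J, by
    conv_lhs => rw [← ha.2.2]
    exact cj_inv_cj a κ⟩

theorem cjS_eq_of_le [Finite G] {x : G} {J K : Subgroup G} (h : cjS x J ≤ K)
    (hc : Nat.card K ≤ Nat.card J) : cjS x J = K :=
  Subgroup.eq_of_le_of_card_ge h (by rwa [card_cjS])

variable [Fintype G] {p : ℕ}

/-- A Fong character `κ` of a `p'`-subgroup `J` isolating `θ` among the characters in `B`. -/
structure FongAt (p : ℕ) (M X : Subgroup G) (B : (G → ℂ) → Prop) (θ : G → ℂ) (J : Subgroup G)
    (κ : G → ℂ) : Prop where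
  le : J ≤ M
  reg : ∀ x ∈ J, ¬ p ∣ orderOf x
  irr : Irr J κ
  one : ∀ θ', B θ' → ip J θ' κ = if θ' = θ then 1 else 0
  tr : ∀ x ∈ X, cj x θ = θ → ∃ m ∈ M, cjS (m * x) J = J ∧ cj (m * x) κ = κ
  mem : ∀ m ∈ M, ¬ p ∣ orderOf m → cjS m J = J → cj m κ = κ → m ∈ J

theorem FongAt.fixed {σ : ℂ →+* ℂ} (hσ : Sg p G σ) {M X J : Subgroup G} {B : (G → ℂ) → Prop}
    {θ κ : G → ℂ} (h : FongAt p M X B θ J κ) (hθ : B θ) (hBσ : B (mp σ θ)) : mp σ θ = θ := by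
  have hκ : mp σ κ = κ := by
    ext g
    by_cases hg : g ∈ J
    · exact hσ.apply_reg h.irr.chr (h.reg g hg)
    · simp [mp, h.irr.1 g hg]
  have h1 : ip J (mp σ θ) κ = 1 := by
    conv_lhs => rw [← hκ]
    rw [ip_mp h.irr.chr, h.one θ hθ, if_pos rfl, map_one]
  rw [h.one _ hBσ] at h1
  by_contra hne
  simp [hne] at h1

theorem FongAt.pstep {σ : ℂ →+* ℂ} (hσ : Sg p G σ) {M L X J : Subgroup G} {B B' : (G → ℂ) → Prop}
    (hML : PStep p M L) (hL : Nrm L X) (hM : Nrm M X)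
    (hB : ∀ θ, B θ → Irr M θ ∧ mp σ θ = θ)
    (hB' : ∀ η, B' η → Irr L η ∧ mp σ η = η ∧ ∀ θ, Irr M θ → ip M η θ ≠ 0 → B θ)
    {η θ κ : G → ℂ} (hη : B' η) (h0 : ip M η θ ≠ 0) (hθ : B θ) (h : FongAt p M X B θ J κ) :
    FongAt p L X B' η J κ where
  le := h.le.trans hML.1.le
  reg := h.reg
  irr := h.irr
  one η' hη' := by
    obtain ⟨hi, hs, hc⟩ := hB' η' hη'
    rw [hi.chr.ip_mid h.le hML.1.le h.irr.1, Finset.sum_eq_single θ]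
    · rw [h.one θ hθ, if_pos rfl, mul_one]
      obtain ⟨η₀, e1, e2, e3, e4⟩ := hσ.exists_unique_over hML (hB θ hθ).1 (hB θ hθ).2
      have := e4 η (hB' η hη).1 (hB' η hη).2.1 h0
      split_ifs with e
      · rw [e, this, e3]
      · by_contra hne
        exact e ((e4 η' hi hs hne).trans this.symm)
    · intro ψ hψ hne
      by_cases h1 : ip M η' ψ = 0
      · rw [h1, zero_mul]
      · rw [h.one ψ (hc ψ (mem_IrrF.mp hψ) h1), if_neg hne, mul_zero]
    · exact fun hn => absurd (mem_IrrF.mpr (hB θ hθ).1) hn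
  tr x hx hxη := by
    have hirr := (hB θ hθ).1
    have h1 : ip M η (cj x θ) ≠ 0 := by
      conv_lhs => rw [← hxη, hM.ip_cj hx]
      exact h0
    obtain ⟨y, hy, e⟩ := hML.1.conj_const (hB' η hη).1 hirr (hM.irr_cj hx hirr) h0 h1
    obtain ⟨m, hm, e1, e2⟩ := h.tr (y⁻¹ * x) (X.mul_mem (X.inv_mem (hL.le hy)) hx)
      (by rw [cj_mul, e, cj_inv_cj])
    refine ⟨m * y⁻¹, L.mul_mem (hML.1.le hm) (L.inv_mem hy), ?_, ?_⟩
    · rwa [mul_assoc]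
    · rwa [mul_assoc]
  mem m hm hr e1 e2 := h.mem m (hML.mem_of_reg hσ.prime hm hr) hr e1 e2

theorem cjS_inf (x : G) (H K : Subgroup G) : cjS x (H ⊓ K) = cjS x H ⊓ cjS x K := by
  ext g
  simp [mem_cjS, Subgroup.mem_inf]

theorem pow_mem_of_normalizes {J : Subgroup G} {l r j : G} (hj : j ∈ J) (hl : l = r * j)
    (hn : cjS r J = J) {n : ℕ} (hr : r ^ n ∈ J) : l ^ n ∈ J := by
  have key : ∀ n : ℕ, (r ^ n)⁻¹ * l ^ n ∈ J := by
    intro n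
    induction n with
    | zero => simp [J.one_mem]
    | succ k ih =>
      have h1 : r⁻¹ * ((r ^ k)⁻¹ * l ^ k) * r ∈ J := by
        rw [← mem_cjS, hn]
        exact ih
      have e : (r ^ (k + 1))⁻¹ * l ^ (k + 1) = r⁻¹ * ((r ^ k)⁻¹ * l ^ k) * r * j := by
        rw [pow_succ, pow_succ, mul_inv_rev, mul_assoc _ r j, ← hl]
        simp only [mul_assoc]
      rw [e]
      exact J.mul_mem h1 hj
  simpa using J.mul_mem hr (key n)

theorem FongAt.cj_eq {M X J : Subgroup G} {B : (G → ℂ) → Prop} {θ κ : G → ℂ}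
    (h : FongAt p M X B θ J κ) (hBX : ∀ θ, B θ → ∀ x ∈ X, B (cj x θ)) (hθ : B θ) {x : G}
    (hx : x ∈ pstab X J κ) : cj x θ = θ := by
  have h1 : ip J (cj x θ) κ = 1 := by
    conv_lhs => rw [← hx.2.2, ← hx.2.1]
    rw [ip_cj, h.one θ hθ, if_pos rfl]
  rw [h.one _ (hBX θ hθ x hx.1)] at h1
  by_contra hne
  simp [hne] at h1

theorem FongAt.qstep (hp : p.Prime) {M L X J₀ : Subgroup G} {B B' : (G → ℂ) → Prop}
    (hML : QStep p M L) (hL : Nrm L X) (hM : Nrm M X) (hB : ∀ θ, B θ → Irr M θ)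
    (hBX : ∀ θ, B θ → ∀ x ∈ X, B (cj x θ))
    (hB' : ∀ η, B' η → Irr L η ∧ ∀ θ, Irr M θ → ip M η θ ≠ 0 → B θ)
    {η θ κ₀ : G → ℂ} (hη : B' η) (h0 : ip M η θ ≠ 0) (hθ : B θ) (h : FongAt p M X B θ J₀ κ₀) :
    ∃ J κ, FongAt p L X B' η J κ := by
  have hMi := hB θ hθ
  have hηi := (hB' η hη).1
  have hX : ∀ x ∈ pstab X J₀ κ₀, cj x θ = θ := fun x hx => h.cj_eq hBX hθ hx
  set T := stab L θ with hT
  set S := pstab L J₀ κ₀ with hS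
  set R := S ⊓ M with hR
  have hSX : S ≤ pstab X J₀ κ₀ := fun s hs => ⟨hL.le hs.1, hs.2⟩
  have hSL : S ≤ L := fun s hs => hs.1
  have hST : S ≤ T := fun s hs => ⟨hs.1, hX s (hSX hs)⟩
  have hJ0S : J₀ ≤ S := fun x hx => ⟨hML.1.le (h.le hx), cjS_of_mem hx, h.irr.chr.classOn.cj_eq hx⟩
  have hJ0R : J₀ ≤ R := le_inf hJ0S h.le
  have hnS : Nrm J₀ S := ⟨hJ0S, fun x hx m hm => by
    rw [← hx.2.1, mem_cjS]
    simpa [mul_assoc] using hm⟩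
  have hRS : QStep p R S := ⟨⟨inf_le_left, fun x hx m hm => ⟨S.mul_mem (S.mul_mem hx hm.1)
    (S.inv_mem hx), hML.1.2 x hx.1 m hm.2⟩⟩, fun x hx => by
      obtain ⟨m, h1, h2⟩ := hML.2 x hx.1
      exact ⟨m, h1, S.pow_mem hx m, h2⟩⟩
  have hRJ : PStep p J₀ R := ⟨⟨hJ0R, fun x hx => hnS.2 x hx.1⟩, fun x hx => by
    obtain ⟨k, hk⟩ := exists_pow_reg hp x
    have hxR := R.pow_mem hx (p ^ k)
    exact ⟨k, h.mem _ hxR.2 hk hxR.1.2.1 hxR.1.2.2⟩⟩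
  obtain ⟨J, hJ0, hJS, hfac, hJR⟩ := PStep.exists_compl hp hnS hRS hRJ
  have hJM : J ⊓ M = J₀ := by
    rw [← hJR, hR, ← inf_assoc, inf_eq_left.mpr hJS]
  have hJT := hJS.trans hST
  have hTL : T ≤ L := stab_le L θ
  have hMT : Nrm M T := hML.1.stab hMi.chr.classOn
  have hfT : Factors T M J := by
    intro t ht
    obtain ⟨m, hm, e1, e2⟩ := h.tr t (hL.le ht.1) ht.2
    have hs : m * t ∈ S := ⟨L.mul_mem (hML.1.le hm) ht.1, e1, e2⟩
    obtain ⟨r, hr, j, hj, e⟩ := hfac _ hs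
    refine ⟨m⁻¹ * r, M.mul_mem (M.inv_mem hm) hr.2, j, hj, ?_⟩
    rw [mul_assoc, ← e, inv_mul_cancel_left]
  have hreg : ∀ x ∈ J, ¬ p ∣ orderOf x := by
    intro x hx
    obtain ⟨m, h1, h2⟩ := hML.2 x (hSL (hJS hx))
    have h3 : x ^ m ∈ J₀ := hJM ▸ ⟨J.pow_mem hx m, h2⟩
    exact not_dvd_orderOf_of_pow hp h1 (h.reg _ h3)
  have hone : ip J₀ θ κ₀ = 1 := by rw [h.one θ hθ, if_pos rfl]
  have hrest := (hMT.rest hJT hfT hMi (fun x hx => hx.2) (hJM.symm ▸ h.irr)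
    (fun x hx => (hJS hx).2.2) (hJM.symm ▸ hone)).1
  obtain ⟨ψ, hψ, hψθ, hηψ, hind⟩ := hML.1.clifford_exists hηi hMi h0
  obtain ⟨K, hK, hKκ, hK1, hK2⟩ := hrest ψ hψ hψθ
  rw [hJM] at hKκ hK2
  have hKκ0 : ip J₀ K κ₀ ≠ 0 := by rwa [hKκ]
  have hcjM : ∀ x ∈ X, ∀ f k, ip M (cj x f) (cj x k) = ip M f k := fun x hx => hM.ip_cj hx
  have hηψ1 : ip T η ψ = 1 := by
    have h1 := ip_ind_left (K := T) ψ hηi.chr.classOn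
    rw [hind, hηi.ip_self] at h1
    simpa using ip_comm_nat (n := 1) (h1.symm.trans Nat.cast_one.symm)
  refine ⟨J, K, ⟨hJT.trans hTL, hreg, hK, fun η' hη' => ?_, fun x hx hxη => ?_,
    fun l hl hlr e1 e2 => ?_⟩⟩
  · obtain ⟨hi, hc⟩ := hB' η' hη'
    rw [hi.chr.ip_mid hJT hTL hK.1, Finset.sum_eq_single ψ]
    · rw [hK1 ψ hψ hψθ, if_pos rfl, mul_one]
      split_ifs with e
      · rw [e, hηψ1]
      · by_contra hne
        exact e ((hML.1.clifford hi hMi hψ hψθ hne).1.symm.trans hind)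
    · intro ξ hξ hne
      have hξ' := mem_IrrF.mp hξ
      by_contra hmul
      have ha := left_ne_zero_of_mul hmul
      have hb := right_ne_zero_of_mul hmul
      by_cases hξθ : ip M ξ θ = 0
      · have h1 : ip J₀ ξ κ₀ ≠ 0 := hξ'.chr.ip_trans hJ0 hJT h.irr.chr hK hb hKκ0
        obtain ⟨ω, hω, h2, h3⟩ := hξ'.chr.exists_mid h.le hMT.le h.irr.1 h1
        have h4 := hc ω hω (hi.chr.ip_trans hMT.le hTL hω.chr hξ' ha h2)
        rw [h.one ω h4] at h3
        have h5 : ω = θ := by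
          by_contra h5
          exact h3 (if_neg h5)
        exact h2 (h5 ▸ hξθ)
      · rw [hK1 ξ hξ' hξθ, if_neg hne] at hb
        exact hb rfl
    · exact fun hn => absurd (mem_IrrF.mpr hψ) hn
  · have h1 : ip M η (cj x θ) ≠ 0 := by
      conv_lhs => rw [← hxη, hcjM x hx]
      exact h0
    obtain ⟨y, hy, e⟩ := hML.1.conj_const hηi hMi (hM.irr_cj hx hMi) h0 h1
    obtain ⟨m, hm, e1, e2⟩ := h.tr (y⁻¹ * x) (X.mul_mem (X.inv_mem (hL.le hy)) hx)
      (by rw [cj_mul, e, cj_inv_cj])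
    set z := m * (y⁻¹ * x) with hz
    have hzX : z ∈ X := X.mul_mem (hM.le hm) (X.mul_mem (X.inv_mem (hL.le hy)) hx)
    have hzP : z ∈ pstab X J₀ κ₀ := ⟨hzX, e1, e2⟩
    have hzS : ∀ s, z⁻¹ * s * z ∈ S → s ∈ S := fun s hs => by
      have h3 : s ∈ pstab X J₀ κ₀ := by
        have := (pstab X J₀ κ₀).mul_mem ((pstab X J₀ κ₀).mul_mem hzP (hSX hs))
          ((pstab X J₀ κ₀).inv_mem hzP)
        simpa [mul_assoc] using this
      exact ⟨(hL.conj_mem_iff' hzX).mp hs.1, h3.2⟩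
    obtain ⟨c, hc, hcJ⟩ := PStep.conj_compl hp hnS hRS hRJ (J₁ := _root_.cjS z J) (J₂ := J)
      (fun g hg => hzS g (hJS (mem_cjS.mp hg))) hJS hJ0 (fun g hg => by
        rw [← e1, ← hJM, mem_cjS]
        exact ⟨mem_cjS.mp hg.1, (hM.conj_mem_iff' hzX).mpr hg.2.2⟩) hJR.le (fun k hk => by
        obtain ⟨r, hr, j, hj, e⟩ := hfac k (hzS k (hJS (mem_cjS.mp hk)))
        exact ⟨r⁻¹, R.inv_mem hr, by rwa [e, inv_mul_cancel_left]⟩)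
    have hwP : c * z ∈ pstab X J₀ κ₀ := (pstab X J₀ κ₀).mul_mem (hSX hc.1) hzP
    have hwJ : _root_.cjS (c * z) J = J := by
      refine cjS_eq_of_le (fun g hg => ?_) le_rfl
      have := hcJ (c⁻¹ * g * c) (by
        rw [mem_cjS] at hg ⊢
        simpa [mul_assoc] using hg)
      simpa [mul_assoc] using this
    have hwl : c * z = (c * (m * y⁻¹)) * x := by rw [hz]; group
    have hlL : c * (m * y⁻¹) ∈ L :=
      L.mul_mem (hSL hc.1) (L.mul_mem (hML.1.le hm) (L.inv_mem hy))
    have hwX : c * z ∈ X := hwP.1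
    have hwη : cj (c * z) η = η := by
      rw [hwl, cj_mul, hxη, hηi.chr.classOn.cj_eq hlL]
    have hwθ := hX _ hwP
    have hwT : _root_.cjS (c * z) T = T := by
      refine cjS_eq_of_le (fun g hg => ?_) le_rfl
      rw [mem_cjS] at hg
      refine ⟨(hL.conj_mem_iff' hwX).mp hg.1, ?_⟩
      have h3 : g = (c * z) * ((c * z)⁻¹ * g * (c * z)) * (c * z)⁻¹ := by group
      rw [h3, cj_mul, cj_mul, show cj (c * z)⁻¹ θ = θ by
        conv_lhs => rw [← hwθ]
        exact cj_inv_cj _ _, hg.2, hwθ]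
    have hwψ : cj (c * z) ψ = ψ := by
      refine hML.1.clifford_unique hηi hMi (?_ : Irr T _) hψ ?_ hψθ ?_ hηψ
      · have := hψ.cj (c * z)
        rwa [hwT] at this
      · rw [← hwθ, hcjM _ hwX]
        exact hψθ
      · have := _root_.ip_cj (c * z) T η ψ
        rw [hwT, hwη] at this
        rw [← hT, this]
        exact hηψ
    refine ⟨c * (m * y⁻¹), hlL, by rwa [← hwl], ?_⟩
    rw [← hwl]
    have hKi : Irr J (cj (c * z) K) := by
      have := hK.cj (c * z)
      rwa [hwJ] at this
    have h3 : ip J₀ (cj (c * z) K) κ₀ ≠ 0 := by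
      have := _root_.ip_cj (c * z) J₀ K κ₀
      rw [hwP.2.1, hwP.2.2] at this
      rwa [this]
    have h4 : ip J ψ (cj (c * z) K) = 1 := by
      have := _root_.ip_cj (c * z) J ψ K
      rw [hwJ, hwψ, hK2 K hK hKκ0, if_pos rfl] at this
      exact this
    rw [hK2 _ hKi h3] at h4
    by_contra hne
    simp [hne] at h4
  · have hl0 : _root_.cjS l J₀ = J₀ := by
      rw [← hJM, cjS_inf, e1, hML.1.cjS hl]
    have hn0 : Nrm J₀ J := ⟨hJ0, fun x hx => hnS.2 x (hJS hx)⟩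
    have hlκ : cj l κ₀ = κ₀ := by
      refine ext_on (H := J₀) (fun g hg => ?_) h.irr.1 fun g hg => ?_
      · have := cj_supp (x := l) h.irr.1 g
        rw [hl0] at this
        exact this hg
      · have hg' : l⁻¹ * g * l ∈ J₀ := by rwa [← mem_cjS, hl0]
        have h1 := hn0.res_of_inv hK h.irr hKκ0 (fun x hx => (hJS hx).2.2) hg
        have h2 := hn0.res_of_inv hK h.irr hKκ0 (fun x hx => (hJS hx).2.2) hg'
        have h3 : K (l⁻¹ * g * l) = K g := congrFun e2 g
        rw [h1, h2] at h3
        exact mul_left_cancel₀ hKκ0 h3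
    have hlS : l ∈ S := ⟨hl, hl0, hlκ⟩
    obtain ⟨r, hr, j, hj, e⟩ := hfac l hlS
    have hrJ : _root_.cjS r J = J := by
      rw [show r = l * j⁻¹ by rw [e]; group, cjS_mul, cjS_of_mem (J.inv_mem hj), e1]
    obtain ⟨k, hk⟩ := hRJ.2 r hr
    exact mem_of_pow_mem_of_coprime (coprime_of_not_dvd hp hlr k)
      (pow_mem_of_normalizes hj e hrJ (hJ0 hk))
end Fong

section Series
variable {G : Type} [Group G] [Fintype G] {p n : ℕ} {N : ℕ → Subgroup G} {σ : ℂ →+* ℂ}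

theorem FongAt.mono {M X J : Subgroup G} {B B' : (G → ℂ) → Prop} {θ κ : G → ℂ}
    (h : FongAt p M X B θ J κ) (hB : ∀ η, B' η → B η) : FongAt p M X B' θ J κ :=
  ⟨h.le, h.reg, h.irr, fun η hη => h.one η (hB η hη), h.tr, h.mem⟩

theorem NSeries.mono (hN : NSeries p n N ⊤) : Monotone N :=
  monotone_nat_of_le_succ fun i => by
    rcases hN.step i with h | h <;> exact h.1.le

theorem NSeries.nrm (hN : NSeries p n N ⊤) (X : Subgroup G) (i : ℕ) : Nrm (X ⊓ N i) X :=
  ⟨inf_le_left, fun x hx m hm => ⟨X.mul_mem (X.mul_mem hx hm.1) (X.inv_mem hx),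
    (hN.normal i).conj_mem m hm.2 x⟩⟩

theorem NSeries.nrm_le (hN : NSeries p n N ⊤) (X : Subgroup G) {i j : ℕ} (h : i ≤ j) :
    Nrm (X ⊓ N i) (X ⊓ N j) :=
  ⟨inf_le_inf_left X (hN.mono h), fun x hx => (hN.nrm X i).2 x hx.1⟩

theorem NSeries.step_inf (hN : NSeries p n N ⊤) (X : Subgroup G) (i : ℕ) :
    PStep p (X ⊓ N i) (X ⊓ N (i + 1)) ∨ QStep p (X ⊓ N i) (X ⊓ N (i + 1)) := by
  rcases hN.step i with h | h
  · refine Or.inl ⟨hN.nrm_le X i.le_succ, fun x hx => ?_⟩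
    obtain ⟨k, hk⟩ := h.2 x hx.2
    exact ⟨k, X.pow_mem hx.1 _, hk⟩
  · refine Or.inr ⟨hN.nrm_le X i.le_succ, fun x hx => ?_⟩
    obtain ⟨k, h1, hk⟩ := h.2 x hx.2
    exact ⟨k, h1, X.pow_mem hx.1 _, hk⟩

theorem NSeries.top_inf (hN : NSeries p n N ⊤) (X : Subgroup G) : X ⊓ N n = X := by
  rw [hN.last n le_rfl, inf_top_eq]

theorem NSeries.cjS_inf (hN : NSeries p n N ⊤) (X : Subgroup G) (x : G) (i : ℕ) :
    cjS x (X ⊓ N i) = cjS x X ⊓ N i := by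
  rw [_root_.cjS_inf]
  congr 1
  have := hN.nrm ⊤ i
  rw [top_inf_eq] at this
  exact this.cjS (Subgroup.mem_top x)

/-- The irreducible characters of `X ⊓ N i` whose constituents along the series are fixed
by `σ`. -/
def Bs (σ : ℂ →+* ℂ) (N : ℕ → Subgroup G) (i : ℕ) (X : Subgroup G) (χ : G → ℂ) : Prop :=
  Irr (X ⊓ N i) χ ∧ ∀ j ≤ i, ∀ θ, Irr (X ⊓ N j) θ → ip (X ⊓ N j) χ θ ≠ 0 → mp σ θ = θ

variable {i : ℕ} {X : Subgroup G} {χ θ η : G → ℂ}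

theorem Bs.fixed (h : Bs σ N i X χ) : mp σ χ = χ :=
  h.2 i le_rfl χ h.1 (by rw [h.1.ip_self]; exact one_ne_zero)

theorem Bs.cj (hN : NSeries p n N ⊤) (h : Bs σ N i X χ) (x : G) :
    Bs σ N i (cjS x X) (cj x χ) := by
  refine ⟨?_, fun j hj θ hθ h0 => ?_⟩
  · rw [← hN.cjS_inf]
    exact h.1.cj x
  · rw [← hN.cjS_inf] at hθ h0
    have h1 := hθ.cj x⁻¹
    rw [cjS_inv_cjS] at h1
    have h2 := h.2 j hj _ h1 (by
      have := ip_cj x (X ⊓ N j) χ (_root_.cj x⁻¹ θ)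
      rw [cj_cj_inv] at this
      rwa [← this])
    rw [← cj_mp] at h2
    exact cj_inj h2

theorem Bs.cj' (hN : NSeries p n N ⊤) (h : Bs σ N i X χ) {x : G} (hx : x ∈ X) :
    Bs σ N i X (_root_.cj x χ) := by
  have := h.cj hN x
  rwa [cjS_of_mem hx] at this

theorem Bs.under (hN : NSeries p n N ⊤) (h : Bs σ N i X χ) {j : ℕ} (hj : j ≤ i)
    (hθ : Irr (X ⊓ N j) θ) (h0 : ip (X ⊓ N j) χ θ ≠ 0) : Bs σ N j X θ :=
  ⟨hθ, fun k hk ω hω h1 => h.2 k (hk.trans hj) ω hω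
    (h.1.chr.ip_trans (inf_le_inf_left X (hN.mono hk)) (inf_le_inf_left X (hN.mono hj)) hω.chr
      hθ h0 h1)⟩

theorem Bs.over (hN : NSeries p n N ⊤) (hη : Irr (X ⊓ N (i + 1)) η) (hs : mp σ η = η)
    (hc : ∀ θ, Irr (X ⊓ N i) θ → ip (X ⊓ N i) η θ ≠ 0 → Bs σ N i X θ) : Bs σ N (i + 1) X η := by
  refine ⟨hη, fun j hj θ hθ h0 => ?_⟩
  rcases Nat.le_succ_iff.mp hj with hj | rfl
  · obtain ⟨ψ, hψ, h1, h2⟩ := hη.chr.exists_mid (inf_le_inf_left X (hN.mono hj))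
      (inf_le_inf_left X (hN.mono i.le_succ)) hθ.1 h0
    exact (hc ψ hψ h1).2 j hj θ hθ h2
  · rw [hη.orth hθ] at h0
    have : η = θ := by
      by_contra hne
      exact h0 (if_neg hne)
    rwa [← this]

theorem Bs.fong_aux (hσ : Sg p G σ) (hN : NSeries p n N ⊤) : ∀ i,
    (∀ χ, Bs σ N i X χ → ∃ J κ, FongAt p (X ⊓ N i) X (Bs σ N i X) χ J κ) ∧
    (QStep p (X ⊓ N i) (X ⊓ N (i + 1)) → ∀ η, Irr (X ⊓ N (i + 1)) η →
      (∀ θ, Irr (X ⊓ N i) θ → ip (X ⊓ N i) η θ ≠ 0 → Bs σ N i X θ) →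
      mp σ η = η ∧ ∃ J κ, FongAt p (X ⊓ N (i + 1)) X (fun η' => Irr (X ⊓ N (i + 1)) η' ∧
      (∀ θ, Irr (X ⊓ N i) θ → ip (X ⊓ N i) η' θ ≠ 0 → Bs σ N i X θ)) η J κ) := by
  have key : ∀ i, (∀ χ, Bs σ N i X χ → ∃ J κ, FongAt p (X ⊓ N i) X (Bs σ N i X) χ J κ) →
    (QStep p (X ⊓ N i) (X ⊓ N (i + 1)) → ∀ η, Irr (X ⊓ N (i + 1)) η →
      (∀ θ, Irr (X ⊓ N i) θ → ip (X ⊓ N i) η θ ≠ 0 → Bs σ N i X θ) →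
      mp σ η = η ∧ ∃ J κ, FongAt p (X ⊓ N (i + 1)) X (fun η' => Irr (X ⊓ N (i + 1)) η' ∧
      (∀ θ, Irr (X ⊓ N i) θ → ip (X ⊓ N i) η' θ ≠ 0 → Bs σ N i X θ)) η J κ) := by
    intro i ih hq η hη hc
    obtain ⟨θ, hθ, h0⟩ := hη.exists_under hq.1.le
    obtain ⟨J₀, κ₀, hF⟩ := ih θ (hc θ hθ h0)
    obtain ⟨J, κ, h⟩ := hF.qstep hσ.prime hq (hN.nrm X (i + 1)) (hN.nrm X i) (fun θ h => h.1)
      (fun θ h x hx => h.cj' hN hx) (B' := fun η' => Irr (X ⊓ N (i + 1)) η' ∧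
      (∀ θ, Irr (X ⊓ N i) θ → ip (X ⊓ N i) η' θ ≠ 0 → Bs σ N i X θ)) (fun η' h => h) ⟨hη, hc⟩ h0
      (hc θ hθ h0)
    refine ⟨h.fixed hσ ⟨hη, hc⟩ ⟨hη.mp σ, fun ω hω h1 => ?_⟩, J, κ, h⟩
    have h2 := hc (mp σ ω) (hω.mp σ) (fun h2 => h1 (by
      rw [← hσ.sq hω.chr, ip_mp (hω.mp σ).chr, h2, map_zero]))
    have h3 := h2.fixed
    rw [hσ.sq hω.chr] at h3
    rwa [← h3] at h2
  intro i
  refine ⟨?_, key i ?_⟩ <;>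
  · induction i with
    | zero =>
      intro χ hχ
      refine ⟨X ⊓ N 0, χ, le_rfl, fun x hx => ?_, hχ.1, fun θ' h => h.1.orth hχ.1,
        fun x hx h => ⟨1, Subgroup.one_mem _, ?_, by rwa [one_mul]⟩, fun m hm _ _ _ => hm⟩
      · rw [hN.zero, inf_bot_eq] at hx
        rw [Subgroup.mem_bot.mp hx, orderOf_one]
        exact hσ.prime.one_lt.ne' ∘ Nat.dvd_one.mp
      · rw [one_mul]
        exact (hN.nrm X 0).cjS hx
    | succ i ih =>
      intro χ hχ
      have hc : ∀ θ, Irr (X ⊓ N i) θ → ip (X ⊓ N i) χ θ ≠ 0 → Bs σ N i X θ :=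
        fun θ hθ h0 => hχ.under hN i.le_succ hθ h0
      rcases hN.step_inf X i with hp | hq
      · obtain ⟨θ, hθ, h0⟩ := hχ.1.exists_under hp.1.le
        obtain ⟨J, κ, hF⟩ := ih θ (hc θ hθ h0)
        exact ⟨J, κ, hF.pstep hσ hp (hN.nrm X (i + 1)) (hN.nrm X i) (fun θ h => ⟨h.1, h.fixed⟩)
          (fun η h => ⟨h.1, h.fixed, fun θ hθ h0 => h.under hN i.le_succ hθ h0⟩) hχ h0
          (hc θ hθ h0)⟩
      · obtain ⟨-, J, κ, h⟩ := key i ih hq χ hχ.1 hc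
        exact ⟨J, κ, h.mono fun η h => ⟨h.1, fun θ hθ h0 => h.under hN i.le_succ hθ h0⟩⟩

theorem Bs.fong (hσ : Sg p G σ) (hN : NSeries p n N ⊤) (h : Bs σ N i X χ) :
    ∃ J κ, FongAt p (X ⊓ N i) X (Bs σ N i X) χ J κ := (Bs.fong_aux hσ hN i).1 χ h

theorem Bs.all_under (hN : NSeries p n N ⊤) (hθ : Bs σ N i X θ)
    (hη : Irr (X ⊓ N (i + 1)) η) (h0 : ip (X ⊓ N i) η θ ≠ 0) :
    ∀ θ, Irr (X ⊓ N i) θ → ip (X ⊓ N i) η θ ≠ 0 → Bs σ N i X θ := by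
  intro ω hω h1
  obtain ⟨x, hx, rfl⟩ := (hN.nrm_le X i.le_succ).conj_const hη hθ.1 hω h0 h1
  exact hθ.cj' hN hx.1

theorem Bs.of_qstep (hσ : Sg p G σ) (hN : NSeries p n N ⊤)
    (hq : QStep p (X ⊓ N i) (X ⊓ N (i + 1))) (hθ : Bs σ N i X θ) (hη : Irr (X ⊓ N (i + 1)) η)
    (h0 : ip (X ⊓ N i) η θ ≠ 0) : Bs σ N (i + 1) X η :=
  Bs.over hN hη ((Bs.fong_aux hσ hN i).2 hq η hη (hθ.all_under hN hη h0)).1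
    (hθ.all_under hN hη h0)

theorem Bs.of_fixed (hN : NSeries p n N ⊤) (hθ : Bs σ N i X θ) (hη : Irr (X ⊓ N (i + 1)) η)
    (hs : mp σ η = η) (h0 : ip (X ⊓ N i) η θ ≠ 0) : Bs σ N (i + 1) X η :=
  Bs.over hN hη hs (hθ.all_under hN hη h0)

end Series

section Kernel
variable {G : Type} [Group G] [Fintype G] {p : ℕ}

/-- On `p`-regular elements every class function of `M` is a combination of members of `B`. -/
def SpanR (p : ℕ) (M : Subgroup G) (B : (G → ℂ) → Prop) : Prop :=
  ∀ f, ClassOn M f → ∃ g ∈ Submodule.span ℂ {θ | B θ}, ∀ x ∈ M, ¬ p ∣ orderOf x → f x = g x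

variable {M X : Subgroup G} {B : (G → ℂ) → Prop} {s : Finset (G → ℂ)}
  {J : (G → ℂ) → Subgroup G} {κ : (G → ℂ) → G → ℂ}

theorem FongAt.expand (hs : ∀ θ, θ ∈ s ↔ B θ) (hF : ∀ θ, B θ → FongAt p M X B θ (J θ) (κ θ))
    {g : G → ℂ} (hg : g ∈ Submodule.span ℂ {θ | B θ}) :
    g = ∑ θ ∈ s, ip (J θ) g (κ θ) • θ := by
  induction hg using Submodule.span_induction with
  | mem θ hθ =>
    rw [Finset.sum_eq_single θ]
    · rw [(hF θ hθ).one θ hθ, if_pos rfl, one_smul]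
    · intro ψ hψ hne
      rw [(hF ψ ((hs ψ).mp hψ)).one θ hθ, if_neg hne.symm, zero_smul]
    · exact fun h => absurd ((hs θ).mpr hθ) h
  | zero => simp [ip_zero_left]
  | add f h _ _ h1 h2 =>
    conv_lhs => rw [h1, h2]
    rw [← Finset.sum_add_distrib]
    exact Finset.sum_congr rfl fun θ _ => by rw [ip_add_left, add_smul]
  | smul c f _ h1 =>
    conv_lhs => rw [h1]
    rw [Finset.smul_sum]
    exact Finset.sum_congr rfl fun θ _ => by rw [ip_smul_left, mul_smul]

theorem FongAt.ip_congr {J : Subgroup G} {θ κ f g : G → ℂ} (h : FongAt p M X B θ J κ)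
    (he : ∀ x ∈ M, ¬ p ∣ orderOf x → f x = g x) : ip J f κ = ip J g κ := by
  unfold ip
  congr 1
  refine Finset.sum_congr rfl fun x _ => ?_
  by_cases hx : x ∈ J
  · rw [he x (h.le hx) (h.reg x hx)]
  · rw [h.irr.1 x hx]
    simp

theorem SpanR.kernel (hS : SpanR p M B) (hs : ∀ θ, θ ∈ s ↔ B θ)
    (hF : ∀ θ, B θ → FongAt p M X B θ (J θ) (κ θ)) {f : G → ℂ} (hf : ClassOn M f) {x : G}
    (hx : x ∈ M) (hr : ¬ p ∣ orderOf x) : f x = ∑ θ ∈ s, ip (J θ) f (κ θ) * θ x := by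
  obtain ⟨g, hg, he⟩ := hS f hf
  have e := congrFun (FongAt.expand hs hF hg) x
  rw [Finset.sum_apply] at e
  rw [he x hx hr, e]
  exact Finset.sum_congr rfl fun θ hθ => by
    rw [Pi.smul_apply, smul_eq_mul, (hF θ ((hs θ).mp hθ)).ip_congr he]

theorem orderOf_conj' (m y : G) : orderOf (m⁻¹ * y * m) = orderOf y := by
  have := orderOf_injective (MulAut.conj m⁻¹).toMonoidHom (MulAut.conj m⁻¹).injective y
  simpa using this

/-- The number of `g`-invariant members of `B`, computed on `p`-regular elements. -/
theorem SpanR.count (hS : SpanR p M B) (hs : ∀ θ, θ ∈ s ↔ B θ)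
    (hF : ∀ θ, B θ → ∃ J κ, FongAt p M X B θ J κ) {g : G}
    (hB : ∀ θ, B θ → ClassOn M θ ∧ B (cj g θ)) (hg : cjS g M = M) :
    Nat.card M * (s.filter fun θ => cj g θ = θ).card =
      (Finset.univ.filter fun z : G × G => z.1 ∈ M ∧ ¬ p ∣ orderOf z.1 ∧ z.2 ∈ M ∧
        z.2⁻¹ * z.1 * z.2 = g⁻¹ * z.1 * g).card := by
  choose! J κ hF using hF
  have hgM : ∀ m, g⁻¹ * m * g ∈ M ↔ m ∈ M := fun m => by rw [← mem_cjS, hg]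
  have h1 : (((s.filter fun θ => cj g θ = θ).card : ℕ) : ℂ) =
      ∑ θ ∈ s, ip (J θ) (cj g θ) (κ θ) := by
    rw [Finset.card_filter, Nat.cast_sum]
    refine Finset.sum_congr rfl fun θ hθ => ?_
    rw [(hF θ ((hs θ).mp hθ)).one _ (hB θ ((hs θ).mp hθ)).2]
    split_ifs <;> simp
  have h2 : ∀ θ ∈ s, ∀ m ∈ M, ip (J θ) (cj g θ) (κ θ) = (Nat.card (J θ) : ℂ)⁻¹ *
      ∑ y, θ (g⁻¹ * y * g) * (starRingEnd ℂ) (κ θ (m⁻¹ * y * m)) := by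
    intro θ hθ m hm
    unfold ip
    congr 1
    refine Fintype.sum_equiv (MulAut.conj m).toEquiv _ _ fun y => ?_
    have e := congrFun ((hB θ ((hs θ).mp hθ)).1.cj_eq ((hgM m).mpr hm)) (g⁻¹ * (m * y * m⁻¹) * g)
    simp only [cj] at e
    simp only [MulEquiv.toEquiv_eq_coe, EquivLike.coe_coe, MulAut.conj_apply, cj]
    rw [← e]
    congr 2
    · group
    · group
  have h3 : ∀ θ ∈ s, (Nat.card M : ℂ) * ip (J θ) (cj g θ) (κ θ) = ∑ y,
      if y ∈ M ∧ ¬ p ∣ orderOf y then ip (J θ) (fun z => ∑ m, if m ∈ M then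
        (if m⁻¹ * y * m = z then (1 : ℂ) else 0) else 0) (κ θ) * θ (g⁻¹ * y * g) else 0 := by
    intro θ hθ
    have e1 : (Nat.card M : ℂ) * ip (J θ) (cj g θ) (κ θ) =
        ∑ m, if m ∈ M then ip (J θ) (cj g θ) (κ θ) else 0 := by
      rw [← sum_subgroup M (fun _ => ip (J θ) (cj g θ) (κ θ))]
      simp
    have e2 : ∀ y, ip (J θ) (fun z => ∑ m, if m ∈ M then
        (if m⁻¹ * y * m = z then (1 : ℂ) else 0) else 0) (κ θ) = (Nat.card (J θ) : ℂ)⁻¹ *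
        ∑ m, if m ∈ M then (starRingEnd ℂ) (κ θ (m⁻¹ * y * m)) else 0 := by
      intro y
      unfold ip
      congr 1
      simp only [Finset.sum_mul]
      rw [Finset.sum_comm]
      refine Finset.sum_congr rfl fun m _ => ?_
      split_ifs with hm
      · simp
      · simp
    rw [e1, Finset.sum_congr rfl (g := fun m => ∑ y, if m ∈ M then (Nat.card (J θ) : ℂ)⁻¹ *
      (θ (g⁻¹ * y * g) * (starRingEnd ℂ) (κ θ (m⁻¹ * y * m))) else 0) (fun m _ => by
        split_ifs with hm
        · rw [h2 θ hθ m hm, Finset.mul_sum]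
        · simp), Finset.sum_comm]
    refine Finset.sum_congr rfl fun y _ => ?_
    split_ifs with hy
    · rw [e2, Finset.mul_sum, Finset.sum_mul]
      refine Finset.sum_congr rfl fun m _ => ?_
      split_ifs
      · ring
      · simp
    · refine Finset.sum_eq_zero fun m _ => ?_
      split_ifs with hm
      · have hF' := hF θ ((hs θ).mp hθ)
        rw [hF'.irr.1 (m⁻¹ * y * m)]
        · simp
        · intro hJ
          refine hy ⟨?_, by rw [← orderOf_conj' m]; exact hF'.reg _ hJ⟩
          have := M.mul_mem (M.mul_mem hm (hF'.le hJ)) (M.inv_mem hm)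
          simpa [mul_assoc] using this
      · rfl
  have h4 : ∀ y, y ∈ M ∧ ¬ p ∣ orderOf y → ∑ θ ∈ s, ip (J θ) (fun z => ∑ m, if m ∈ M then
        (if m⁻¹ * y * m = z then (1 : ℂ) else 0) else 0) (κ θ) * θ (g⁻¹ * y * g) =
        ∑ m, if m ∈ M then (if m⁻¹ * y * m = g⁻¹ * y * g then (1 : ℂ) else 0) else 0 := by
    intro y hy
    refine (hS.kernel hs hF (f := fun z => ∑ m, if m ∈ M then
        (if m⁻¹ * y * m = z then (1 : ℂ) else 0) else 0) (ClassOn.of_cj ?_ ?_)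
        ((hgM y).mpr hy.1) (by rw [orderOf_conj']; exact hy.2)).symm
    · intro z hz
      refine Finset.sum_eq_zero fun m _ => ?_
      split_ifs with hm e
      · exact absurd (e ▸ M.mul_mem (M.mul_mem (M.inv_mem hm) hy.1) hm) hz
      · rfl
      · rfl
    · intro x hx
      ext z
      simp only [cj]
      refine Fintype.sum_equiv (Equiv.mulRight x⁻¹) _ _ fun m => ?_
      simp only [Equiv.coe_mulRight]
      have e3 : m * x⁻¹ ∈ M ↔ m ∈ M := M.mul_mem_cancel_right (M.inv_mem hx)
      have e4 : m⁻¹ * y * m = x⁻¹ * z * x ↔ (m * x⁻¹)⁻¹ * y * (m * x⁻¹) = z := by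
        rw [show (m * x⁻¹)⁻¹ * y * (m * x⁻¹) = x * (m⁻¹ * y * m) * x⁻¹ by group]
        constructor
        · intro e
          rw [e]
          group
        · rintro rfl
          group
      rw [mul_inv_rev, inv_inv] at e4
      by_cases hm : m ∈ M
      · by_cases e : m⁻¹ * y * m = x⁻¹ * z * x
        · simp [hm, e3, e, e4.mp e]
        · simp [hm, e3, e, mt e4.mpr e]
      · simp [hm, e3]
  have h5 : ((Nat.card M * (s.filter fun θ => cj g θ = θ).card : ℕ) : ℂ) =
      ((Finset.univ.filter fun z : G × G => z.1 ∈ M ∧ ¬ p ∣ orderOf z.1 ∧ z.2 ∈ M ∧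
        z.2⁻¹ * z.1 * z.2 = g⁻¹ * z.1 * g).card : ℕ) := by
    rw [Nat.cast_mul, h1, Finset.mul_sum, Finset.sum_congr rfl h3, Finset.sum_comm,
      Finset.card_filter, Nat.cast_sum, Fintype.sum_prod_type]
    refine Finset.sum_congr rfl fun y _ => ?_
    by_cases hy : y ∈ M ∧ ¬ p ∣ orderOf y
    · simp only [if_pos hy]
      rw [h4 y hy]
      refine Finset.sum_congr rfl fun m _ => ?_
      by_cases hm : m ∈ M <;> simp [hy.1, hy.2, hm]
    · simp only [if_neg hy]
      rw [Finset.sum_const_zero, Finset.sum_eq_zero]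
      intro m _
      rw [if_neg (fun h => hy ⟨h.1, h.2.1⟩), Nat.cast_zero]
  exact_mod_cast h5

end Kernel

section Span
variable {G : Type} [Group G]

/-- Exponents extracting the `p'`-part and the `p`-part of every element. -/
theorem exists_parts [Finite G] {p : ℕ} (hp : p.Prime) : ∃ a b e : ℕ, ∀ g : G, g ^ a * g ^ b = g ∧
    ¬ p ∣ orderOf (g ^ a) ∧ (¬ p ∣ orderOf g → g ^ a = g ∧ g ^ b = 1) ∧ (g ^ b) ^ a = 1 ∧
    (g ^ b) ^ b = g ^ b ∧ (g ^ b) ^ p ^ e = 1 := by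
  obtain ⟨e, m, hm, hc⟩ := Nat.exists_eq_pow_mul_and_not_dvd (Nat.card_pos (α := G)).ne' p hp.ne_one
  have hco : (p ^ e).Coprime m := (hp.coprime_iff_not_dvd.mpr hm).pow_left e
  obtain ⟨a, ha0, ha1⟩ := Nat.chineseRemainder hco 0 1
  obtain ⟨b, hb1, hb0⟩ := Nat.chineseRemainder hco 1 0
  have hpw : ∀ (g : G) (u v : ℕ), u ≡ v [MOD p ^ e] → u ≡ v [MOD m] → g ^ u = g ^ v := by
    intro g u v h1 h2
    rw [pow_eq_pow_iff_modEq]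
    exact ((Nat.modEq_and_modEq_iff_modEq_mul hco).mp ⟨h1, h2⟩).of_dvd (hc ▸ orderOf_dvd_natCard g)
  refine ⟨a, b, e, fun g => ⟨?_, ?_, ?_, ?_, ?_, ?_⟩⟩
  · rw [← pow_add, hpw g (a + b) 1 (by simpa using ha0.add hb1) (by simpa using ha1.add hb0), pow_one]
  · intro h
    refine hm (h.trans (orderOf_dvd_of_pow_eq_one ?_))
    rw [← pow_mul, hpw g (a * m) 0 (by simpa using ha0.mul_right m)
      ((Nat.modEq_zero_iff_dvd).mpr (dvd_mul_left _ _)), pow_zero]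
  · intro hg
    have hd : orderOf g ∣ m := by
      have := hc ▸ orderOf_dvd_natCard g
      exact (coprime_of_not_dvd hp hg e).dvd_of_dvd_mul_left this
    refine ⟨?_, ?_⟩
    · conv_rhs => rw [← pow_one g]
      exact pow_eq_pow_iff_modEq.mpr (ha1.of_dvd hd)
    · rw [← pow_zero g]
      exact pow_eq_pow_iff_modEq.mpr (hb0.of_dvd hd)
  · rw [← pow_mul, hpw g (b * a) 0 (by simpa using ha0.mul_left b) (by simpa using hb0.mul_right a),
      pow_zero]
  · rw [← pow_mul, hpw g (b * b) b (by simpa using hb1.mul_left b)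
      (by simpa using (hb0.mul_right b).trans (by simpa using hb0.symm))]
  · rw [← pow_mul, hpw g (b * p ^ e) 0 ((Nat.modEq_zero_iff_dvd).mpr (dvd_mul_left _ _))
      (by simpa using hb0.mul_right (p ^ e)), pow_zero]

variable {p r : ℕ} {K L X : Subgroup G} {l : G → ℂ} {BK BL : (G → ℂ) → Prop}

/-- The `p`-regular elements of `L` in the coset of `x₀` modulo the kernel of `l`. -/
def RegCoset (p : ℕ) (L : Subgroup G) (l : G → ℂ) (x₀ : G) : Type :=
  {x : G // x ∈ L ∧ ¬ p ∣ orderOf x ∧ l x = l x₀}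

theorem orderOf_conj'' [Fintype G] (m y : G) : orderOf (m * y * m⁻¹) = orderOf y := by
  simpa using orderOf_conj' m⁻¹ y

/-- Conjugation action on a coset. -/
def Step.act [Fintype G] (h : Step K L l r) (p : ℕ) (x₀ : G) : MulAction K (RegCoset p L l x₀) where
  smul k x := ⟨k * x.1 * (k : G)⁻¹, L.mul_mem (L.mul_mem (h.le k.2) x.2.1) (L.inv_mem (h.le k.2)),
    by rw [orderOf_conj'']; exact x.2.2.1, by rw [h.lin.conj_apply (h.le k.2) x.2.1, x.2.2.2]⟩
  one_smul x := Subtype.ext (by change (1 : G) * x.1 * (1 : G)⁻¹ = x.1; simp)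
  mul_smul k j x := Subtype.ext (by
    change ((k : G) * j) * x.1 * ((k : G) * j)⁻¹ = k * (j * x.1 * (j : G)⁻¹) * (k : G)⁻¹; group)

theorem Step.orbits [Fintype G] (h : Step K L l r) (hp : p.Prime) (hrp : r ≠ p) {x₀ : G}
    (hx : x₀ ∈ L) :
    letI := h.act p x₀
    Nat.card (Quotient (MulAction.orbitRel K (RegCoset p L l x₀))) * Nat.card K =
      (Finset.univ.filter fun z : G × G => z.1 ∈ K ∧ ¬ p ∣ orderOf z.1 ∧ z.2 ∈ K ∧
        z.2⁻¹ * z.1 * z.2 = x₀⁻¹ * z.1 * x₀).card := by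
  letI := h.act p x₀
  haveI : Fintype (RegCoset p L l x₀) := inferInstanceAs (Fintype {x : G // _})
  have e1 := MulAction.sum_card_fixedBy_eq_card_orbits_mul_card_group K (RegCoset p L l x₀)
  simp only [Nat.card_eq_fintype_card]
  rw [← e1]
  have e2 : ∑ a : K, Fintype.card (MulAction.fixedBy (RegCoset p L l x₀) a) =
      (Finset.univ.filter fun z : G × G => z.1 ∈ K ∧ z.2 ∈ L ∧ ¬ p ∣ orderOf z.2 ∧ l z.2 = l x₀ ∧
        z.1 * z.2 = z.2 * z.1).card := by
    rw [← Fintype.card_sigma, ← Fintype.card_subtype]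
    refine Fintype.card_congr ⟨fun z => ⟨(z.1.1, z.2.1.1), z.1.2, z.2.1.2.1, z.2.1.2.2.1,
      z.2.1.2.2.2, ?_⟩, fun z => ⟨⟨z.1.1, z.2.1⟩, ⟨⟨z.1.2, z.2.2.1, z.2.2.2.1, z.2.2.2.2.1⟩, ?_⟩⟩,
      fun z => rfl, fun z => rfl⟩
    · have := congrArg Subtype.val z.2.2
      exact mul_inv_eq_iff_eq_mul.mp this
    · exact Subtype.ext (mul_inv_eq_iff_eq_mul.mpr z.2.2.2.2.2)
  rw [e2]
  obtain ⟨a, b, e, H⟩ := exists_parts (G := G) hp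
  have hbK : ∀ x ∈ L, x ^ b ∈ K := fun x hxL => by
    refine h.mem_of_pow (L.pow_mem hxL b) (n := p ^ e) (fun hd => hrp ?_) ?_
    · exact (Nat.prime_dvd_prime_iff_eq h.prime hp).mp (h.prime.dvd_of_dvd_pow hd)
    · rw [(H x).2.2.2.2.2]
      exact K.one_mem
  have hla : ∀ x ∈ L, l (x ^ a) = l x := fun x hxL => by
    have e3 := congrArg l (H x).1
    rw [h.lin.2.2 _ (L.pow_mem hxL a) _ (L.pow_mem hxL b),
      ((h.mem _).mp (hbK x hxL)).2, mul_one] at e3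
    exact e3
  refine Finset.card_nbij' (fun z => (z.1 ^ a, (z.2 * z.1 ^ b)⁻¹ * x₀))
    (fun z => (z.1 * (x₀ * z.2⁻¹) ^ b, (x₀ * z.2⁻¹) ^ a)) ?_ ?_ ?_ ?_
  · rintro ⟨k, x⟩ hz
    simp only [Finset.coe_filter, Finset.mem_univ, true_and, Set.mem_setOf_eq] at hz ⊢
    obtain ⟨hk, hxL, hr, hl, hc⟩ := hz
    refine ⟨K.pow_mem hk a, (H k).2.1, (h.mem _).mpr ⟨L.mul_mem (L.inv_mem (L.mul_mem hxL
      (h.le (K.pow_mem hk b)))) hx, ?_⟩, ?_⟩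
    · have e3 : l (x * k ^ b) = l x₀ := by
        rw [h.lin.2.2 _ hxL _ (h.le (K.pow_mem hk b)), ((h.mem _).mp (K.pow_mem hk b)).2, mul_one, hl]
      have hm : x * k ^ b ∈ L := L.mul_mem hxL (h.le (K.pow_mem hk b))
      rw [h.lin.2.2 _ (L.inv_mem hm) _ hx, ← e3, h.lin.map_inv hm]
    · have hc' : Commute (x * k ^ b) (k ^ a) := by
        have : Commute k x := hc
        exact ((this.pow_left a).symm).mul_left ((Commute.refl k).pow_pow b a)
      have : (x * k ^ b) * k ^ a * (x * k ^ b)⁻¹ = k ^ a := mul_inv_eq_iff_eq_mul.mpr hc'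
      rw [show ((x * k ^ b)⁻¹ * x₀)⁻¹ * k ^ a * ((x * k ^ b)⁻¹ * x₀) =
        x₀⁻¹ * ((x * k ^ b) * k ^ a * (x * k ^ b)⁻¹) * x₀ by group, this]
  · rintro ⟨y, m⟩ hz
    simp only [Finset.coe_filter, Finset.mem_univ, true_and, Set.mem_setOf_eq] at hz ⊢
    obtain ⟨hy, hr, hm, hc⟩ := hz
    have hh : x₀ * m⁻¹ ∈ L := L.mul_mem hx (L.inv_mem (h.le hm))
    have hc' : Commute y (x₀ * m⁻¹) := by
      change y * (x₀ * m⁻¹) = (x₀ * m⁻¹) * y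
      have : x₀ * (m⁻¹ * y * m) * m⁻¹ = x₀ * (x₀⁻¹ * y * x₀) * m⁻¹ := by rw [hc]
      simpa [mul_assoc] using this.symm
    refine ⟨K.mul_mem hy (hbK _ hh), L.pow_mem hh a, (H _).2.1, ?_, ?_⟩
    · rw [hla _ hh, h.lin.2.2 _ hx _ (L.inv_mem (h.le hm)), ((h.mem _).mp (K.inv_mem hm)).2, mul_one]
    · exact ((hc'.pow_right a).mul_left ((Commute.refl _).pow_pow b a)).eq
  · rintro ⟨k, x⟩ hz
    simp only [Finset.coe_filter, Finset.mem_univ, true_and, Set.mem_setOf_eq] at hz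
    obtain ⟨hk, hxL, hr, hl, hc⟩ := hz
    have hc' : Commute x k := hc.symm
    have e3 : x₀ * ((x * k ^ b)⁻¹ * x₀)⁻¹ = x * k ^ b := by group
    simp only [e3, Prod.mk.injEq]
    rw [(hc'.pow_right b).mul_pow, (hc'.pow_right b).mul_pow, ((H x).2.2.1 hr).1,
      ((H x).2.2.1 hr).2, (H k).2.2.2.1, (H k).2.2.2.2.1, one_mul, mul_one]
    exact ⟨(H k).1, rfl⟩
  · rintro ⟨y, m⟩ hz
    simp only [Finset.coe_filter, Finset.mem_univ, true_and, Set.mem_setOf_eq] at hz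
    obtain ⟨hy, hr, hm, hc⟩ := hz
    have hc' : Commute y (x₀ * m⁻¹) := by
      change y * (x₀ * m⁻¹) = (x₀ * m⁻¹) * y
      have : x₀ * (m⁻¹ * y * m) * m⁻¹ = x₀ * (x₀⁻¹ * y * x₀) * m⁻¹ := by rw [hc]
      simpa [mul_assoc] using this.symm
    simp only [Prod.mk.injEq]
    rw [(hc'.pow_right b).mul_pow, (hc'.pow_right b).mul_pow, ((H y).2.2.1 hr).1,
      ((H y).2.2.1 hr).2, (H _).2.2.2.1, (H _).2.2.2.2.1, one_mul, mul_one, (H (x₀ * m⁻¹)).1]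
    exact ⟨rfl, by group⟩


theorem span_classOn [Fintype G] (hB : ∀ θ, BK θ → Irr K θ) {g : G → ℂ}
    (hg : g ∈ Submodule.span ℂ {θ | BK θ}) : ClassOn K g := by
  induction hg using Submodule.span_induction with
  | mem θ hθ => exact (hB θ hθ).chr.classOn
  | zero => exact ClassOn.zero
  | add f h _ _ h1 h2 => exact h1.add h2
  | smul c f _ h1 => exact h1.smul c

theorem span_ind [Fintype G] (hKL : K ≤ L) (hB : ∀ θ, BK θ → Irr K θ)
    (hover : ∀ η θ, Irr L η → BK θ → ip K η θ ≠ 0 → BL η) {g : G → ℂ}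
    (hg : g ∈ Submodule.span ℂ {θ | BK θ}) : ind K L g ∈ Submodule.span ℂ {θ | BL θ} := by
  induction hg using Submodule.span_induction with
  | mem θ hθ =>
    rw [((hB θ hθ).chr.ind hKL).classOn.expand]
    refine Submodule.sum_mem _ fun χ hχ => ?_
    by_cases h0 : ip L (ind K L θ) χ = 0
    · rw [h0, zero_smul]
      exact Submodule.zero_mem _
    · have hχ' := mem_IrrF.mp hχ
      refine Submodule.smul_mem _ _ (Submodule.subset_span (hover χ θ hχ' hθ ?_))
      rw [ip_ind_left _ hχ'.chr.classOn] at h0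
      exact ip_ne_comm.mp h0
  | zero => rw [ind_zero]; exact Submodule.zero_mem _
  | add f h _ _ h1 h2 => rw [ind_add]; exact Submodule.add_mem _ h1 h2
  | smul c f _ h1 => rw [ind_smul]; exact Submodule.smul_mem _ _ h1

theorem sum_pr [Fintype G] (L : Subgroup G) : ∑ y, pr L y = Nat.card L := by
  simp only [pr, ← sum_subgroup L fun _ => (1 : ℂ), Finset.sum_const, Finset.card_univ, nsmul_eq_mul,
    mul_one, Nat.card_eq_fintype_card]

theorem ind_congr_reg [Fintype G] {f g : G → ℂ} (hf : ∀ x, x ∉ K → f x = 0)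
    (hg : ∀ x, x ∉ K → g x = 0) (he : ∀ x ∈ K, ¬ p ∣ orderOf x → f x = g x) {x : G}
    (hx : ¬ p ∣ orderOf x) : ind K L f x = ind K L g x := by
  unfold ind
  congr 1
  refine Finset.sum_congr rfl fun y _ => ?_
  by_cases hy : y * x * y⁻¹ ∈ K
  · rw [he _ hy (by rwa [orderOf_conj''])]
  · rw [hf _ hy, hg _ hy]

theorem SpanR.step [Fintype G] {X' : Subgroup G} (hp : p.Prime) (h : Step K L l r) (hrp : r ≠ p) {s : Finset (G → ℂ)}
    (hS : SpanR p K BK) (hs : ∀ θ, θ ∈ s ↔ BK θ)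
    (hK : ∀ θ, BK θ → Irr K θ ∧ (∀ x ∈ L, BK (cj x θ)) ∧ ∃ J κ, FongAt p K X BK θ J κ)
    (hL : ∀ η, BL η ↔ Irr L η ∧ ∀ θ, Irr K θ → ip K η θ ≠ 0 → BK θ)
    (hLF : ∀ η, BL η → ∃ J κ, FongAt p L X' BL η J κ) : SpanR p L BL := by
  have hover : ∀ η θ, Irr L η → BK θ → ip K η θ ≠ 0 → BL η := by
    intro η θ hη hθ h0
    refine (hL η).mpr ⟨hη, fun θ' hθ' h0' => ?_⟩
    obtain ⟨x, hx, rfl⟩ := h.nrm.conj_const hη (hK θ hθ).1 hθ' h0 h0'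
    exact (hK θ hθ).2.1 x hx
  have hcL : (Nat.card L : ℂ) ≠ 0 := card_ne_zero' L
  have hcK : (Nat.card K : ℂ) ≠ 0 := card_ne_zero' K
  have hr0 : (r : ℂ) ≠ 0 := Nat.cast_ne_zero.mpr h.prime.ne_zero
  have hprK : ClassOn L (pr K) := by
    refine ⟨fun g hg => if_neg fun hK => hg (h.le hK), fun x hx g => ?_⟩
    simp only [pr, h.nrm.conj_mem_iff hx]
  have hkey : ∀ x₀ ∈ L, ∀ f, ClassOn L f → ∃ g ∈ Submodule.span ℂ {θ | BL θ}, ∀ x ∈ L,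
      ¬ p ∣ orderOf x → f x * pr K (x * x₀⁻¹) = g x := by
    intro x₀ hx₀ f hf
    by_cases hx₀K : x₀ ∈ K
    · obtain ⟨g, hg, he⟩ := hS (res K f) ((show ClassOn K (res K f) from
        ⟨res_supp K f, fun x hx g => by
          simp only [res, K.mul_mem_cancel_right (K.inv_mem hx), K.mul_mem_cancel_left hx,
            hf.2 x (h.le hx)]⟩))
      refine ⟨((Nat.card K : ℂ) / Nat.card L) • ind K L g, Submodule.smul_mem _ _ ?_, ?_⟩
      · exact span_ind h.le (fun θ hθ => (hK θ hθ).1) hover hg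
      · intro x hx hr
        have e2 : res K f = pr K * f := by
          ext y
          simp only [res, Pi.mul_apply, pr]
          split_ifs <;> simp
        rw [Pi.smul_apply, smul_eq_mul, ← ind_congr_reg (res_supp K f) (span_classOn (fun θ hθ =>
          (hK θ hθ).1) hg).1 he hr, e2, ind_mul K L (pr K) hf, Pi.mul_apply]
        have e3 : ind K L (pr K) x = (Nat.card K : ℂ)⁻¹ * (Nat.card L * pr K x) := by
          have e5 : ∀ y, (if y ∈ L then pr K (y * x * y⁻¹) else 0) = pr K x * pr L y := by
            intro y
            by_cases hy : y ∈ L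
            · rw [if_pos hy, hprK.2 y hy, pr_of_mem hy, mul_one]
            · simp [pr, hy]
          unfold ind
          rw [Finset.sum_congr rfl fun y _ => e5 y, ← Finset.mul_sum, sum_pr, mul_comm (pr K x)]
        have e4 : pr K (x * x₀⁻¹) = pr K x := by
          simp only [pr, K.mul_mem_cancel_right (K.inv_mem hx₀K)]
        rw [e3, e4]
        field_simp
    · have hl0 := h.lin.ne_zero hx₀
      have hl1 : l x₀ ≠ 1 := fun e => hx₀K ((h.mem _).mpr ⟨hx₀, e⟩)
      set S := s.filter fun θ => cj x₀ θ = θ with hSdef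
      letI := h.act p x₀
      haveI : Fintype (RegCoset p L l x₀) := inferInstanceAs (Fintype {x : G // _})
      have hcount : S.card = Nat.card (Quotient (MulAction.orbitRel K (RegCoset p L l x₀))) := by
        have e1 := hS.count hs (fun θ hθ => (hK θ hθ).2.2) (g := x₀)
          (fun θ hθ => ⟨(hK θ hθ).1.chr.classOn, (hK θ hθ).2.1 x₀ hx₀⟩) (h.nrm.cjS hx₀)
        rw [← h.orbits hp hrp hx₀, mul_comm] at e1
        exact Nat.eq_of_mul_eq_mul_right Nat.card_pos e1
      have hext : ∀ θ ∈ S, ∃ η, BL η ∧ res K η = θ ∧ ∀ j, η * lpow L l j = η → r ∣ j := by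
        intro θ hθ
        obtain ⟨hθs, hθx⟩ := Finset.mem_filter.mp hθ
        have hθ' := hK θ ((hs θ).mp hθs)
        have hst : _root_.stab L θ = L := by
          refine (h.eq_or_eq (h.nrm.le_stab hθ'.1.chr.classOn) (stab_le L θ)).resolve_left fun e => ?_
          exact hx₀K (e ▸ mem_stab.mpr ⟨hx₀, hθx⟩)
        obtain ⟨η, hη, h0⟩ := hθ'.1.exists_over h.le
        obtain ⟨e1, -, e3⟩ := h.ext hη hθ'.1 h0 fun x hx => (mem_stab.mp (hst ▸ hx : x ∈ _)).2
        exact ⟨η, hover η θ hη ((hs θ).mp hθs) h0, e1, e3⟩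
      choose! E hE using hext
      let v : S → Quotient (MulAction.orbitRel K (RegCoset p L l x₀)) → ℂ := fun θ =>
        Quotient.lift (fun x => E θ x.1) (by
          rintro x y ⟨k, rfl⟩
          exact ((hL _).mp (hE θ θ.2).1).1.chr.classOn.2 k (h.le k.2) y.1)
      have hpt : ∀ x ∈ L, pr K (x * x₀⁻¹) = (r : ℂ)⁻¹ * ∑ j ∈ Finset.range r,
          (l x₀)⁻¹ ^ j * lpow L l j x := by
        intro x hx
        have hm : x * x₀⁻¹ ∈ L := L.mul_mem hx (L.inv_mem hx₀)
        have e0 : l x₀⁻¹ = (l x₀)⁻¹ := eq_inv_of_mul_eq_one_left (h.lin.map_inv hx₀)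
        rw [← mul_right_inj' hr0, ← h.sum_lpow, mul_inv_cancel_left₀ hr0]
        refine Finset.sum_congr rfl fun j _ => ?_
        simp only [lpow, if_pos hm, if_pos hx]
        rw [h.lin.2.2 _ hx _ (L.inv_mem hx₀), e0, mul_pow, mul_comm]
      have hval : ∀ c : S → ℂ, ∀ x ∈ L, (∑ θ : S, c θ • ((r : ℂ)⁻¹ • ∑ j ∈ Finset.range r,
          (l x₀)⁻¹ ^ j • (E θ * lpow L l j))) x = (∑ θ : S, c θ * E θ x) * pr K (x * x₀⁻¹) := by
        intro c x hx
        rw [hpt x hx]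
        simp only [Finset.sum_apply, Pi.smul_apply, Pi.mul_apply, smul_eq_mul, Finset.sum_mul]
        refine Finset.sum_congr rfl fun θ _ => ?_
        rw [mul_assoc, mul_left_comm (E θ x)]
        congr 2
        rw [Finset.mul_sum]
        refine Finset.sum_congr rfl fun j _ => ?_
        ring
      have hEB : ∀ θ ∈ S, ∀ j, BL (E θ * lpow L l j) := by
        intro θ hθ j
        obtain ⟨h1, h2⟩ := (hL _).mp (hE θ hθ).1
        refine (hL _).mpr ⟨h1.mul_lin (h.lin.lpow j), fun ψ hψ h0 => h2 ψ hψ ?_⟩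
        rw [← ip_res_left K _ hψ.chr.1] at h0 ⊢
        rwa [res_mul, show res K (lpow L l j) = pr K by
          ext y
          by_cases hy : y ∈ K
          · simp [res, lpow, pr, hy, h.le hy, ((h.mem y).mp hy).2]
          · simp [res, pr, hy], mul_pr (res_supp K _)] at h0
      have hind : LinearIndependent ℂ v := by
        rw [Fintype.linearIndependent_iff]
        intro c hc θ
        obtain ⟨J, κ, hJ⟩ := hLF _ (hE θ θ.2).1
        have h1 := hJ.ip_congr (f := ∑ θ : S, c θ • ((r : ℂ)⁻¹ • ∑ j ∈ Finset.range r,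
          (l x₀)⁻¹ ^ j • (E θ * lpow L l j))) (g := 0) (fun x hx hr => by
            rw [hval c x hx, Pi.zero_apply]
            by_cases hxx : x * x₀⁻¹ ∈ K
            · have e2 : l x = l x₀ := by
                have := h.lin.2.2 _ (h.le hxx) _ hx₀
                rwa [((h.mem _).mp hxx).2, one_mul, inv_mul_cancel_right] at this
              have := congrFun hc (Quotient.mk _ ⟨x, hx, hr, e2⟩)
              simp only [Finset.sum_apply, Pi.smul_apply, smul_eq_mul, Pi.zero_apply] at this
              rw [show ∑ θ : S, c θ * E θ x = 0 from this, zero_mul]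
            · simp [pr, hxx])
        rw [ip_zero_left, ip_sum_left, Finset.sum_eq_single θ, ip_smul_left, ip_smul_left, ip_sum_left,
          Finset.sum_eq_single 0, ip_smul_left, hJ.one _ (hEB θ θ.2 0), if_pos] at h1
        · simpa [hr0] using h1
        · rw [lpow_zero, mul_pr ((hL _).mp (hE θ θ.2).1).1.chr.1]
        · intro j hj hj0
          rw [ip_smul_left, hJ.one _ (hEB θ θ.2 j), if_neg, mul_zero]
          exact fun e => hj0 (Nat.eq_zero_of_dvd_of_lt ((hE θ θ.2).2.2 j e) (Finset.mem_range.mp hj))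
        · exact fun hn => absurd (Finset.mem_range.mpr h.prime.pos) hn
        · intro ψ _ hne
          rw [ip_smul_left, ip_smul_left, ip_sum_left, Finset.sum_eq_zero, mul_zero, mul_zero]
          intro j _
          rw [ip_smul_left, hJ.one _ (hEB ψ ψ.2 j), if_neg, mul_zero]
          intro e
          have e' := congrArg (res K) e
          rw [res_mul, (hE θ θ.2).2.1, (hE ψ ψ.2).2.1, show res K (lpow L l j) = pr K by
            ext y
            by_cases hy : y ∈ K
            · simp [res, lpow, pr, hy, h.le hy, ((h.mem y).mp hy).2]
            · simp [res, pr, hy], mul_pr (hK ψ ((hs _).mp (Finset.mem_filter.mp ψ.2).1)).1.chr.1] at e'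
          exact hne (Subtype.ext e')
        · exact fun hn => absurd (Finset.mem_univ _) hn
      have hspan := hind.span_eq_top_of_card_eq_finrank' (by
        rw [Module.finrank_fintype_fun_eq_card, ← Nat.card_eq_fintype_card (α := Quotient _), ← hcount,
          Fintype.card_coe])
      have hfv : Quotient.lift (fun x : RegCoset p L l x₀ => f x.1) (by
          rintro x y ⟨k, rfl⟩
          exact hf.2 k (h.le k.2) y.1) ∈ Submodule.span ℂ (Set.range v) := by
        rw [hspan]
        trivial
      obtain ⟨c, hc⟩ := (Submodule.mem_span_range_iff_exists_fun ℂ).mp hfv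
      refine ⟨∑ θ : S, c θ • ((r : ℂ)⁻¹ • ∑ j ∈ Finset.range r, (l x₀)⁻¹ ^ j •
        (E θ * lpow L l j)), ?_, ?_⟩
      · exact Submodule.sum_mem _ fun θ _ => Submodule.smul_mem _ _ (Submodule.smul_mem _ _
          (Submodule.sum_mem _ fun j _ => Submodule.smul_mem _ _ (Submodule.subset_span
            (hEB θ θ.2 j))))
      · intro x hx hr
        rw [hval c x hx]
        by_cases hxx : x * x₀⁻¹ ∈ K
        · have e2 : l x = l x₀ := by
            have := h.lin.2.2 _ (h.le hxx) _ hx₀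
            rwa [((h.mem _).mp hxx).2, one_mul, inv_mul_cancel_right] at this
          have := congrFun hc (Quotient.mk _ ⟨x, hx, hr, e2⟩)
          simp only [Finset.sum_apply, Pi.smul_apply, smul_eq_mul] at this
          rw [show ∑ θ : S, c θ * E θ x = f x from this]
        · simp [pr, hxx]
  intro f hf
  choose! g hg using fun x₀ hx₀ => hkey x₀ hx₀ f hf
  refine ⟨(Nat.card K : ℂ)⁻¹ • ∑ y ∈ Finset.univ.filter (· ∈ L), g y, Submodule.smul_mem _ _
    (Submodule.sum_mem _ fun y hy => (hg y (Finset.mem_filter.mp hy).2).1), fun x hx hr => ?_⟩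
  rw [Pi.smul_apply, Finset.sum_apply, Finset.sum_congr rfl fun y hy =>
    ((hg y (Finset.mem_filter.mp hy).2).2 x hx hr).symm, ← Finset.mul_sum, Finset.sum_filter,
    Fintype.sum_equiv ((Equiv.inv G).trans (Equiv.mulLeft x)) _ (pr K) (fun y => ?_), sum_pr, smul_eq_mul]
  · field_simp
  · by_cases hy : y ∈ L
    · simp [hy]
    · have : x * y⁻¹ ∉ K := fun hn => hy (by
        simpa using L.mul_mem (L.inv_mem (h.le hn)) hx)
      simp [hy, pr, this]

end Span

section SpanSeries
variable {G : Type} [Group G] [Fintype G] {p : ℕ} {M L X : Subgroup G} {B : (G → ℂ) → Prop}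

/-- The irreducible characters of `L` all of whose constituents on `M` satisfy `B`. -/
def Over (M L : Subgroup G) (B : (G → ℂ) → Prop) (η : G → ℂ) : Prop :=
  Irr L η ∧ ∀ θ, Irr M θ → ip M η θ ≠ 0 → B θ

theorem Over.of_mid {Y : Subgroup G} (hML : Nrm M L) (hBL : ∀ θ, B θ → Irr M θ ∧ ∀ x ∈ L, B (cj x θ))
    (hMY : M ≤ Y) (hYL : Y ≤ L) {η θ : G → ℂ} (hη : Irr L η) (hθ : Over M Y B θ)
    (h0 : ip Y η θ ≠ 0) : Over M L B η := by
  refine ⟨hη, fun ω hω h1 => ?_⟩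
  obtain ⟨ω', hω', h2⟩ := hθ.1.exists_under hMY
  have h3 := hη.chr.ip_trans hMY hYL hω'.chr hθ.1 h0 h2
  obtain ⟨x, hx, rfl⟩ := hML.conj_const hη hω' hω h3 h1
  exact (hBL _ (hθ.2 _ hω' h2)).2 x hx

theorem SpanR.poly (hp : p.Prime) (hS : SpanR p M B) (hMX : Nrm M X)
    (hB : ∀ θ, B θ → Irr M θ ∧ (∀ x ∈ X, B (cj x θ)) ∧ ∃ J κ, FongAt p M X B θ J κ)
    (hP : Polyc M L) (hLX : L ≤ X) (hQ : QStep p M L) : SpanR p L (Over M L B) := by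
  have hF : ∀ K, M ≤ K → K ≤ L → ∀ η, Over M K B η →
      ∃ J κ, FongAt p K K (Over M K B) η J κ := by
    intro K hMK hKL η hη
    obtain ⟨θ, hθ, h0⟩ := hη.1.exists_under hMK
    obtain ⟨h1, h2, J, κ, h3⟩ := hB θ (hη.2 θ hθ h0)
    have h4 : FongAt p M K B θ J κ := ⟨h3.le, h3.reg, h3.irr, h3.one, fun x hx =>
      h3.tr x (hLX (hKL hx)), h3.mem⟩
    exact h4.qstep hp (hQ.mono hMK hKL) (Nrm.refl K) (hMX.mono hMK (hKL.trans hLX))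
      (fun θ h => (hB θ h).1) (fun θ h x hx => (hB θ h).2.1 x (hLX (hKL hx))) (fun η h => h) hη h0
      (hη.2 θ hθ h0)
  revert hLX hQ hF
  refine hP.induct (P := fun L => L ≤ X → QStep p M L → (∀ K, M ≤ K → K ≤ L → ∀ η, Over M K B η →
      ∃ J κ, FongAt p K K (Over M K B) η J κ) → SpanR p L (Over M L B)) ?_ ?_
  · intro _ _ _ f hf
    obtain ⟨g, hg, he⟩ := hS f hf
    have hsub : {θ | B θ} ⊆ {θ | Over M M B θ} := fun θ hθ => by
      refine ⟨(hB θ hθ).1, fun ω hω h0 => ?_⟩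
      rw [(hB θ hθ).1.orth hω] at h0
      have : θ = ω := by
        by_contra e
        exact h0 (if_neg e)
      exact this ▸ hθ
    exact ⟨g, Submodule.span_mono hsub hg, he⟩
  · intro L K l r hMK hP hs ih hLX hQ hF
    refine SpanR.step (X := K) (X' := L) (s := (IrrF K).filter (Over M K B)) hp hs ?_ (ih (hs.le.trans hLX)
      (hQ.mono hMK hs.le) fun K' h1 h2 => hF K' h1 (h2.trans hs.le)) ?_ ?_ ?_
      (hF L (hMK.trans hs.le) le_rfl)
    · rintro rfl
      obtain ⟨x, hx, hl⟩ := hs.nontriv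
      obtain ⟨m, hm, hxm⟩ := hQ.2 x hx
      exact hl ((hs.mem x).mp (hs.mem_of_pow hx hm (hMK hxm))).2
    · intro θ
      rw [Finset.mem_filter, mem_IrrF]
      exact ⟨fun h => h.2, fun h => ⟨h.1, h⟩⟩
    · intro θ hθ
      refine ⟨hθ.1, fun x hx => ⟨hs.nrm.irr_cj hx hθ.1, fun ω hω h0 => ?_⟩, hF K hMK hs.le θ hθ⟩
      have hx' := L.inv_mem hx
      have h1 := hθ.2 (cj x⁻¹ ω) (hQ.1.irr_cj hx' hω) (by
        rw [← hQ.1.ip_cj hx, cj_cj_inv]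
        exact h0)
      have h2 := (hB _ h1).2.1 x (hLX hx)
      rwa [cj_cj_inv] at h2
    · intro η
      refine ⟨fun h => ⟨h.1, fun θ hθ h0 => ⟨hθ, fun ω hω h1 => h.2 ω hω ?_⟩⟩,
        fun h => ⟨h.1, fun ω hω h1 => ?_⟩⟩
      · exact h.1.chr.ip_trans hMK hs.le hω.chr hθ h0 h1
      · obtain ⟨θ, hθ, h2, h3⟩ := h.1.chr.exists_mid hMK hs.le hω.chr.1 h1
        exact (h.2 θ hθ h2).2 ω hω h3

theorem SpanR.qstep (hp : p.Prime) (hS : SpanR p M B) (hMX : Nrm M X)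
    (hB : ∀ θ, B θ → Irr M θ ∧ (∀ x ∈ X, B (cj x θ)) ∧ ∃ J κ, FongAt p M X B θ J κ)
    (hLX : L ≤ X) (hQ : QStep p M L) : SpanR p L (Over M L B) := by
  intro f hf
  have key : ∀ g ∈ L, ∃ Y, M ≤ Y ∧ Y ≤ L ∧ g ∈ Y ∧ SpanR p Y (Over M Y B) := by
    intro g hg
    have hn : Nrm M (M ⊔ Subgroup.zpowers g) := hMX.mono le_sup_left
      (sup_le hMX.le (by simpa using hLX hg))
    have hYL : M ⊔ Subgroup.zpowers g ≤ L := sup_le hQ.1.le (by simpa using hg)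
    refine ⟨M ⊔ Subgroup.zpowers g, le_sup_left, hYL, Subgroup.mem_sup_right (by simp),
      hS.poly hp hMX hB (AbStep.poly ⟨hn, ?_⟩) (hYL.trans hLX) (hQ.mono le_sup_left hYL)⟩
    have hc : ∀ (k : ℤ) {m : G}, m ∈ M → g ^ k * m * (g ^ k)⁻¹ ∈ M := fun k m hm =>
      (hQ.1.conj_mem_iff (L.zpow_mem hg k)).mpr hm
    have hdec : ∀ x ∈ M ⊔ Subgroup.zpowers g, ∃ m ∈ M, ∃ k : ℤ, x = m * g ^ k := by
      intro x hx
      refine Subgroup.closure_induction (p := fun x _ => ∃ m ∈ M, ∃ k : ℤ, x = m * g ^ k)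
        ?_ ⟨1, M.one_mem, 0, by simp⟩ ?_ ?_ (Subgroup.sup_eq_closure M _ ▸ hx)
      · rintro x (hx | hx)
        · exact ⟨x, hx, 0, by simp⟩
        · obtain ⟨k, rfl⟩ := Subgroup.mem_zpowers_iff.mp hx
          exact ⟨1, M.one_mem, k, by simp⟩
      · rintro _ _ _ _ ⟨m, hm, j, rfl⟩ ⟨m', hm', k, rfl⟩
        exact ⟨m * (g ^ j * m' * (g ^ j)⁻¹), M.mul_mem hm (hc j hm'), j + k, by
          rw [zpow_add]; group⟩
      · rintro _ _ ⟨m, hm, j, rfl⟩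
        exact ⟨g ^ (-j) * m⁻¹ * (g ^ (-j))⁻¹, hc _ (M.inv_mem hm), -j, by group⟩
    rintro x hx y hy
    obtain ⟨m, hm, j, rfl⟩ := hdec x hx
    obtain ⟨m', hm', k, rfl⟩ := hdec y hy
    have e : m * g ^ j * (m' * g ^ k) * (m * g ^ j)⁻¹ * (m' * g ^ k)⁻¹ =
        m * (g ^ j * m' * (g ^ j)⁻¹) * (g ^ k * m⁻¹ * (g ^ k)⁻¹) * m'⁻¹ := by
      simp only [mul_inv_rev, mul_assoc, inv_mul_cancel_left, mul_left_cancel_iff]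
      simp only [← mul_assoc, mul_left_inj]
      rw [← zpow_neg, ← zpow_add, ← zpow_add, add_comm]
    rw [e]
    exact M.mul_mem (M.mul_mem (M.mul_mem hm (hc j hm')) (hc k (M.inv_mem hm))) (M.inv_mem hm')
  choose! Y hMY hYL hgY hSY using key
  have h1 : ∀ g ∈ L, ∃ u ∈ Submodule.span ℂ {θ | Over M L B θ}, ∀ x ∈ L, ¬ p ∣ orderOf x →
      ind (Y g) L (fun y => if y = g then 1 else 0) x = u x := by
    intro g hg
    have hs : ∀ y, y ∉ Y g → (if y = g then (1 : ℂ) else 0) = 0 := fun y hy =>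
      if_neg fun (e : y = g) => hy (e ▸ hgY g hg)
    have hc := ind_classOn (le_refl (Y g)) hs
    obtain ⟨u, hu, he⟩ := hSY g hg _ hc
    refine ⟨ind (Y g) L u, span_ind (hYL g hg) (fun θ h => h.1) (fun η θ hη hθ h0 => hθ.of_mid hQ.1
      (fun θ h => ⟨(hB θ h).1, fun x hx => (hB θ h).2.1 x (hLX hx)⟩) (hMY g hg) (hYL g hg) hη h0) hu,
      fun x _ hr => ?_⟩
    rw [← ind_congr_reg hc.1 (span_classOn (fun θ h => h.1) hu).1 he hr, ind_ind (hYL g hg)]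
  choose! u hu he using h1
  refine ⟨(Nat.card L : ℂ)⁻¹ • ∑ g ∈ Finset.univ.filter (· ∈ L), (f g * Nat.card (Y g)) • u g,
    Submodule.smul_mem _ _ (Submodule.sum_mem _ fun g hg => Submodule.smul_mem _ _
      (hu g (Finset.mem_filter.mp hg).2)), fun x hx hr => ?_⟩
  have h2 : ∀ g ∈ Finset.univ.filter (· ∈ L), ((f g * Nat.card (Y g)) • u g) x =
      ∑ z, if z ∈ L then (if z * x * z⁻¹ = g then f g else 0) else 0 := by
    intro g hg
    rw [Pi.smul_apply, ← he g (Finset.mem_filter.mp hg).2 x hx hr, smul_eq_mul, mul_assoc, ind,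
      mul_inv_cancel_left₀ (card_ne_zero' _), Finset.mul_sum]
    refine Finset.sum_congr rfl fun z _ => ?_
    split_ifs <;> simp
  rw [Pi.smul_apply, Finset.sum_apply, Finset.sum_congr rfl h2, Finset.sum_comm, smul_eq_mul,
    Finset.sum_congr rfl (g := fun z => f x * pr L z) fun z _ => ?_, ← Finset.mul_sum, sum_pr]
  · field_simp [card_ne_zero' L]
  · by_cases hz : z ∈ L
    · simp only [if_pos hz, pr, mul_one]
      rw [Finset.sum_ite_eq, if_pos (by simpa using L.mul_mem (L.mul_mem hz hx) (L.inv_mem hz)),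
        hf.2 z hz]
    · simp [hz, pr]

theorem SpanR.pstep {σ : ℂ →+* ℂ} (hσ : Sg p G σ) (hS : SpanR p M B) (hML : PStep p M L)
    {B' : (G → ℂ) → Prop} (hB : ∀ θ, B θ → Irr M θ ∧ mp σ θ = θ)
    (hB' : ∀ η θ, B θ → Irr L η → mp σ η = η → ip M η θ ≠ 0 → B' η) : SpanR p L B' := by
  intro f hf
  obtain ⟨g, hg, he⟩ := hS (res M f) ⟨res_supp M f, fun x hx y => by
    simp only [res, M.mul_mem_cancel_right (M.inv_mem hx), M.mul_mem_cancel_left hx,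
      hf.2 x (hML.1.le hx)]⟩
  have key : ∃ h ∈ Submodule.span ℂ {η | B' η}, ∀ x ∈ M,
      (∑ y, if y ∈ L then cj y g x else 0) = h x := by
    clear he
    induction hg using Submodule.span_induction with
    | mem θ hθ =>
      obtain ⟨η, hη, hησ, h1, -⟩ := hσ.exists_unique_over hML (hB θ hθ).1 (hB θ hθ).2
      have h0 : ip M η θ ≠ 0 := by rw [h1]; exact one_ne_zero
      refine ⟨(Nat.card (stab L θ) : ℂ) • η, Submodule.smul_mem _ _ (Submodule.subset_span
        (hB' η θ hθ hη hησ h0)), fun x hx => ?_⟩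
      rw [Pi.smul_apply, hML.1.res_eq hη (hB θ hθ).1 h0 hx, h1, smul_eq_mul, one_div,
        mul_inv_cancel_left₀ (card_ne_zero' _)]
    | zero => exact ⟨0, Submodule.zero_mem _, fun x _ => by simp [cj]⟩
    | add f h _ _ h1 h2 =>
      obtain ⟨u, hu, hu'⟩ := h1
      obtain ⟨v, hv, hv'⟩ := h2
      refine ⟨u + v, Submodule.add_mem _ hu hv, fun x hx => ?_⟩
      rw [Pi.add_apply, ← hu' x hx, ← hv' x hx, ← Finset.sum_add_distrib]
      exact Finset.sum_congr rfl fun y _ => by split_ifs <;> simp [cj]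
    | smul c f _ h1 =>
      obtain ⟨u, hu, hu'⟩ := h1
      refine ⟨c • u, Submodule.smul_mem _ _ hu, fun x hx => ?_⟩
      rw [Pi.smul_apply, ← hu' x hx, Finset.smul_sum]
      exact Finset.sum_congr rfl fun y _ => by split_ifs <;> simp [cj]
  obtain ⟨h, hh, hh'⟩ := key
  refine ⟨(Nat.card L : ℂ)⁻¹ • h, Submodule.smul_mem _ _ hh, fun x hx hr => ?_⟩
  have hxM := hML.mem_of_reg hσ.prime hx hr
  rw [Pi.smul_apply, ← hh' x hxM, Finset.sum_congr rfl (g := fun z => f x * pr L z) fun z _ => ?_,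
    ← Finset.mul_sum, sum_pr, smul_eq_mul]
  · field_simp [card_ne_zero' L]
  · by_cases hz : z ∈ L
    · have h1 := (hML.1.conj_mem_iff' hz).mpr hxM
      rw [if_pos hz, pr_of_mem hz, mul_one, cj, ← he _ h1 (by rwa [orderOf_conj']), res_of_mem h1]
      have := hf.2 z⁻¹ (L.inv_mem hz) x
      rwa [inv_inv] at this
    · simp [hz, pr]

variable {n : ℕ} {N : ℕ → Subgroup G} {σ : ℂ →+* ℂ}

theorem Bs.span (hσ : Sg p G σ) (hN : NSeries p n N ⊤) (X : Subgroup G) (i : ℕ) :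
    SpanR p (X ⊓ N i) (Bs σ N i X) := by
  induction i with
  | zero =>
    have h0 : X ⊓ N 0 = ⊥ := by rw [hN.zero, inf_bot_eq]
    rw [h0]
    intro f hf
    have h1 : Bs σ N 0 X (pr ⊥) := by
      refine ⟨h0 ▸ (lin_pr _).irr, fun j hj θ hθ _ => ?_⟩
      obtain rfl : j = 0 := by omega
      rw [h0] at hθ
      obtain ⟨k, -, hk⟩ := hθ.deg_pos
      ext g
      by_cases hg : g = 1
      · simp [_root_.mp, hg, hk]
      · have : θ g = 0 := hθ.chr.1 g (by simpa using hg)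
        simp [_root_.mp, this]
    refine ⟨f 1 • pr ⊥, Submodule.smul_mem _ _ (Submodule.subset_span h1), fun x hx _ => ?_⟩
    rw [Subgroup.mem_bot.mp hx]
    simp [pr]
  | succ i ih =>
    rcases hN.step_inf X i with hs | hs
    · exact ih.pstep hσ hs (fun θ h => ⟨h.1, h.fixed⟩) fun η θ hθ hη hs h0 => hθ.of_fixed hN hη hs h0
    · intro f hf
      obtain ⟨g, hg, he⟩ := ih.qstep hσ.prime (hN.nrm X i) (fun θ h => ⟨h.1, fun x hx => h.cj' hN hx,
        h.fong hσ hN⟩) inf_le_left hs f hf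
      refine ⟨g, Submodule.span_mono (fun η hη => ?_) hg, he⟩
      obtain ⟨θ, hθ, h0⟩ := hη.1.exists_under hs.1.le
      exact Bs.of_qstep hσ hN hs (hη.2 θ hθ h0) hη.1 h0

end SpanSeries

section Lifts
variable {G : Type} [Group G] [Fintype G] {p : ℕ}

/-- Two functions agree on the `p`-regular elements of `H`. -/
def RegEq (p : ℕ) (H : Subgroup G) (f g : G → ℂ) : Prop := ∀ x ∈ H, ¬ p ∣ orderOf x → f x = g x

/-- The restriction of `f` to the `p`-regular elements of `H` is not a sum of two such restrictions
of nonzero characters. -/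
def PIrr (p : ℕ) (H : Subgroup G) (f : G → ℂ) : Prop :=
  ∀ a b, Chr H a → Chr H b → a ≠ 0 → b ≠ 0 → ¬ RegEq p H f (a + b)

theorem PIrr.congr {H : Subgroup G} {f g : G → ℂ} (h : PIrr p H f) (e : RegEq p H f g) :
    PIrr p H g := fun a b ha hb ha0 hb0 h1 =>
  h a b ha hb ha0 hb0 fun x hx hr => (e x hx hr).trans (h1 x hx hr)

theorem Chr.deg_ne {H : Subgroup G} {f : G → ℂ} (h : Chr H f) (h0 : f ≠ 0) : f 1 ≠ 0 :=
  fun h1 => h0 (h.eq_zero_of_deg h1)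

theorem Chr.ind_ne_zero {K H : Subgroup G} {f : G → ℂ} (h : Chr K f) (h0 : f ≠ 0) :
    _root_.ind K H f ≠ 0 := fun h1 => by
  have h2 := congrFun h1 1
  rw [ind_one] at h2
  exact mul_ne_zero (div_ne_zero (card_ne_zero' H) (card_ne_zero' K)) (h.deg_ne h0) h2

theorem RegEq.ind {K : Subgroup G} {f g : G → ℂ} (e : RegEq p K f g) (hf : ∀ x, x ∉ K → f x = 0)
    (hg : ∀ x, x ∉ K → g x = 0) (H : Subgroup G) : RegEq p H (ind K H f) (ind K H g) :=
  fun _ _ hr => ind_congr_reg hf hg e hr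

theorem PIrr.of_ind {K H : Subgroup G} {f : G → ℂ} (h : PIrr p H (ind K H f)) (hKH : K ≤ H)
    (hf : ∀ x, x ∉ K → f x = 0) : PIrr p K f := by
  intro a b ha hb ha0 hb0 h1
  refine h _ _ (ha.ind hKH) (hb.ind hKH) (ha.ind_ne_zero ha0) (hb.ind_ne_zero hb0) ?_
  rw [← ind_add]
  exact h1.ind hf (ha.add hb).1 H

theorem PIrr.left {H : Subgroup G} {f g : G → ℂ} (h : PIrr p H (f * g)) (hg : Chr H g)
    (h0 : g ≠ 0) : PIrr p H f := by
  intro a b ha hb ha0 hb0 h1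
  have hne : ∀ c, Chr H c → c ≠ 0 → c * g ≠ 0 := fun c hc hc0 h2 =>
    mul_ne_zero (hc.deg_ne hc0) (hg.deg_ne h0) (congrFun h2 1)
  refine h _ _ (ha.mul hg) (hb.mul hg) (hne a ha ha0) (hne b hb hb0) fun x hx hr => ?_
  rw [← add_mul, Pi.mul_apply, Pi.mul_apply, h1 x hx hr]

theorem PIrr.right {H : Subgroup G} {f g : G → ℂ} (h : PIrr p H (f * g)) (hf : Chr H f)
    (h0 : f ≠ 0) : PIrr p H g := by
  rw [mul_comm] at h
  exact h.left hf h0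

theorem Chr.split {H : Subgroup G} {f : G → ℂ} (h : Chr H f) (h0 : f ≠ 0) (hn : ¬ Irr H f) :
    ∃ a b, Chr H a ∧ Chr H b ∧ a ≠ 0 ∧ b ≠ 0 ∧ f = a + b := by
  obtain ⟨χ, hχ, h1⟩ := h.exists_const h0
  refine ⟨χ, f - χ, hχ.chr, h.sub_const hχ h1, hχ.ne_zero, fun e => hn ?_, by abel⟩
  rwa [sub_eq_zero.mp e]

theorem Irr.eq_zero_or {H : Subgroup G} {f a b : G → ℂ} (h : Irr H f) (ha : Chr H a) (hb : Chr H b)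
    (e : f = a + b) : a = 0 ∨ b = 0 := by
  by_contra! h0
  have hne : ∀ c, Chr H c → c ≠ 0 → (fun x : H => c x) ≠ 0 := fun c hc hc0 e0 =>
    hc.deg_ne hc0 (congrFun e0 1)
  exact h.2.2.2 ⟨_, _, ha.2, hne a ha h0.1, hb.2, hne b hb h0.2, by rw [e]; rfl⟩

theorem Chr.irr_of_res {M K : Subgroup G} {f : G → ℂ} (hf : Chr K f) (hM : M ≤ K)
    (h : Irr M (_root_.res M f)) : Irr K f := by
  by_contra hn
  obtain ⟨a, b, ha, hb, ha0, hb0, e⟩ := hf.split (fun e => h.deg_ne (by rw [res_one, e]; rfl)) hn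
  rw [e, res_add] at h
  have hne : ∀ c, Chr K c → c ≠ 0 → _root_.res M c ≠ 0 := fun c hc hc0 e =>
    hc.deg_ne hc0 (by rw [← res_one (K := M) c, e]; rfl)
  rcases h.eq_zero_or (ha.res hM) (hb.res hM) rfl with h1 | h1
  · exact hne a ha ha0 h1
  · exact hne b hb hb0 h1

theorem Nrm.not_pirr_ind {K H : Subgroup G} {θ f : G → ℂ} (hK : Nrm K H) (hlt : K < H)
    (hθ : Irr K θ) (hinv : ∀ x ∈ H, cj x θ = θ) (he : RegEq p H f (ind K H θ)) : ¬ PIrr p H f := by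
  intro h
  obtain ⟨a, b, ha, hb, ha0, hb0, e⟩ := (hθ.chr.ind hK.le).split (hθ.chr.ind_ne_zero hθ.ne_zero)
    (fun h1 => by
      have h2 := h1.ip_self
      rw [ip_ind_left _ h1.chr.classOn, hK.ind_inv hθ.1 hinv, ip_smul_right, hθ.ip_self, mul_one,
        map_div₀, Complex.conj_natCast, Complex.conj_natCast, div_eq_one_iff_eq (card_ne_zero' K)]
        at h2
      exact hlt.ne (Subgroup.eq_of_le_of_card_ge hK.le (Nat.cast_injective h2).le))
  exact h a b ha hb ha0 hb0 (e ▸ he)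

theorem SpanR.exists_lift {M X : Subgroup G} {B : (G → ℂ) → Prop} (hS : SpanR p M B)
    (hp : p.Prime) (hB : ∀ θ, B θ → Irr M θ ∧ ∃ J κ, FongAt p M X B θ J κ) {ρ : G → ℂ} (hρ : Chr M ρ)
    (h0 : ρ ≠ 0) (hP : PIrr p M ρ) : ∃ η, B η ∧ RegEq p M ρ η := by
  have hF := fun θ h => (hB θ h).2
  choose! J κ hF using hF
  have hs : ∀ θ, θ ∈ (IrrF M).filter B ↔ B θ := fun θ => by
    rw [Finset.mem_filter, mem_IrrF]
    exact ⟨fun h => h.2, fun h => ⟨(hB θ h).1, h⟩⟩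
  have hk := fun x hx hr => hS.kernel hs hF hρ.classOn (x := x) hx hr
  have hc : ∀ θ, B θ → ∃ c : ℕ, ip (J θ) ρ (κ θ) = c := fun θ h =>
    hρ.ip_nat' (hF θ h).le (hF θ h).irr.chr
  choose! c hc using hc
  have hr1 : ¬ p ∣ orderOf (1 : G) := by
    rw [orderOf_one]
    exact hp.one_lt.ne' ∘ Nat.dvd_one.mp
  obtain ⟨η, hη, hcη⟩ : ∃ η ∈ (IrrF M).filter B, ip (J η) ρ (κ η) * η 1 ≠ 0 :=
    Finset.exists_ne_zero_of_sum_ne_zero (by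
      rw [← hk 1 M.one_mem hr1]
      exact hρ.deg_ne h0)
  have hBη := (hs η).mp hη
  have hcpos : c η ≠ 0 := by
    intro e
    rw [hc η hBη, e] at hcη
    simp at hcη
  set b : G → ℂ := ∑ θ ∈ (IrrF M).filter B, ((c θ - (if θ = η then 1 else 0) : ℕ) : ℂ) • θ with hb
  have hbC : Chr M b := Chr.sum _ _ fun θ h => ((hB θ ((hs θ).mp h)).1.chr.nsmul _)
  have he : RegEq p M ρ (η + b) := by
    intro x hx hr
    have h1 : η x = ∑ θ ∈ (IrrF M).filter B, (if θ = η then 1 else 0) * θ x := by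
      simp only [ite_mul, one_mul, zero_mul]
      rw [Finset.sum_ite_eq', if_pos hη]
    rw [hk x hx hr, Pi.add_apply, hb, Finset.sum_apply, h1, ← Finset.sum_add_distrib]
    refine Finset.sum_congr rfl fun θ hθ => ?_
    rw [hc θ ((hs θ).mp hθ), Pi.smul_apply, smul_eq_mul, ← add_mul]
    congr 1
    by_cases e : θ = η
    · subst e
      rw [if_pos rfl, if_pos rfl]
      rw [Nat.cast_sub (by omega)]
      push_cast
      ring
    · simp [e]
  by_cases hb0 : b = 0
  · rw [hb0, add_zero] at he
    exact ⟨η, hBη, he⟩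
  · exact absurd he (hP η b (hB η hBη).1.chr hbC (hB η hBη).1.ne_zero hb0)

variable {n : ℕ} {N : ℕ → Subgroup G} {σ : ℂ →+* ℂ} {X : Subgroup G} {χ : G → ℂ}

theorem Bs.irr (hN : NSeries p n N ⊤) (h : Bs σ N n X χ) : Irr X χ := hN.top_inf X ▸ h.1

theorem Bs.exists_lift (hσ : Sg p G σ) (hN : NSeries p n N ⊤) (hχ : Chr X χ) (h0 : χ ≠ 0)
    (hP : PIrr p X χ) : ∃ η, Bs σ N n X η ∧ RegEq p X χ η := by
  have h := (Bs.span hσ hN X n).exists_lift (X := X) hσ.prime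
    (fun θ hθ => ⟨hθ.1, hθ.fong hσ hN⟩) (ρ := χ)
  rw [hN.top_inf X] at h
  exact h hχ h0 hP

theorem Bs.eq_of_regEq (hσ : Sg p G σ) (hN : NSeries p n N ⊤) {η : G → ℂ} (h : Bs σ N n X χ)
    (h' : Bs σ N n X η) (e : RegEq p X χ η) : χ = η := by
  obtain ⟨J, κ, hF⟩ := h.fong hσ hN
  by_contra hne
  have h1 := hF.ip_congr (f := χ) (g := η) fun x hx => e x hx.1
  rw [hF.one χ h, hF.one η h', if_pos rfl, if_neg (Ne.symm hne)] at h1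
  exact one_ne_zero h1

theorem Nrm.pstab {X J : Subgroup G} {κ : G → ℂ} (hJ : J ≤ X) (hκ : ClassOn J κ) :
    Nrm J (_root_.pstab X J κ) := by
  refine ⟨fun x hx => ⟨hJ hx, cjS_of_mem hx, hκ.cj_eq hx⟩, fun x hx m hm => ?_⟩
  have h1 : x * m * x⁻¹ ∈ _root_.cjS x J := by
    rw [mem_cjS]
    simpa [mul_assoc] using hm
  rwa [hx.2.1] at h1

theorem Bs.of_pirr (hσ : Sg p G σ) (hN : NSeries p n N ⊤) {α : G → ℂ} (hα : Irr X α)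
    (hs : mp σ α = α) (hP : PIrr p X α) : Bs σ N n X α := by
  refine ⟨(hN.top_inf X).symm ▸ hα, fun j _ ω hω h0 => ?_⟩
  by_contra hne
  have hM := hN.nrm X j
  have hωσ := hω.mp σ
  have h0σ : ip (X ⊓ N j) α (mp σ ω) ≠ 0 := by
    obtain ⟨k, hk⟩ := hα.chr.ip_nat' hM.le hω.chr
    have h1 := ip_mp (f := α) hω.chr σ
    rw [hs, hk, map_natCast, ← hk] at h1
    rwa [h1]
  obtain ⟨g, hg, hgω⟩ := hM.conj_const hα hω hωσ h0 h0σ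
  have hTσ : stab X (mp σ ω) = stab X ω := by
    ext x
    rw [mem_stab, mem_stab, cj_mp]
    refine and_congr_right fun _ => ⟨fun h => ?_, fun h => by rw [h]⟩
    ext y
    exact σ.injective (congrFun h y)
  have hTg : cjS g (stab X ω) = stab X ω := by
    ext x
    nth_rw 2 [← hTσ]
    rw [mem_cjS, mem_stab, mem_stab, hgω, ← cj_mul]
    have : x * g = g * (g⁻¹ * x * g) := by group
    rw [this, cj_mul g]
    refine and_congr ?_ ⟨fun h => congrArg _ h, fun h => cj_inj h⟩
    rw [X.mul_mem_cancel_right hg, X.mul_mem_cancel_left (X.inv_mem hg)]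
  obtain ⟨ψ, hψ, h1, h2, h3⟩ := hM.clifford_exists hα hω h0
  have hψσ : mp σ ψ = _root_.cj g ψ := by
    have hi1 := hψ.mp σ
    have hi2 := hψ.cj g
    have hi4 : ip (stab X ω) α (mp σ ψ) ≠ 0 := by
      have := ip_mp (H := stab X ω) (f := α) hψ.chr σ
      rw [hs] at this
      rw [this]
      exact (map_ne_zero σ).mpr h2
    have hi5 : ip (stab X ω) α (_root_.cj g ψ) ≠ 0 := by
      have h5 := _root_.ip_cj g (stab X ω) α ψ
      rw [hTg, hα.chr.classOn.cj_eq hg] at h5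
      rwa [h5]
    have hi6 : ip (X ⊓ N j) (mp σ ψ) (mp σ ω) ≠ 0 := by
      rw [ip_mp hω.chr]
      exact (map_ne_zero σ).mpr h1
    have hi7 : ip (X ⊓ N j) (_root_.cj g ψ) (mp σ ω) ≠ 0 := by
      rwa [hgω, hM.ip_cj hg]
    rw [hTg] at hi2
    rw [← hTσ] at hi1 hi2 hi4 hi5
    exact hM.clifford_unique hα hωσ hi1 hi2 hi6 hi7 hi4 hi5
  have hTX := stab_le X ω
  rw [← h3] at hP
  obtain ⟨η, hη, he⟩ := Bs.exists_lift hσ hN hψ.chr hψ.ne_zero (hP.of_ind hTX hψ.1)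
  have hηi := Bs.irr hN hη
  have hgη : _root_.cj g η = η := by
    have h4 := hη.cj hN g
    rw [hTg] at h4
    refine Bs.eq_of_regEq hσ hN h4 hη fun x hx hr => ?_
    have hx' : g⁻¹ * x * g ∈ stab X ω := by rwa [← mem_cjS, hTg]
    have h5 := he _ hx' (by rwa [orderOf_conj'])
    have h6 := congrFun hψσ x
    rw [_root_.mp, hσ.apply_reg hψ.chr hr] at h6
    rw [_root_.cj, ← h5, ← he x hx hr, h6, _root_.cj]
  have hn := Nrm.pstab hTX hηi.chr.classOn
  have hSX : pstab X (stab X ω) η ≤ X := fun x hx => hx.1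
  rw [← ind_ind hSX] at hP
  refine hn.not_pirr_ind (lt_of_le_of_ne hn.le fun e => hne ?_) hηi (fun x hx => hx.2.2) ?_
    (hP.of_ind hSX (hψ.chr.ind hn.le).1)
  · have : g ∈ stab X ω := by
      rw [e]
      exact ⟨hg, hTg, hgη⟩
    rw [hgω, this.2]
  · exact he.ind hψ.1 hηi.1 _

/-- Specialness for masked characters: the degree is a `π`-number and constituents on subnormal
subgroups have determinants of `π`-order. -/
def Spec (π : Set ℕ) (H : Subgroup G) (χ : G → ℂ) : Prop :=
  Irr H χ ∧ (∀ n : ℕ, χ 1 = n → IsPiNumber π n) ∧ ∀ K, Relation.ReflTransGen Nrm K H → ∀ θ, Irr K θ →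
    ip K χ θ ≠ 0 → ∃ d m, HasDet K θ d ∧ m ≠ 0 ∧ IsPiNumber π m ∧ ∀ x ∈ K, d x ^ m = 1

theorem Nrm.deg_dvd {M H : Subgroup G} (h : Nrm M H) {χ θ : G → ℂ} (hχ : Irr H χ) (hθ : Irr M θ)
    (h1 : ip M χ θ ≠ 0) {a b : ℕ} (ha : χ 1 = a) (hb : θ 1 = b) : b ∣ a := by
  obtain ⟨e, he⟩ := hχ.chr.ip_nat' h.le hθ.chr
  obtain ⟨c, hc⟩ := Subgroup.card_dvd_of_le (stab_le H θ)
  have h2 := h.deg_eq hχ hθ h1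
  rw [ha, hb, he, hc, Nat.cast_mul, mul_div_cancel_left₀ _ (card_ne_zero' _)] at h2
  exact ⟨e * c, by rw [mul_comm]; exact_mod_cast h2⟩

theorem Spec.bs (hσ : Sg p G σ) (hN : NSeries p n N ⊤) (h : Spec {p}ᶜ X χ) : Bs σ N n X χ := by
  have key : ∀ i, ∀ θ, Irr (X ⊓ N i) θ → ip (X ⊓ N i) χ θ ≠ 0 → Bs σ N i X θ := by
    intro i
    induction i with
    | zero =>
      intro θ hθ h0
      refine ⟨hθ, fun j hj ω hω _ => ?_⟩
      obtain rfl : j = 0 := by omega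
      rw [hN.zero, inf_bot_eq] at hω
      obtain ⟨k, -, hk⟩ := hω.deg_pos
      ext g
      by_cases hg : g = 1
      · simp [_root_.mp, hg, hk]
      · have : ω g = 0 := hω.chr.1 g (by simpa using hg)
        simp [_root_.mp, this]
    | succ i ih =>
      intro η hη h0
      have hML := hN.nrm_le X (Nat.le_succ i)
      have hL := hN.nrm X (i + 1)
      obtain ⟨θ, hθ, h1⟩ := hη.exists_under hML.le
      have hBθ := ih θ hθ (h.1.chr.ip_trans hML.le hL.le hθ.chr hη h0 h1)
      rcases hN.step_inf X i with hs | hs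
      · refine hBθ.of_fixed hN hη ?_ h1
        obtain ⟨b, -, hb⟩ := hη.deg_pos
        obtain ⟨a, ha0, ha⟩ := h.1.deg_pos
        have hpb : ¬ p ∣ b := fun hd => h.2.1 a ha p hσ.prime
          (hd.trans (hL.deg_dvd h.1 hη h0 ha hb)) rfl
        obtain ⟨h2, h3⟩ := (hs.poly hσ.prime).chain hη hb fun x hx => by
          obtain ⟨k, hk⟩ := hs.2 x hx
          exact ⟨p ^ k, ((hσ.prime.coprime_iff_not_dvd).mpr hpb).pow_left k, hk⟩
        have h4 : θ = res (X ⊓ N i) η := by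
          have h5 := h2.orth hθ
          rw [ip_res_left _ _ hθ.1] at h5
          by_contra e
          rw [if_neg (Ne.symm e)] at h5
          exact h1 h5
        refine h3 σ (h4 ▸ hBθ.fixed) fun K d hMK hK hd => ?_
        have hKL : K ≤ X ⊓ N (i + 1) := by
          clear hd hMK
          induction hK using Relation.ReflTransGen.head_induction_on with
          | refl => exact le_rfl
          | head h _ ih => exact h.le.trans ih
        have h5 : Irr K (res K η) := by
          refine (hη.chr.res hKL).irr_of_res hMK ?_
          rwa [res_res hMK]
        have h6 : ip K χ (res K η) ≠ 0 := by
          refine h.1.chr.ip_trans hKL hL.le h5.chr hη h0 ?_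
          rw [← ip_res_left K _ h5.1, h5.ip_self]
          exact one_ne_zero
        obtain ⟨d', m, hd', hm0, hm, hdm⟩ := h.2.2 K (hK.tail hL) _ h5 h6
        obtain rfl := hd.unique hd'
        exact hσ.lin_p' hd.lin fun x hx => ⟨m, fun hpm => hm p hσ.prime hpm rfl, hdm x hx⟩
      · exact hBθ.of_qstep hσ hN hs hη h1
  have h1 := hN.top_inf X
  refine key n χ (h1.symm ▸ h.1) ?_
  rw [h1, h.1.ip_self]
  exact one_ne_zero

end Lifts

section
variable {Γ : Type} [Group Γ] [Fintype Γ]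

theorem sum_char_conj {χ : Γ → ℂ} (hχ : IsIrrChar Γ χ) (g h : Γ) :
    χ 1 * ∑ z, χ (g * (z * h * z⁻¹)) = Nat.card Γ * (χ g * χ h) := by
  obtain ⟨V, _, _, _, ρ, rfl⟩ := hχ.1.exists_rep
  have hI := irr_rep_of_isIrrChar ρ hχ
  let T : V →ₗ[ℂ] V := ∑ z, ρ (z * h * z⁻¹)
  have hT : ∀ x, T ∘ₗ ρ x = ρ x ∘ₗ T := fun x => by
    change T * ρ x = ρ x * T
    simp only [T, Finset.sum_mul, Finset.mul_sum, ← map_mul]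
    refine Fintype.sum_equiv (Equiv.mulLeft x⁻¹) _ _ fun z => congrArg ρ ?_
    simp only [Equiv.coe_mulLeft]
    group
  obtain ⟨c, hc⟩ := (Representation.IsIrreducible.algebraMap_intertwiningMap_bijective_of_isAlgClosed
    (ρ := ρ)).2 (⟨T, hT⟩ : Representation.IntertwiningMap ρ ρ)
  have hc' : T = c • (1 : V →ₗ[ℂ] V) := by
    ext v
    have := congrArg (fun F : Representation.IntertwiningMap ρ ρ => F v) hc
    simpa [Algebra.algebraMap_eq_smul_one] using this.symm
  have e1 : ∀ x, ∑ z, ρ.character (x * (z * h * z⁻¹)) = c * ρ.character x := fun x => by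
    have : LinearMap.trace ℂ V (ρ x * T) = c * ρ.character x := by
      rw [hc', mul_smul_comm, mul_one, map_smul]; rfl
    rw [← this]
    simp only [T, Finset.mul_sum, ← map_mul, map_sum]
    rfl
  have e2 := e1 1
  have hcl : ∀ z, ρ.character (1 * (z * h * z⁻¹)) = ρ.character h := fun z => by
    rw [one_mul, Representation.char_conj]
  rw [Finset.sum_congr rfl fun z _ => hcl z] at e2
  rw [e1]
  simp only [Finset.sum_const, Finset.card_univ, nsmul_eq_mul, ← Nat.card_eq_fintype_card] at e2
  linear_combination -(ρ.character g) * e2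

theorem sum_quotient_out {M : Subgroup Γ} {F : Γ → ℂ} (hF : ∀ x, ∀ m ∈ M, F (x * m) = F x) :
    ∑ x, F x = Nat.card M * ∑ q : Γ ⧸ M, F q.out := by
  have h1 : ∀ x : Γ, F x = F ((Subgroup.groupEquivQuotientProdSubgroup (s := M) x).1).out :=
    fun x => by
    obtain ⟨m, hm⟩ := QuotientGroup.mk_out_eq_mul M x
    change F x = F ((QuotientGroup.mk x : Γ ⧸ M).out)
    rw [hm, hF x m m.2]
  rw [Finset.sum_congr rfl fun x _ => h1 x, Fintype.sum_equiv
    (Subgroup.groupEquivQuotientProdSubgroup (s := M)) _ (fun q => F q.1.out) fun x => rfl,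
    Fintype.sum_prod_type]
  simp [Finset.mul_sum]

theorem deg_eq_one_of_p' {χ : Γ → ℂ} (hχ : IsIrrChar Γ χ) {M : Subgroup Γ} (hn : M.Normal)
    (hM : ∀ x, ∀ m ∈ M, χ (x * m) = χ x) {d p : ℕ} (hd : χ 1 = (p ^ d : ℕ)) (hp : p.Prime)
    (hQ : ¬ p ∣ Nat.card (Γ ⧸ M)) (hit : ∀ g, IsIntegral ℤ (χ g))
    (hs : ∑ g, χ g * (starRingEnd ℂ) (χ g) = Nat.card Γ) : d = 0 := by
  have h1 : χ 1 ≠ 0 := by rw [hd]; exact_mod_cast (pow_pos hp.pos d).ne'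
  set Q := Nat.card (Γ ⧸ M) with hQd
  have hMQ : (Nat.card Γ : ℂ) = Q * Nat.card M := by
    exact_mod_cast M.card_eq_card_quotient_mul_card_subgroup
  have hM0 : (Nat.card M : ℂ) ≠ 0 := by exact_mod_cast Nat.card_pos.ne'
  have hQ0 : (Q : ℂ) ≠ 0 := by exact_mod_cast Nat.card_pos.ne'
  let c : Γ → ℂ := fun g => Q * (χ g / χ 1)
  have hc : ∀ g h, c g * c h = ∑ q : Γ ⧸ M, c (g * (q.out * h * q.out⁻¹)) := fun g h => by
    have e1 := sum_char_conj hχ g h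
    rw [sum_quotient_out (M := M), hMQ] at e1
    · have e2 : χ 1 * ∑ q : Γ ⧸ M, χ (g * (q.out * h * q.out⁻¹)) = Q * (χ g * χ h) :=
        mul_left_cancel₀ hM0 (by linear_combination e1)
      simp only [c, ← Finset.mul_sum, ← Finset.sum_div]
      field_simp
      linear_combination -e2
    · intro z m hm
      have := hM (g * (z * h * z⁻¹)) (z * (h⁻¹ * m * h⁻¹⁻¹ * m⁻¹) * z⁻¹)
        (hn.conj_mem _ (M.mul_mem (hn.conj_mem m hm h⁻¹) (M.inv_mem hm)) z)
      rw [← this]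
      congr 1
      group
  have hci : ∀ g, IsIntegral ℤ (c g) := fun g => by
    refine isIntegral_of_smul_mem_submodule (Submodule.span ℤ (Set.range c)) ?_
      (Submodule.fg_span (Set.finite_range c)) _ fun n hnn => ?_
    · intro h0
      have : c 1 ∈ Submodule.span ℤ (Set.range c) := Submodule.subset_span ⟨1, rfl⟩
      rw [h0, Submodule.mem_bot] at this
      simp only [c, div_self h1, mul_one] at this
      exact hQ0 this
    · induction hnn using Submodule.span_induction with
      | mem x hx =>
        obtain ⟨h, rfl⟩ := hx
        rw [smul_eq_mul, hc]
        exact Submodule.sum_mem _ fun q _ => Submodule.subset_span ⟨_, rfl⟩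
      | zero => simp
      | add x y _ _ hx hy => rw [smul_add]; exact Submodule.add_mem _ hx hy
      | smul k x _ hx => rw [smul_comm]; exact Submodule.smul_mem _ _ hx
  have hai : ∀ g, IsIntegral ℤ (χ g / χ 1) := fun g => by
    have hco : IsCoprime (Q : ℤ) ((p ^ d : ℕ) : ℤ) := Nat.isCoprime_iff_coprime.mpr
      (((hp.coprime_iff_not_dvd.mpr hQ).pow_left d).symm)
    obtain ⟨u, v, huv⟩ := hco
    have huv' : (u : ℂ) * Q + v * χ 1 = 1 := by rw [hd]; exact_mod_cast huv
    have : χ g / χ 1 = (u : ℤ) • c g + (v : ℤ) • χ g := by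
      simp only [c, zsmul_eq_mul]
      field_simp
      linear_combination -(χ g) * huv'
    rw [this]
    exact ((hci g).smul u).add ((hit g).smul v)
  have hS := sum_quotient_out (M := M) (F := fun g => χ g * (starRingEnd ℂ) (χ g))
    fun x m hm => by simp only [hM x m hm]
  rw [hs, hMQ] at hS
  have hS' : ∑ q : Γ ⧸ M, χ q.out * (starRingEnd ℂ) (χ q.out) = Q :=
    mul_left_cancel₀ hM0 (by linear_combination -hS)
  have hSi : IsIntegral ℤ ((Q : ℂ) / (χ 1 * χ 1)) := by
    rw [← hS', Finset.sum_div]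
    refine IsIntegral.sum _ fun q _ => ?_
    have hcj : (starRingEnd ℂ) (χ 1) = χ 1 := by rw [hd]; simp
    have e : χ q.out * (starRingEnd ℂ) (χ q.out) / (χ 1 * χ 1) =
        χ q.out / χ 1 * (starRingEnd ℂ) (χ q.out / χ 1) := by
      rw [map_div₀, hcj]; field_simp
    rw [e]
    exact (hai _).mul ((hai _).map ((starRingEnd ℂ).toIntAlgHom))
  have hr : ((Q : ℂ) / (χ 1 * χ 1)) = algebraMap ℚ ℂ (Q / (p ^ d * p ^ d)) := by
    rw [hd]; simp
  rw [hr, isIntegral_algebraMap_iff (algebraMap ℚ ℂ).injective] at hSi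
  obtain ⟨k, hk⟩ := IsIntegrallyClosed.isIntegral_iff.mp hSi
  have hp0 : (p : ℚ) ≠ 0 := by exact_mod_cast hp.ne_zero
  have hk' : (Q : ℤ) = p ^ d * (p ^ d * k) := by
    have : (Q : ℚ) = p ^ d * (p ^ d * k) := by
      rw [eq_div_iff (by positivity)] at hk
      rw [← hk]; simp; ring
    exact_mod_cast this
  by_contra hd0
  exact hQ (Int.natCast_dvd_natCast.mp (hk' ▸ ((dvd_pow_self (p : ℤ) hd0).mul_right _)))
end

section
variable {G : Type} [Group G] [Fintype G] {p : ℕ}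

theorem Irr.deg_one_of_qstep (hp : p.Prime) {M N : Subgroup G} (h : QStep p M N) {ω : G → ℂ}
    (hω : Irr N ω) (hM : ∀ m ∈ M, ω m = ω 1) {d : ℕ} (hd : ω 1 = (p ^ d : ℕ)) : ω 1 = 1 := by
  have := deg_eq_one_of_p' hω.2 (M := M.subgroupOf N) h.1.normal
    (fun x m hm => hω.chr.kernel m.2 (hM m hm) x) hd hp ?_ (fun g => ?_) ?_
  · rw [hd, this, pow_zero, Nat.cast_one]
  · have := h.1.normal
    refine not_dvd_card_of_pow hp fun x => ?_
    obtain ⟨x, rfl⟩ := QuotientGroup.mk_surjective x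
    obtain ⟨m, hm, hx⟩ := h.2 x x.2
    exact ⟨m, hm, (QuotientGroup.eq_one_iff (N := M.subgroupOf N) (x ^ m)).mpr hx⟩
  · obtain ⟨s, hs, he⟩ := hω.chr.exists_eig g.2
    have h1 := he 1
    simp only [pow_one, Multiset.map_id'] at h1
    rw [h1]
    refine IsIntegral.multiset_sum fun μ hμ => IsIntegral.of_pow (orderOf_pos (g : G)) ?_
    rw [hs μ hμ]
    exact isIntegral_one
  · have := hω.ip_self
    rw [ip_eq_sub hω.1, inv_mul_eq_one₀ (card_ne_zero' N)] at this
    exact this.symm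
end

section
variable {G : Type} [Group G] [Fintype G] {p : ℕ}

theorem Chr.sq_apply {H : Subgroup G} {f : G → ℂ} (hf : Chr H f) {x : G} (hx : x ∈ H)
    (h : f (x * x) = f 1) : ∃ k : ℕ, f x + 2 * k = f 1 := by
  obtain ⟨s, hs, he⟩ := hf.exists_eig hx
  have h0 := he 0
  simp only [pow_zero, Multiset.map_const', Multiset.sum_replicate, nsmul_eq_mul, mul_one] at h0
  have h1 := he 1
  simp only [pow_one, Multiset.map_id'] at h1
  have hn : ∀ μ ∈ s, ‖μ‖ = 1 := fun μ hμ =>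
    Complex.norm_eq_one_of_pow_eq_one (hs μ hμ) (orderOf_pos x).ne'
  have a := multiset_eq_one (s := s.map (· ^ 2)) (fun ν hν => by
    obtain ⟨μ, hμ, rfl⟩ := Multiset.mem_map.mp hν
    rw [norm_pow, hn μ hμ, one_pow]) (by rw [← he 2, pow_two, h, h0, Multiset.card_map])
  have hpm : ∀ μ ∈ s, μ = 1 ∨ μ = -1 := fun μ hμ =>
    sq_eq_one_iff.mp (a _ (Multiset.mem_map_of_mem _ hμ))
  rw [h1, h0]
  clear h h0 h1 he a hs hn
  induction s using Multiset.induction_on with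
  | empty => exact ⟨0, by simp⟩
  | cons a s ih =>
    obtain ⟨m, hm⟩ := ih fun μ hμ => hpm μ (Multiset.mem_cons_of_mem hμ)
    rcases hpm a (Multiset.mem_cons_self a s) with rfl | rfl
    · exact ⟨m, by rw [Multiset.sum_cons, Multiset.card_cons]; push_cast; linear_combination hm⟩
    · exact ⟨m + 1, by
        rw [Multiset.sum_cons, Multiset.card_cons]; push_cast; linear_combination hm⟩

/-- A constituent of a restriction is trivial on a normal subgroup on which the character is. -/
theorem Nrm.const_trivial {M K H : Subgroup G} (hM : Nrm M K) (hK : K ≤ H) {χ η : G → ℂ}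
    (hχ : Chr H χ) (hη : Irr K η) (h0 : ip K χ η ≠ 0) (ht : ∀ m ∈ M, χ m = χ 1) :
    ∀ m ∈ M, η m = η 1 := by
  obtain ⟨θ, hθ, h1⟩ := hη.exists_under hM.le
  have h2 := hχ.ip_trans hM.le hK hθ.chr hη h0 h1
  have h3 : ip M χ θ = ip M (χ 1 • pr M) θ := by
    rw [← ip_res_left M χ hθ.1, ← ip_res_left M (χ 1 • pr M) hθ.1]
    congr 1
    funext g
    by_cases hg : g ∈ M
    · simp [res, hg, ht g hg, pr]
    · simp [res, hg]
  rw [h3, ip_smul_left, (lin_pr M).irr.orth hθ] at h2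
  have h4 : pr M = θ := by
    by_contra h
    simp [h] at h2
  intro m hm
  rw [hM.res_of_inv hη hθ h1 _ hm, hM.res_of_inv hη hθ h1 _ M.one_mem, ← h4, pr_of_mem hm,
    pr_of_mem M.one_mem] <;>
  · intro x hx
    rw [← h4]
    funext g
    simp only [cj, pr, hM.conj_mem_iff' hx]

theorem AbStep.of_sq {M N : Subgroup G} (h : Nrm M N) (hs : ∀ x ∈ N, x * x ∈ M) : AbStep M N :=
  ⟨h, fun x hx y hy => by
    have h1 := hs (x * y) (N.mul_mem hx hy)
    have h2 := (h.conj_mem_iff' hy).mpr (M.inv_mem (hs x hx))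
    have h3 := M.mul_mem (M.mul_mem h1 h2) (M.inv_mem (hs y hy))
    convert h3 using 1
    group⟩

/-- The product of a normal subgroup and a subgroup. -/
def prodS {M N J : Subgroup G} (h : Nrm M N) (hJ : J ≤ N) : Subgroup G where
  carrier := {z | ∃ m ∈ M, ∃ j ∈ J, z = m * j}
  one_mem' := ⟨1, M.one_mem, 1, J.one_mem, by simp⟩
  mul_mem' := by
    rintro _ _ ⟨m, hm, j, hj, rfl⟩ ⟨m', hm', j', hj', rfl⟩
    exact ⟨m * (j * m' * j⁻¹), M.mul_mem hm (h.2 j (hJ hj) m' hm'), j * j', J.mul_mem hj hj', by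
      group⟩
  inv_mem' := by
    rintro _ ⟨m, hm, j, hj, rfl⟩
    refine ⟨j⁻¹ * m⁻¹ * j⁻¹⁻¹, h.2 _ (N.inv_mem (hJ hj)) _ (M.inv_mem hm), j⁻¹, J.inv_mem hj, ?_⟩
    group

variable {M N J : Subgroup G}

theorem mem_prodS {h : Nrm M N} {hJ : J ≤ N} {z : G} :
    z ∈ prodS h hJ ↔ ∃ m ∈ M, ∃ j ∈ J, z = m * j := Iff.rfl

theorem le_prodS (h : Nrm M N) (hJ : J ≤ N) : M ≤ prodS h hJ ∧ J ≤ prodS h hJ ∧ prodS h hJ ≤ N :=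
  ⟨fun m hm => ⟨m, hm, 1, J.one_mem, (mul_one m).symm⟩,
    fun j hj => ⟨1, M.one_mem, j, hj, (one_mul j).symm⟩, by
    rintro _ ⟨m, hm, j, hj, rfl⟩
    exact N.mul_mem (h.le hm) (hJ hj)⟩

theorem Nrm.sq_mem {E : Subgroup G} (h : Nrm M N) (hJ : J ≤ N) (hF : Factors N M J) (hE : E ≤ M)
    (hs : ∀ x ∈ J, x * x ∈ E) : ∀ x ∈ N, x * x ∈ M := by
  intro x hx
  obtain ⟨m, hm, j, hj, rfl⟩ := hF x hx
  have := M.mul_mem (M.mul_mem hm (h.2 j (hJ hj) m hm)) (hE (hs j hj))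
  convert this using 1
  group

theorem Step.eq_prime {E K : Subgroup G} {l : G → ℂ} {r : ℕ} (hp : p.Prime) (hE : PStep p E M)
    (hEK : E ≤ K) (h : Step K M l r) : r = p := by
  by_contra hne
  have : ∀ x ∈ M, x ∈ K := fun x hx => by
    obtain ⟨k, hk⟩ := hE.2 x hx
    exact h.mem_of_pow hx (fun hd => hne ((Nat.prime_dvd_prime_iff_eq h.prime hp).mp
      (h.prime.dvd_of_dvd_pow hd))) (hEK hk)
  exact h.lt.not_ge this
end

section
variable {G : Type} [Group G] [Fintype G] {p : ℕ} {E M N J : Subgroup G}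

theorem Nrm.cj_pr (h : Nrm M N) {x : G} (hx : x ∈ N) : cj x (pr M) = pr M := by
  funext g
  simp only [cj, pr, h.conj_mem_iff' hx]

theorem exists_pm_step (hp : p.Prime) (hEN : Nrm E N) (hMN : Nrm M N) (hEM : PStep p E M)
    (hlt : E < M) (hF : Factors N M J) (hJ : J ≤ N) (hEJ : E ≤ J) (hJ2 : ∀ x ∈ J, x * x ∈ E) :
    ∃ l K, E ≤ K ∧ Step K M l p ∧ Nrm K N ∧ ∀ x ∈ J, cj x l = l ∨ cj x l * l = pr M := by
  let P : (G → ℂ) → Prop := fun l => (∀ e ∈ E, l e = 1) ∧ (∀ x ∈ M, l x ^ p = 1) ∧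
    (∃ x ∈ M, l x ≠ 1) ∧ Lin M l
  let good : (G → ℂ) → Finset G := fun l =>
    Finset.univ.filter fun x => x ∈ J ∧ (cj x l = l ∨ cj x l * l = pr M)
  have hne : ((IrrF M).filter P).Nonempty := by
    obtain ⟨K, l, r, hK, hs⟩ := (hEM.poly hp).2 M hlt le_rfl
    obtain rfl := hs.eq_prime hp hEM hK
    exact ⟨l, Finset.mem_filter.mpr ⟨mem_IrrF.mpr hs.lin.irr,
      fun e he => ((hs.mem e).mp (hK he)).2, hs.pow, hs.nontriv, hs.lin⟩⟩
  obtain ⟨l, hl, hmax⟩ := Finset.exists_max_image _ (fun l => (good l).card) hne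
  obtain ⟨hlE, hlp, hl1, hlin⟩ := (Finset.mem_filter.mp hl).2
  have hcl := hlin.chr.classOn
  have hab : AbStep E J := .of_sq (hEN.mono hEJ hJ) hJ2
  have hgood : ∀ x ∈ J, cj x l = l ∨ cj x l * l = pr M := by
    by_contra! hbad
    obtain ⟨x, hx, hb1, hb2⟩ := hbad
    have hxl : Lin M (cj x l) := by
      have := hlin.cj x
      rwa [hMN.cjS (hJ hx)] at this
    have hE1 : ∀ e ∈ E, cj x l e = 1 := fun e he =>
      hlE _ ((hEN.conj_mem_iff' (hJ hx)).mpr he)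
    have hcomm : ∀ y ∈ J, cj y (cj x l) = cj x (cj y l) := fun y hy => by
      rw [← cj_mul, ← cj_mul]
      rw [show y * x = x * y * (y⁻¹ * x⁻¹ * y * x) by group, cj_mul,
        hcl.cj_eq (hEM.1.le (by simpa using hab.2 y⁻¹ (J.inv_mem hy) x⁻¹ (J.inv_mem hx)))]
    have hxx : cj x (cj x l) = l := by
      rw [← cj_mul, hcl.cj_eq (hEM.1.le (hJ2 x hx))]
    have hgx : ∀ y ∈ J, (cj y l = l ∨ cj y l * l = pr M) →
        cj y (l * cj x l) = l * cj x l ∨ cj y (l * cj x l) * (l * cj x l) = pr M := by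
      intro y hy h
      rw [cj_mul_fun, hcomm y hy]
      rcases h with h | h
      · exact Or.inl (by rw [h])
      · right
        have : cj y l * cj x (cj y l) * (l * cj x l) = (cj y l * l) * cj x (cj y l * l) := by
          rw [cj_mul_fun]; ring
        rw [this, h, hMN.cj_pr (hJ hx), mul_pr (lin_pr M).1]
    refine absurd (hmax (l * cj x l) (Finset.mem_filter.mpr ⟨mem_IrrF.mpr (hlin.mul hxl).irr,
      fun e he => ?_, fun y hy => ?_, ?_, hlin.mul hxl⟩)) (not_le.mpr (Finset.card_lt_card ?_))
    · rw [Pi.mul_apply, hlE e he, hE1 e he, one_mul]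
    · rw [Pi.mul_apply, mul_pow, hlp y hy, one_mul]
      exact hlp _ ((hMN.conj_mem_iff' (hJ hx)).mpr hy)
    · by_contra! h
      refine hb2 (ext_on (H := M) (fun g hg => ?_) (lin_pr M).1 fun g hg => ?_)
      · rw [Pi.mul_apply, hlin.1 g hg, mul_zero]
      · rw [mul_comm, h g hg, pr_of_mem hg]
    · refine Finset.ssubset_iff_of_subset (fun y hy => ?_) |>.mpr ⟨x, ?_, ?_⟩
      · have := (Finset.mem_filter.mp hy).2
        exact Finset.mem_filter.mpr ⟨Finset.mem_univ _, this.1, hgx y this.1 this.2⟩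
      · exact Finset.mem_filter.mpr ⟨Finset.mem_univ _, hx, Or.inl (by
          rw [cj_mul_fun, hxx, mul_comm])⟩
      · exact fun h => (Finset.mem_filter.mp h).2.2.elim hb1 hb2
  have hpm : ∀ z ∈ N, cj z l = l ∨ cj z l * l = pr M := by
    intro z hz
    obtain ⟨m, hm, j, hj, rfl⟩ := hF z hz
    rw [cj_mul]
    rcases hgood j hj with h | h
    · exact Or.inl (by rw [h, hcl.cj_eq hm])
    · right
      calc _ = cj m (cj j l) * cj m l := by rw [hcl.cj_eq hm]
        _ = pr M := by rw [← cj_mul_fun, h, hMN.cj_pr (hMN.le hm)]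
  have hmem : ∀ x, x ∈ ker hlin.chr ↔ x ∈ M ∧ l x = 1 := fun x => by rw [mem_ker, hlin.2.1]
  refine ⟨l, ker hlin.chr, fun e he => (hmem e).mpr ⟨hEM.1.le he, hlE e he⟩,
    ⟨hp, hlin, hlp, hl1, hmem⟩, ⟨fun x hx => hMN.le ((hmem x).mp hx).1, fun x hx m hm => ?_⟩, hgood⟩
  obtain ⟨hm1, hm2⟩ := (hmem m).mp hm
  refine (hmem _).mpr ⟨(hMN.conj_mem_iff hx).mpr hm1, ?_⟩
  have e : l (x * m * x⁻¹) = cj x⁻¹ l m := by simp [cj]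
  rw [e]
  rcases hpm x⁻¹ (N.inv_mem hx) with h | h
  · rw [h, hm2]
  · have := congrFun h m
    rwa [Pi.mul_apply, hm2, mul_one, pr_of_mem hm1] at this
end

section
variable {G : Type} [Group G] [Fintype G] {p : ℕ} {E K M N J : Subgroup G} {l ρ : G → ℂ}

theorem Step.mem_of_prodS (hl : Step K M l p) (hKN : Nrm K N) (hJ : J ≤ N) (hEK : E ≤ K)
    (hJM : J ⊓ M = E) {w : G} (hw : w ∈ prodS hKN hJ) (hwM : w ∈ M) : w ∈ K := by
  obtain ⟨k, hk, j, hj, rfl⟩ := hw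
  refine K.mul_mem hk (hEK (hJM ▸ ⟨hj, ?_⟩))
  simpa using M.mul_mem (M.inv_mem (hl.le hk)) hwM

theorem Step.ind_of_inv (hl : Step K M l p) (h2 : p ≠ 2) (hKN : Nrm K N) (hMN : Nrm M N) (hJ : J ≤ N)
    (hF : Factors N M J) (hEK : E ≤ K) (hJM : J ⊓ M = E) (hρ : Irr (prodS hKN hJ) ρ) {x : G}
    (hx : x ∈ J) (hinv : cj x l * l = pr M) : ind (prodS hKN hJ) N ρ x = ρ x := by
  obtain ⟨hK0, hJ0, h0N⟩ := le_prodS hKN hJ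
  have key : ∀ y, (if y ∈ N then ρ (y * x * y⁻¹) else 0) =
      if y ∈ prodS hKN hJ then ρ x else 0 := by
    intro y
    by_cases hy0 : y ∈ prodS hKN hJ
    · rw [if_pos (h0N hy0), if_pos hy0, hρ.chr.classOn.2 y hy0]
    rw [if_neg hy0]
    split_ifs with hy
    · refine hρ.1 _ fun hmem => hy0 ?_
      obtain ⟨m, hm, j, hj, e⟩ := hF y⁻¹ (N.inv_mem hy)
      obtain rfl : y = j⁻¹ * m⁻¹ := by rw [← inv_inv y, e]; group
      have hmi := M.inv_mem hm
      have hz : x * m * x⁻¹ ∈ M := hMN.2 x (hJ hx) m hm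
      have hw := hl.mem_of_prodS hKN hJ hEK hJM (w := m⁻¹ * (x * m * x⁻¹)) (by
        have := (prodS hKN hJ).mul_mem ((prodS hKN hJ).mul_mem ((prodS hKN hJ).mul_mem (hJ0 hj) hmem)
          (hJ0 (J.inv_mem hj))) (hJ0 (J.inv_mem hx))
        convert this using 1
        group) (M.mul_mem hmi hz)
      have e1 := ((hl.mem _).mp hw).2
      rw [hl.lin.2.2 _ hmi _ hz] at e1
      have e2 := congrFun hinv (x * m * x⁻¹)
      rw [Pi.mul_apply, pr_of_mem hz] at e2
      have e3 : cj x l (x * m * x⁻¹) = l m := congrArg l (by group)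
      rw [e3] at e2
      have e4 := hl.lin.map_inv hm
      have e5 : l (m ^ 2) = 1 := by
        rw [hl.lin.map_pow hm]
        have h3 : l m = l m⁻¹ := by
          have h6 := hl.lin.ne_zero hz
          exact mul_right_cancel₀ h6 (e2.trans e1.symm)
        rw [← e4, ← h3, pow_two]
      have := hl.mem_of_pow hm (fun hd => h2 ((Nat.prime_dvd_prime_iff_eq hl.prime
        Nat.prime_two).mp hd)) ((hl.mem _).mpr ⟨M.pow_mem hm 2, e5⟩)
      exact (prodS hKN hJ).mul_mem (hJ0 (J.inv_mem hj)) (hK0 (K.inv_mem this))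
    · rfl
  rw [ind, Finset.sum_congr rfl fun y _ => key y, ← Finset.sum_filter, Finset.sum_const,
    nsmul_eq_mul, ← Fintype.card_subtype, ← Nat.card_eq_fintype_card, ← mul_assoc]
  exact (congrArg (· * ρ x) (inv_mul_cancel₀ (card_ne_zero' (prodS hKN hJ)))).trans (one_mul _)

theorem Step.ind_of_fix (hp : p.Prime) (hl : Step K M l p) (h2 : p ≠ 2) (hKN : Nrm K N)
    (hMN : Nrm M N) (hEN : Nrm E N) (hEM : PStep p E M) (hJ : J ≤ N) (hF : Factors N M J)
    (hEK : E ≤ K) (hEJ : E ≤ J) (hJM : J ⊓ M = E) (hJ2 : ∀ x ∈ J, x * x ∈ E)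
    (hρ : Irr (prodS hKN hJ) ρ) (hρE : ∀ e ∈ E, ρ e = ρ 1) {x : G}
    (hx : x ∈ J) (hfix : cj x l = l) :
    ind (prodS hKN hJ) N ρ x = (Nat.card (prodS hKN hJ) : ℂ)⁻¹ * Nat.card N * ρ x := by
  obtain ⟨hK0, hJ0, h0N⟩ := le_prodS hKN hJ
  have hJ' : stab J l ≤ N := (stab_le J l).trans hJ
  obtain ⟨hK1, hJ1, h1N⟩ := le_prodS hKN hJ'
  have hEs : E ≤ stab J l := fun e he =>
    ⟨hEJ he, hl.lin.chr.classOn.cj_eq (hEM.1.le he)⟩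
  have hnd : ¬ p ∣ 2 := fun hd => h2 ((Nat.prime_dvd_prime_iff_eq hp Nat.prime_two).mp hd)
  have hcent : ∀ m ∈ M, ∃ c ∈ K, ∀ k ∈ stab J l, c * m * k * (c * m)⁻¹ ∈ J := by
    intro m hm
    have hcm : ∀ k ∈ stab J l, m * k * m⁻¹ * k⁻¹ ∈ K := fun k hk => by
      have hz : k * m⁻¹ * k⁻¹ ∈ M := hMN.2 k (hJ' hk) _ (M.inv_mem hm)
      refine (hl.mem _).mpr ⟨by simpa [mul_assoc] using M.mul_mem hm hz, ?_⟩
      rw [show m * k * m⁻¹ * k⁻¹ = m * (k * m⁻¹ * k⁻¹) by group, hl.lin.2.2 _ hm _ hz]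
      conv_lhs => rw [show l (k * m⁻¹ * k⁻¹) = l m⁻¹ by
        conv_lhs => rw [← hk.2]
        exact congrArg l (by group)]
      rw [mul_comm, hl.lin.map_inv hm]
    have h12 : ∀ z ∈ cjS m (stab J l), ∃ a ∈ K, a * z ∈ stab J l := fun z hz => by
      have hk := mem_cjS.mp hz
      refine ⟨_, K.inv_mem (hcm _ hk), ?_⟩
      convert hk using 1
      group
    have h1 : cjS m (stab J l) ≤ prodS hKN hJ' := fun z hz => by
      have hk := mem_cjS.mp hz
      exact ⟨_, hcm _ hk, _, hk, by group⟩
    have h3 : cjS m (stab J l) ⊓ K ≤ E := by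
      rintro z ⟨hz, hzK⟩
      have hk := mem_cjS.mp hz
      have : m⁻¹ * z * m ∈ E := hJM ▸ ⟨stab_le J l hk,
        (hMN.conj_mem_iff' (hMN.le hm)).mpr (hl.le hzK)⟩
      exact (hEN.conj_mem_iff' (hMN.le hm)).mp this
    have h4 : stab J l ⊓ K ≤ E := by
      rintro z ⟨hz, hzK⟩
      exact hJM ▸ ⟨stab_le J l hz, hl.le hzK⟩
    obtain ⟨c, hc, h⟩ := PStep.conj_compl hp (hEN.mono (hEK.trans hK1) h1N)
      ⟨hKN.mono hK1 h1N, fun z hz => ⟨2, hnd, by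
        rw [pow_two]
        exact (hKN.mono hK1 h1N).sq_mem hJ1 (fun t ht => ht) hEK
          (fun x hx => hJ2 x (stab_le J l hx)) z hz⟩⟩ (hEM.mono hEK hl.le) h1 hJ1 hEs h3 h4 h12
    refine ⟨c, hc, fun k hk => stab_le J l ?_⟩
    have := h (m * k * m⁻¹) (mem_cjS.mpr (by simpa [mul_assoc] using hk))
    convert this using 1
    simp only [mul_inv_rev, mul_assoc]
  have key : ∀ y, (if y ∈ N then ρ (y * x * y⁻¹) else 0) = if y ∈ N then ρ x else 0 := by
    intro y
    split_ifs with hy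
    · obtain ⟨m, hm, j, hj, e⟩ := hF y⁻¹ (N.inv_mem hy)
      obtain rfl : y = j⁻¹ * m⁻¹ := by rw [← inv_inv y, e]; group
      obtain ⟨c, hc, h⟩ := hcent m⁻¹ (M.inv_mem hm)
      have hu := h x ⟨hx, hfix⟩
      have huM : c * m⁻¹ ∈ M := M.mul_mem (hl.le hc) (M.inv_mem hm)
      have hE : x⁻¹ * (c * m⁻¹ * x * (c * m⁻¹)⁻¹) ∈ E := hJM ▸ ⟨J.mul_mem (J.inv_mem hx) hu, by
        have := M.mul_mem ((hMN.conj_mem_iff' (hJ hx)).mpr huM) (M.inv_mem huM)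
        rw [show x⁻¹ * (c * m⁻¹ * x * (c * m⁻¹)⁻¹) = x⁻¹ * (c * m⁻¹) * x * (c * m⁻¹)⁻¹ by group]
        exact this⟩
      have h3 := hρ.chr.kernel (hK0 (hEK hE)) (hρE _ hE) x
      have h4 := hρ.chr.classOn.2 (j⁻¹ * c⁻¹) ((prodS hKN hJ).mul_mem (hJ0 (J.inv_mem hj))
        (hK0 (K.inv_mem hc))) (c * m⁻¹ * x * (c * m⁻¹)⁻¹)
      rw [← h3, mul_inv_cancel_left, ← h4]
      congr 1
      group
    · rfl
  rw [ind, Finset.sum_congr rfl fun y _ => key y, ← Finset.sum_filter, Finset.sum_const,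
    nsmul_eq_mul, ← Fintype.card_subtype, ← Nat.card_eq_fintype_card, ← mul_assoc]
end

section
variable {G : Type} [Group G] [Fintype G] {p : ℕ} {E K M N J : Subgroup G} {l ρ f g h : G → ℂ}

theorem ip_congr_left (hh : ∀ g, g ∉ K → h g = 0) (e : ∀ x ∈ K, f x = g x) : ip K f h = ip K g h := by
  rw [← ip_res_left K f hh, ← ip_res_left K g hh]
  congr 1
  exact ext_on (res_supp K f) (res_supp K g) fun x hx => by
    rw [res_of_mem hx, res_of_mem hx, e x hx]

theorem Chr.exists_odd_const (hf : Chr N f) (hK : K ≤ N) {n : ℕ} (hn : Odd n) (h1 : f 1 = n) :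
    ∃ ρ, Irr K ρ ∧ ip K f ρ ≠ 0 ∧ ∃ r, Odd r ∧ ρ 1 = (r : ℕ) := by
  by_contra! hc
  have hres := (hf.res hK).classOn.expand
  have hd : ∀ χ ∈ IrrF K, ∃ k : ℕ, ip K (_root_.res K f) χ * χ 1 = (2 * k : ℕ) := by
    intro χ hχ
    have hχ := mem_IrrF.mp hχ
    rw [ip_res_left K f hχ.1]
    by_cases h0 : ip K f χ = 0
    · exact ⟨0, by simp [h0]⟩
    obtain ⟨r, hr⟩ := hχ.chr.deg_nat
    obtain ⟨a, ha⟩ := hf.ip_nat' hK hχ.chr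
    obtain ⟨k, hk⟩ := Nat.not_odd_iff_even.mp fun ho => hc χ hχ h0 r ho hr
    exact ⟨a * k, by rw [ha, hr, hk]; push_cast; ring⟩
  choose! k hk using hd
  have h2 := congrFun hres 1
  rw [res_one, h1, Finset.sum_apply, Finset.sum_congr rfl fun χ hχ => (by exact hk χ hχ), ← Nat.cast_sum,
    Nat.cast_inj, ← Finset.mul_sum] at h2
  exact (Nat.not_odd_iff_even.mpr ⟨_, h2.trans (two_mul _)⟩) hn

theorem Nrm.res_irr_of_sq (h : Nrm M N) (hs : ∀ x ∈ N, x * x ∈ M) (hζ : Irr N f) {n : ℕ}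
    (hn : Odd n) (h1 : f 1 = n) : Irr M (res M f) :=
  ((AbStep.of_sq h hs).poly.chain hζ h1 fun x hx =>
    ⟨2, (Nat.coprime_two_left.mpr hn), by rw [pow_two]; exact hs x hx⟩).1

theorem irr_trivial_of_sq (hEN : Nrm E N) (hN2 : ∀ x ∈ N, x * x ∈ E) (hf : Irr N f)
    (hfE : ∀ e ∈ E, f e = f 1) {n : ℕ} (hn : Odd n) (h1 : f 1 = n)
    (h4 : ∀ x ∈ N, ∃ k : ℕ, f x + 4 * k = f 1) : f = pr N := by
  have hE := hEN.res_irr_of_sq hN2 hf hn h1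
  have e1 : res E f = (n : ℂ) • pr E := ext_on (res_supp E f)
    (fun g hg => by rw [Pi.smul_apply, (lin_pr E).1 g hg, smul_zero]) fun g hg => by
      rw [res_of_mem hg, hfE g hg, h1, Pi.smul_apply, pr_of_mem hg, smul_eq_mul, mul_one]
  have e2 := hE.orth (lin_pr E).irr
  have h0 : (n : ℂ) ≠ 0 := Nat.cast_ne_zero.mpr hn.pos.ne'
  have e3 : ip E (res E f) (pr E) = n := by
    rw [e1, ip_smul_left, (lin_pr E).irr.ip_self, mul_one]
  rw [e3] at e2
  have e4 : res E f = pr E := by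
    by_contra hne
    rw [if_neg hne] at e2
    exact h0 e2
  have e5 : f 1 = 1 := by rw [← res_one (K := E) f, e4, pr_of_mem E.one_mem]
  have hl := hf.chr.lin_of_deg e5
  refine ext_on hf.1 (lin_pr N).1 fun x hx => ?_
  rw [pr_of_mem hx]
  have e6 : f x * f x = 1 := by rw [← hl.2.2 x hx x hx, hfE _ (hN2 x hx), e5]
  rcases mul_self_eq_one_iff.mp e6 with h | h
  · exact h
  · obtain ⟨k, hk⟩ := h4 x hx
    rw [h, e5] at hk
    have : ((4 * k : ℕ) : ℂ) = (2 : ℕ) := by push_cast; linear_combination hk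
    have := Nat.cast_injective this
    omega

theorem Step.exists_sign (hl : Step K M l p) (h2 : p ≠ 2) (hMN : Nrm M N) (hJ : J ≤ N)
    (hKN : Nrm K N) (hJl : ∀ x ∈ J, cj x l = l ∨ cj x l * l = pr M) :
    ∃ μ, Lin (prodS hKN hJ) μ ∧ (∀ x ∈ J, cj x l = l → μ x = 1) ∧
      ∀ x ∈ J, cj x l * l = pr M → μ x = -1 := by
  obtain ⟨hK0, hJ0, h0N⟩ := le_prodS hKN hJ
  have hor : ∀ z ∈ prodS hKN hJ, cj z l = l ∨ cj z l * l = pr M := by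
    rintro _ ⟨k, hk, j, hj, rfl⟩
    have hkl := hl.lin.chr.classOn.cj_eq (hl.le hk)
    rw [cj_mul]
    rcases hJl j hj with h | h
    · exact Or.inl (by rw [h, hkl])
    · right
      have := congrArg (cj k) h
      rwa [cj_mul_fun, hkl, hMN.cj_pr (hMN.le (hl.le hk))] at this
  have hxor : ∀ z, cj z l = l → cj z l * l ≠ pr M := by
    intro z h h'
    obtain ⟨x, hx, hx1⟩ := hl.nontriv
    rw [h] at h'
    have := congrFun h' x
    rw [Pi.mul_apply, pr_of_mem hx, ← pow_two, ← hl.lin.map_pow hx] at this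
    exact hx1 ((hl.mem x).mp (hl.mem_of_pow hx (fun hd => h2 ((Nat.prime_dvd_prime_iff_eq hl.prime
        Nat.prime_two).mp hd)) ((hl.mem _).mpr ⟨M.pow_mem hx 2, this⟩))).2
  let μ : G → ℂ := fun z => if z ∈ prodS hKN hJ then (if cj z l = l then 1 else -1) else 0
  have hμ1 : ∀ z ∈ prodS hKN hJ, cj z l = l → μ z = 1 := fun z hz h => by
    simp only [μ, if_pos hz, if_pos h]
  have hμ2 : ∀ z ∈ prodS hKN hJ, cj z l * l = pr M → μ z = -1 := fun z hz h => by
    simp only [μ, if_pos hz, if_neg fun h' => hxor z h' h]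
  refine ⟨μ, ⟨fun g hg => if_neg hg, hμ1 1 (one_mem _) (cj_one l), fun x hx y hy => ?_⟩,
    fun x hx => hμ1 x (hJ0 hx), fun x hx => hμ2 x (hJ0 hx)⟩
  have hxy := mul_mem hx hy
  have hprx := hMN.cj_pr (h0N hx)
  rcases hor x hx with h | h <;> rcases hor y hy with h' | h'
  · rw [hμ1 x hx h, hμ1 y hy h', hμ1 _ hxy (by rw [cj_mul, h', h]), one_mul]
  · rw [hμ1 x hx h, hμ2 y hy h', hμ2 _ hxy ?_, one_mul]
    have := congrArg (cj x) h'
    rwa [cj_mul_fun, h, hprx, ← cj_mul] at this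
  · rw [hμ2 x hx h, hμ1 y hy h', hμ2 _ hxy (by rw [cj_mul, h', h]), mul_one]
  · rw [hμ2 x hx h, hμ2 y hy h', hμ1 _ hxy ?_]
    · norm_num
    have := congrArg (cj x) h'
    rw [cj_mul_fun, hprx, ← cj_mul] at this
    have h3 : cj (x * y) l * pr M = cj (x * y) l := mul_pr fun g hg => hl.lin.1 _ fun hg' => hg
      ((hMN.conj_mem_iff' (h0N hxy)).mp hg')
    rw [← h3, ← h, ← mul_assoc, this, mul_comm, mul_pr hl.lin.1]

theorem ip_pr_ne_zero (hp : p.Prime) (h2 : p ≠ 2) (hEJ : E ≤ J) (hJ2 : ∀ x ∈ J, x * x ∈ E) (s : ℕ) :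
    ∀ (M N : Subgroup G) (ζ : G → ℂ), Nat.card M = s → Nrm E N → Nrm M N → PStep p E M →
      Factors N M J → J ≤ N → J ⊓ M = E → Irr N ζ → (∀ e ∈ E, ζ e = ζ 1) →
      (∃ n : ℕ, Odd n ∧ ζ 1 = n) → (∀ x ∈ J, ∃ k : ℕ, ζ x + 4 * k = ζ 1) →
      ip J ζ (pr J) ≠ 0 := by
  induction s using Nat.strong_induction_on with | _ s ih
  intro M N ζ hs hEN hMN hEM hF hJ hJM hζ hζE ⟨n, hn, hn1⟩ h4
  rcases hEM.1.le.eq_or_lt with rfl | hlt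
  · obtain rfl : N = J := le_antisymm (fun t ht => by
      obtain ⟨m, hm, j, hj, rfl⟩ := hF t ht
      exact J.mul_mem (hEJ hm) hj) hJ
    rw [irr_trivial_of_sq hEN hJ2 hζ hζE hn hn1 h4, (lin_pr N).irr.ip_self]
    exact one_ne_zero
  obtain ⟨l, K, hEK, hl, hKN, hJl⟩ := exists_pm_step hp hEN hMN hEM hlt hF hJ hEJ hJ2
  obtain ⟨hK0, hJ0, h0N⟩ := le_prodS hKN hJ
  set N₀ := prodS hKN hJ with hN₀
  have hF0 : Factors N₀ K J := fun t ht => ht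
  have hJK : J ⊓ K = E := le_antisymm (fun x hx => hJM ▸ ⟨hx.1, hl.le hx.2⟩) fun x hx => ⟨hEJ hx, hEK hx⟩
  have hcard : Nat.card K < s := by
    rw [← hs, hl.card]
    have := hl.prime.two_le
    have : 0 < Nat.card K := Nat.card_pos
    nlinarith
  have hM2 := hMN.sq_mem hJ hF hEM.1.le hJ2
  have hζM := hMN.res_irr_of_sq hM2 hζ hn hn1
  obtain ⟨ρ, hρ, hζρ, r, hr, hr1⟩ := hζ.chr.exists_odd_const h0N hn hn1
  have hKN0 := hKN.mono hK0 h0N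
  have hEN0 := hEN.mono (hEK.trans hK0) h0N
  have hρK := hKN0.res_irr_of_sq (hKN0.sq_mem hJ0 hF0 hEK hJ2) hρ hr hr1
  have hρE := hEN0.const_trivial h0N hζ.chr hρ hζρ hζE
  have h0 : ip K (res M ζ) (res K ρ) ≠ 0 := by
    rw [← ip_res_left K _ (res_supp K ρ), res_res hl.le, ip_res_left K _ (res_supp K ρ)]
    refine hζ.chr.ip_trans hK0 h0N hρK.chr hρ hζρ ?_
    rw [← ip_res_left K _ (res_supp K ρ), hρK.ip_self]
    exact one_ne_zero
  have hEKp := hEM.mono hEK hl.le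
  rcases hl.dichotomy hζM hρK h0 with ⟨e, -⟩ | ⟨-, -, e, -⟩
  · rw [res_res hl.le] at e
    have hζ0 : Irr N₀ (res N₀ ζ) := (hζ.chr.res h0N).irr_of_res hK0 (by
      rw [res_res hK0, e]; exact hρK)
    have := ih _ hcard K N₀ (res N₀ ζ) rfl hEN0 hKN0 hEKp hF0 hJ0 hJK hζ0
      (fun e he => by rw [res_of_mem (hK0 (hEK he)), res_one, hζE e he]) ⟨n, hn, by rw [res_one, hn1]⟩
      fun x hx => by rw [res_of_mem (hJ0 hx), res_one]; exact h4 x hx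
    rwa [ip_congr_left (lin_pr J).1 fun x hx => res_of_mem (hJ0 hx)] at this
  rw [res_one, res_one] at e
  have hNN : (Nat.card N : ℂ) = p * Nat.card N₀ := by
    have c1 := hMN.card_mul hJ hF
    have c2 := hKN0.card_mul hJ0 hF0
    rw [hJM, hl.card, mul_assoc] at c1
    rw [hJK] at c2
    rw [← c2, ← mul_assoc] at c1
    exact_mod_cast Nat.eq_of_mul_eq_mul_right (Nat.card_pos (α := E)) c1
  have hc0 := card_ne_zero' N₀
  have hind : ind N₀ N ρ = ζ := by
    have h3 : ip N (ind N₀ N ρ) ζ ≠ 0 := by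
      rw [ip_ind_left _ hζ.chr.classOn]
      exact ip_ne_comm.mp hζρ
    refine sub_eq_zero.mp (((hρ.chr.ind h0N).sub_const hζ h3).eq_zero_of_deg ?_)
    rw [Pi.sub_apply, ind_one, e, hNN, mul_div_cancel_right₀ _ hc0, sub_self]
  have hinv : ∀ x ∈ J, cj x l * l = pr M → ζ x = ρ x := fun x hx hi => by
    rw [← hind]
    exact hl.ind_of_inv h2 hKN hMN hJ hF hEK hJM hρ hx hi
  have hfix : ∀ x ∈ J, cj x l = l → ζ x = p * ρ x := fun x hx hi => by
    have := hl.ind_of_fix hp h2 hKN hMN hEN hEM hJ hF hEK hEJ hJM hJ2 hρ hρE hx hi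
    rw [← hN₀, hind, hNN] at this
    rw [this]
    field_simp
  obtain ⟨μ, hμ, hμ1, hμ2⟩ := hl.exists_sign h2 hMN hJ hKN hJl
  have hρμ := hρ.mul_lin hμ
  have hμE : ∀ e ∈ E, μ e = 1 := fun e he =>
    hμ1 e (hEJ he) (hl.lin.chr.classOn.cj_eq (hEM.1.le he))
  obtain ⟨a, ha⟩ := hρ.chr.ip_nat' hJ0 (lin_pr J).chr
  obtain ⟨b, hb⟩ := hρμ.chr.ip_nat' hJ0 (lin_pr J).chr
  have hab : a ≠ 0 ∨ b ≠ 0 := by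
    have hsq : ∀ f, Irr N₀ f → (∀ e ∈ E, f e = f 1) → ∀ x ∈ J, ∃ k : ℕ, f x + 2 * k = f 1 :=
      fun f hf hfE x hx => hf.chr.sq_apply (hJ0 hx) (hfE _ (hJ2 x hx))
    have hodd := hp.odd_of_ne_two h2
    obtain ⟨q, hq⟩ := hodd
    have hrμ : (ρ * μ) 1 = r := by rw [Pi.mul_apply, hμ.2.1, mul_one, hr1]
    have hEμ : ∀ e ∈ E, (ρ * μ) e = (ρ * μ) 1 := fun e he => by
      rw [Pi.mul_apply, hμE e he, mul_one, hrμ, hρE e he, hr1]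
    have hrec : ∀ f, Irr N₀ f → (∀ e ∈ E, f e = f 1) → f 1 = r →
        (∀ x ∈ J, ∃ k : ℕ, f x + 4 * k = f 1) → ip J f (pr J) ≠ 0 := fun f hf hfE hf1 hf4 =>
      ih _ hcard K N₀ f rfl hEN0 hKN0 hEKp hF0 hJ0 hJK hf hfE ⟨r, hr, hf1⟩ hf4
    have even_quarter : ∀ f, Irr N₀ f → (∀ e ∈ E, f e = f 1) → f 1 = r →
        (∀ x ∈ J, ∀ j k : ℕ, f x + 2 * j = r → ζ x + 4 * k = p * r → Even j) →
        ip J f (pr J) ≠ 0 := by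
      intro f hf hfE hf1 hj
      refine hrec f hf hfE hf1 fun x hx => ?_
      obtain ⟨j, hj1⟩ := hsq f hf hfE x hx
      obtain ⟨k, hk⟩ := h4 x hx
      rw [e, hr1] at hk
      obtain ⟨i, hi⟩ := hj x hx j k (hj1.trans hf1) hk
      refine ⟨i, ?_⟩
      rw [← hj1, hi]
      push_cast
      ring
    have hcast : ∀ {a b : ℤ}, (a : ℂ) = b → a = b := fun h => Int.cast_injective h
    obtain ⟨t, ht⟩ := hr
    rcases Nat.even_or_odd q with ⟨v, hv⟩ | ⟨v, hv⟩
    · left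
      have := even_quarter ρ hρ hρE hr1 fun x hx j k hj hk => by
        rcases hJl x hx with h | h
        · rw [hfix x hx h] at hk
          have h3 : 2 * (k : ℤ) = p * j := hcast (by push_cast; linear_combination hk / 2 - p / 2 * hj)
          have h3' : 2 * k = p * j := by exact_mod_cast h3
          exact (Nat.even_mul.mp ⟨k, by rw [← h3']; ring⟩).resolve_left
            (Nat.not_even_iff_odd.mpr ⟨q, hq⟩)
        · rw [hinv x hx h] at hk
          have h3 : (j : ℤ) + q * r = 2 * k := hcast (by
            rw [hq] at hk; push_cast at hk ⊢; linear_combination hj / 2 - hk / 2)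
          refine ⟨k - v * r, ?_⟩
          subst hv
          have : (v + v) * r = 2 * (v * r) := by ring
          zify at this
          push_cast at h3
          omega
      rwa [ha, Nat.cast_ne_zero] at this
    · right
      have := even_quarter (ρ * μ) hρμ hEμ hrμ fun x hx j k hj hk => by
        rw [Pi.mul_apply] at hj
        rcases hJl x hx with h | h
        · rw [hμ1 x hx h, mul_one] at hj
          rw [hfix x hx h] at hk
          have h3 : 2 * (k : ℤ) = p * j := hcast (by push_cast; linear_combination hk / 2 - p / 2 * hj)
          have h3' : 2 * k = p * j := by exact_mod_cast h3
          exact (Nat.even_mul.mp ⟨k, by rw [← h3']; ring⟩).resolve_left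
            (Nat.not_even_iff_odd.mpr ⟨q, hq⟩)
        · rw [hμ2 x hx h] at hj
          rw [hinv x hx h] at hk
          have h3 : (j : ℤ) + 2 * k = (q + 1) * r := hcast (by
            rw [hq] at hk; push_cast at hk ⊢; linear_combination hj / 2 + hk / 2)
          have h6 : (q + 1) * r = 2 * ((v + 1) * r) := by rw [hv]; ring
          have h7 : j + 2 * k = (q + 1) * r := by exact_mod_cast h3
          exact ⟨(v + 1) * r - k, by omega⟩
      rwa [hb, Nat.cast_ne_zero] at this
  have h5 : ip J ζ (pr J) = ((p : ℂ) + 1) / 2 * a + ((p : ℂ) - 1) / 2 * b := by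
    rw [← ha, ← hb, ← ip_smul_left, ← ip_smul_left, ← ip_add_left]
    refine ip_congr_left (lin_pr J).1 fun x hx => ?_
    simp only [Pi.add_apply, Pi.smul_apply, Pi.mul_apply, smul_eq_mul]
    rcases hJl x hx with h | h
    · rw [hfix x hx h, hμ1 x hx h]; ring
    · rw [hinv x hx h, hμ2 x hx h]; ring
  rw [h5]
  intro h6
  have h7 : (((p + 1) * a + (p - 1) * b : ℕ) : ℂ) = 0 := by
    push_cast [Nat.cast_sub hp.one_le]
    linear_combination 2 * h6
  have := Nat.cast_eq_zero.mp h7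
  have := hp.two_le
  simp only [Nat.add_eq_zero_iff, mul_eq_zero] at *
  omega
end

section
variable {G : Type} [Group G] [Fintype G] {p : ℕ} {σ : ℂ →+* ℂ} {E K L M N J U X : Subgroup G}
  {f η θ χ β ω d : G → ℂ} {π : Set ℕ}

theorem le_of_subnormal (h : Relation.ReflTransGen Nrm K L) : K ≤ L := by
  induction h using Relation.ReflTransGen.head_induction_on with
  | refl => exact le_rfl
  | head h _ ih => exact h.le.trans ih

theorem Spec.det_under (h : Spec π X χ) (hL : Nrm L X) (hη : Irr L η) (h0 : ip L χ η ≠ 0)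
    (hM : Irr M (res M η)) (hMK : M ≤ K) (hK : Relation.ReflTransGen Nrm K L)
    (hd : HasDet K (res K η) d) : ∃ m, m ≠ 0 ∧ IsPiNumber π m ∧ ∀ x ∈ K, d x ^ m = 1 := by
  have hKL := le_of_subnormal hK
  have h5 : Irr K (res K η) := (hη.chr.res hKL).irr_of_res hMK (by rwa [res_res hMK])
  have h6 : ip K χ (res K η) ≠ 0 := by
    refine h.1.chr.ip_trans hKL hL.le h5.chr hη h0 ?_
    rw [← ip_res_left K _ h5.1, h5.ip_self]
    exact one_ne_zero
  obtain ⟨d', m, hd', hm0, hm, hdm⟩ := h.2.2 K (hK.tail hL) _ h5 h6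
  obtain rfl := hd.unique hd'
  exact ⟨m, hm0, hm, hdm⟩

theorem IsPiNumber.eq_pow {n : ℕ} (h : IsPiNumber {p} n) (h0 : n ≠ 0) : ∃ k, n = p ^ k :=
  ⟨_, Nat.eq_prime_pow_of_unique_prime_dvd h0 fun hq hd => h _ hq hd⟩

theorem Sg.tau_apply (hσ : Sg p G σ) (hf : Chr L f) {g : G} {k : ℕ} (hg : g ^ p ^ k = 1) :
    tau σ (f g) = f g := by
  by_cases hL : g ∈ L
  · obtain ⟨s, h1, h2⟩ := hf.exists_eig hL
    have h3 := h2 1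
    simp only [pow_one, Multiset.map_id'] at h3
    rw [h3, map_multiset_sum]
    congr 1
    conv_rhs => rw [← Multiset.map_id s]
    refine Multiset.map_congr rfl fun μ hμ => ?_
    have h4 : μ ^ p ^ k = 1 := by
      obtain ⟨c, hc⟩ := orderOf_dvd_of_pow_eq_one hg
      rw [hc, pow_mul, h1 μ hμ, one_pow]
    have h5 := hσ.inv μ k (pow_card_of_pow_orderOf (h1 μ hμ)) h4
    have h6 : ‖μ‖ = 1 := Complex.norm_eq_one_of_pow_eq_one h4 (pow_ne_zero _ hσ.prime.ne_zero)
    have h7 : (starRingEnd ℂ) μ * μ = 1 := by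
      rw [mul_comm, Complex.mul_conj, Complex.normSq_eq_norm_sq, h6]; simp
    have h8 : σ μ = (starRingEnd ℂ) μ :=
      mul_right_cancel₀ (right_ne_zero_of_mul (h7.trans_ne one_ne_zero)) (h5.trans h7.symm)
    change (starRingEnd ℂ) (σ μ) = μ
    rw [h8, Complex.conj_conj]
  · rw [hf.1 g hL, map_zero]

/-- If the constituents below an irreducible character of odd degree are linear and closed under
complex conjugation, they are all real. -/
theorem Nrm.real_of_odd (hN : Nrm N U) (hη : Irr U η) {n : ℕ} (hn : Odd n) (h1 : η 1 = n)
    (hl : ∀ ω, Irr N ω → ip N η ω ≠ 0 → Lin N ω)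
    (hc : ∀ ω, Irr N ω → ip N η ω ≠ 0 → ip N η (mp (starRingEnd ℂ) ω) ≠ 0)
    (hω : Irr N ω) (h0 : ip N η ω ≠ 0) : mp (starRingEnd ℂ) ω = ω := by
  have hcc : ∀ f : G → ℂ, mp (starRingEnd ℂ) (mp (starRingEnd ℂ) f) = f := fun f => by
    funext g; simp [_root_.mp]
  obtain ⟨e, he⟩ := hη.chr.ip_nat' hN.le hω.chr
  set s := (IrrF N).filter fun ω => ip N η ω ≠ 0 with hs
  have hms : ∀ ψ, ψ ∈ s ↔ Irr N ψ ∧ ip N η ψ ≠ 0 := fun ψ => by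
    rw [hs, Finset.mem_filter, mem_IrrF]
  have hmult : ∀ ψ ∈ s, ip N η ψ = e := fun ψ hψ => by
    obtain ⟨x, hx, rfl⟩ := hN.conj_const hη hω ((hms ψ).1 hψ).1 h0 ((hms ψ).1 hψ).2
    rw [hN.ip_cj_right hx hη.chr.classOn, he]
  have h2 : (n : ℂ) = s.card * e := by
    have h3 := congrFun (hη.chr.res hN.le).classOn.expand 1
    rw [res_one, h1] at h3
    rw [h3, Finset.sum_apply, hs, Finset.card_filter, Nat.cast_sum, Finset.sum_mul]
    refine Finset.sum_congr rfl fun ψ hψ => ?_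
    rw [mem_IrrF] at hψ
    rw [Pi.smul_apply, smul_eq_mul, ip_res_left _ _ hψ.1]
    by_cases h4 : ip N η ψ = 0
    · simp [h4]
    · rw [if_pos h4, (hl ψ hψ h4).2.1, hmult ψ ((hms ψ).2 ⟨hψ, h4⟩)]; simp
  have h3 : Odd s.card := by
    have : n = s.card * e := by exact_mod_cast h2
    rw [this] at hn
    exact (Nat.odd_mul.1 hn).1
  by_cases hr : ∀ ψ ∈ s, mp (starRingEnd ℂ) ψ ≠ ψ
  · exfalso
    have h4 : ∑ ψ ∈ s, (1 : ZMod 2) = 0 := by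
      refine Finset.sum_involution (fun ψ _ => mp (starRingEnd ℂ) ψ) (fun _ _ => by decide)
        (fun ψ hψ _ => hr ψ hψ) (fun ψ hψ => ?_) (fun ψ _ => hcc ψ)
      obtain ⟨h5, h6⟩ := (hms ψ).1 hψ
      exact (hms _).2 ⟨h5.mp _, hc ψ h5 h6⟩
    rw [Finset.sum_const, nsmul_one, ZMod.natCast_eq_zero_iff] at h4
    exact (Nat.not_even_iff_odd.2 h3) (even_iff_two_dvd.2 h4)
  · push Not at hr
    obtain ⟨ψ, hψ, hψr⟩ := hr
    obtain ⟨x, hx, rfl⟩ := hN.conj_const hη ((hms ψ).1 hψ).1 hω ((hms ψ).1 hψ).2 h0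
    rw [← cj_mp, hψr]

end

section
variable {G : Type} [Group G] [Fintype G] {p : ℕ} {σ : ℂ →+* ℂ} {E K L M N J U X : Subgroup G}
  {f η θ χ β ω d : G → ℂ} {π : Set ℕ}

theorem Nrm.trivial_of_pr (hM : Nrm M U) (hη : Irr U η)
    (h : ∀ θ, Irr M θ → ip M η θ ≠ 0 → θ = pr M) : ∀ m ∈ M, η m = η 1 := by
  obtain ⟨θ, hθ, h0⟩ := hη.exists_under hM.le
  obtain rfl := h θ hθ h0
  have h1 : ∀ m ∈ M, η m = ip M η (pr M) * pr M m := fun m hm =>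
    hM.res_of_inv hη hθ h0 (fun x hx => hM.cj_pr hx) hm
  intro m hm
  rw [h1 m hm, h1 1 (one_mem M), pr_of_mem hm, pr_of_mem (one_mem M)]

theorem Lin.of_ip_ne (hω : Lin N ω) (hJ : J ≤ N) (hθ : Irr J θ) (h0 : ip J ω θ ≠ 0) :
    ∀ x ∈ J, ω x = θ x := by
  have h1 := (hω.res hJ).irr.orth hθ
  rw [ip_res_left _ _ hθ.1] at h1
  by_cases e : _root_.res J ω = θ
  · intro x hx
    rw [← e, res_of_mem hx]
  · exact absurd (h1.trans (if_neg e)) h0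

theorem QStep.mem_of_pow (hp : p.Prime) (h : QStep p M N) {x : G} (hx : x ∈ N) {k : ℕ}
    (hk : x ^ p ^ k = 1) : x ∈ M := by
  obtain ⟨m, hm, hxm⟩ := h.2 x hx
  refine mem_of_pow_mem_of_coprime (Nat.Coprime.coprime_dvd_left (orderOf_dvd_of_pow_eq_one hk) ?_) hxm
  exact ((hp.coprime_iff_not_dvd).2 hm).pow_left k

/-- The part of the kernel lying in a normal subgroup is normal. -/
theorem ker_inf_nrm (hβ : Chr U β) (hN : Nrm N U) : Nrm (ker hβ ⊓ N) U := by
  refine ⟨inf_le_right.trans hN.le, fun x hx m hm => ⟨mem_ker.2 ⟨?_, ?_⟩, hN.2 x hx m hm.2⟩⟩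
  · exact U.mul_mem (U.mul_mem hx (hN.le hm.2)) (U.inv_mem hx)
  · rw [hβ.classOn.2 x hx, (mem_ker.1 hm.1).2]

theorem PStep.prodS (hp : p.Prime) (hM : Nrm M N) (hE : Nrm E N)
    (h : ∀ x ∈ M, ¬ p ∣ orderOf x → x ∈ E) : PStep p E (prodS hM hE.le) := by
  obtain ⟨h1, h2, h3⟩ := le_prodS hM hE.le
  refine ⟨hE.mono h2 h3, fun x hx => ?_⟩
  obtain ⟨m, hm, e, he, rfl⟩ := mem_prodS.1 hx
  obtain ⟨k, hk⟩ := exists_pow_reg hp m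
  exact ⟨k, pow_mem_of_normalizes he rfl (hE.cjS (hM.le hm)) (h _ (M.pow_mem hm _) hk)⟩

theorem Nrm.prodS (hM : Nrm M N) (hE : Nrm E N) : Nrm (prodS hM hE.le) N := by
  refine ⟨(le_prodS hM hE.le).2.2, fun x hx y hy => ?_⟩
  obtain ⟨m, hm, e, he, rfl⟩ := mem_prodS.1 hy
  exact mem_prodS.2 ⟨_, hM.2 x hx m hm, _, hE.2 x hx e he, by group⟩

/-- Data around a `p'`-step: `η` is trivial on `R`, agrees with `β` on `J`, and `J` covers `N`
modulo `R`. -/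
structure Cov (p : ℕ) (U : Subgroup G) (β η : G → ℂ) (E R J N : Subgroup G) : Prop where
  nE : Nrm E N
  nR : Nrm R N
  pE : PStep p E R
  qR : QStep p R N
  EJ : E ≤ J
  JN : J ≤ N
  fac : Factors N R J
  inf : J ⊓ R = E
  memE : ∀ x ∈ N, x ∈ E ↔ β x = β 1
  triv : ∀ x ∈ R, η x = η 1
  eq : ∀ x ∈ J, β x = η x

theorem exists_cov (hp : p.Prime) (hβ : Chr U β) (hη : Irr U η) (e : RegEq p U β η) (hM : Nrm M U)
    (hN : Nrm N U) (hq : QStep p M N) (ht : ∀ m ∈ M, η m = η 1) : ∃ E R J, Cov p U β η E R J N := by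
  have hEU := ker_inf_nrm hβ hN
  have hE : Nrm (ker hβ ⊓ N) N := hEU.mono inf_le_right hN.le
  have e1 : β 1 = η 1 := e 1 (one_mem U) (by simpa using hp.ne_one)
  have hmE : ∀ x ∈ N, x ∈ ker hβ ⊓ N ↔ β x = β 1 := fun x hx =>
    ⟨fun h => (mem_ker.1 h.1).2, fun h => ⟨mem_ker.2 ⟨hN.le hx, h⟩, hx⟩⟩
  have hreg : ∀ x ∈ M, ¬ p ∣ orderOf x → x ∈ ker hβ ⊓ N := fun x hx hr =>
    (hmE x (hq.1.le hx)).2 (by rw [e x (hM.le hx) hr, ht x hx, e1])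
  have hP := PStep.prodS hp hq.1 hE hreg
  have hR := Nrm.prodS hq.1 hE
  obtain ⟨l1, l2, l3⟩ := le_prodS hq.1 hE.le
  have hQ : QStep p (prodS hq.1 hE.le) N := ⟨hR, fun x hx => by
    obtain ⟨m, hm, hx⟩ := hq.2 x hx
    exact ⟨m, hm, l1 hx⟩⟩
  obtain ⟨J, hEJ, hJN, hF, hJR⟩ := PStep.exists_compl hp hE hQ hP
  have hJ : ∀ x ∈ J, β x = η x := by
    obtain ⟨a, b, c, hab⟩ := exists_parts (G := G) hp
    intro x hx
    obtain ⟨h1, h2, -, -, -, h3⟩ := hab x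
    have hxb := J.pow_mem hx b
    have h4 : x ^ b ∈ ker hβ ⊓ N := hJR ▸ ⟨hxb, hQ.mem_of_pow hp (hJN hxb) h3⟩
    rw [← h1, hβ.kernel (hN.le (hJN hxb)) (mem_ker.1 h4.1).2,
      hη.chr.kernel (hN.le (hJN hxb)) (ht _ (hq.mem_of_pow hp (hJN hxb) h3))]
    exact e _ (U.pow_mem (hN.le (hJN hx)) a) h2
  refine ⟨_, _, J, hE, hR, hP, hQ, hEJ, hJN, hF, hJR, hmE, fun x hx => ?_, hJ⟩
  obtain ⟨m, hm, y, hy, rfl⟩ := mem_prodS.1 hx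
  rw [hη.chr.kernel (hN.le hy.2), ht m hm]
  rw [← hJ y (hEJ hy), (hmE y hy.2).1 hy, e1]

variable {R : Subgroup G}

theorem Cov.const_of_const (c : Cov p U β η E R J N) (hN : N ≤ U) (hη : Chr U η) (hθ : Irr J θ)
    (h : ip J β θ ≠ 0) : ∃ ω, Irr N ω ∧ ip N η ω ≠ 0 ∧ ip J ω θ ≠ 0 :=
  hη.exists_mid c.JN hN hθ.1 (by rwa [ip_congr_left hθ.1 c.eq] at h)

theorem Cov.ext (c : Cov p U β η E R J N) {ω ω' : G → ℂ} (hω : Lin N ω) (hω' : Lin N ω')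
    (h1 : ∀ x ∈ R, ω x = ω 1) (h1' : ∀ x ∈ R, ω' x = ω' 1) (h : ∀ x ∈ J, ω x = ω' x) : ω = ω' := by
  refine ext_on hω.1 hω'.1 fun x hx => ?_
  obtain ⟨m, hm, j, hj, rfl⟩ := c.fac x hx
  rw [hω.2.2 m (c.nR.le hm) j (c.JN hj), hω'.2.2 m (c.nR.le hm) j (c.JN hj), h1 m hm, h1' m hm,
    h j hj, hω'.2.1, hω.2.1]

/-- Lifting a constituent of `η` on `J` to a real constituent of `β` on `N`. -/
theorem Cov.exists_over (c : Cov p U β η E R J N) (hσ : Sg p G σ) (hβ : Spec {p} U β) (hN : Nrm N U)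
    (hab : AbStep R N) (hθ : Irr J θ) (h0 : ip J β θ ≠ 0) : ∃ ζ, Irr N ζ ∧ ip N β ζ ≠ 0 ∧
      ip J ζ θ ≠ 0 ∧ (∃ n : ℕ, Odd n ∧ ζ 1 = n) ∧ (∀ x ∈ E, ζ x = ζ 1) ∧
      (∀ x ∈ J, (starRingEnd ℂ) (ζ x) = ζ x) ∧
      ((∀ x ∈ J, x * x ∈ E) → ∀ x ∈ J, ∃ k : ℕ, ζ x + 4 * k = ζ 1) := by
  have hp := hσ.prime
  obtain ⟨ζ, hζ, h1, h2⟩ := hβ.1.chr.exists_mid c.JN hN.le hθ.1 h0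
  obtain ⟨b, hb0, hb⟩ := hβ.1.deg_pos
  obtain ⟨n, hn0, hn⟩ := hζ.deg_pos
  have hnb := hN.deg_dvd hβ.1 hζ h1 hb hn
  have hpi : IsPiNumber {p} n := fun q hq hd => hβ.2.1 b hb q hq (hd.trans hnb)
  obtain ⟨k, hk⟩ := hpi.eq_pow hn0.ne'
  have hE : ∀ x ∈ E, ζ x = ζ 1 := c.nE.const_trivial hN.le hβ.1.chr hζ h1 fun m hm => by
    have hE := fun x hx => (c.memE x hx).1
    rw [hE m (c.nE.le hm) hm]
  obtain ⟨a, b, e, hab'⟩ := exists_parts (G := G) hp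
  obtain ⟨h3, h4⟩ := hab.poly.chain hζ hn fun x hx => by
    obtain ⟨m, hm, hxm⟩ := c.qR.2 x hx
    exact ⟨m, hk ▸ (((hp.coprime_iff_not_dvd).2 hm).pow_left k).symm, hxm⟩
  have hdet : ∀ K d, R ≤ K → Relation.ReflTransGen Nrm K N → HasDet K (res K ζ) d →
      ∀ x ∈ K, ∃ k, d x ^ p ^ k = 1 := fun K d hRK hK hd x hx => by
    obtain ⟨m, hm0, hm, hd1⟩ := hβ.det_under hN hζ h1 h3 hRK hK hd
    obtain ⟨k, rfl⟩ := hm.eq_pow hm0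
    exact ⟨k, hd1 x hx⟩
  have hτ : _root_.mp (tau σ) ζ = ζ := by
    refine h4 _ ?_ fun K d hRK hK hd => hσ.tau_lin hd.lin (hdet K d hRK hK hd)
    refine ext_on (fun g hg => ?_) (res_supp R ζ) fun x hx => ?_
    · simp [_root_.mp, res_supp R ζ g hg]
    · obtain ⟨h5, h6, -, -, -, h7⟩ := hab' x
      have h8 := c.pE.mem_of_reg hp (R.pow_mem hx a) h6
      have h9 : ζ x = ζ (x ^ b) := by
        rw [← hζ.chr.kernel (c.nE.le h8) (hE _ h8) (x ^ b), ← pow_add, add_comm, pow_add, h5]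
      rw [_root_.mp, res_of_mem hx, h9, hσ.tau_apply hζ.chr h7]
  have hJb : ∀ x ∈ J, x ^ b ∈ E := fun x hx => by
    rw [← c.inf]
    exact ⟨J.pow_mem hx b, c.qR.mem_of_pow hp (c.JN (J.pow_mem hx b)) (hab' x).2.2.2.2.2⟩
  have hJa : ∀ x ∈ J, ζ x = ζ (x ^ a) := fun x hx => by
    rw [← hζ.chr.kernel (c.nE.le (hJb x hx)) (hE _ (hJb x hx)) (x ^ a), (hab' x).1]
  refine ⟨ζ, hζ, h1, h2, ⟨n, ?_, hn⟩, hE, fun x hx => ?_, fun hJ2 x hx => ?_⟩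
  · exact hk ▸ (hp.odd_of_ne_two hσ.odd).pow
  · have h5 := congrFun hτ (x ^ a)
    change (starRingEnd ℂ) (σ (ζ (x ^ a))) = ζ (x ^ a) at h5
    rw [hσ.apply_reg hζ.chr (hab' x).2.1] at h5
    rw [hJa x hx, h5]
  · have hxN := c.JN hx
    obtain ⟨d, hd⟩ := hζ.chr.exists_det
    obtain ⟨k, hk'⟩ := hdet N d c.nR.le .refl (by rwa [res_eq_self hζ.1]) _ (N.pow_mem hxN a)
    rw [hJa x hx]
    refine hd.involution (N.pow_mem hxN a) ?_ ?_
    · have h5 := hd.lin.pow_orderOf (N.pow_mem hxN a)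
      have h6 := (coprime_of_not_dvd hp (hab' x).2.1 k)
      have h7 := orderOf_dvd_of_pow_eq_one h5
      have h8 := orderOf_dvd_of_pow_eq_one hk'
      exact orderOf_eq_one_iff.1 (Nat.eq_one_of_dvd_coprimes h6 h7 h8)
    · rw [pow_two]
      exact hE _ (hJ2 _ (J.pow_mem hx a))

end

section
variable {G : Type} [Group G] [Fintype G] {p n : ℕ} {σ : ℂ →+* ℂ} {E K L M J U X R : Subgroup G}
  {f η θ χ β ω d : G → ℂ} {π : Set ℕ}

section
variable {N : Subgroup G}

theorem Cov.all_pr (c : Cov p U β η E R J N) (hσ : Sg p G σ) (hβ : Spec {p} U β) (hη : Irr U η)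
    (hN : Nrm N U) (hω : Irr N ω) (h0 : ip N η ω ≠ 0) : ω = pr N := by
  have hp := hσ.prime
  have e1 : β 1 = η 1 := c.eq 1 (one_mem J)
  obtain ⟨b, hb0, hb⟩ := hη.deg_pos
  obtain ⟨r, hr⟩ : ∃ r, b = p ^ r := IsPiNumber.eq_pow (hβ.2.1 b (e1.trans hb)) hb0.ne'
  have htr : ∀ ω, Irr N ω → ip N η ω ≠ 0 → ∀ x ∈ R, ω x = ω 1 := fun ω hω h0 =>
    c.nR.const_trivial hN.le hη.chr hω h0 c.triv
  have hlin : ∀ ω, Irr N ω → ip N η ω ≠ 0 → Lin N ω := fun ω hω h0 => by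
    obtain ⟨a, -, ha⟩ := hω.deg_pos
    obtain ⟨k, -, hk⟩ := (Nat.dvd_prime_pow hp).1 (hr ▸ hN.deg_dvd hη hω h0 hb ha)
    exact hω.chr.lin_of_deg (hω.deg_one_of_qstep hp c.qR (htr ω hω h0) (hk ▸ ha))
  have hker : ∀ x ∈ N, (∀ ω, Irr N ω → ip N η ω ≠ 0 → ω x = 1) → η x = η 1 := fun x hx h => by
    have h1 := (hη.chr.res hN.le).classOn.expand
    rw [← res_of_mem (f := η) hx, ← res_of_mem (f := η) (one_mem N), h1, Finset.sum_apply, Finset.sum_apply]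
    refine Finset.sum_congr rfl fun ω hω => ?_
    rw [mem_IrrF] at hω
    simp only [Pi.smul_apply, ip_res_left _ _ hω.1]
    by_cases h2 : ip N η ω = 0
    · rw [h2, zero_smul, zero_smul]
    · rw [h ω hω h2, (hlin ω hω h2).2.1]
  have hJE : ∀ x ∈ J, η x = η 1 → x ∈ E := fun x hx h => by
    rw [c.memE x (c.JN hx), c.eq x hx, h, e1]
  have hab : AbStep R N := ⟨c.nR, fun x hx y hy => by
    have h1 : x * y * x⁻¹ * y⁻¹ ∈ N :=
      N.mul_mem (N.mul_mem (N.mul_mem hx hy) (N.inv_mem hx)) (N.inv_mem hy)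
    have h2 : η (x * y * x⁻¹ * y⁻¹) = η 1 := hker _ h1 fun ω hω h0 => by
      have hl := hlin ω hω h0
      rw [hl.2.2 _ (N.mul_mem (N.mul_mem hx hy) (N.inv_mem hx)) _ (N.inv_mem hy),
        hl.conj_apply hx hy, mul_comm, hl.map_inv hy]
    obtain ⟨m, hm, j, hj, he⟩ := c.fac _ h1
    have h3 : η (j * (j⁻¹ * m * j)) = η j := hη.chr.kernel (hN.le (c.nR.le
      ((c.nR.conj_mem_iff' (c.JN hj)).2 hm))) (c.triv _ ((c.nR.conj_mem_iff' (c.JN hj)).2 hm)) j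
    rw [he] at h2 ⊢
    refine R.mul_mem hm ((c.inf.symm.le.trans inf_le_right) (hJE j hj ?_))
    rw [← h3, ← h2]
    congr 1
    group⟩
  have hJη : ∀ ω, Irr N ω → ip N η ω ≠ 0 → ip J β (res J ω) ≠ 0 := fun ω hω h0 => by
    have hl := ((hlin ω hω h0).res c.JN).irr
    rw [ip_congr_left hl.1 c.eq]
    refine hη.chr.ip_trans c.JN hN.le hl.chr hω h0 ?_
    rw [← ip_res_left _ _ hl.1, hl.ip_self]
    exact one_ne_zero
  have hreal : ∀ ω, Irr N ω → ip N η ω ≠ 0 → mp (starRingEnd ℂ) ω = ω := fun ω hω h0 => by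
    refine hN.real_of_odd hη (hr ▸ (hp.odd_of_ne_two hσ.odd).pow) hb hlin (fun ω hω h0 => ?_) hω h0
    have hl := hlin ω hω h0
    have hlJ := (hl.res c.JN).irr
    obtain ⟨ζ, hζ, h1, h2, -, -, h3, -⟩ := c.exists_over hσ hβ hN hab hlJ (hJη ω hω h0)
    have h4 : ip J ζ (mp (starRingEnd ℂ) (res J ω)) ≠ 0 := by
      rw [ip_congr_left (hlJ.mp _).1 (fun x hx => (h3 x hx).symm)]
      change ip J (mp (starRingEnd ℂ) ζ) _ ≠ 0
      rw [ip_mp hlJ.chr]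
      exact (map_ne_zero _).2 h2
    obtain ⟨ω', hω', h5, h6⟩ := c.const_of_const hN.le hη.chr (hlJ.mp (starRingEnd ℂ))
      (hβ.1.chr.ip_trans c.JN hN.le (hlJ.mp _).chr hζ h1 h4)
    have hl' := hlin ω' hω' h5
    have hlc := (hω.mp (starRingEnd ℂ)).chr.lin_of_deg (by simp [mp, hl.2.1])
    have h7 : ω' = mp (starRingEnd ℂ) ω := by
      refine c.ext hl' hlc (htr ω' hω' h5) (fun x hx => ?_) fun x hx => ?_
      · simp only [mp, htr ω hω h0 x hx]
      · rw [hl'.of_ip_ne c.JN (hlJ.mp _) h6 x hx]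
        simp only [mp, res_of_mem hx]
    rwa [← h7]
  have hJ2 : ∀ x ∈ J, x * x ∈ E := fun x hx => by
    refine hJE _ (J.mul_mem hx hx) (hker _ (c.JN (J.mul_mem hx hx)) fun ω hω h0 => ?_)
    have hl := hlin ω hω h0
    have h1 := hl.norm_eq (c.JN hx)
    have h2 : (starRingEnd ℂ) (ω x) = ω x := congrFun (hreal ω hω h0) x
    rw [hl.2.2 x (c.JN hx) x (c.JN hx)]
    rwa [h2] at h1
  obtain ⟨ζ, hζ, h1, -, h2, h3, -, h4⟩ :=
    c.exists_over hσ hβ hN hab ((hlin ω hω h0).res c.JN).irr (hJη ω hω h0)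
  have h5 := ip_pr_ne_zero hp hσ.odd c.EJ hJ2 _ R N ζ rfl c.nE c.nR c.pE c.fac c.JN c.inf hζ h3 h2
    (h4 hJ2)
  have hprJ := (lin_pr J).irr
  obtain ⟨ω', hω', h6, h7⟩ := c.const_of_const hN.le hη.chr hprJ
      (hβ.1.chr.ip_trans c.JN hN.le hprJ.chr hζ h1 h5)
  have h8 : ω' = pr N := by
    refine c.ext (hlin ω' hω' h6) (lin_pr N) (htr ω' hω' h6) (fun x hx => ?_) fun x hx => ?_
    · rw [pr_of_mem (c.nR.le hx), pr_of_mem (one_mem N)]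
    · rw [(hlin ω' hω' h6).of_ip_ne c.JN hprJ h7 x hx, pr_of_mem hx, pr_of_mem (c.JN hx)]
  obtain ⟨x, hx, rfl⟩ := hN.conj_const hη hω' hω h6 h0
  rw [h8, hN.cj_pr hx]
end

variable {N : ℕ → Subgroup G}

/-- A `p`-special character with irreducible reduction is linear. -/
theorem Spec.deg_one (hσ : Sg p G σ) (hN : NSeries p n N ⊤) (hβ : Spec {p} U β) (hP : PIrr p U β) :
    β 1 = 1 := by
  obtain ⟨η, hη, he⟩ := Bs.exists_lift hσ hN hβ.1.chr hβ.1.ne_zero hP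
  have hI := hη.irr hN
  have key : ∀ i ≤ n, ∀ θ, Irr (U ⊓ N i) θ → ip (U ⊓ N i) η θ ≠ 0 → θ = pr (U ⊓ N i) := by
    intro i
    induction i with
    | zero =>
      intro _ θ hθ _
      have hbot : U ⊓ N 0 = ⊥ := by rw [hN.zero, inf_bot_eq]
      obtain ⟨k, hk0, hk⟩ := hθ.deg_pos
      rw [hbot] at hθ ⊢
      have h1 : θ = (k : ℂ) • pr ⊥ := by
        refine ext_on hθ.1 (fun g hg => ?_) fun g hg => ?_
        · simp [(lin_pr ⊥).1 g hg]
        · rw [Subgroup.mem_bot] at hg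
          rw [hg, hk, Pi.smul_apply, pr_of_mem (one_mem _), smul_eq_mul, mul_one]
      have h2 := hθ.ip_self
      rw [h1, ip_smul_left, ip_smul_right, (lin_pr ⊥).irr.ip_self, mul_one, Complex.conj_natCast] at h2
      have h3 : k = 1 := by
        have : k * k = 1 := by exact_mod_cast h2
        exact Nat.eq_one_of_mul_eq_one_left this
      rw [h1, h3, Nat.cast_one, one_smul]
    | succ i ih =>
      intro hi θ hθ h0
      have hi' : i ≤ n := Nat.le_of_succ_le hi
      have hL := hN.nrm U (i + 1)
      have hM := hN.nrm U i
      have hML := hN.nrm_le U (Nat.le_succ i)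
      rcases hN.step_inf U i with hs | hs
      · obtain ⟨ψ, hψ, h1⟩ := hθ.exists_under hML.le
        have h2 := ih hi' ψ hψ (hI.chr.ip_trans hML.le hL.le hψ.chr hθ h0 h1)
        subst h2
        have hpr : ∀ X : Subgroup G, mp σ (pr X) = pr X := fun X => hσ.lin_p' (lin_pr X) fun x hx =>
          ⟨1, hσ.prime.not_dvd_one, by rw [pr_of_mem hx, one_pow]⟩
        obtain ⟨ρ, -, -, -, h3⟩ := hσ.exists_unique_over hs hψ (hpr _)
        rw [h3 θ hθ (hη.2 _ hi θ hθ h0) h1, h3 (pr _) (lin_pr _).irr (hpr _)]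
        rw [ip_congr_left (g := pr (U ⊓ N i)) hψ.1 fun x hx => ?_, hψ.ip_self]
        · exact one_ne_zero
        · rw [pr_of_mem hx, pr_of_mem (hML.le hx)]
      · obtain ⟨E, R, J, c⟩ := exists_cov hσ.prime hβ.1.chr hI he hM hL hs
          (hM.trivial_of_pr hI (ih hi'))
        exact c.all_pr hσ hβ hI hL hθ h0
  have h1 := key n le_rfl
  rw [hN.top_inf] at h1
  have h2 := h1 η hI (by rw [hI.ip_self]; exact one_ne_zero)
  rw [he 1 (one_mem U) (by simpa using hσ.prime.ne_one), h2, pr_of_mem (one_mem U)]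

end

section
variable {G : Type} [Group G] [Fintype G] {p n : ℕ} {σ : ℂ →+* ℂ} {E K L M J U X R : Subgroup G}
  {f η θ χ α β ω d b l : G → ℂ}

/-- A linear character of `p`-power order. -/
def LinP (p : ℕ) (L : Subgroup G) (l : G → ℂ) : Prop :=
  Lin L l ∧ ∀ x ∈ L, ∃ k, l x ^ p ^ k = 1

theorem LinP.reg (hp : p.Prime) (h : LinP p L l) {x : G} (hx : x ∈ L) (hr : ¬ p ∣ orderOf x) :
    l x = 1 := by
  obtain ⟨k, hk⟩ := h.2 x hx
  exact orderOf_eq_one_iff.1 (Nat.eq_one_of_dvd_coprimes (coprime_of_not_dvd hp hr k)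
    (orderOf_dvd_of_pow_eq_one (h.1.pow_orderOf hx)) (orderOf_dvd_of_pow_eq_one hk))

theorem LinP.ext (hp : p.Prime) (h : LinP p M l) (h' : LinP p M b) (hq : QStep p L M)
    (e : ∀ x ∈ L, l x = b x) : l = b := by
  obtain ⟨c, c', i, hc⟩ := exists_parts (G := G) hp
  refine ext_on h.1.1 h'.1.1 fun x hx => ?_
  obtain ⟨h1, h2, -, -, -, h3⟩ := hc x
  have ha := M.pow_mem hx c
  have hb := M.pow_mem hx c'
  rw [← h1, h.1.2.2 _ ha _ hb, h'.1.2.2 _ ha _ hb, h.reg hp ha h2, h'.reg hp ha h2,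
    e _ (hq.mem_of_pow hp hb h3)]

theorem LinP.res (h : LinP p M l) (hL : L ≤ M) : LinP p L (res L l) :=
  ⟨h.1.res hL, fun x hx => by rw [res_of_mem hx]; exact h.2 x (hL hx)⟩

theorem LinP.cj (h : LinP p M l) (x : G) : LinP p (cjS x M) (cj x l) :=
  ⟨h.1.cj x, fun y hy => h.2 _ (mem_cjS.1 hy)⟩

theorem HasDet.of_smul (hd : HasDet L χ d) (hb : Lin L b) (h1 : χ 1 = n) {x : G} (hx : x ∈ L)
    (h : χ x = n * b x) : d x = b x ^ n := by
  obtain ⟨s, hs⟩ := hd.2.exists_eig ⟨x, hx⟩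
  have hc : s.card = n := by
    have := hs.card
    simp only [OneMemClass.coe_one, h1] at this
    exact_mod_cast this.symm
  have h0 := hb.ne_zero hx
  have h2 : ∀ μ ∈ s.map (· * (b x)⁻¹), μ = 1 := by
    refine multiset_eq_one (fun μ hμ => ?_) ?_
    · obtain ⟨ν, hν, rfl⟩ := Multiset.mem_map.1 hμ
      rw [norm_mul, norm_inv, hs.norm ν hν, Complex.norm_eq_one_of_pow_eq_one (hb.pow_orderOf hx)
        (orderOf_pos x).ne']; simp
    · rw [Multiset.sum_map_mul_right, Multiset.map_id', ← hs.apply, Multiset.card_map, hc]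
      simp only [h]
      field_simp
  have h3 : ∀ μ ∈ s, μ = b x := fun μ hμ =>
    (mul_inv_eq_one₀ h0).1 (h2 _ (Multiset.mem_map_of_mem _ hμ))
  have h4 := hs.2.2
  rwa [Multiset.eq_replicate_card.2 h3, Multiset.prod_replicate, hc] at h4

theorem QStep.not_dvd_relIndex (hp : p.Prime) (h : QStep p L M) : ¬ p ∣ L.relIndex M := by
  have := h.1.normal
  refine not_dvd_card_of_pow (Γ := M ⧸ L.subgroupOf M) hp fun q => ?_
  induction q using QuotientGroup.induction_on with | _ x =>
  obtain ⟨m, hm, hx⟩ := h.2 x x.2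
  exact ⟨m, hm, (QuotientGroup.eq_one_iff (x ^ m)).2 hx⟩

theorem QStep.extend (hp : p.Prime) (hq : QStep p L M) (hb : LinP p L b)
    (hinv : ∀ x ∈ M, cj x b = b) : ∃ b', LinP p M b' ∧ ∀ x ∈ L, b' x = b x := by
  set n := L.relIndex M with hn
  have hcard : (Nat.card M : ℂ) / Nat.card L = n := by
    rw [← card_mul_relIndex hq.1.le, Nat.cast_mul, mul_div_cancel_left₀ _ (card_ne_zero' _)]
  obtain ⟨d, hd⟩ := (hb.1.chr.ind hq.1.le).exists_det
  have h1 : ∀ x ∈ L, d x = b x ^ n := fun x hx => by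
    refine hd.res hq.1.le |>.of_smul hb.1 ?_ hx ?_ |> (res_of_mem hx).symm.trans
    · rw [res_one, ind_one, hcard, hb.1.2.1, mul_one]
    · rw [res_of_mem hx, hq.1.ind_inv hb.1.1 hinv, hcard]; rfl
  obtain ⟨s, q, hq0, hs⟩ := Nat.exists_eq_pow_mul_and_not_dvd (n := Nat.card M)
    Nat.card_pos.ne' p hp.ne_one
  have hco : (q * n).Coprime (p ^ (s + 1)) := Nat.Coprime.pow_right _ (Nat.Coprime.symm
    ((hp.coprime_iff_not_dvd).2 (hp.not_dvd_mul hq0 (hq.not_dvd_relIndex hp))))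
  obtain ⟨c, -, hc⟩ := Nat.exists_mul_mod_eq_one_of_coprime hco (Nat.one_lt_pow (by omega) hp.one_lt)
  have hxM : ∀ l, Lin M l → ∀ x ∈ M, l x ^ Nat.card M = 1 := fun l hl x hx => by
    obtain ⟨t, ht⟩ := Subgroup.orderOf_dvd_natCard M hx
    rw [ht, pow_mul, hl.pow_orderOf hx, one_pow]
  have hlp : ∀ x ∈ M, lpow M d (q * c) x = d x ^ (q * c) := fun x hx => by simp [_root_.lpow, hx]
  refine ⟨lpow M d (q * c), ⟨hd.lin.lpow _, fun x hx => ⟨s, ?_⟩⟩, fun x hx => ?_⟩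
  · rw [hlp x hx, ← pow_mul, show q * c * p ^ s = p ^ s * q * c by ring, ← hs, pow_mul,
      hxM d hd.lin x hx, one_pow]
  · have h2 : b x ^ p ^ s = 1 := by
      obtain ⟨k, hk⟩ := hb.2 x hx
      have h3 : b x ^ Nat.card M = 1 := by
        obtain ⟨t, ht⟩ := Subgroup.orderOf_dvd_natCard M (hq.1.le hx)
        rw [ht, pow_mul, hb.1.pow_orderOf hx, one_pow]
      rw [hs] at h3
      rw [← orderOf_dvd_iff_pow_eq_one]
      refine Nat.Coprime.dvd_of_dvd_mul_right (Nat.Coprime.coprime_dvd_left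
        (orderOf_dvd_of_pow_eq_one hk) ?_) (orderOf_dvd_of_pow_eq_one h3)
      exact ((hp.coprime_iff_not_dvd).2 hq0).pow_left k
    rw [hlp x (hq.1.le hx), h1 x hx, ← pow_mul, show n * (q * c) = q * n * c by ring,
      ← Nat.mod_add_div (q * n * c) (p ^ (s + 1)), hc, pow_add, pow_one, pow_succ, pow_mul, pow_mul,
      h2, one_pow, one_pow, mul_one]

/-- The factorization into a `σ`-fixed character of `p'`-degree and a linear character of `p`-power
order is unique. -/
theorem factor_unique (hσ : Sg p G σ) {α' β' : G → ℂ} (hα : Irr U α) (hα' : Irr U α')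
    (hs : mp σ α = α) (hs' : mp σ α' = α') (hd : ∀ n : ℕ, α' 1 = n → ¬ p ∣ n) (hβ : LinP p U β)
    (hβ' : LinP p U β') (e : α * β = α' * β') : α = α' ∧ β = β' := by
  have hp := hσ.prime
  have h1 := hσ.lin_p hβ.1 hβ.2
  have h1' := hσ.lin_p hβ'.1 hβ'.2
  obtain ⟨n, -, hn⟩ := hα'.deg_pos
  have hmm : ∀ f g : G → ℂ, mp σ (f * g) = mp σ f * mp σ g := fun f g => by
    funext x; simp [_root_.mp]
  have hlP : LinP p U (β' * mp σ β) := by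
    have hc := (hβ.1.irr.mp σ).chr.lin_of_deg (by simp [_root_.mp, hβ.1.2.1])
    refine ⟨hβ'.1.mul hc, fun x hx => ?_⟩
    obtain ⟨k, hk⟩ := hβ.2 x hx
    obtain ⟨k', hk'⟩ := hβ'.2 x hx
    refine ⟨k + k', ?_⟩
    rw [Pi.mul_apply, mul_pow]
    have h3 : (mp σ β x) ^ p ^ k = 1 := by rw [_root_.mp, ← map_pow, hk, map_one]
    rw [pow_add, pow_mul (mp σ β x), h3, mul_comm (p ^ k), pow_mul (β' x), hk', one_pow, one_pow,
      mul_one]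
  set lam := β' * mp σ β with hlam
  have h2 : α' * lam = α := by
    rw [hlam, ← mul_assoc, ← e, mul_assoc, mul_comm β, h1, mul_pr hα.1]
  have h3 : mp σ lam * lam = pr U := hσ.lin_p hlP.1 hlP.2
  have h4 : α' * mp σ lam = α := by rw [← hs', ← hmm, h2, hs]
  have h5 : α' = α' * (lam * lam) := by
    rw [← mul_assoc, h2, ← h4, mul_assoc, h3, mul_pr hα'.1]
  obtain ⟨d, hd'⟩ := hα'.chr.exists_det
  have h6 := hd'.lpow_eq (τ := RingHom.id ℂ) rfl (hlP.1.mul hlP.1) hn h5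
  have h7 : lam = pr U := by
    refine ext_on hlP.1.1 (lin_pr U).1 fun x hx => ?_
    obtain ⟨k, hk⟩ := hlP.2 x hx
    have h8 : (lam x) ^ (2 * n) = 1 := by
      have := congrFun h6 x
      rw [pr_of_mem hx] at this
      simp only [_root_.lpow, hx, if_true, Pi.mul_apply] at this
      rw [pow_mul, pow_two]; exact this
    rw [pr_of_mem hx]
    refine orderOf_eq_one_iff.1 (Nat.eq_one_of_dvd_coprimes (a := p ^ k) (b := 2 * n) ?_
      (orderOf_dvd_of_pow_eq_one hk) (orderOf_dvd_of_pow_eq_one h8))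
    refine ((hp.coprime_iff_not_dvd).2 (hp.not_dvd_mul (fun h => ?_) (hd n hn))).pow_left k
    exact hσ.odd ((Nat.prime_dvd_prime_iff_eq hp Nat.prime_two).1 h)
  refine ⟨by rw [← h2, h7, mul_pr hα'.1], ?_⟩
  rw [← mul_pr hβ'.1.1, ← h1, ← mul_assoc, ← hlam, h7, mul_comm, mul_pr hβ.1.1]

end

section
variable {G : Type} [Group G] [Fintype G] {p n i : ℕ} {σ : ℂ →+* ℂ} {N : ℕ → Subgroup G}
  {K L M H U : Subgroup G} {f θ χ α β : G → ℂ}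

theorem Irr.of_ind (h : Irr H (ind K H f)) (hf : Chr K f) (hK : K ≤ H) : Irr K f := by
  by_contra hn
  have h0 : f ≠ 0 := by rintro rfl; exact h.ne_zero (ind_zero K H)
  obtain ⟨a, b, ha, hb, ha0, hb0, rfl⟩ := hf.split h0 hn
  rcases h.eq_zero_or (ha.ind hK) (hb.ind hK) (ind_add K H a b) with e | e
  exacts [ha.ind_ne_zero ha0 e, hb.ind_ne_zero hb0 e]

/-- `χ` is induced from `α * β` on `U`, with `α` a `σ`-fixed irreducible character of `p'`-degree
and `β` linear of `p`-power order. -/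
structure Dat (p : ℕ) (σ : ℂ →+* ℂ) (H : Subgroup G) (χ : G → ℂ) (U : Subgroup G)
    (α β : G → ℂ) : Prop where
  le : U ≤ H
  irr : Irr U α
  fix : mp σ α = α
  deg : ∀ n : ℕ, α 1 = n → ¬ p ∣ n
  lin : LinP p U β
  ind_eq : ind U H (α * β) = χ

theorem Dat.bs (hD : Dat p σ H χ U α β) (hσ : Sg p G σ) (hN : NSeries p n N ⊤)
    (hP : PIrr p H χ) : Bs σ N n U α := by
  have h1 : PIrr p U (α * β) := PIrr.of_ind (by rw [hD.ind_eq]; exact hP) hD.le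
    (hD.irr.mul_lin hD.lin.1).1
  exact Bs.of_pirr hσ hN hD.irr hD.fix (h1.left hD.lin.1.chr hD.lin.1.irr.ne_zero)

theorem Dat.ip_ne (hD : Dat p σ H χ U α β) (hχ : Irr H χ) : ip U χ (α * β) ≠ 0 := by
  rw [← ip_ind_right _ hχ.chr.classOn, hD.ind_eq, hχ.ip_self]
  exact one_ne_zero

/-- The restrictions of `α` and `β` to a normal subgroup over an invariant character. -/
theorem Dat.under (hD : Dat p σ H χ U α β) (hσ : Sg p G σ) (hN : NSeries p n N ⊤) (hi : i ≤ n)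
    (hχ : Irr H χ) (hP : PIrr p H χ) (hθ : Irr (H ⊓ N i) θ)
    (hinv : ∀ x ∈ H, cj x θ = θ) (h0 : ip (H ⊓ N i) χ θ ≠ 0) (hL : H ⊓ N i ≤ U) :
    ∃ α₀, Irr (H ⊓ N i) α₀ ∧ mp σ α₀ = α₀ ∧ ip (H ⊓ N i) α α₀ ≠ 0 ∧
      (∀ ω, Irr (H ⊓ N i) ω → ip (H ⊓ N i) α ω ≠ 0 → ω = α₀) ∧ (∀ x ∈ H, cj x α₀ = α₀) ∧
      ∀ x ∈ H, cj x (res (H ⊓ N i) β) = res (H ⊓ N i) β := by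
  have hL' : U ⊓ N i = H ⊓ N i :=
    le_antisymm (inf_le_inf_right _ hD.le) (le_inf hL inf_le_right)
  have hLH := hN.nrm H i
  set L := H ⊓ N i with hLdef
  have hLU : Nrm L U := hLH.mono hL hD.le
  have hb := hD.lin.res hL
  have key : ∀ ω, Irr L ω → ip L α ω ≠ 0 → ω * res L β = θ := fun ω hω h1 => by
    have h2 : ip L (α * β) (ω * res L β) ≠ 0 := by
      rw [← ip_res_left L (α * β) (hω.mul_lin hb.1).1, res_mul, ip_mul_lin hb.1 _ (res_supp _ _),
        ip_res_left L α hω.1]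
      exact h1
    have h3 := hχ.chr.ip_trans hL hD.le (hω.mul_lin hb.1).chr (hD.irr.mul_lin hD.lin.1)
      (hD.ip_ne hχ) h2
    obtain ⟨x, hx, e⟩ := hLH.conj_const hχ hθ (hω.mul_lin hb.1) h0 h3
    rw [e, hinv x hx]
  obtain ⟨α₀, hα₀, h1⟩ := hD.irr.exists_under hL
  have hs : mp σ α₀ = α₀ := (hD.bs hσ hN hP).2 i hi α₀ (hL'.symm ▸ hα₀) (hL'.symm ▸ h1)
  have hd : ∀ n : ℕ, α₀ 1 = n → ¬ p ∣ n := fun b hb' hpb => by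
    obtain ⟨a, -, ha⟩ := hD.irr.deg_pos
    exact hD.deg a ha (hpb.trans (hLU.deg_dvd hD.irr hα₀ h1 ha hb'))
  have hu : ∀ x ∈ H, cj x α₀ = α₀ ∧ cj x (res L β) = res L β := fun x hx => by
    have hc := hLH.cjS hx
    have hl := hb.cj x
    rw [hc] at hl
    refine factor_unique hσ (hLH.irr_cj hx hα₀) hα₀ (by rw [← cj_mp, hs]) hs hd hl hb ?_
    rw [← cj_mul_fun, key α₀ hα₀ h1, hinv x hx]
  refine ⟨α₀, hα₀, hs, h1, fun ω hω h2 => ?_, fun x hx => (hu x hx).1, fun x hx => (hu x hx).2⟩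
  have e := (key ω hω h2).trans (key α₀ hα₀ h1).symm
  refine ext_on hω.1 hα₀.1 fun x hx => ?_
  exact mul_right_cancel₀ (hb.1.ne_zero hx) (congrFun e x)

end

section
variable {G : Type} [Group G] [Fintype G] {p n i : ℕ} {σ : ℂ →+* ℂ} {N : ℕ → Subgroup G}
  {K L M H U : Subgroup G} {f b θ χ α β : G → ℂ}

/-- Two `p`-power order linear characters agreeing on `M ⊓ U` glue to `M * U`. -/
theorem LinP.glue (hM : Nrm M H) (hU : U ≤ H) (hb : LinP p M b) (hβ : LinP p U β)
    (he : ∀ x ∈ M, x ∈ U → b x = β x) (hinv : ∀ u ∈ U, _root_.cj u b = b) :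
    ∃ β', LinP p (prodS hM hU) β' ∧ ∀ x ∈ U, β' x = β x := by
  set T := prodS hM hU with hT
  let F : G → ℂ := fun z => if h : ∃ y : G × G, y.1 ∈ M ∧ y.2 ∈ U ∧ z = y.1 * y.2 then
    b h.choose.1 * β h.choose.2 else 0
  have hF : ∀ m ∈ M, ∀ u ∈ U, F (m * u) = b m * β u := fun m hm u hu => by
    have h : ∃ y : G × G, y.1 ∈ M ∧ y.2 ∈ U ∧ m * u = y.1 * y.2 := ⟨(m, u), hm, hu, rfl⟩
    simp only [F, dif_pos h]
    obtain ⟨h1, h2, h3⟩ := h.choose_spec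
    set m' := h.choose.1
    set u' := h.choose.2
    have e : m'⁻¹ * m = u' * u⁻¹ := by
      rw [inv_mul_eq_iff_eq_mul, ← mul_assoc, ← h3, mul_inv_cancel_right]
    have hm' : m'⁻¹ * m ∈ M := M.mul_mem (M.inv_mem h1) hm
    have hu' : m'⁻¹ * m ∈ U := e ▸ U.mul_mem h2 (U.inv_mem hu)
    have e1 : b m = b m' * b (m'⁻¹ * m) := by rw [← hb.1.2.2 _ h1 _ hm', mul_inv_cancel_left]
    have e2 : β u' = β (m'⁻¹ * m) * β u := by
      rw [← hβ.1.2.2 _ hu' _ hu, e, inv_mul_cancel_right]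
    rw [e1, e2, he _ hm' hu', mul_assoc]
  have hFU : ∀ x ∈ U, F x = β x := fun x hx => by
    have := hF 1 M.one_mem x hx
    rwa [one_mul, hb.1.2.1, one_mul] at this
  have hlin : Lin T F := by
    refine ⟨fun g hg => ?_, by rw [hFU 1 U.one_mem, hβ.1.2.1], fun x hx y hy => ?_⟩
    · refine dif_neg fun ⟨y, h1, h2, h3⟩ => hg (mem_prodS.2 ⟨y.1, h1, y.2, h2, h3⟩)
    · obtain ⟨m, hm, u, hu, rfl⟩ := mem_prodS.1 hx
      obtain ⟨m', hm', u', hu', rfl⟩ := mem_prodS.1 hy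
      have hc := hM.2 u (hU hu) m' hm'
      have e1 : b (u * m' * u⁻¹) = b m' := by
        have := congrFun (hinv u hu) (u * m' * u⁻¹)
        rw [← this]
        simp only [_root_.cj]
        congr 1; group
      rw [show m * u * (m' * u') = (m * (u * m' * u⁻¹)) * (u * u') by group,
        hF _ (M.mul_mem hm hc) _ (U.mul_mem hu hu'), hF m hm u hu, hF m' hm' u' hu',
        hb.1.2.2 _ hm _ hc, e1, hβ.1.2.2 _ hu _ hu']
      ring
  refine ⟨F, ⟨hlin, fun x hx => ?_⟩, hFU⟩
  obtain ⟨m, hm, u, hu, rfl⟩ := mem_prodS.1 hx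
  obtain ⟨k, hk⟩ := hb.2 m hm
  obtain ⟨k', hk'⟩ := hβ.2 u hu
  refine ⟨k + k', ?_⟩
  rw [hF m hm u hu, mul_pow, pow_add, pow_mul (b m), hk, mul_comm (p ^ k), pow_mul (β u), hk',
    one_pow, one_pow, mul_one]

theorem prodS_factors (hM : Nrm M H) (hU : U ≤ H) : Factors (prodS hM hU) M U :=
  fun _ ht => mem_prodS.1 ht

theorem prodS_nrm (hM : Nrm M H) (hU : U ≤ H) : Nrm M (prodS hM hU) :=
  hM.mono (le_prodS hM hU).1 (le_prodS hM hU).2.2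

theorem prodS_index (hM : Nrm M H) (hU : U ≤ H) :
    U.relIndex (prodS hM hU) = (U ⊓ M).relIndex M := by
  have h1 := (prodS_nrm hM hU).card_mul (le_prodS hM hU).2.1 (prodS_factors hM hU)
  rw [← card_mul_relIndex (le_prodS hM hU).2.1,
    ← card_mul_relIndex (inf_le_right : U ⊓ M ≤ M)] at h1
  have h2 : 0 < Nat.card U * Nat.card (U ⊓ M : Subgroup G) :=
    Nat.mul_pos Nat.card_pos Nat.card_pos
  refine Nat.eq_of_mul_eq_mul_left h2 ?_
  rw [mul_right_comm, h1]
  ring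

/-- Crossing a `p'`-section. -/
theorem Dat.qstep (hD : Dat p σ H χ U α β) (hσ : Sg p G σ) (hχ : Irr H χ) (hL : Nrm L H)
    (hLU : L ≤ U) (hM : Nrm M H) (hq : QStep p L M)
    (hinv : ∀ x ∈ H, cj x (res L β) = res L β) :
    ∃ U' α' β', Dat p σ H χ U' α' β' ∧ M ≤ U' ∧ U ≤ U' ∧ ¬ p ∣ U.relIndex U' ∧
      ∀ x ∈ U, β' x = β x := by
  have hp := hσ.prime
  have hU := hD.le
  obtain ⟨b, hb, hbL⟩ := hq.extend hp (hD.lin.res hLU) fun x hx => hinv x (hM.le hx)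
  have hinvb : ∀ u ∈ U, cj u b = b := fun u hu => by
    have h1 := hb.cj u
    rw [hM.cjS (hU hu)] at h1
    refine h1.ext hp hb hq fun x hx => ?_
    have h2 := congrFun (hinv u (hU hu)) x
    simp only [_root_.cj] at h2 ⊢
    rw [hbL _ ((hL.conj_mem_iff' (hU hu)).2 hx), h2, hbL x hx]
  have hLI : L ≤ U ⊓ M := le_inf hLU hq.1.le
  have hres : ∀ x ∈ M, x ∈ U → b x = β x := fun x hx hxu => by
    have h1 := (hb.res (inf_le_right : U ⊓ M ≤ M)).ext hp (hD.lin.res inf_le_left)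
      (hq.mono hLI inf_le_right) fun y hy => by
        rw [res_of_mem (hLI hy), res_of_mem (hLI hy), hbL y hy, res_of_mem hy]
    have := congrFun h1 x
    rwa [res_of_mem (Subgroup.mem_inf.2 ⟨hxu, hx⟩), res_of_mem (Subgroup.mem_inf.2 ⟨hxu, hx⟩)] at this
  obtain ⟨β', hβ', he⟩ := hb.glue hM hU hD.lin hres hinvb
  obtain ⟨hMT, hUT, hTH⟩ := le_prodS hM hU
  have hidx : ¬ p ∣ U.relIndex (prodS hM hU) := by
    rw [prodS_index]
    have hq2 : QStep p L M := hq
    intro h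
    refine hq2.not_dvd_relIndex hp (h.trans ?_)
    exact ⟨L.relIndex (U ⊓ M), by
      rw [mul_comm]; exact (Subgroup.relIndex_mul_relIndex L _ M hLI inf_le_right).symm⟩
  set T := prodS hM hU
  have hab : ind U T (α * β) = ind U T α * β' := by
    rw [← ind_mul U T α hβ'.1.chr.classOn]
    congr 1
    funext x
    by_cases hx : x ∈ U
    · simp [he x hx]
    · simp [hD.irr.1 x hx]
  have hi : ind T H (ind U T α * β') = χ := by rw [← hab, ind_ind hTH, hD.ind_eq]
  have hirr : Irr T (ind U T α) := by
    have h1 : Irr T (ind U T α * β') := Irr.of_ind (by rw [hi]; exact hχ)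
      ((hD.irr.chr.ind hUT).mul hβ'.1.chr) hTH
    have h2 := h1.mul_lin ((hβ'.1.irr.mp σ).chr.lin_of_deg (by simp [_root_.mp, hβ'.1.2.1]))
    rwa [mul_assoc, mul_comm β', hσ.lin_p hβ'.1 hβ'.2,
      mul_pr (ind_classOn hUT hD.irr.1).1] at h2
  refine ⟨T, ind U T α, β', ⟨hTH, hirr, by rw [mp_ind, hD.fix], fun m hm hpm => ?_, hβ', hi⟩,
    hMT, hUT, hidx, he⟩
  obtain ⟨a, -, ha⟩ := hD.irr.deg_pos
  rw [ind_one, ← card_mul_relIndex hUT, Nat.cast_mul, mul_div_cancel_left₀ _ (card_ne_zero' _),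
    ha] at hm
  rw [← show U.relIndex T * a = m by exact_mod_cast hm] at hpm
  exact hp.not_dvd_mul hidx (hD.deg a ha) hpm

/-- Across a `p`-section nothing changes. -/
theorem Dat.pstep (hD : Dat p σ H χ U α β) (hσ : Sg p G σ) (hN : NSeries p n N ⊤) (hi : i + 1 ≤ n)
    (hP : PIrr p H χ) (hs : PStep p (H ⊓ N i) (H ⊓ N (i + 1))) (hLU : H ⊓ N i ≤ U) {α₀ : G → ℂ}
    (hα₀ : Irr (H ⊓ N i) α₀) (hfix : mp σ α₀ = α₀) (h0 : ip (H ⊓ N i) α α₀ ≠ 0)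
    (hu : ∀ ω, Irr (H ⊓ N i) ω → ip (H ⊓ N i) α ω ≠ 0 → ω = α₀)
    (hinv : ∀ x ∈ H, cj x α₀ = α₀) : H ⊓ N (i + 1) ≤ U := by
  have hLH := hN.nrm H i
  have hM := hN.nrm H (i + 1)
  have hU := hD.le
  have hJ : U ⊓ N (i + 1) = U ⊓ (H ⊓ N (i + 1)) := by
    rw [← inf_assoc, inf_eq_left.2 hU]
  have hB := hD.bs hσ hN hP
  set L := H ⊓ N i
  set M := H ⊓ N (i + 1)
  obtain ⟨η₀, h1, h2, h3, h4⟩ := hσ.exists_unique_over hs hα₀ hfix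
  have hinv' : ∀ x ∈ H, cj x η₀ = η₀ := fun x hx => by
    refine h4 _ (hM.irr_cj hx h1) (by rw [← cj_mp, h2]) ?_
    rw [← hinv x hx, hLH.ip_cj hx, h3]
    exact one_ne_zero
  have hresL : res L η₀ = α₀ := ext_on (res_supp _ _) hα₀.1 fun x hx => by
    rw [res_of_mem hx, hs.1.res_of_inv h1 hα₀ (by rw [h3]; exact one_ne_zero)
      (fun y hy => hinv y (hM.le hy)) hx, h3, one_mul]
  have hLI : L ≤ U ⊓ M := le_inf hLU hs.1.le
  set κ := res (U ⊓ M) η₀ with hκdef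
  have hκL : res L κ = α₀ := by rw [hκdef, res_res hLI, hresL]
  have hκ : Irr (U ⊓ M) κ := (h1.chr.res inf_le_right).irr_of_res hLI (by rw [hκL]; exact hα₀)
  have hsI := hs.mono hLI inf_le_right
  have hMU : Nrm (U ⊓ M) U := ⟨inf_le_left, fun x hx m hm =>
    ⟨U.mul_mem (U.mul_mem hx hm.1) (U.inv_mem hx), hM.2 x (hU hx) m hm.2⟩⟩
  have hκα : ∀ ω, Irr (U ⊓ M) ω → ip (U ⊓ M) α ω ≠ 0 → ω = κ := fun ω hω hω0 => by
    obtain ⟨ν, hν, hν0⟩ := hω.exists_under hLI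
    have e := hu ν hν (hD.irr.chr.ip_trans hLI inf_le_left hν.chr hω hω0 hν0)
    obtain ⟨η₁, -, -, -, h5⟩ := hσ.exists_unique_over hsI hα₀ hfix
    rw [h5 ω hω (hB.2 (i + 1) hi ω (hJ ▸ hω) (hJ ▸ hω0)) (e ▸ hν0)]
    refine (h5 κ hκ (by rw [hκdef, ← res_mp, h2]) ?_).symm
    rw [← ip_res_left L κ hα₀.1, hκL, hα₀.ip_self]
    exact one_ne_zero
  obtain ⟨ω, hω, hω0⟩ := hD.irr.exists_under (inf_le_left : U ⊓ M ≤ U)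
  have hακ : ip (U ⊓ M) α κ ≠ 0 := hκα ω hω hω0 ▸ hω0
  have hMT := prodS_nrm hM hU
  have hF := prodS_factors hM hU
  obtain ⟨-, hUT, hTH⟩ := le_prodS hM hU
  set T := prodS hM hU
  have hκi : ∀ x ∈ U, cj x κ = κ := fun x hx => by
    rw [hκdef]
    conv_rhs => rw [← hinv' x (hU hx), ← hMU.cjS hx]
    rw [res_cj]
  obtain ⟨η, hη, hη1, -, hη3⟩ := (hMT.rest hUT hF h1 (fun x hx => hinv' x (hTH hx)) hκ hκi
    (by rw [← ip_res_left _ _ hκ.1, ← hκdef, hκ.ip_self])).2 α hD.irr hακ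
  have h5 := hη3 α hD.irr hακ
  rw [if_pos rfl] at h5
  have hαη : res U η = α := by
    have hc : Chr U (res U η - α) := (hη.chr.res hUT).sub_const hD.irr (by
      rw [ip_res_left U η hD.irr.1, h5]; exact one_ne_zero)
    refine sub_eq_zero.1 (hc.eq_zero_of_deg ?_)
    have e1 := hMT.res_of_inv hη h1 (by rw [hη1]; exact hακ) (fun x hx => hinv' x (hTH hx)) M.one_mem
    have e2 := hMU.res_of_inv hD.irr hκ hακ hκi (U ⊓ M).one_mem
    rw [Pi.sub_apply, res_one, e1, e2, hη1, hκdef, res_one, sub_self]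
  have hPT : PIrr p T (ind U T (α * β)) := PIrr.of_ind (by rw [ind_ind hTH, hD.ind_eq]; exact hP) hTH
    (ind_classOn hUT (hD.irr.mul_lin hD.lin.1).1).1
  have hreg : RegEq p U (α * β) α := fun x hx hr => by
    rw [Pi.mul_apply, hD.lin.reg hσ.prime hx hr, mul_one]
  have hPT2 := hPT.congr (RegEq.ind hreg (hD.irr.mul_lin hD.lin.1).1 hD.irr.1 T)
  have hpr : pr U * η = α := by
    rw [← hαη]
    refine ext_on (fun g hg => ?_) (res_supp _ _) fun g hg => ?_
    · rw [Pi.mul_apply, (lin_pr U).1 g hg, zero_mul]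
    · rw [Pi.mul_apply, pr_of_mem hg, one_mul, res_of_mem hg]
  rw [← hpr, ind_mul U T _ hη.chr.classOn] at hPT2
  have hPT3 := hPT2.left hη.chr hη.ne_zero
  have hprc : Chr T (ind U T (pr U)) := (lin_pr U).chr.ind hUT
  have hc := hprc.sub_const (lin_pr T).irr (by
    rw [ip_ind_left _ (lin_pr T).chr.classOn, ← ip_res_right U _ (lin_pr U).1,
      show res U (pr T) = pr U from ext_on (res_supp _ _) (lin_pr U).1 fun g hg => by
        rw [res_of_mem hg, pr_of_mem (hUT hg), pr_of_mem hg], (lin_pr U).irr.ip_self]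
    exact one_ne_zero)
  have hz : ind U T (pr U) - pr T = 0 := by
    by_contra hne
    exact hPT3 _ _ (lin_pr T).chr hc (lin_pr T).irr.ne_zero hne fun x _ _ => by simp
  have h6 := congrFun hz 1
  rw [Pi.sub_apply, ind_one, pr_of_mem U.one_mem, pr_of_mem T.one_mem, Pi.zero_apply, mul_one,
    sub_eq_zero, div_eq_one_iff_eq (card_ne_zero' _)] at h6
  rw [Subgroup.eq_of_le_of_card_ge hUT (Nat.cast_injective (R := ℂ) h6).le]
  exact (le_prodS hM hU).1

end

section
variable {G : Type} [Group G] [Fintype G] {p n i : ℕ} {σ : ℂ →+* ℂ} {N : ℕ → Subgroup G}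
  {K L M H U P Q S : Subgroup G} {f b θ χ ψ α β δ ω : G → ℂ}

/-- `Q` is a Sylow `p`-subgroup of `U`. -/
def IsSyl (p : ℕ) (Q U : Subgroup G) : Prop :=
  Q ≤ U ∧ IsPGroup p Q ∧ ¬ p ∣ Q.relIndex U

theorem IsSyl.cj (h : IsSyl p Q U) (x : G) : IsSyl p (cjS x Q) (cjS x U) := by
  refine ⟨cjS_mono h.1, h.2.1.map _, ?_⟩
  have := Subgroup.relIndex_map_map_of_injective (f := (MulAut.conj x).toMonoidHom) Q U
    (MulAut.conj x).injective
  exact this ▸ h.2.2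

theorem exists_isSyl (hp : p.Prime) (U : Subgroup G) : ∃ Q, IsSyl p Q U := by
  have := Fact.mk hp
  let P : Sylow p U := default
  refine ⟨(P : Subgroup U).map U.subtype, Subgroup.map_subtype_le _, P.2.map _, ?_⟩
  rw [Subgroup.relIndex, Subgroup.subgroupOf, Subgroup.comap_map_eq_self_of_injective
    U.subtype_injective]
  exact P.not_dvd_index

theorem IsSyl.trans (hp : p.Prime) (h : IsSyl p Q S) (hS : S ≤ U) (hi : ¬ p ∣ S.relIndex U) :
    IsSyl p Q U :=
  ⟨h.1.trans hS, h.2.1, by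
    rw [← Subgroup.relIndex_mul_relIndex Q S U h.1 hS]; exact hp.not_dvd_mul h.2.2 hi⟩

theorem IsSyl.exists_conj (hp : p.Prime) (h : IsSyl p Q U) (h' : IsSyl p P U) :
    ∃ u ∈ U, P = cjS u Q := by
  have := Fact.mk hp
  have hg : ∀ {R : Subgroup G}, IsSyl p R U → IsPGroup p (R.subgroupOf U) := fun hR =>
    hR.2.1.comap_of_injective U.subtype U.subtype_injective
  obtain ⟨u, hu⟩ := MulAction.exists_smul_eq U ((hg h).toSylow h.2.2) ((hg h').toSylow h'.2.2)
  refine ⟨u, u.2, ?_⟩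
  have hu' : P.subgroupOf U = (Q.subgroupOf U).map (MulAut.conj u).toMonoidHom :=
    (congrArg (fun R : Sylow p U => (R : Subgroup U)) hu).symm
  have key : ∀ g : U, (g : G) ∈ P ↔ (u : G)⁻¹ * g * u ∈ Q := fun g => by
    rw [← Subgroup.mem_subgroupOf, hu']
    constructor
    · rintro ⟨y, hy, rfl⟩
      have : (y : G) ∈ Q := hy
      simpa [mul_assoc] using this
    · intro hy
      exact ⟨u⁻¹ * g * u, hy, by simp [mul_assoc]⟩
  ext g
  rw [mem_cjS]
  constructor
  · exact fun hg' => (key ⟨g, h'.1 hg'⟩).1 hg'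
  · intro hgQ
    have : g ∈ U := by
      have h1 := U.mul_mem (U.mul_mem u.2 (h.1 hgQ)) (U.inv_mem u.2)
      rwa [show (u : G) * ((u : G)⁻¹ * g * u) * (u : G)⁻¹ = g by group] at h1
    exact (key ⟨g, this⟩).2 hgQ

/-- A vertex pair whose inducing subgroup contains `M`. -/
def VPair (p : ℕ) (σ : ℂ →+* ℂ) (M H : Subgroup G) (χ : G → ℂ) (Q : Subgroup G) (δ : G → ℂ) :
    Prop :=
  ∃ U α β, Dat p σ H χ U α β ∧ M ≤ U ∧ IsSyl p Q U ∧ δ = res Q β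

theorem VPair.up (hV : VPair p σ (H ⊓ N i) H χ Q δ) (hσ : Sg p G σ) (hN : NSeries p n N ⊤)
    (hi : i + 1 ≤ n) (hχ : Irr H χ) (hP : PIrr p H χ) (hθ : Irr (H ⊓ N i) θ)
    (hinv : ∀ x ∈ H, cj x θ = θ) (h0 : ip (H ⊓ N i) χ θ ≠ 0) :
    VPair p σ (H ⊓ N (i + 1)) H χ Q δ := by
  obtain ⟨U, α, β, hD, hL, hQ, rfl⟩ := hV
  obtain ⟨α₀, h1, h2, h3, h4, h5, h6⟩ := hD.under hσ hN (by omega) hχ hP hθ hinv h0 hL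
  rcases hN.step_inf H i with hs | hs
  · exact ⟨U, α, β, hD, hD.pstep hσ hN hi hP hs hL h1 h2 h3 h4 h5, hQ, rfl⟩
  · obtain ⟨U', α', β', hD', hM, hU, hidx, he⟩ :=
      hD.qstep hσ hχ (hN.nrm H i) hL (hN.nrm H (i + 1)) hs h6
    refine ⟨U', α', β', hD', hM, hQ.trans hσ.prime hU hidx, ?_⟩
    exact ext_on (res_supp _ _) (res_supp _ _) fun x hx => by
      rw [res_of_mem hx, res_of_mem hx, he x (hQ.1 hx)]

theorem Dat.cj (hD : Dat p σ H χ U α β) {x : G} (hx : x ∈ H) :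
    Dat p σ H χ (cjS x U) (cj x α) (cj x β) where
  le := cjS_of_mem hx ▸ cjS_mono hD.le
  irr := hD.irr.cj x
  fix := by rw [← cj_mp, hD.fix]
  deg := by rw [cj_apply_one]; exact hD.deg
  lin := hD.lin.cj x
  ind_eq := by
    rw [← cj_mul_fun, ind_cj hD.le (hD.irr.mul_lin hD.lin.1).1 hx, hD.ind_eq]

theorem Dat.clifford (hD : Dat p σ H χ U α β) (hσ : Sg p G σ) (hχ : Irr H χ) (hM : Nrm M H)
    (hMU : M ≤ U) (hω : Irr M ω) (hωσ : mp σ ω = ω) (hω0 : ip M α ω ≠ 0)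
    (hθ : θ = ω * res M β) (hψ : Irr (stab H θ) ψ) (h1 : ip M ψ θ ≠ 0)
    (h2 : ip (stab H θ) χ ψ ≠ 0) :
    ∃ S α', Dat p σ (stab H θ) ψ S α' (res S β) ∧ M ≤ S ∧ S ≤ U ∧ ¬ p ∣ S.relIndex U := by
  have hU := hD.le
  have hMn := hM.mono hMU hU
  have hb := hD.lin.res hMU
  have hθi : Irr M θ := hθ ▸ hω.mul_lin hb.1
  have hTH := stab_le H θ
  have hST : stab U ω ≤ stab H θ := fun u hu => by
    obtain ⟨hu, e⟩ := mem_stab.1 hu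
    refine mem_stab.2 ⟨hU hu, ?_⟩
    have e2 : _root_.cj u (res M β) = res M β := by
      have := res_cj u M β
      rw [hMn.cjS hu, hD.lin.1.chr.classOn.cj_eq hu] at this
      exact this.symm
    rw [hθ, cj_mul_fun, e, e2]
  obtain ⟨α', ha1, ha2, ha3, ha4⟩ := hMn.clifford_exists hD.irr hω hω0
  have hMS : M ≤ stab U ω := hMn.le_stab hω.chr.classOn
  have hSU := stab_le U ω
  have hfix : mp σ α' = α' := by
    refine hMn.clifford_unique hD.irr hω (ha1.mp σ) ha1 ?_ ha2 ?_ ha3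
    · rw [← hωσ, ip_mp hω.chr]
      exact (map_ne_zero σ).2 ha2
    · rw [← hD.fix, ip_mp ha1.chr]
      exact (map_ne_zero σ).2 ha3
  obtain ⟨a, -, ha⟩ := hD.irr.deg_pos
  obtain ⟨c, -, hc⟩ := ha1.deg_pos
  have hac : a = (stab U ω).relIndex U * c := by
    have := congrFun ha4 1
    rw [ind_one, ← card_mul_relIndex hSU, Nat.cast_mul, mul_div_cancel_left₀ _ (card_ne_zero' _),
      ha, hc] at this
    exact_mod_cast this.symm
  have hd := hD.deg a ha
  set S := stab U ω
  have hbS := hD.lin.res hSU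
  have hi : ind (stab H θ) H (ind S (stab H θ) (α' * res S β)) = χ := by
    rw [ind_ind hTH, ← ind_ind hU]
    have : α' * res S β = α' * β := by
      funext x
      by_cases hx : x ∈ S
      · simp [res_of_mem hx]
      · simp [ha1.1 x hx]
    rw [this, ind_mul _ _ _ hD.lin.1.chr.classOn, ha4, hD.ind_eq]
  have hch := ((ha1.mul_lin hbS.1).chr.ind hST)
  have hirr : Irr (stab H θ) (ind S (stab H θ) (α' * res S β)) :=
    Irr.of_ind (by rw [hi]; exact hχ) hch hTH
  have h4 : ip S (ind S (stab H θ) (α' * res S β)) (α' * res S β) ≠ 0 := by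
    rw [← ip_ind_right _ hirr.chr.classOn, hirr.ip_self]; exact one_ne_zero
  have h5 : ip M (α' * res S β) θ ≠ 0 := by
    rw [← ip_res_left M _ hθi.1, res_mul, res_res hMS, hθ, ip_mul_lin hb.1 _ (res_supp _ _),
      ip_res_left M _ hω.1]
    exact ha2
  have h6 := hirr.chr.ip_trans hMS hST hθi.chr (ha1.mul_lin hbS.1) h4 h5
  have h7 : ip (stab H θ) χ (ind S (stab H θ) (α' * res S β)) ≠ 0 := by
    rw [← ip_ind_right _ hχ.chr.classOn, hi, hχ.ip_self]; exact one_ne_zero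
  have h8 := hM.clifford_unique hχ hθi hirr hψ h6 h1 h7 h2
  refine ⟨S, α', ⟨hST, ha1, hfix, fun m hm hpm => ?_, hbS, h8⟩, hMS, hSU, fun h => ?_⟩
  · rw [hc] at hm
    rw [← show c = m by exact_mod_cast hm] at hpm
    exact hd (hac ▸ hpm.mul_left _)
  · exact hd (hac ▸ h.mul_right _)

theorem VPair.clifford (hV : VPair p σ (H ⊓ N i) H χ Q δ) (hσ : Sg p G σ) (hN : NSeries p n N ⊤)
    (hi : i ≤ n) (hχ : Irr H χ) (hP : PIrr p H χ) (hθ : Irr (H ⊓ N i) θ)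
    (h0 : ip (H ⊓ N i) χ θ ≠ 0) (hψ : Irr (stab H θ) ψ) (h1 : ip (H ⊓ N i) ψ θ ≠ 0)
    (h2 : ip (stab H θ) χ ψ ≠ 0) :
    ∃ h ∈ H, VPair p σ (H ⊓ N i) (stab H θ) ψ (cjS h Q) (cj h δ) := by
  obtain ⟨U, α, β, hD, hM, hQ, rfl⟩ := hV
  have hL' : U ⊓ N i = H ⊓ N i :=
    le_antisymm (inf_le_inf_right _ hD.le) (le_inf hM inf_le_right)
  have hMH := hN.nrm H i
  obtain ⟨ω, hω, hω0⟩ := hD.irr.exists_under hM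
  have hωσ : mp σ ω = ω := (hD.bs hσ hN hP).2 i hi ω (hL'.symm ▸ hω) (hL'.symm ▸ hω0)
  set M := H ⊓ N i
  have hb := hD.lin.res hM
  have h3 : ip M (α * β) (ω * res M β) ≠ 0 := by
    rw [← ip_res_left M (α * β) (hω.mul_lin hb.1).1, res_mul, ip_mul_lin hb.1 _ (res_supp _ _),
      ip_res_left M α hω.1]
    exact hω0
  obtain ⟨x, hx, e⟩ := hMH.conj_const hχ (hω.mul_lin hb.1) hθ
    (hχ.chr.ip_trans hM hD.le (hω.mul_lin hb.1).chr (hD.irr.mul_lin hD.lin.1) (hD.ip_ne hχ) h3) h0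
  have hMx := hMH.cjS hx
  obtain ⟨S, α', hD', hMS, hSU, hidx⟩ := (hD.cj hx).clifford hσ hχ hMH (hMx ▸ cjS_mono hM)
    (hMH.irr_cj hx hω) (by rw [← cj_mp, hωσ]) (by rw [hMH.ip_cj hx]; exact hω0)
    (by rw [e, cj_mul_fun, ← res_cj, hMx]) hψ h1 h2
  obtain ⟨P, hPS⟩ := exists_isSyl hσ.prime S
  obtain ⟨u, hu, rfl⟩ := (hQ.cj x).exists_conj hσ.prime (hPS.trans hσ.prime hSU hidx)
  have huH : u ∈ H := (hD.cj hx).le hu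
  refine ⟨u * x, H.mul_mem huH hx, S, α', res S (cj x β), hD', hMS, ?_, ?_⟩
  · rw [cjS_mul]; exact hPS
  · rw [cjS_mul, res_res hPS.1, cj_mul, ← res_cj, ← res_cj,
      (hD.cj hx).lin.1.chr.classOn.cj_eq hu]

/-- Uniqueness of vertex pairs up to conjugacy, by descent along the series. -/
theorem VPair.conj (hσ : Sg p G σ) (hN : NSeries p n N ⊤) (k : ℕ) : ∀ (i : ℕ) (H Q Q' : Subgroup G)
    (χ θ δ δ' : G → ℂ), n = i + k → Irr H χ → PIrr p H χ → Irr (H ⊓ N i) θ →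
    (∀ x ∈ H, _root_.cj x θ = θ) → ip (H ⊓ N i) χ θ ≠ 0 → VPair p σ (H ⊓ N i) H χ Q δ →
    VPair p σ (H ⊓ N i) H χ Q' δ' → ∃ h ∈ H, Q' = cjS h Q ∧ δ' = _root_.cj h δ := by
  induction k with
  | zero =>
    rintro i H Q Q' χ θ δ δ' rfl hχ hP hθ hinv h0 ⟨U, α, β, hD, hM, hQ, rfl⟩
      ⟨U', α', β', hD', hM', hQ', rfl⟩
    rw [hN.top_inf] at hM hM'
    obtain rfl := le_antisymm hD.le hM
    obtain rfl := le_antisymm hD'.le hM'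
    have e := hD.ind_eq.trans hD'.ind_eq.symm
    rw [ind_self (hD.irr.mul_lin hD.lin.1).chr.classOn,
      ind_self (hD'.irr.mul_lin hD'.lin.1).chr.classOn] at e
    obtain ⟨-, rfl⟩ := factor_unique hσ hD.irr hD'.irr hD.fix hD'.fix hD'.deg hD.lin hD'.lin e
    obtain ⟨u, hu, rfl⟩ := hQ.exists_conj hσ.prime hQ'
    exact ⟨u, hu, rfl, by rw [← res_cj, hD.lin.1.chr.classOn.cj_eq hu]⟩
  | succ k ih =>
    intro i H Q Q' χ θ δ δ' hn hχ hP hθ hinv h0 hV hV'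
    replace hV := hV.up hσ hN (by omega) hχ hP hθ hinv h0
    replace hV' := hV'.up hσ hN (by omega) hχ hP hθ hinv h0
    have hM := hN.nrm H (i + 1)
    obtain ⟨ζ, hζ, hζ0⟩ := hχ.exists_under hM.le
    obtain ⟨ψ, hψ, h1, h2, h3⟩ := hM.clifford_exists hχ hζ hζ0
    obtain ⟨x, hx, hW⟩ := hV.clifford hσ hN (by omega) hχ hP hζ hζ0 hψ h1 h2
    obtain ⟨x', hx', hW'⟩ := hV'.clifford hσ hN (by omega) hχ hP hζ hζ0 hψ h1 h2
    have hT : stab H ζ ⊓ N (i + 1) = H ⊓ N (i + 1) := le_antisymm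
      (inf_le_inf_right _ (stab_le H ζ)) (le_inf (hM.le_stab hζ.chr.classOn) inf_le_right)
    rw [← hT] at hζ h1 hW hW'
    obtain ⟨t, ht, e1, e2⟩ := ih (i + 1) _ _ _ ψ ζ _ _ (by omega) hψ
      (PIrr.of_ind (by rw [h3]; exact hP) (stab_le H ζ) hψ.1) hζ (fun y hy => (mem_stab.1 hy).2) h1
      hW hW'
    refine ⟨x'⁻¹ * t * x, H.mul_mem (H.mul_mem (H.inv_mem hx') (stab_le H ζ ht)) hx, ?_, ?_⟩
    · rw [cjS_mul, cjS_mul, ← e1, cjS_inv_cjS]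
    · rw [cj_mul, cj_mul, ← e2, cj_inv_cj]

end

section

theorem IsIrrChar.comp_equiv {Γ Δ : Type} [Group Γ] [Group Δ] {χ : Γ → ℂ} (h : IsIrrChar Γ χ)
    (e : Δ ≃* Γ) : IsIrrChar Δ (fun x => χ (e x)) := by
  have aux : ∀ {f : Δ → ℂ}, f ≠ 0 → (fun x => f (e.symm x)) ≠ 0 := fun hf h0 =>
    hf (funext fun x => by simpa using congrFun h0 (e x))
  refine ⟨h.1.comp e.toMonoidHom, fun h0 => h.2.1 (funext fun x => ?_), ?_⟩
  · simpa using congrFun h0 (e.symm x)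
  · rintro ⟨a, b, ha, ha0, hb, hb0, hab⟩
    refine h.2.2 ⟨_, _, ha.comp e.symm.toMonoidHom, aux ha0, hb.comp e.symm.toMonoidHom, aux hb0,
      funext fun x => ?_⟩
    simpa using congrFun hab (e.symm x)

variable {G : Type} [Group G] [Fintype G] {p n : ℕ} {σ : ℂ →+* ℂ} {N : ℕ → Subgroup G}
  {K U Q : Subgroup G} {χ φ : G → ℂ} {π : Set ℕ}

theorem isSubnormalSubgroup_of_nrm (h : Relation.ReflTransGen Nrm K U) :
    IsSubnormalSubgroup (K.subgroupOf U) := by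
  induction h using Relation.ReflTransGen.head_induction_on with
  | refl => exact ⟨0, fun _ => ⊤, by simp, rfl, fun i => i.elim0⟩
  | @head K L h hL ih =>
    obtain ⟨m, c, h0, h1, h2⟩ := ih
    refine ⟨m + 1, Fin.cons (K.subgroupOf U) c, rfl, by simpa [← Fin.succ_last] using h1,
      fun i => ?_⟩
    refine Fin.cases ?_ (fun j => h2 j) i
    change K.subgroupOf U ≤ c 0 ∧ ((K.subgroupOf U).subgroupOf (c 0)).Normal
    rw [h0]
    exact ⟨fun x hx => h.le hx, ⟨fun x hx y => h.2 _ y.2 _ hx⟩⟩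

theorem IsPiSpecial.spec {χ : ↥U → ℂ} (h : IsPiSpecial π ↥U χ) : Spec π U (mask U χ) := by
  obtain ⟨h1, ⟨m, hm, hmπ⟩, h3⟩ := h
  have hi := irr_mask h1
  refine ⟨hi, fun k hk => ?_, fun K hK θ hθ h0 => ?_⟩
  · have : mask U χ (1 : U) = k := hk
    rw [mask_coe, hm] at this
    rwa [← show m = k by exact_mod_cast this]
  · have hKU := le_of_subnormal hK
    let e : K.subgroupOf U ≃* K := Subgroup.subgroupOfEquivOfLe hKU
    have hsub := (hi.chr.sub_const' hKU hθ h0).2.comp e.toMonoidHom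
    obtain ⟨d, hd, ho⟩ := hasPiDetOrder_imp (h3 _ (isSubnormalSubgroup_of_nrm hK) _
      ⟨hθ.2.comp_equiv e, _, Or.inr hsub, funext fun x => by
        have := res_of_mem (f := mask U χ) (e x).2
        change χ x = θ (e x) + (res K (mask U χ) (e x) - θ (e x))
        rw [this, add_sub_cancel]
        exact (mask_coe U χ x).symm⟩)
    have hd' : DetOf (fun x : K => θ x) (fun x => d (e.symm x)) := by
      simpa using hd.comp e.symm.toMonoidHom
    refine ⟨mask K fun x => d (e.symm x), orderOf d, ⟨mask_supp _ _, by simpa using hd'⟩, ?_, ho,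
      fun x hx => ?_⟩
    · have := Fintype.ofFinite (K.subgroupOf U)
      refine (orderOf_pos_iff.2 (isOfFinOrder_iff_pow_eq_one.2
        ⟨Nat.card (K.subgroupOf U), Nat.card_pos, funext fun x => ?_⟩)).ne'
      rw [Pi.pow_apply, ← hd.map_pow, pow_card_eq_one', hd.map_one, Pi.one_apply]
    · have := mask_coe K (fun x => d (e.symm x)) ⟨x, hx⟩
      rw [this, ← Pi.pow_apply, pow_orderOf_eq_one, Pi.one_apply]

theorem ind_mask_mul (α β : ↥U → ℂ) :
    ind U ⊤ (mask U α * mask U β) = indChar U (α * β) := by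
  funext g
  simp only [ind, indChar, mask, Pi.mul_apply, Subgroup.mem_top, if_true]
  congr 1
  refine Finset.sum_congr rfl fun x _ => ?_
  split_ifs <;> simp

theorem IsIrrChar.irr_top (h : IsIrrChar G χ) : Irr ⊤ χ :=
  ⟨fun g hg => (hg trivial).elim, h.comp_equiv Subgroup.topEquiv⟩

theorem isPiElt_compl (hp : p.Prime) {x : G} : IsPiElt {p}ᶜ x ↔ ¬ p ∣ orderOf x :=
  ⟨fun h hd => h p hp hd rfl, fun h q _ hd e => h (e ▸ hd)⟩

theorem IsIBrChar.pirr (hp : p.Prime) (h : IsIBrChar p G φ) (hl : IsLiftOfPi {p}ᶜ G χ φ) :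
    PIrr p ⊤ χ := fun a b ha hb ha0 hb0 e => by
  refine h.2 ⟨_, _, ⟨a, ha.2.comp Subgroup.topEquiv.symm.toMonoidHom, ha0, rfl⟩,
    ⟨b, hb.2.comp Subgroup.topEquiv.symm.toMonoidHom, hb0, rfl⟩, ?_⟩
  rw [← hl.2]
  funext x
  simp only [piRestrict, Pi.add_apply]
  split_ifs with hx
  · exact e x trivial ((isPiElt_compl hp).1 hx)
  · simp

theorem Spec.linP (hσ : Sg p G σ) (hN : NSeries p n N ⊤) {β : G → ℂ} (hβ : Spec {p} U β)
    (hP : PIrr p U β) : LinP p U β := by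
  have hl := hβ.1.chr.lin_of_deg (hβ.deg_one hσ hN hP)
  refine ⟨hl, ?_⟩
  obtain ⟨d, m, hd, hm0, hm, h⟩ := hβ.2.2 U .refl β hβ.1 (by rw [hβ.1.ip_self]; exact one_ne_zero)
  obtain ⟨k, rfl⟩ := hm.eq_pow hm0
  intro x hx
  have e := hd.of_smul (n := 1) hl (by simpa using hl.2.1) hx (by simp)
  rw [pow_one] at e
  exact ⟨k, e ▸ h x hx⟩

theorem IsVertexPair.vpair {δ : ↥Q → ℂ} (h : IsVertexPair p χ Q δ) (hσ : Sg p G σ)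
    (hN : NSeries p n N ⊤) (hP : PIrr p ⊤ χ) : VPair p σ (⊤ ⊓ N 0) ⊤ χ Q (mask Q δ) := by
  obtain ⟨hQ, -, U, hQU, α, β, hα, hβ, -, rfl, hidx, hδ⟩ := h
  have hα' := hα.spec
  have hβ' := hβ.spec
  rw [← ind_mask_mul] at hP ⊢
  have hPU := hP.of_ind le_top (hα'.1.chr.mul hβ'.1.chr).1
  refine ⟨U, mask U α, mask U β, ⟨le_top, hα'.1, (hα'.bs hσ hN).fixed, fun m hm hd => ?_,
    hβ'.linP hσ hN (hPU.right hα'.1.chr hα'.1.ne_zero), rfl⟩, by simp [hN.zero], ⟨hQU, hQ, hidx⟩,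
    ext_on (mask_supp _ _) (res_supp _ _) fun x hx => ?_⟩
  · exact hα'.2.1 m hm p hσ.prime hd rfl
  · have := hδ ⟨x, hx⟩
    rw [res_of_mem hx]
    simpa [mask, hx, hQU hx] using this

end
section

/-- **Theorem (Statement 2).** Let `p` be an odd prime and `G` a finite `p`-solvable group.
If `χ ∈ Irr(G)` is a lift of `φ ∈ IBr(G)`, then all of the vertex pairs for `χ` are
conjugate in `G`. -/
theorem vertex_pairs_conjugate
    (p : ℕ) (hp : p.Prime) (hodd : Odd p)
    (G : Type) [Group G] [Fintype G] (hG : IsPSolvable p G)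
    (χ φ : G → ℂ) (hφ : IsIBrChar p G φ) (hlift : IsLiftOfPi ({p}ᶜ) G χ φ) :
    ∀ (Q₁ : Subgroup G) (δ₁ : ↥Q₁ → ℂ) (Q₂ : Subgroup G) (δ₂ : ↥Q₂ → ℂ),
      IsVertexPair p χ Q₁ δ₁ → IsVertexPair p χ Q₂ δ₂ →
      ∃ g : G, IsConjPair g Q₁ δ₁ Q₂ δ₂ := by
  intro Q₁ δ₁ Q₂ δ₂ h₁ h₂
  obtain ⟨σ, hσ⟩ := exists_sg (G := G) hp (by rintro rfl; exact absurd hodd (by decide))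
  obtain ⟨n, N, hN⟩ := exists_nseries hp hG
  have hP := hφ.pirr hp hlift
  have hχ := hlift.1.irr_top
  obtain ⟨θ, hθ, h0⟩ := hχ.exists_under (hN.nrm ⊤ 0).le
  have hinv : ∀ x ∈ (⊤ : Subgroup G), cj x θ = θ := fun x _ => by
    funext g
    by_cases hg : g = 1
    · rw [hg, cj_apply_one]
    · rw [hθ.1 g (by simpa [hN.zero] using hg)]
      refine hθ.1 _ fun h => hg ?_
      simpa [hN.zero, inv_mul_eq_one, mul_eq_right, eq_comm (a := x), mul_assoc] using h
  obtain ⟨g, -, hQ, hδ⟩ := VPair.conj hσ hN n 0 ⊤ Q₁ Q₂ χ θ _ _ (zero_add n).symm hχ hP hθ hinv h0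
    (h₁.vpair hσ hN hP) (h₂.vpair hσ hN hP)
  refine ⟨g, hQ, fun x h => ?_⟩
  have := congrFun hδ (g * x * g⁻¹)
  have e : g⁻¹ * (g * x * g⁻¹) * g = (x : G) := by group
  rwa [cj, e, mask_coe, mask, dif_pos h] at this

end
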